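/- Let 1<p<5, ω>0, and β = min(p−1, 1)/6. There exists m* ∈ ℕ such that for every integer m ≥ m* the following holds: for every φ ∈ C²((0,∞), ℝ) with φ(r) > 0 for all r > 0 satisfying φ''(r) + φ'(r)/r − (ω + m²/r²)·φ(r) + φ(r)^p = 0 on (0,∞), the limits lim_{r→0} φ(r)/r^m and lim_{r→0} φ'(r)/(m r^{m−1}) existing, finite and equal, and lim_{r→∞} φ(r) = 0, and for j = ⌊m^β⌋, there exist λ ∈ ℂ with Re λ > 0 and functions y₊, y₋ ∈ C²((0,∞), ℂ), not both identically zero, with ∫₀^∞ ( |y_±(r)|² + |y_±'(r)|² + r^{−2}|y_±(r)|² ) r dr < ∞, such that on (0,∞): y₊'' + y₊'/r − (ω + (m+j)²/r²)y₊ + iλ·y₊ + β₁·y₊ + β₂·y₋ = 0 and y₋'' + y₋'/r − (ω + (m−j)²/r²)y₋ − iλ·y₋ + β₁·y₋ + β₂·y₊ = 0, where β₁(r) = ((p+1)/2)·φ(r)^{p−1} and β₂(r) = ((p−1)/2)·φ(r)^{p−1}. (The linearized operator with angular perturbation index j = ⌊m^β⌋ has an unstable eigenvalue.) -/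

import Mathlib

open MeasureTheory Real Filter
open scoped ComplexConjugate

section Calculus

theorem monotoneOn_of_hasDerivAt_nonneg {f f' : ℝ → ℝ} {D : Set ℝ} (hD : Convex ℝ D)
    (hf : ∀ x ∈ D, HasDerivAt f (f' x) x) (h : ∀ x ∈ D, 0 ≤ f' x) : MonotoneOn f D :=
  monotoneOn_of_deriv_nonneg hD (fun x hx => (hf x hx).continuousAt.continuousWithinAt)
    (fun x hx => (hf x (interior_subset hx)).differentiableAt.differentiableWithinAt)
    (fun x hx => by rw [(hf x (interior_subset hx)).deriv]; exact h x (interior_subset hx))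

theorem antitoneOn_of_hasDerivAt_nonpos {f f' : ℝ → ℝ} {D : Set ℝ} (hD : Convex ℝ D)
    (hf : ∀ x ∈ D, HasDerivAt f (f' x) x) (h : ∀ x ∈ D, f' x ≤ 0) : AntitoneOn f D :=
  antitoneOn_of_deriv_nonpos hD (fun x hx => (hf x hx).continuousAt.continuousWithinAt)
    (fun x hx => (hf x (interior_subset hx)).differentiableAt.differentiableWithinAt)
    (fun x hx => by rw [(hf x (interior_subset hx)).deriv]; exact h x (interior_subset hx))

/-- A function that is monotone on `(-∞, t]` and tends to `0` at `-∞` is nonnegative at `t`. -/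
theorem nonneg_of_monotoneOn_Iic {f : ℝ → ℝ} {t : ℝ} (hf : MonotoneOn f (Set.Iic t))
    (h0 : Tendsto f atBot (nhds 0)) : 0 ≤ f t :=
  le_of_tendsto h0 (by
    filter_upwards [eventually_le_atBot t] with s hs
    exact hf hs (Set.mem_Iic.2 le_rfl) hs)

theorem nonpos_of_antitoneOn_Iic {f : ℝ → ℝ} {t : ℝ} (hf : AntitoneOn f (Set.Iic t))
    (h0 : Tendsto f atBot (nhds 0)) : f t ≤ 0 :=
  ge_of_tendsto h0 (by
    filter_upwards [eventually_le_atBot t] with s hs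
    exact hf hs (Set.mem_Iic.2 le_rfl) hs)

theorem nonneg_of_antitoneOn_Ici {f : ℝ → ℝ} {t : ℝ} (hf : AntitoneOn f (Set.Ici t))
    (h0 : Tendsto f atTop (nhds 0)) : 0 ≤ f t :=
  le_of_tendsto h0 (by
    filter_upwards [eventually_ge_atTop t] with s hs
    exact hf (Set.mem_Ici.2 le_rfl) hs hs)

theorem nonpos_of_monotoneOn_Ici {f : ℝ → ℝ} {t : ℝ} (hf : MonotoneOn f (Set.Ici t))
    (h0 : Tendsto f atTop (nhds 0)) : f t ≤ 0 :=
  ge_of_tendsto h0 (by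
    filter_upwards [eventually_ge_atTop t] with s hs
    exact hf (Set.mem_Ici.2 le_rfl) hs hs)

/-- Barrier estimate for a differential inequality of Riccati type. -/
theorem riccati_barrier {k l ε : ℝ} {y y' N N' : ℝ → ℝ} (hk : 0 < k) (hl : 0 < l)
    (hl1 : l ≤ 1 / 4) (hlk : l ≤ k / 4) (hε : 0 < ε) (hε1 : ε ≤ 1 / 10)
    (hy : ∀ s, 0 ≤ s → HasDerivAt y (y' s) s) (hN : ∀ s, 0 ≤ s → HasDerivAt N (N' s) s)
    (hN1 : ∀ s, 0 ≤ s → 1 ≤ N s) (hN' : ∀ s, 0 ≤ s → |N' s| ≤ ε * N s) (hy0 : y 0 = 0)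
    (hyd : ∀ s, 0 ≤ s → y' s ≤ -k * (N s ^ 2 - ε ^ 2 - y s ^ 2) + ε * |y s|)
    {s : ℝ} (hs : 0 ≤ s) : y s ≤ -(l * N s * (s / (1 + s))) := by
  have hB : ∀ x, 0 ≤ x → HasDerivAt (fun s => -(l * N s * (s / (1 + s))))
      (-(l * N' x * (x / (1 + x)) + l * N x * (1 / (1 + x) ^ 2))) x := by
    intro x hx
    have h1 : HasDerivAt (fun s : ℝ => s / (1 + s)) (1 / (1 + x) ^ 2) x := by
      have := (hasDerivAt_id x).div ((hasDerivAt_id x).const_add 1)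
        (by simp; positivity)
      refine this.congr_deriv ?_
      simp
    exact (((hN x hx).const_mul l).mul h1).neg
  refine image_le_of_deriv_right_lt_deriv_boundary' (f := y) (f' := y') (a := 0) (b := s)
    (B := fun s => -(l * N s * (s / (1 + s))))
    (B' := fun x => -(l * N' x * (x / (1 + x)) + l * N x * (1 / (1 + x) ^ 2)))
    (fun x hx => (hy x hx.1).continuousAt.continuousWithinAt)
    (fun x hx => (hy x hx.1).hasDerivWithinAt) (by simp [hy0])
    (fun x hx => (hB x hx.1).continuousAt.continuousWithinAt)
    (fun x hx => (hB x hx.1).hasDerivWithinAt) ?_ ⟨hs, le_rfl⟩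
  intro x hx hxy
  have hx0 := hx.1
  have h1 := hyd x hx0
  have hn := hN1 x hx0
  have hn' := abs_le.1 (hN' x hx0)
  have hu0 : 0 ≤ x / (1 + x) := by positivity
  have hu1 : x / (1 + x) ≤ 1 := by rw [div_le_one (by positivity)]; linarith
  have hv0 : 1 / (1 + x) ^ 2 ≤ 1 := by
    rw [div_le_one (by positivity)]; nlinarith
  set u := x / (1 + x)
  set n := N x
  have hlu : 0 ≤ l * n * u := by positivity
  have hlu1 : l * n * u ≤ l * n := mul_le_of_le_one_right (by positivity) hu1
  have ha : |y x| = l * n * u := by rw [hxy, abs_neg, abs_of_nonneg hlu]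
  have hsq : y x ^ 2 ≤ (n / 4) ^ 2 := by
    rw [hxy, neg_sq]
    apply pow_le_pow_left₀ hlu
    nlinarith
  have e1 : l * N' x * u ≤ l * n * ε := by
    have h2 : N' x * u ≤ ε * n :=
      (mul_le_mul_of_nonneg_right hn'.2 hu0).trans (mul_le_of_le_one_right (by positivity) hu1)
    calc l * N' x * u = l * (N' x * u) := by ring
      _ ≤ l * (ε * n) := by gcongr
      _ = _ := by ring
  have e2 : l * n * (1 / (1 + x) ^ 2) ≤ l * n := mul_le_of_le_one_right (by positivity) hv0
  have e3 : y' x ≤ -k * (n ^ 2 - ε ^ 2 - (n/4) ^ 2) + ε * (l * n) := by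
    rw [ha] at h1
    have h3 : k * y x ^ 2 ≤ k * (n / 4) ^ 2 := by gcongr
    have h4 : ε * (l * n * u) ≤ ε * (l * n) := by gcongr
    linarith
  have e4 : l * n ≤ k / 4 * n := by gcongr
  have e5 : ε * (l * n) ≤ 1 / 10 * (k / 4 * n) := by gcongr
  have e6 : ε ^ 2 ≤ 1 / 100 * n := by nlinarith
  have e7 : n ≤ n ^ 2 := by nlinarith
  have e8 : k * ε ^ 2 ≤ k * (1 / 100 * n) := by gcongr
  have e9 : k * n ≤ k * n ^ 2 := by gcongr
  have e10 : 0 < k * n := by positivity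
  linarith

end Calculus

/-- Logarithmic variables for a radial vortex profile: `f` is the profile, `P` its logarithmic
derivative and `T` the rescaled nonlinearity, `ε` the inverse of the vorticity. -/
structure Profile (p ε R : ℝ) (f P T : ℝ → ℝ) : Prop where
  R_pos : 0 < R
  f_pos : ∀ t, 0 < f t
  T_pos : ∀ t, 0 < T t
  hf : ∀ t, HasDerivAt f (P t * f t) t
  hP : ∀ t, HasDerivAt P (1 + R * exp (2 * ε * t) - T t - P t ^ 2) t
  hT : ∀ t, HasDerivAt T (T t * ((p - 1) * P t + 2 * ε)) t
  bound : ∃ C, ∀ t, f t ≤ C * exp (-|t|) ∧ |P t| * f t ≤ C * exp (-|t|) ∧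
    T t ≤ C * exp (2 * ε * |t|)

namespace Profile

variable {p ε R : ℝ} {f P T : ℝ → ℝ}

/-- The exponent of the weight for which the energy identity closes. -/
noncomputable def th (p : ℝ) : ℝ := 4 / (p + 3)

/-- The weighted square of the profile. -/
noncomputable def W (p ε : ℝ) (f : ℝ → ℝ) (t : ℝ) : ℝ := exp (-(th p * ε * t)) * f t ^ 2

/-- The normalized energy density. -/
noncomputable def en (p ε R : ℝ) (P T : ℝ → ℝ) (t : ℝ) : ℝ :=
  (P t + th p * ε / 2) ^ 2 / 2 - (1 + R * exp (2 * ε * t) - th p ^ 2 * ε ^ 2 / 4) / 2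
    + T t / (p + 1)

theorem th_pos (hp : 1 < p) : 0 < th p := by unfold th; positivity

theorem th_lt_one (hp : 1 < p) : th p < 1 := by
  unfold th; rw [div_lt_one (by linarith)]; linarith

theorem half_lt_th (hp : 1 < p) (hp5 : p < 5) : 1 / 2 < th p := by
  unfold th; rw [div_lt_div_iff₀ (by norm_num) (by linarith)]; linarith

theorem hasDerivAt_exp_mul (c t : ℝ) : HasDerivAt (fun t => exp (c * t)) (c * exp (c * t)) t := by
  have := ((hasDerivAt_id t).const_mul c).exp
  simpa [mul_comm] using this

theorem W_pos (h : Profile p ε R f P T) (t : ℝ) : 0 < W p ε f t := by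
  have := h.f_pos t
  unfold W; positivity

theorem hasDerivAt_W (h : Profile p ε R f P T) (t : ℝ) :
    HasDerivAt (W p ε f) ((2 * P t - th p * ε) * W p ε f t) t := by
  have h1 := (hasDerivAt_exp_mul (-(th p * ε)) t).mul ((h.hf t).pow 2)
  have : W p ε f = (fun t => exp (-(th p * ε) * t)) * (f ^ 2) := by
    funext s; simp [W]
  rw [this]
  refine h1.congr_deriv ?_
  simp; ring

theorem hasDerivAt_energy (hp : 1 < p) (h : Profile p ε R f P T) (t : ℝ) :
    HasDerivAt (fun t => en p ε R P T t * W p ε f t)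
      (ε * W p ε f t * (th p - th p ^ 3 * ε ^ 2 / 4 - (1 - th p) * (R * exp (2 * ε * t)))) t := by
  have hE := (hasDerivAt_exp_mul (2 * ε) t).const_mul R
  have h1 := ((((h.hP t).add_const (th p * ε / 2)).pow 2).div_const 2).sub
    (((hE.const_add 1).sub_const (th p ^ 2 * ε ^ 2 / 4)).div_const 2)
  have h2 := (h1.add ((h.hT t).div_const (p + 1))).mul (h.hasDerivAt_W t)
  refine h2.congr_deriv ?_
  have hp3 : p + 3 ≠ 0 := by linarith
  have hp1 : p + 1 ≠ 0 := by linarith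
  have hth : p = 4 / th p - 3 := by unfold th; field_simp; ring
  have ht0 : th p ≠ 0 := (th_pos hp).ne'
  have ht1 : 2 - th p ≠ 0 := by linarith [th_lt_one hp]
  generalize hE' : exp (2 * ε * t) = E
  simp only [Pi.pow_apply, Pi.add_apply, Pi.sub_apply, hE']
  generalize W p ε f t = w
  have hq : p + 1 = 2 * (2 - th p) / th p := by rw [eq_div_iff ht0]; unfold th; field_simp; ring
  have hq' : p - 1 = 4 * (1 - th p) / th p := by rw [eq_div_iff ht0]; unfold th; field_simp; ring
  rw [hq, hq']
  generalize th p = θ at *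
  field_simp
  push_cast
  ring

end Profile

theorem tendsto_zero_of_le_exp_abs {g : ℝ → ℝ} {C : ℝ} (h : ∀ t, |g t| ≤ C * exp (-|t|)) :
    Tendsto g atTop (nhds 0) ∧ Tendsto g atBot (nhds 0) := by
  have key : ∀ l : Filter ℝ, Tendsto (fun t : ℝ => |t|) l atTop → Tendsto g l (nhds 0) := by
    intro l hl
    refine squeeze_zero_norm (a := fun t => C * exp (-|t|)) h ?_
    simpa using ((tendsto_exp_neg_atTop_nhds_zero.comp hl).const_mul C)
  exact ⟨key _ tendsto_abs_atTop_atTop, key _ tendsto_abs_atBot_atTop⟩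

namespace Profile

variable {p ε R : ℝ} {f P T : ℝ → ℝ}

theorem one_le_Q (h : Profile p ε R f P T) (t : ℝ) : 1 ≤ 1 + R * exp (2 * ε * t) := by
  have := mul_pos h.R_pos (exp_pos (2 * ε * t)); linarith

theorem exists_weighted_bound (hp : 1 < p) (hε : 0 < ε) (hε1 : ε ≤ 1 / 10)
    (h : Profile p ε R f P T) :
    ∃ C, ∀ t, (1 + R * exp (2 * ε * t) + P t ^ 2 + T t) * W p ε f t ≤ C * exp (-|t|) := by
  obtain ⟨C, hC⟩ := h.bound
  have hC0 : 0 < C := by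
    by_contra! hc
    have := (hC 0).1
    have := h.f_pos 0
    have := mul_nonpos_of_nonpos_of_nonneg hc (exp_pos (-|(0:ℝ)|)).le
    linarith
  refine ⟨(1 + R) * C ^ 2 + C ^ 2 + C ^ 3, fun t => ?_⟩
  obtain ⟨h1, h2, h3⟩ := hC t
  have hR := h.R_pos
  have hf0 := h.f_pos t
  have ht := abs_nonneg t
  have hθ := th_pos hp
  have hθ1 := th_lt_one hp
  have hθε : th p * ε ≤ ε := mul_le_of_le_one_left hε.le hθ1.le
  have hw : exp (-(th p * ε * t)) ≤ exp (ε * |t|) := by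
    apply exp_le_exp.2
    have : |th p * ε * t| ≤ ε * |t| := by
      rw [abs_mul, abs_of_pos (by positivity)]; gcongr
    linarith [neg_abs_le (th p * ε * t)]
  have hE : 1 + R * exp (2 * ε * t) ≤ (1 + R) * exp (2 * ε * |t|) := by
    have a1 : exp (2 * ε * t) ≤ exp (2 * ε * |t|) := by gcongr; exact le_abs_self t
    have a2 : (1:ℝ) ≤ exp (2 * ε * |t|) := one_le_exp (by positivity)
    nlinarith
  have hb : ∀ x : ℝ, 0 ≤ x → x ≤ C → ∀ y : ℝ, 0 ≤ y → y ≤ exp (2 * ε * |t|) →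
      y * (exp (-(th p * ε * t)) * (C * exp (-|t|)) ^ 2) ≤ C ^ 2 * exp (-|t|) := by
    intro x hx0 hx y hy0 hy
    calc y * (exp (-(th p * ε * t)) * (C * exp (-|t|)) ^ 2)
        ≤ exp (2 * ε * |t|) * (exp (ε * |t|) * (C * exp (-|t|)) ^ 2) := by gcongr
      _ = C ^ 2 * exp ((3 * ε - 2) * |t|) := by
          rw [mul_pow, ← exp_nat_mul, mul_comm (C ^ 2), ← mul_assoc, ← mul_assoc, ← exp_add,
            ← exp_add, mul_comm]
          congr 2; push_cast; ring
      _ ≤ C ^ 2 * exp (-|t|) := by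
          gcongr; nlinarith
  have hone : (1:ℝ) ≤ exp (2 * ε * |t|) := one_le_exp (by positivity)
  have b1 : (1 + R * exp (2 * ε * t)) * W p ε f t ≤ (1 + R) * C ^ 2 * exp (-|t|) := by
    calc (1 + R * exp (2 * ε * t)) * W p ε f t
        ≤ ((1 + R) * exp (2 * ε * |t|)) * (exp (-(th p * ε * t)) * (C * exp (-|t|)) ^ 2) := by
          unfold W; gcongr
      _ = (1 + R) * (exp (2 * ε * |t|) * (exp (-(th p * ε * t)) * (C * exp (-|t|)) ^ 2)) := by ring
      _ ≤ (1 + R) * (C ^ 2 * exp (-|t|)) := by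
          gcongr ?_ * ?_
          exact hb 0 le_rfl hC0.le _ (exp_pos _).le le_rfl
      _ = _ := by ring
  have b2 : P t ^ 2 * W p ε f t ≤ C ^ 2 * exp (-|t|) := by
    calc P t ^ 2 * W p ε f t = exp (-(th p * ε * t)) * (|P t| * f t) ^ 2 := by
          rw [mul_pow, sq_abs]; unfold W; ring
      _ ≤ exp (-(th p * ε * t)) * (C * exp (-|t|)) ^ 2 := by gcongr
      _ = 1 * (exp (-(th p * ε * t)) * (C * exp (-|t|)) ^ 2) := by ring
      _ ≤ _ := hb 0 le_rfl hC0.le 1 (by norm_num) hone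
  have b3 : T t * W p ε f t ≤ C ^ 3 * exp (-|t|) := by
    have hT := h.T_pos t
    calc T t * W p ε f t
        ≤ (C * exp (2 * ε * |t|)) * (exp (-(th p * ε * t)) * (C * exp (-|t|)) ^ 2) := by
          unfold W; gcongr
      _ = C * (exp (2 * ε * |t|) * (exp (-(th p * ε * t)) * (C * exp (-|t|)) ^ 2)) := by ring
      _ ≤ C * (C ^ 2 * exp (-|t|)) := by
          gcongr ?_ * ?_
          exact hb 0 le_rfl hC0.le _ (exp_pos _).le le_rfl
      _ = _ := by ring
  linarith

theorem abs_en_le (hp : 1 < p) (hε : 0 < ε) (hε1 : ε ≤ 1 / 10) (h : Profile p ε R f P T) (t : ℝ) :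
    |en p ε R P T t| ≤ 1 + R * exp (2 * ε * t) + P t ^ 2 + T t := by
  have hQ := h.one_le_Q t
  have hT := h.T_pos t
  have hθ := th_pos hp
  have hθ1 := th_lt_one hp
  have hθε : th p * ε ≤ 1 / 10 := by nlinarith
  have hθε0 : 0 < th p * ε := by positivity
  have hT1 : T t / (p + 1) ≤ T t := div_le_self hT.le (by linarith)
  have hT2 : 0 < T t / (p + 1) := div_pos hT (by linarith)
  have hsq : th p ^ 2 * ε ^ 2 ≤ 1 / 100 := by nlinarith
  have hsq0 : 0 ≤ th p ^ 2 * ε ^ 2 := by positivity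
  unfold en
  rw [abs_le]
  constructor <;> nlinarith [sq_nonneg (P t + th p * ε / 2), sq_nonneg (P t - th p * ε / 2)]

theorem tendsto_energy (hp : 1 < p) (hε : 0 < ε) (hε1 : ε ≤ 1 / 10) (h : Profile p ε R f P T) :
    Tendsto (fun t => en p ε R P T t * W p ε f t) atTop (nhds 0) ∧
      Tendsto (fun t => en p ε R P T t * W p ε f t) atBot (nhds 0) := by
  obtain ⟨C, hC⟩ := h.exists_weighted_bound hp hε hε1
  refine tendsto_zero_of_le_exp_abs (C := C) fun t => (le_trans ?_ (hC t))
  rw [abs_mul, abs_of_pos (h.W_pos t)]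
  exact mul_le_mul_of_nonneg_right (h.abs_en_le hp hε hε1 t) (h.W_pos t).le

theorem tendsto_QW (hp : 1 < p) (hε : 0 < ε) (hε1 : ε ≤ 1 / 10) (h : Profile p ε R f P T) :
    Tendsto (fun t => (1 + R * exp (2 * ε * t)) * W p ε f t) atTop (nhds 0) ∧
      Tendsto (fun t => (1 + R * exp (2 * ε * t)) * W p ε f t) atBot (nhds 0) := by
  obtain ⟨C, hC⟩ := h.exists_weighted_bound hp hε hε1
  refine tendsto_zero_of_le_exp_abs (C := C) fun t => (le_trans ?_ (hC t))
  have := h.one_le_Q t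
  rw [abs_mul, abs_of_pos (h.W_pos t), abs_of_pos (by linarith)]
  apply mul_le_mul_of_nonneg_right _ (h.W_pos t).le
  linarith [sq_nonneg (P t), h.T_pos t]

theorem en_nonneg (hp : 1 < p) (hε : 0 < ε) (hε1 : ε ≤ 1 / 10) (h : Profile p ε R f P T) (t : ℝ) :
    0 ≤ en p ε R P T t := by
  have hW := h.W_pos t
  have hlim := h.tendsto_energy hp hε hε1
  have hR := h.R_pos
  have hθ1 := th_lt_one hp
  suffices hJ : 0 ≤ en p ε R P T t * W p ε f t from nonneg_of_mul_nonneg_left hJ hW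
  have hmono : ∀ a b : ℝ, a ≤ b → (1 - th p) * (R * exp (2 * ε * a)) ≤
      (1 - th p) * (R * exp (2 * ε * b)) := by
    intro a b hab
    have : 0 ≤ 1 - th p := by linarith
    gcongr
  rcases le_total 0 (th p - th p ^ 3 * ε ^ 2 / 4 - (1 - th p) * (R * exp (2 * ε * t))) with hs | hs
  · refine nonneg_of_monotoneOn_Iic (f := fun t => en p ε R P T t * W p ε f t)
      (monotoneOn_of_hasDerivAt_nonneg (convex_Iic t)
        (fun x _ => h.hasDerivAt_energy hp x) fun x hx => ?_) hlim.2
    have := hmono x t hx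
    have := h.W_pos x
    apply mul_nonneg (by positivity)
    linarith
  · refine nonneg_of_antitoneOn_Ici (f := fun t => en p ε R P T t * W p ε f t)
      (antitoneOn_of_hasDerivAt_nonpos (convex_Ici t)
        (fun x _ => h.hasDerivAt_energy hp x) fun x hx => ?_) hlim.1
    have := hmono t x hx
    have := h.W_pos x
    apply mul_nonpos_of_nonneg_of_nonpos (by positivity)
    linarith

/-- Riccati inequality for the shifted logarithmic derivative. -/
theorem riccati_le (hp : 1 < p) (hε : 0 < ε) (hε1 : ε ≤ 1 / 10) (h : Profile p ε R f P T) (t : ℝ) :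
    1 + R * exp (2 * ε * t) - T t - P t ^ 2 ≤
      -((p - 1) / 2) * (1 + R * exp (2 * ε * t) - ε ^ 2 - (P t + th p * ε / 2) ^ 2)
        + ε * |P t + th p * ε / 2| := by
  have h0 := h.en_nonneg hp hε hε1 t
  have hθ := th_pos hp
  have hθ1 := th_lt_one hp
  set S := P t + th p * ε / 2 with hS
  have hP : P t = S - th p * ε / 2 := by rw [hS]; ring
  have e1 : th p * ε * S ≤ ε * |S| := by
    calc th p * ε * S ≤ |th p * ε * S| := le_abs_self _
      _ = th p * (ε * |S|) := by rw [abs_mul, abs_of_pos (by positivity)]; ring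
      _ ≤ _ := mul_le_of_le_one_left (by positivity) hθ1.le
  have e2 : th p ^ 2 * ε ^ 2 ≤ ε ^ 2 := by
    have : th p ^ 2 ≤ 1 := by nlinarith
    nlinarith [sq_nonneg ε]
  have e3 : (p - 1) * (th p ^ 2 * ε ^ 2) ≤ (p - 1) * ε ^ 2 :=
    mul_le_mul_of_nonneg_left e2 (by linarith)
  unfold en at h0
  rw [← hS] at h0
  have hp1 : 0 < p + 1 := by linarith
  have e4 : 0 ≤ (p + 1) * (S ^ 2 / 2 - (1 + R * exp (2 * ε * t) - th p ^ 2 * ε ^ 2 / 4) / 2)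
      + T t := by
    have := mul_nonneg hp1.le h0
    rw [mul_add, mul_div_cancel₀ _ hp1.ne'] at this
    exact this
  rw [hP]
  nlinarith [sq_nonneg ε]

end Profile

theorem hasDerivAt_comp_neg_real {g : ℝ → ℝ} {g' s : ℝ} (hg : HasDerivAt g g' (-s)) :
    HasDerivAt (fun s => g (-s)) (-g') s := by
  simpa [Function.comp_def] using hg.comp s (hasDerivAt_neg s)

namespace Profile

variable {p ε R : ℝ} {f P T : ℝ → ℝ}

/-- The barrier constant. -/
noncomputable def la (p : ℝ) : ℝ := min ((p - 1) / 2) 1 / 4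

theorem la_pos (hp : 1 < p) : 0 < la p := by
  have : 0 < min ((p - 1) / 2) 1 := lt_min (by linarith) one_pos
  unfold la; positivity

theorem la_le (p : ℝ) : la p ≤ 1 / 4 := by
  have := min_le_right ((p - 1) / 2) 1
  unfold la; linarith

theorem la_le' (p : ℝ) : la p ≤ (p - 1) / 2 / 4 := by
  have := min_le_left ((p - 1) / 2) 1
  unfold la; linarith

theorem hasDerivAt_sqrt_Q (hR : 0 < R) (t : ℝ) :
    HasDerivAt (fun t => √(1 + R * exp (2 * ε * t)))
      (R * (2 * ε * exp (2 * ε * t)) / (2 * √(1 + R * exp (2 * ε * t)))) t := by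
  have hE := exp_pos (2 * ε * t)
  refine HasDerivAt.sqrt (((hasDerivAt_exp_mul (2 * ε) t).const_mul R).const_add 1) ?_
  positivity

theorem sqrt_Q_deriv_le (hR : 0 < R) (hε : 0 < ε) (t : ℝ) :
    |R * (2 * ε * exp (2 * ε * t)) / (2 * √(1 + R * exp (2 * ε * t)))|
      ≤ ε * √(1 + R * exp (2 * ε * t)) := by
  have hE := exp_pos (2 * ε * t)
  have hQ : 0 < 1 + R * exp (2 * ε * t) := by positivity
  have hs := sqrt_pos.2 hQ
  have hsq := sq_sqrt hQ.le
  rw [abs_of_nonneg (by positivity), div_le_iff₀ (by positivity)]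
  nlinarith

theorem one_le_sqrt_Q (hR : 0 < R) (t : ℝ) : 1 ≤ √(1 + R * exp (2 * ε * t)) := by
  rw [one_le_sqrt]
  have := mul_pos hR (exp_pos (2 * ε * t)); linarith

theorem barrier_right (hp : 1 < p) (hε : 0 < ε) (hε1 : ε ≤ 1 / 10) (h : Profile p ε R f P T)
    (h0 : P 0 = -(th p * ε / 2)) {t : ℝ} (ht : 0 ≤ t) :
    P t + th p * ε / 2 ≤ -(la p * √(1 + R * exp (2 * ε * t)) * (t / (1 + t))) := by
  refine riccati_barrier (k := (p - 1) / 2) (y := fun t => P t + th p * ε / 2)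
    (N := fun t => √(1 + R * exp (2 * ε * t))) (by linarith) (la_pos hp) (la_le p) (la_le' p)
    hε hε1 (fun s _ => (h.hP s).add_const _) (fun s _ => hasDerivAt_sqrt_Q h.R_pos s)
    (fun s _ => one_le_sqrt_Q h.R_pos s) (fun s _ => sqrt_Q_deriv_le h.R_pos hε s)
    (by simp [h0]) (fun s _ => ?_) ht
  have := h.riccati_le hp hε hε1 s
  have hQ := h.one_le_Q s
  simp only [sq_sqrt (by linarith : 0 ≤ 1 + R * exp (2 * ε * s))]
  exact this

theorem barrier_left (hp : 1 < p) (hε : 0 < ε) (hε1 : ε ≤ 1 / 10) (h : Profile p ε R f P T)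
    (h0 : P 0 = -(th p * ε / 2)) {t : ℝ} (ht : t ≤ 0) :
    la p * √(1 + R * exp (2 * ε * t)) * (-t / (1 - t)) ≤ P t + th p * ε / 2 := by
  have key := riccati_barrier (k := (p - 1) / 2) (y := fun t => -(P (-t) + th p * ε / 2))
    (N := fun t => √(1 + R * exp (2 * ε * -t))) (by linarith) (la_pos hp) (la_le p) (la_le' p)
    hε hε1 (fun s _ => (hasDerivAt_comp_neg_real ((h.hP (-s)).add_const _)).neg)
    (fun s _ => hasDerivAt_comp_neg_real (hasDerivAt_sqrt_Q h.R_pos (-s)))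
    (fun s _ => one_le_sqrt_Q h.R_pos (-s))
    (fun s _ => by rw [abs_neg]; exact sqrt_Q_deriv_le h.R_pos hε (-s))
    (by simp [h0]) (fun s _ => ?_) (neg_nonneg.2 ht)
  · simp only [neg_neg] at key
    rw [← sub_eq_add_neg] at key
    linarith
  · have := h.riccati_le hp hε hε1 (-s)
    have hQ := h.one_le_Q (-s)
    simp only [sq_sqrt (by linarith : 0 ≤ 1 + R * exp (2 * ε * -s)), neg_neg, neg_sq, abs_neg]
    exact this

/-- The constant of the energy bounds. -/
noncomputable def enC (p : ℝ) : ℝ := 3 / la p + 3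

theorem enC_ge (hp : 1 < p) : 15 ≤ enC p := by
  have h1 := la_pos hp
  have h2 := la_le p
  have : 12 ≤ 3 / la p := by rw [le_div_iff₀ h1]; linarith
  unfold enC; linarith

theorem abs_S_lb (hp : 1 < p) {t N S : ℝ} (ht : 0 ≤ t) (hN : 1 ≤ N)
    (hS : la p * N * (t / (1 + t)) ≤ S) : la p * (t / (1 + t)) ≤ S := by
  refine le_trans ?_ hS
  have h1 := la_pos hp
  have h2 : 0 ≤ t / (1 + t) := by positivity
  have : la p * 1 * (t / (1 + t)) ≤ la p * N * (t / (1 + t)) := by gcongr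
  linarith

theorem weight_aux (hp : 1 < p) {t : ℝ} (ht : 0 ≤ t) :
    3 ≤ 3 / (1 + t) ^ 2 + 2 * (3 / la p + 3 / (1 + t)) * (la p * (t / (1 + t))) := by
  have h1 := la_pos hp
  have h2 : t / (1 + t) = 1 - 1 / (1 + t) := by field_simp; ring
  have hu : 0 ≤ 1 / (1 + t) := by positivity
  have hu1 : 1 / (1 + t) ≤ 1 := by rw [div_le_one (by positivity)]; linarith
  have h3 : 3 / la p * (la p * (t / (1 + t))) = 3 * (t / (1 + t)) := by field_simp
  have h4 : 0 ≤ 3 / (1 + t) * (la p * (t / (1 + t))) := by positivity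
  have h5 : 3 / (1 + t) ^ 2 = 3 * (1 / (1 + t)) ^ 2 := by field_simp
  rw [mul_assoc, add_mul, h3, h5, h2] at *
  rw [h2] at h4
  nlinarith

theorem hasDerivAt_weight {t : ℝ} (ht : 0 ≤ t) (K : ℝ) :
    HasDerivAt (fun t => K + 3 / (1 + t)) (-(3 / (1 + t) ^ 2)) t := by
  have := ((hasDerivAt_id t).const_add 1).inv (by simp; positivity)
  have := (this.const_mul 3).const_add K
  refine (this.congr_deriv ?_).congr_of_eventuallyEq ?_
  · simp; ring
  · exact Eventually.of_forall fun s => by simp [div_eq_mul_inv]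

theorem energy_left (hp : 1 < p) (hε : 0 < ε) (hε1 : ε * enC p ≤ 1 / 10)
    (h : Profile p ε R f P T) (h0 : P 0 = -(th p * ε / 2)) {t : ℝ} (ht : t ≤ 0) :
    en p ε R P T t ≤ ε * enC p := by
  have hM := enC_ge hp
  have hε2 : ε ≤ 1 / 10 := by nlinarith
  have hθ := th_pos hp
  have hθ1 := th_lt_one hp
  have hl := la_pos hp
  set m : ℝ → ℝ := fun t => 3 / la p + 3 / (1 + -t) with hm
  have hmd : ∀ s, s ≤ 0 → HasDerivAt m (3 / (1 + -s) ^ 2) s := by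
    intro s hs
    simpa [hm] using hasDerivAt_comp_neg_real (hasDerivAt_weight (neg_nonneg.2 hs) (3 / la p))
  have hm1 : ∀ s, s ≤ 0 → 0 ≤ m s ∧ m s ≤ enC p := by
    intro s hs
    have h1 : 3 / (1 + -s) ≤ 3 := div_le_self (by norm_num) (by linarith)
    have h2 : 0 ≤ 3 / (1 + -s) := div_nonneg (by norm_num) (by linarith)
    have h3 : 0 ≤ 3 / la p := by positivity
    simp only [hm, enC]
    constructor <;> linarith
  have hlim := h.tendsto_energy hp hε hε2
  have hW0 := (h.tendsto_QW hp hε hε2).2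
  have hlim2 : Tendsto (fun t => m t * ε * W p ε f t) atBot (nhds 0) := by
    have h1 := hW0.const_mul (ε * enC p)
    rw [mul_zero] at h1
    refine squeeze_zero' ?_ ?_ h1
    · filter_upwards [eventually_le_atBot 0] with s hs
      have := (hm1 s hs).1
      have := h.W_pos s
      positivity
    · filter_upwards [eventually_le_atBot 0] with s hs
      have a1 := hm1 s hs
      have a2 := h.W_pos s
      have a3 := h.one_le_Q s
      calc m s * ε * W p ε f s ≤ enC p * ε * (1 * W p ε f s) := by
            rw [one_mul]; gcongr; exact a1.2
        _ ≤ enC p * ε * ((1 + R * exp (2 * ε * s)) * W p ε f s) := by gcongr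
        _ = _ := by ring
  have hlim3 : Tendsto (fun t => en p ε R P T t * W p ε f t - m t * ε * W p ε f t) atBot
      (nhds 0) := by simpa using hlim.2.sub hlim2
  have key : en p ε R P T t * W p ε f t - m t * ε * W p ε f t ≤ 0 := by
    refine nonpos_of_antitoneOn_Iic
      (f := fun t => en p ε R P T t * W p ε f t - m t * ε * W p ε f t) ?_ hlim3
    refine antitoneOn_of_hasDerivAt_nonpos (convex_Iic t)
      (fun x hx => (h.hasDerivAt_energy hp x).sub
        (((hmd x (le_trans hx ht)).mul_const ε).mul (h.hasDerivAt_W x))) fun x hx => ?_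
    have hx0 : x ≤ 0 := le_trans hx ht
    have hS := h.barrier_left hp hε hε2 h0 hx0
    rw [sub_eq_add_neg] at hS
    have hS' := abs_S_lb hp (neg_nonneg.2 hx0) (one_le_sqrt_Q h.R_pos x) hS
    have hw := weight_aux hp (neg_nonneg.2 hx0)
    have hm2 := hm1 x hx0
    have hWx := h.W_pos x
    have hE := mul_pos h.R_pos (exp_pos (2 * ε * x))
    set S := P x + th p * ε / 2 with hSdef
    have hPx : 2 * P x - th p * ε = 2 * (S - th p * ε) := by rw [hSdef]; ring
    have hmx : m x = 3 / la p + 3 / (1 + -x) := rfl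
    rw [← hmx] at hw
    have e1 : 2 * m x * (la p * (-x / (1 + -x))) ≤ 2 * m x * S := by
      have := hm2.1; gcongr
    have e2 : m x * (th p * ε) ≤ 1 / 10 := by
      calc m x * (th p * ε) ≤ enC p * (1 * ε) := by gcongr; exact hm2.2
        _ ≤ _ := by linarith
    have e3 : (1 - th p) * (R * exp (2 * ε * x)) ≥ 0 := by
      apply mul_nonneg _ hE.le; linarith
    have e4 : 0 ≤ th p ^ 3 * ε ^ 2 / 4 := by positivity
    rw [hPx]
    have : th p - th p ^ 3 * ε ^ 2 / 4 - (1 - th p) * (R * exp (2 * ε * x)) -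
        (3 / (1 + -x) ^ 2 + m x * (2 * (S - th p * ε))) ≤ 0 := by
      linarith
    have := mul_nonpos_of_nonneg_of_nonpos (mul_pos hε hWx).le this
    linarith
  have hWt := h.W_pos t
  have : (en p ε R P T t - m t * ε) * W p ε f t ≤ 0 := by linarith
  have h2 : en p ε R P T t - m t * ε ≤ 0 := by
    by_contra! hc
    have := mul_pos hc hWt; linarith
  have := mul_le_mul_of_nonneg_right (hm1 t ht).2 hε.le
  linarith

theorem energy_right (hp : 1 < p) (hε : 0 < ε) (hε1 : ε * enC p ≤ 1 / 10)
    (h : Profile p ε R f P T) (h0 : P 0 = -(th p * ε / 2)) {t : ℝ} (ht : 0 ≤ t) :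
    en p ε R P T t ≤ ε * enC p * (1 + R * exp (2 * ε * t)) := by
  have hM := enC_ge hp
  have hε2 : ε ≤ 1 / 10 := by nlinarith
  have hθ := th_pos hp
  have hθ1 := th_lt_one hp
  have hl := la_pos hp
  set m : ℝ → ℝ := fun t => 3 / la p + 3 / (1 + t) with hm
  have hm1 : ∀ s, 0 ≤ s → 0 ≤ m s ∧ m s ≤ enC p := by
    intro s hs
    have h1 : 3 / (1 + s) ≤ 3 := div_le_self (by norm_num) (by linarith)
    have h2 : 0 ≤ 3 / (1 + s) := div_nonneg (by norm_num) (by linarith)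
    have h3 : 0 ≤ 3 / la p := by positivity
    simp only [hm, enC]
    constructor <;> linarith
  have hlim := h.tendsto_energy hp hε hε2
  have hW0 := (h.tendsto_QW hp hε hε2).1
  have hlim2 : Tendsto (fun t => m t * ε * ((1 + R * exp (2 * ε * t)) * W p ε f t)) atTop
      (nhds 0) := by
    have h1 := hW0.const_mul (enC p * ε)
    rw [mul_zero] at h1
    refine squeeze_zero' ?_ ?_ h1
    · filter_upwards [eventually_ge_atTop 0] with s hs
      have := (hm1 s hs).1
      have := h.W_pos s
      have := h.one_le_Q s
      positivity
    · filter_upwards [eventually_ge_atTop 0] with s hs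
      have a1 := hm1 s hs
      have a2 := h.W_pos s
      have a3 := h.one_le_Q s
      have a4 : 0 ≤ (1 + R * exp (2 * ε * s)) * W p ε f s := by positivity
      gcongr
      exact a1.2
  have hlim3 : Tendsto (fun t => en p ε R P T t * W p ε f t -
      m t * ε * ((1 + R * exp (2 * ε * t)) * W p ε f t)) atTop
      (nhds 0) := by simpa using hlim.1.sub hlim2
  have key : en p ε R P T t * W p ε f t - m t * ε * ((1 + R * exp (2 * ε * t)) * W p ε f t)
      ≤ 0 := by
    refine nonpos_of_monotoneOn_Ici
      (f := fun t => en p ε R P T t * W p ε f t -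
        m t * ε * ((1 + R * exp (2 * ε * t)) * W p ε f t)) ?_ hlim3
    refine monotoneOn_of_hasDerivAt_nonneg (convex_Ici t)
      (fun x hx => (h.hasDerivAt_energy hp x).sub
        (((hasDerivAt_weight (le_trans ht hx) (3 / la p)).mul_const ε).mul
          ((((hasDerivAt_exp_mul (2 * ε) x).const_mul R).const_add 1).mul
            (h.hasDerivAt_W x)))) fun x hx => ?_
    have hx0 : 0 ≤ x := le_trans ht hx
    have hS := h.barrier_right hp hε hε2 h0 hx0
    set S := P x + th p * ε / 2 with hSdef
    have hS' := abs_S_lb hp hx0 (one_le_sqrt_Q h.R_pos x) (S := -S) (by linarith)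
    have hw := weight_aux hp hx0
    have hm2 := hm1 x hx0
    have hWx := h.W_pos x
    have hE := mul_pos h.R_pos (exp_pos (2 * ε * x))
    have hPx : 2 * P x - th p * ε = 2 * (S - th p * ε) := by rw [hSdef]; ring
    have hmx : m x = 3 / la p + 3 / (1 + x) := rfl
    rw [← hmx] at hw ⊢
    have e1 : 2 * m x * (la p * (x / (1 + x))) ≤ 2 * m x * (-S) := by
      have := hm2.1; gcongr
    have e2 : ε * m x ≤ 1 / 10 := (mul_le_mul_of_nonneg_left hm2.2 hε.le).trans hε1
    have e5 : 0 ≤ m x * (th p * ε) := by have := hm2.1; positivity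
    have e4 : th p ^ 3 * ε ^ 2 / 4 ≤ th p := by
      have : th p ^ 2 ≤ 1 := by nlinarith
      have : ε ^ 2 ≤ 1 := by nlinarith
      have : th p ^ 2 * ε ^ 2 ≤ 1 := by nlinarith [sq_nonneg ε, sq_nonneg (th p)]
      nlinarith
    rw [hPx]
    set X := R * exp (2 * ε * x) with hX
    have hX' : R * (2 * ε * exp (2 * ε * x)) = 2 * ε * X := by rw [hX]; ring
    rw [hX']
    have e6 : m x * (2 * (S - th p * ε)) ≤ -3 + 3 / (1 + x) ^ 2 := by linarith
    have e7 : (1 + X) * (m x * (2 * (S - th p * ε))) ≤ (1 + X) * (-3 + 3 / (1 + x) ^ 2) := by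
      gcongr
    have e8 : ε * m x * X ≤ 1 / 10 * X := by gcongr
    have e9 : th p * X > 0 := by positivity
    have : 0 ≤ th p - th p ^ 3 * ε ^ 2 / 4 - (1 - th p) * X -
        (-(3 / (1 + x) ^ 2) * (1 + X) + m x * (2 * ε * X +
          (1 + X) * (2 * (S - th p * ε)))) := by
      linarith
    have := mul_nonneg (mul_pos hε hWx).le this
    linarith
  have hWt := h.W_pos t
  have hQ := h.one_le_Q t
  have : (en p ε R P T t - m t * ε * (1 + R * exp (2 * ε * t))) * W p ε f t ≤ 0 := by linarith
  have h2 : en p ε R P T t - m t * ε * (1 + R * exp (2 * ε * t)) ≤ 0 := by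
    by_contra! hc
    have := mul_pos hc hWt; linarith
  have := mul_le_mul_of_nonneg_right (mul_le_mul_of_nonneg_right (hm1 t ht).2 hε.le)
    (by linarith : 0 ≤ 1 + R * exp (2 * ε * t))
  linarith

end Profile

namespace Profile

variable {p ε R : ℝ} {f P T : ℝ → ℝ}

theorem R_le (hp : 1 < p) (hε : 0 < ε) (hε1 : ε * enC p ≤ exp (-2) / 2)
    (h : Profile p ε R f P T) (h0 : P 0 = -(th p * ε / 2)) :
    R ≤ 2 * exp 2 / (1 - th p) := by
  have hM := enC_ge hp
  have he2 : exp (-2 : ℝ) ≤ 1 / 5 := by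
    rw [exp_neg, inv_eq_one_div]
    apply one_div_le_one_div_of_le (by norm_num)
    have h1 := exp_one_gt_d9
    have : exp (2:ℝ) = exp 1 * exp 1 := by rw [← exp_add]; norm_num
    nlinarith
  have hε3 : ε * enC p ≤ 1 / 10 := by linarith
  have hε2 : ε ≤ 1 / 10 := by nlinarith
  have hθ := th_pos hp
  have hθ1 := th_lt_one hp
  by_contra! hR
  rw [div_lt_iff₀ (by linarith)] at hR
  have hl : -(1 / ε) ≤ 0 := by rw [neg_nonpos]; positivity
  set s₀ := -(1 / ε) with hs₀
  have hεs : ε * s₀ = -1 := by rw [hs₀]; field_simp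
  set w := W p ε f s₀ with hw
  have hw0 : 0 < w := h.W_pos s₀
  have hWlow : ∀ t ∈ Set.Icc s₀ 0, exp (-2) * w ≤ W p ε f t := by
    have hm : MonotoneOn (fun t => exp (2 * ε * t) * W p ε f t) (Set.Icc s₀ 0) := by
      refine monotoneOn_of_hasDerivAt_nonneg (convex_Icc _ _)
        (fun x _ => (hasDerivAt_exp_mul (2 * ε) x).mul (h.hasDerivAt_W x)) fun x hx => ?_
      have hS := h.barrier_left hp hε hε2 h0 hx.2
      have h1 : 0 ≤ la p * √(1 + R * exp (2 * ε * x)) * (-x / (1 - x)) := by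
        have := la_pos hp
        have h2 : 0 ≤ -x := neg_nonneg.2 hx.2
        have : 0 ≤ -x / (1 - x) := div_nonneg h2 (by linarith)
        positivity
      have hW := h.W_pos x
      have h3 : 0 ≤ 2 * ε + (2 * P x - th p * ε) := by nlinarith
      have := mul_nonneg (mul_pos (exp_pos (2 * ε * x)) hW).le h3
      linarith
    intro t ht
    have h1 := hm (Set.left_mem_Icc.2 hl) ht ht.1
    simp only at h1
    rw [show 2 * ε * s₀ = -2 by linarith] at h1
    have h2 : exp (2 * ε * t) ≤ 1 := by
      rw [exp_le_one_iff]
      exact mul_nonpos_of_nonneg_of_nonpos (by positivity) ht.2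
    refine h1.trans (mul_le_of_le_one_left (h.W_pos t).le h2)
  have ha : AntitoneOn (fun t => en p ε R P T t * W p ε f t + ε * (exp (-2) * w) * t)
      (Set.Icc s₀ 0) := by
    refine antitoneOn_of_hasDerivAt_nonpos (convex_Icc _ _)
      (fun x _ => (h.hasDerivAt_energy hp x).add ((hasDerivAt_id x).const_mul _)) fun x hx => ?_
    have h1 : exp (-2) ≤ exp (2 * ε * x) := by
      apply exp_le_exp.2; nlinarith [hx.1]
    have h2 : 2 ≤ (1 - th p) * (R * exp (2 * ε * x)) := by
      calc (2:ℝ) = 2 * exp 2 * exp (-2) := by rw [mul_assoc, ← exp_add]; norm_num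
        _ ≤ R * (1 - th p) * exp (2 * ε * x) := by
            have : 0 ≤ 1 - th p := by linarith
            have := h.R_pos
            gcongr
        _ = _ := by ring
    have h3 := hWlow x hx
    have h4 := h.W_pos x
    have h5 : 0 ≤ th p ^ 3 * ε ^ 2 / 4 := by positivity
    have h6 : th p - th p ^ 3 * ε ^ 2 / 4 - (1 - th p) * (R * exp (2 * ε * x)) ≤ -1 := by linarith
    have h7 := mul_le_mul_of_nonneg_left h6 (mul_pos hε h4).le
    have h8 := mul_le_mul_of_nonneg_left h3 hε.le
    linarith
  have h1 := ha (Set.left_mem_Icc.2 hl) (Set.right_mem_Icc.2 hl) hl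
  simp only [mul_zero, add_zero] at h1
  have h2 := h.energy_left hp hε hε3 h0 hl
  have h3 := h.en_nonneg hp hε hε2 0
  have h4 := h.W_pos 0
  have h5 := mul_nonneg h3 h4.le
  have h6 : en p ε R P T s₀ * w ≤ exp (-2) / 2 * w := by gcongr; linarith
  have h7 : ε * (exp (-2) * w) * s₀ = -(exp (-2) * w) := by
    rw [show ε * (exp (-2) * w) * s₀ = ε * s₀ * (exp (-2) * w) by ring, hεs]; ring
  have h8 : 0 < exp (-2) * w := by positivity
  rw [h7] at h1
  linarith

theorem le_R (hp : 1 < p) (hp5 : p < 5) (hε : 0 < ε)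
    (hε1 : ε * enC p ≤ (1 - th p) / 100)
    (h : Profile p ε R f P T) (h0 : P 0 = -(th p * ε / 2)) :
    exp (-2) / 8 ≤ R := by
  have hM := enC_ge hp
  have hθ := th_pos hp
  have hθ1 := th_lt_one hp
  have hθ2 := half_lt_th hp hp5
  have hε3 : ε * enC p ≤ 1 / 100 := by linarith
  have hε2 : ε ≤ 1 / 10 := by nlinarith
  by_contra! hR
  have hl : 0 ≤ 1 / ε := by positivity
  set s₀ := 1 / ε with hs₀
  have hεs : ε * s₀ = 1 := by rw [hs₀]; field_simp
  have hR2 : ∀ t ∈ Set.Icc 0 s₀, R * exp (2 * ε * t) ≤ 1 / 8 := by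
    intro t ht
    have h1 : exp (2 * ε * t) ≤ exp 2 := by apply exp_le_exp.2; nlinarith [ht.2]
    calc R * exp (2 * ε * t) ≤ exp (-2) / 8 * exp 2 := by gcongr
      _ = exp (-2) * exp 2 / 8 := by ring
      _ = 1 / 8 := by rw [← exp_add]; norm_num
  have hWa : AntitoneOn (W p ε f) (Set.Icc 0 s₀) := by
    refine antitoneOn_of_hasDerivAt_nonpos (convex_Icc _ _)
      (fun x _ => h.hasDerivAt_W x) fun x hx => ?_
    have hS := h.barrier_right hp hε hε2 h0 hx.1
    have h1 : 0 ≤ la p * √(1 + R * exp (2 * ε * x)) * (x / (1 + x)) := by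
      have := la_pos hp
      have := hx.1
      positivity
    have h2 : 0 < th p * ε := by positivity
    exact mul_nonpos_of_nonpos_of_nonneg (by linarith) (h.W_pos x).le
  set w := W p ε f s₀ with hw
  have hw0 : 0 < w := h.W_pos s₀
  have ha : MonotoneOn (fun t => en p ε R P T t * W p ε f t - ε * (w / 8) * t)
      (Set.Icc 0 s₀) := by
    refine monotoneOn_of_hasDerivAt_nonneg (convex_Icc _ _)
      (fun x _ => (h.hasDerivAt_energy hp x).sub ((hasDerivAt_id x).const_mul _)) fun x hx => ?_
    have h1 := hR2 x hx
    have h2 : w ≤ W p ε f x := hWa hx (Set.right_mem_Icc.2 hl) hx.2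
    have h4 := h.W_pos x
    have hX := mul_pos h.R_pos (exp_pos (2 * ε * x))
    have h5 : th p ^ 3 * ε ^ 2 / 4 ≤ 1 / 8 := by
      have a1 : th p ^ 3 ≤ 1 := pow_le_one₀ hθ.le hθ1.le
      have a2 : ε ^ 2 ≤ 1 / 100 := by nlinarith
      have : th p ^ 3 * ε ^ 2 ≤ 1 * (1 / 100) := by gcongr
      linarith
    have h6 : (1:ℝ) / 8 ≤ th p - th p ^ 3 * ε ^ 2 / 4 - (1 - th p) * (R * exp (2 * ε * x)) := by
      nlinarith
    have h7 := mul_le_mul_of_nonneg_left h6 (mul_pos hε h4).le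
    have h8 := mul_le_mul_of_nonneg_left h2 hε.le
    linarith
  have h1 := ha (Set.left_mem_Icc.2 hl) (Set.right_mem_Icc.2 hl) hl
  simp only [mul_zero, sub_zero] at h1
  have h2 := h.energy_right hp hε (by linarith) h0 hl
  have h3 := mul_nonneg (h.en_nonneg hp hε hε2 0) (h.W_pos 0).le
  have h9 := hR2 s₀ (Set.right_mem_Icc.2 hl)
  have h10 := h.one_le_Q s₀
  have h11 : en p ε R P T s₀ ≤ 1 / 100 * (9 / 8) := by
    refine h2.trans ?_
    gcongr
    linarith
  have h6 : en p ε R P T s₀ * w ≤ 1 / 100 * (9 / 8) * w := by gcongr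
  have h7 : ε * (w / 8) * s₀ = w / 8 := by
    rw [show ε * (w / 8) * s₀ = ε * s₀ * (w / 8) by ring, hεs]; ring
  rw [h7] at h1
  linarith

end Profile

/-- Uniform quantitative control of a centered profile. -/
structure Ctrl (p ε R c C : ℝ) (f P T : ℝ → ℝ) : Prop extends Profile p ε R f P T where
  f_zero : f 0 = 1
  R_lb : c ≤ R
  R_ub : R ≤ C
  T_close : ∀ t, |T t - (p + 1) / 2 * (1 + R * exp (2 * ε * t) - P t ^ 2)|
    ≤ C * ε * (1 + R * exp (2 * ε * t))
  P_le : ∀ t, P t ^ 2 ≤ 4 * (1 + R * exp (2 * ε * t))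
  P_right : ∀ t, 0 ≤ t → P t ≤ -(c * (t / (1 + t)))
  P_left : ∀ t, t ≤ 0 → c * (-t / (1 - t)) - ε ≤ P t
  f_le : ∀ t, f t ≤ C * exp (-(c * |t|))
  f_ge : ∀ t, |t| ≤ 2 → c ≤ f t

namespace Profile

variable {p ε R : ℝ} {f P T : ℝ → ℝ}

theorem en_le (hp : 1 < p) (hε : 0 < ε) (hε1 : ε * enC p ≤ 1 / 10)
    (h : Profile p ε R f P T) (h0 : P 0 = -(th p * ε / 2)) (t : ℝ) :
    en p ε R P T t ≤ ε * enC p * (1 + R * exp (2 * ε * t)) := by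
  rcases le_total 0 t with ht | ht
  · exact h.energy_right hp hε hε1 h0 ht
  · refine (h.energy_left hp hε hε1 h0 ht).trans ?_
    have := enC_ge hp
    exact le_mul_of_one_le_right (by positivity) (h.one_le_Q t)

theorem P_sq_le (hp : 1 < p) (hε : 0 < ε) (hε1 : ε * enC p ≤ 1 / 10)
    (h : Profile p ε R f P T) (h0 : P 0 = -(th p * ε / 2)) (t : ℝ) :
    P t ^ 2 ≤ 4 * (1 + R * exp (2 * ε * t)) := by
  have h1 := h.en_le hp hε hε1 h0 t
  have hM := enC_ge hp
  have hε2 : ε ≤ 1 / 10 := by nlinarith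
  have hθ := th_pos hp
  have hθ1 := th_lt_one hp
  have hθε : th p * ε ≤ 1 / 10 := by nlinarith
  have hθε0 : 0 < th p * ε := by positivity
  have hQ := h.one_le_Q t
  have hT : 0 < T t / (p + 1) := div_pos (h.T_pos t) (by linarith)
  have h2 : ε * enC p * (1 + R * exp (2 * ε * t)) ≤ 1 / 10 * (1 + R * exp (2 * ε * t)) := by gcongr
  unfold en at h1
  nlinarith [sq_nonneg (P t + th p * ε), sq_nonneg (th p * ε)]

theorem T_close_aux (hp : 1 < p) (hp5 : p < 5) (hε : 0 < ε) (hε1 : ε * enC p ≤ 1 / 10)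
    (h : Profile p ε R f P T) (h0 : P 0 = -(th p * ε / 2)) (t : ℝ) :
    |T t - (p + 1) / 2 * (1 + R * exp (2 * ε * t) - P t ^ 2)| ≤
      6 * (enC p + 3) * ε * (1 + R * exp (2 * ε * t)) := by
  have h1 := h.en_le hp hε hε1 h0 t
  have hM := enC_ge hp
  have hε2 : ε ≤ 1 / 10 := by nlinarith
  have h2 := h.en_nonneg hp hε hε2 t
  have hP := h.P_sq_le hp hε hε1 h0 t
  have hθ := th_pos hp
  have hθ1 := th_lt_one hp
  have hQ := h.one_le_Q t
  set Q := 1 + R * exp (2 * ε * t)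
  have e1 : T t - (p + 1) / 2 * (Q - P t ^ 2) =
      (p + 1) * (en p ε R P T t - th p * ε * P t / 2 - th p ^ 2 * ε ^ 2 / 4) := by
    unfold en
    have : p + 1 ≠ 0 := by linarith
    field_simp
    ring
  have hPQ : |P t| ≤ 2 * Q := by
    apply abs_le_of_sq_le_sq
    · nlinarith
    · linarith
  have e2 : |th p * ε * P t| ≤ 2 * ε * Q := by
    rw [abs_mul, abs_mul, abs_of_pos hθ, abs_of_pos hε]
    calc th p * ε * |P t| ≤ 1 * ε * (2 * Q) := by gcongr
      _ = _ := by ring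
  have e3 : th p ^ 2 * ε ^ 2 ≤ ε * Q := by
    have a1 : th p ^ 2 ≤ 1 := pow_le_one₀ hθ.le hθ1.le
    calc th p ^ 2 * ε ^ 2 ≤ 1 * (ε * 1) := by
          rw [sq ε]; gcongr; linarith
      _ ≤ _ := by rw [one_mul]; gcongr
  have e4 : 0 ≤ th p ^ 2 * ε ^ 2 := by positivity
  rw [e1, abs_mul, abs_of_pos (by linarith : 0 < p + 1)]
  have e5 : |en p ε R P T t - th p * ε * P t / 2 - th p ^ 2 * ε ^ 2 / 4| ≤ ε * (enC p + 3) * Q := by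
    have := abs_le.1 e2
    have : 0 < ε * Q := by positivity
    rw [abs_le]
    constructor <;> nlinarith
  calc (p + 1) * _ ≤ 6 * (ε * (enC p + 3) * Q) := by gcongr; linarith
    _ = _ := by ring

theorem P_right_le (hp : 1 < p) (hε : 0 < ε) (hε2 : ε ≤ 1 / 10)
    (h : Profile p ε R f P T) (h0 : P 0 = -(th p * ε / 2)) {t : ℝ} (ht : 0 ≤ t) :
    P t ≤ -(la p * (t / (1 + t))) := by
  have hS := h.barrier_right hp hε hε2 h0 ht
  have := abs_S_lb hp ht (one_le_sqrt_Q (ε := ε) h.R_pos t) (S := -(P t + th p * ε / 2))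
      (by linarith)
  have hθ := th_pos hp
  have : 0 < th p * ε := by positivity
  linarith

theorem le_P_left (hp : 1 < p) (hε : 0 < ε) (hε2 : ε ≤ 1 / 10)
    (h : Profile p ε R f P T) (h0 : P 0 = -(th p * ε / 2)) {t : ℝ} (ht : t ≤ 0) :
    la p * (-t / (1 - t)) - ε ≤ P t := by
  have hS := h.barrier_left hp hε hε2 h0 ht
  rw [sub_eq_add_neg] at hS
  have := abs_S_lb hp (neg_nonneg.2 ht) (one_le_sqrt_Q h.R_pos t) hS
  have hθ := th_pos hp
  have hθ1 := th_lt_one hp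
  have : th p * ε ≤ 1 * ε := by gcongr
  rw [sub_eq_add_neg 1 t]
  linarith

theorem f_le_right (hp : 1 < p) (hε : 0 < ε) (hε2 : ε ≤ 1 / 10)
    (h : Profile p ε R f P T) (h0 : P 0 = -(th p * ε / 2)) (hf0 : f 0 = 1) {t : ℝ} (ht : 0 ≤ t) :
    f t ≤ 3 * exp (-(la p / 4 * t)) := by
  have hl := la_pos hp
  have hl4 := la_le p
  have ha : AntitoneOn (fun t => f t * exp (la p / 4 * t) * (1 + exp (-t))) (Set.Ici 0) := by
    refine antitoneOn_of_hasDerivAt_nonpos (convex_Ici 0)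
      (fun x _ => ((h.hf x).mul (hasDerivAt_exp_mul (la p / 4) x)).mul
        ((hasDerivAt_neg x).exp.const_add 1)) fun x hx => ?_
    have hx0 : 0 ≤ x := hx
    have h1 := h.P_right_le hp hε hε2 h0 hx0
    have hf := h.f_pos x
    have hE := exp_pos (la p / 4 * x)
    have hE2 := exp_pos (-x)
    have h3 : exp (-x) ≤ 1 := by rw [exp_le_one_iff]; linarith
    have h4 : 1 - x ≤ exp (-x) := by linarith [add_one_le_exp (-x)]
    have h5 : x / (1 + x) = 1 - 1 / (1 + x) := by field_simp; ring
    have h6 : 1 / 4 * (1 + exp (-x)) ≤ x / (1 + x) * (1 + exp (-x)) + exp (-x) := by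
      rcases le_total x 1 with h7 | h7
      · have : 1 / 2 * x ≤ x / (1 + x) := by
          rw [le_div_iff₀ (by linarith)]; nlinarith
        nlinarith
      · have : 1 / 2 ≤ x / (1 + x) := by
          rw [le_div_iff₀ (by linarith)]; linarith
        nlinarith
    have h8 : (P x + la p / 4) * (1 + exp (-x)) - exp (-x) ≤ 0 := by
      have : (P x + la p / 4) * (1 + exp (-x)) ≤
          (-(la p * (x / (1 + x))) + la p / 4) * (1 + exp (-x)) := by gcongr
      nlinarith
    have := mul_nonpos_of_nonneg_of_nonpos (mul_pos hf hE).le h8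
    simp only [Pi.mul_apply]
    linarith
  have h1 := ha (Set.mem_Ici.2 le_rfl) ht ht
  simp only [hf0, mul_zero, exp_zero, neg_zero] at h1
  have hE := exp_pos (la p / 4 * t)
  have hE2 := exp_pos (-t)
  have hf := h.f_pos t
  rw [exp_neg]
  rw [← div_eq_mul_inv, le_div_iff₀ hE]
  nlinarith [mul_pos hf hE, mul_pos (mul_pos hf hE) hE2]

theorem f_le_left (hp : 1 < p) (hε : 0 < ε) (hε2 : ε ≤ la p / 100)
    (h : Profile p ε R f P T) (h0 : P 0 = -(th p * ε / 2)) (hf0 : f 0 = 1) {t : ℝ} (ht : t ≤ 0) :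
    f t ≤ 3 * exp (-(la p / 8 * -t)) := by
  have hl := la_pos hp
  have hl4 := la_le p
  have ha : MonotoneOn (fun t => f t * exp (-(la p / 8) * t) * (1 + exp t)) (Set.Iic 0) := by
    refine monotoneOn_of_hasDerivAt_nonneg (convex_Iic 0)
      (fun x _ => ((h.hf x).mul (hasDerivAt_exp_mul (-(la p / 8)) x)).mul
        ((hasDerivAt_exp x).const_add 1)) fun x hx => ?_
    have hx0 : x ≤ 0 := hx
    have h1 := h.le_P_left hp hε (by linarith) h0 hx0
    have hf := h.f_pos x
    have hE := exp_pos (-(la p / 8) * x)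
    have hE2 := exp_pos x
    have h3 : exp x ≤ 1 := by rw [exp_le_one_iff]; linarith
    have h4 : 1 + x ≤ exp x := by linarith [add_one_le_exp x]
    have h6 : 1 / 4 * (1 + exp x) ≤ -x / (1 - x) * (1 + exp x) + exp x := by
      rcases le_total (-1) x with h7 | h7
      · have : 1 / 2 * (-x) ≤ -x / (1 - x) := by
          rw [le_div_iff₀ (by linarith)]; nlinarith
        nlinarith
      · have : 1 / 2 ≤ -x / (1 - x) := by
          rw [le_div_iff₀ (by linarith)]; linarith
        nlinarith
    have h8 : 0 ≤ (P x - la p / 8) * (1 + exp x) + exp x := by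
      have : (la p * (-x / (1 - x)) - la p / 100 - la p / 8) * (1 + exp x) ≤
          (P x - la p / 8) * (1 + exp x) := by gcongr; linarith
      nlinarith
    have := mul_nonneg (mul_pos hf hE).le h8
    simp only [Pi.mul_apply]
    linarith
  have h1 := ha ht (Set.mem_Iic.2 le_rfl) ht
  simp only [hf0, mul_zero, exp_zero] at h1
  have hE := exp_pos (-(la p / 8) * t)
  have hE2 := exp_pos t
  have hf := h.f_pos t
  rw [show -(la p / 8) * t = la p / 8 * -t by ring] at h1 hE
  rw [exp_neg, ← div_eq_mul_inv, le_div_iff₀ hE]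
  nlinarith [mul_pos hf hE, mul_pos (mul_pos hf hE) hE2]

/-- A lower bound near the center. -/
theorem le_f (hε : 0 < ε) (hε2 : ε ≤ 1 / 10) (h : Profile p ε R f P T) (hf0 : f 0 = 1)
    {B : ℝ} (hB : 0 < B) (hP : ∀ t, |t| ≤ 2 → |P t| ≤ B) {t : ℝ} (ht : |t| ≤ 2) :
    exp (-(2 * B)) ≤ f t := by
  have ht' := abs_le.1 ht
  rcases le_total 0 t with h0 | h0
  · have hm : MonotoneOn (fun t => f t * exp (B * t)) (Set.Icc 0 2) := by
      refine monotoneOn_of_hasDerivAt_nonneg (convex_Icc 0 2)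
        (fun x _ => ((h.hf x).mul (hasDerivAt_exp_mul B x))) fun x hx => ?_
      have h1 := abs_le.1 (hP x (by rw [abs_of_nonneg hx.1]; exact hx.2))
      have h2 := mul_nonneg (mul_pos (h.f_pos x) (exp_pos (B * x))).le
        (by linarith : 0 ≤ P x + B)
      linarith
    have h1 := hm (Set.left_mem_Icc.2 (by norm_num)) ⟨h0, ht'.2⟩ h0
    simp only [hf0, mul_zero, exp_zero, mul_one] at h1
    have h2 : exp (B * t) ≤ exp (2 * B) := by apply exp_le_exp.2; nlinarith
    have h3 : f t * exp (B * t) ≤ f t * exp (2 * B) :=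
      mul_le_mul_of_nonneg_left h2 (h.f_pos t).le
    rw [exp_neg, inv_le_iff_one_le_mul₀ (exp_pos _)]
    linarith
  · have hm : AntitoneOn (fun t => f t * exp (-B * t)) (Set.Icc (-2) 0) := by
      refine antitoneOn_of_hasDerivAt_nonpos (convex_Icc (-2) 0)
        (fun x _ => ((h.hf x).mul (hasDerivAt_exp_mul (-B) x))) fun x hx => ?_
      have h1 := abs_le.1 (hP x (by rw [abs_of_nonpos hx.2]; linarith [hx.1]))
      have h2 := mul_nonneg (mul_pos (h.f_pos x) (exp_pos (-B * x))).le
        (by linarith : 0 ≤ B - P x)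
      linarith
    have h1 := hm ⟨ht'.1, h0⟩ (Set.right_mem_Icc.2 (by norm_num)) h0
    simp only [hf0, mul_zero, exp_zero, mul_one] at h1
    have h2 : exp (-B * t) ≤ exp (2 * B) := by apply exp_le_exp.2; nlinarith
    have h3 : f t * exp (-B * t) ≤ f t * exp (2 * B) :=
      mul_le_mul_of_nonneg_left h2 (h.f_pos t).le
    rw [exp_neg, inv_le_iff_one_le_mul₀ (exp_pos _)]
    linarith

theorem exists_ctrl (hp : 1 < p) (hp5 : p < 5) :
    ∃ ε₀ > 0, ∃ c > 0, ∃ C > 0, ε₀ ≤ 1 / 100 ∧ c ≤ 1 ∧ 1 ≤ C ∧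
      ∀ {ε R : ℝ} {f P T : ℝ → ℝ}, 0 < ε → ε ≤ ε₀ →
      Profile p ε R f P T → P 0 = -(th p * ε / 2) → f 0 = 1 → Ctrl p ε R c C f P T := by
  have hM := enC_ge hp
  have hl := la_pos hp
  have hl4 := la_le p
  have hθ := th_pos hp
  have hθ1 := th_lt_one hp
  have h1θ : 0 < 1 - th p := by linarith
  set R₁ := 2 * exp 2 / (1 - th p) with hR₁
  have hR₁0 : 0 < R₁ := by positivity
  set B := 2 * (1 + R₁ * exp 1) with hBdef
  have hB : 0 < B := by positivity
  set c := min (exp (-(2 * B))) (min (exp (-2) / 8) (la p / 8)) with hc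
  have hc0 : 0 < c := by rw [hc]; positivity
  have hc1 : c ≤ exp (-(2 * B)) := min_le_left _ _
  have hc2 : c ≤ exp (-2) / 8 := (min_le_right _ _).trans (min_le_left _ _)
  have hc3 : c ≤ la p / 8 := (min_le_right _ _).trans (min_le_right _ _)
  set C := R₁ + 6 * (enC p + 3) + 3 with hC
  set ε₀ := min (min (exp (-2) / 2) ((1 - th p) / 100) / enC p) (la p / 100) with hε₀
  have hε₀0 : 0 < ε₀ := by rw [hε₀]; positivity
  refine ⟨ε₀, hε₀0, c, hc0, C, by positivity, ?_, by linarith, by linarith, ?_⟩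
  · exact (min_le_right _ _).trans (by linarith)
  intro ε R f P T hε hεε h h0 hf0
  have e1 : ε * enC p ≤ min (exp (-2) / 2) ((1 - th p) / 100) := by
    rw [← le_div_iff₀ (by linarith)]; exact hεε.trans (min_le_left _ _)
  have e2 : ε ≤ la p / 100 := hεε.trans (min_le_right _ _)
  have e3 : ε ≤ 1 / 10 := by linarith
  have e4 : ε * enC p ≤ (1 - th p) / 100 := e1.trans (min_le_right _ _)
  have e5 : ε * enC p ≤ 1 / 10 := by linarith
  have hRu := h.R_le hp hε (e1.trans (min_le_left _ _)) h0
  have hRl := h.le_R hp hp5 hε e4 h0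
  have hR := h.R_pos
  refine ⟨h, hf0, hc2.trans hRl, by linarith, ?_, h.P_sq_le hp hε e5 h0, ?_, ?_, ?_, ?_⟩
  · intro t
    refine (h.T_close_aux hp hp5 hε e5 h0 t).trans ?_
    have := h.one_le_Q t
    gcongr
    linarith
  · intro t ht
    refine (h.P_right_le hp hε e3 h0 ht).trans ?_
    have : 0 ≤ t / (1 + t) := by positivity
    have : c * (t / (1 + t)) ≤ la p * (t / (1 + t)) := by gcongr; linarith
    linarith
  · intro t ht
    refine le_trans ?_ (h.le_P_left hp hε e3 h0 ht)
    have : 0 ≤ -t / (1 - t) := div_nonneg (by linarith) (by linarith)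
    have : c * (-t / (1 - t)) ≤ la p * (-t / (1 - t)) := by gcongr; linarith
    linarith
  · intro t
    rcases le_total 0 t with ht | ht
    · refine (h.f_le_right hp hε e3 h0 hf0 ht).trans ?_
      rw [abs_of_nonneg ht]
      gcongr <;> linarith
    · refine (h.f_le_left hp hε e2 h0 hf0 ht).trans ?_
      rw [abs_of_nonpos ht]
      have : 0 ≤ -t := by linarith
      gcongr; linarith
  · intro t ht
    refine hc1.trans (h.le_f hε e3 hf0 hB (fun s hs => ?_) ht)
    have h1 := h.P_sq_le hp hε e5 h0 s
    have h2 := h.one_le_Q s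
    have h3 : |P s| ≤ 2 * (1 + R * exp (2 * ε * s)) := by
      apply abs_le_of_sq_le_sq
      · nlinarith
      · linarith
    refine h3.trans ?_
    rw [hBdef]
    have h4 : 2 * ε * s ≤ 1 := by
      have := (abs_le.1 hs).2
      nlinarith
    gcongr
end Profile

section CompactSupport

variable {E F : Type*} [NormedAddCommGroup E] [NormedSpace ℝ E] [NormedAddCommGroup F]

theorem HasCompactSupport.of_deriv_zero {a : ℝ → E} {g : ℝ → F} (ha : HasCompactSupport a)
    (hg : ∀ t, a t = 0 → deriv a t = 0 → g t = 0) : HasCompactSupport g := by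
  refine HasCompactSupport.intro ha.isCompact fun t ht => ?_
  refine hg t (image_eq_zero_of_notMem_tsupport ht) ?_
  have := (notMem_tsupport_iff_eventuallyEq.1 ht).deriv_eq
  simpa using this

theorem Continuous.integrable_of_deriv_zero {a : ℝ → E} {g : ℝ → F} (hg : Continuous g)
    (ha : HasCompactSupport a) (h0 : ∀ t, a t = 0 → deriv a t = 0 → g t = 0) : Integrable g :=
  hg.integrable_of_hasCompactSupport (ha.of_deriv_zero h0)

theorem HasCompactSupport.tendsto_zero {V : Type*} [NormedAddCommGroup V] {u : ℝ → V}
    (hs : HasCompactSupport u) :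
    Tendsto u atTop (nhds 0) ∧ Tendsto u atBot (nhds 0) := by
  have h := (hasCompactSupport_iff_eventuallyEq.1 hs).tendsto
  rw [coclosedCompact_eq_cocompact, ← Metric.cobounded_eq_cocompact,
    IsOrderBornology.cobounded_eq] at h
  exact ⟨h.mono_left le_sup_right, h.mono_left le_sup_left⟩

theorem HasCompactSupport.integral_hasDerivAt_eq_zero [CompleteSpace E] {u u' : ℝ → E}
    (hs : HasCompactSupport u) (hd : ∀ t, HasDerivAt u (u' t) t) (hc : Continuous u') :
    ∫ t, u' t = 0 := by
  have hu : u' = deriv u := by funext t; exact (hd t).deriv.symm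
  have hi : Integrable u' := hc.integrable_of_deriv_zero hs fun t _ h => by rw [hu]; exact h
  have := integral_of_hasDerivAt_of_tendsto hd hi hs.tendsto_zero.2 hs.tendsto_zero.1
  simpa using this

/-- Comparison with the derivative of a function vanishing at the origin, on both half-lines. -/
theorem HasCompactSupport.integral_nonneg_of_deriv_le {g u₁ u₂ u₁' u₂' : ℝ → ℝ}
    (hg : Integrable g) (h₁ : HasCompactSupport u₁) (h₂ : HasCompactSupport u₂)
    (d₁ : ∀ t, HasDerivAt u₁ (u₁' t) t) (d₂ : ∀ t, HasDerivAt u₂ (u₂' t) t)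
    (c₁ : Continuous u₁') (c₂ : Continuous u₂') (z₁ : u₁ 0 = 0) (z₂ : u₂ 0 = 0)
    (l₁ : ∀ t, t ≤ 0 → u₁' t ≤ g t) (l₂ : ∀ t, 0 ≤ t → u₂' t ≤ g t) : 0 ≤ ∫ t, g t := by
  have hu : ∀ {u u' : ℝ → ℝ}, HasCompactSupport u → (∀ t, HasDerivAt u (u' t) t) →
      Continuous u' → Integrable u' := fun {u u'} hs hd hc =>
    hc.integrable_of_deriv_zero hs fun t _ h => by rw [← (hd t).deriv]; exact h
  have i₁ := hu h₁ d₁ c₁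
  have i₂ := hu h₂ d₂ c₂
  have e₁ : ∫ t in Set.Iic 0, u₁' t = 0 := by
    rw [integral_Iic_of_hasDerivAt_of_tendsto' (fun t _ => d₁ t) i₁.integrableOn h₁.tendsto_zero.2]
    simp [z₁]
  have e₂ : ∫ t in Set.Ioi 0, u₂' t = 0 := by
    rw [integral_Ioi_of_hasDerivAt_of_tendsto' (fun t _ => d₂ t) i₂.integrableOn h₂.tendsto_zero.1]
    simp [z₂]
  rw [← intervalIntegral.integral_Iic_add_Ioi (b := 0) hg.integrableOn hg.integrableOn]
  apply add_nonneg
  · refine e₁.symm.le.trans ?_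
    exact setIntegral_mono_on i₁.integrableOn hg.integrableOn measurableSet_Iic l₁
  · refine e₂.symm.le.trans ?_
    exact setIntegral_mono_on i₂.integrableOn hg.integrableOn measurableSet_Ioi
      fun t ht => l₂ t (le_of_lt ht)

end CompactSupport

/-- The coefficient `Q = 1 + R e^{2εt}`. -/
noncomputable def QQ (ε R t : ℝ) : ℝ := 1 + R * exp (2 * ε * t)

namespace Ctrl

variable {p ε R c C : ℝ} {f P T : ℝ → ℝ}

theorem contP (h : Profile p ε R f P T) : Continuous P :=
  continuous_iff_continuousAt.2 fun t => (h.hP t).continuousAt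

theorem contT (h : Profile p ε R f P T) : Continuous T :=
  continuous_iff_continuousAt.2 fun t => (h.hT t).continuousAt

theorem contf (h : Profile p ε R f P T) : Continuous f :=
  continuous_iff_continuousAt.2 fun t => (h.hf t).continuousAt

@[fun_prop]
theorem contQ : Continuous (QQ ε R) := by unfold QQ; fun_prop

theorem one_le_QQ (hR : 0 < R) (t : ℝ) : 1 ≤ QQ ε R t := by
  have := mul_pos hR (exp_pos (2 * ε * t)); unfold QQ; linarith

/-- The pointwise inequality behind the Hardy-type estimate, `q` being the logarithmic derivative
with the sign of the half-line. -/
theorem hardy_pointwise {k κ e N N' q P' δ : ℝ} (hκ : 0 < κ) (hκk : κ ≤ k) (hκ2 : κ ≤ 2)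
    (he : 0 ≤ e) (hek : (k + 20) * e ≤ κ / 100) (hN : 1 ≤ N) (hN' : |N'| ≤ e * N)
    (hP' : P' ≤ -k * (N ^ 2 - q ^ 2) + e * N ^ 2) (hq : q ≤ e) (hqN : q ^ 2 ≤ (1 + e) * N ^ 2)
    (hδ : δ ≤ κ ^ 2 / 40) :
    δ * N ^ 2 ≤ -(κ / 20) * (2 * N' + P') - 2 * (κ / 20 * (2 * N + q)) * q
      - (κ / 20 * (2 * N + q)) ^ 2 := by
  have hN'' := abs_le.1 hN'
  have hNN : N ≤ N ^ 2 := by nlinarith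
  have he1 : e ≤ 1 / 100 := by
    have : 20 * e ≤ (k + 20) * e := by gcongr; linarith
    linarith
  have hqlb : -(11 / 10 * N) ≤ q := by nlinarith
  have hx0 : 0 ≤ 2 * N + q := by linarith
  have hx1 : (2 * N + q) ^ 2 ≤ 5 * N ^ 2 := by nlinarith
  have hkeN : (k + 20) * e * N ^ 2 ≤ κ / 100 * N ^ 2 := by gcongr
  have hκN : 0 < κ * N ^ 2 := by positivity
  have heN : 0 ≤ e * N ^ 2 := by positivity
  have hkN : 0 ≤ k * (e * N ^ 2) := mul_nonneg (by linarith) heN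
  have h1 : κ / 2 * N ^ 2 ≤ -(2 * N' + P') - 2 * (2 * N + q) * q
      - κ / 20 * (2 * N + q) ^ 2 := by
    have a1 : κ / 20 * (2 * N + q) ^ 2 ≤ κ / 20 * (5 * N ^ 2) := by gcongr
    have a2 : 9 / 10 * κ * N ^ 2 - (k + 6) * (e * N ^ 2) ≤
        k * (N ^ 2 - q ^ 2) - 2 * (2 * N + q) * q := by
      rcases le_total 0 q with h | h
      · have b1 : k * q ^ 2 ≤ k * (e * N ^ 2) := by
          have hk : 0 ≤ k := by linarith
          gcongr
          calc q ^ 2 ≤ e ^ 2 := by gcongr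
            _ ≤ e * N ^ 2 := by nlinarith
        have b2 : (2 * N + q) * q ≤ 3 * (e * N ^ 2) := by
          calc (2 * N + q) * q ≤ (3 * N) * e := by gcongr; linarith
            _ ≤ _ := by nlinarith
        have b3 : κ * N ^ 2 ≤ k * N ^ 2 := by gcongr
        linarith
      · by_cases hc : q ^ 2 ≤ N ^ 2
        · have b1 : κ * (N ^ 2 - q ^ 2) ≤ k * (N ^ 2 - q ^ 2) := by
            have : 0 ≤ N ^ 2 - q ^ 2 := by linarith
            gcongr
          have b2 : -q ≤ N := by
            have := abs_le_of_sq_le_sq hc (by linarith)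
            linarith [(abs_le.1 this).1]
          have b3 : q ^ 2 ≤ (2 * N + q) * -q := by
            nlinarith [mul_nonneg (neg_nonneg.2 h) (by linarith : 0 ≤ N + q)]
          have b4 : κ * q ^ 2 ≤ 2 * ((2 * N + q) * -q) := by
            have : κ * q ^ 2 ≤ 2 * q ^ 2 := by gcongr
            linarith
          linarith
        · push Not at hc
          have b1 : k * q ^ 2 ≤ k * ((1 + e) * N ^ 2) := by
            have hk : 0 ≤ k := by linarith
            gcongr
          have b2 : N ≤ -q := by
            rw [← neg_sq q] at hc
            exact (lt_of_pow_lt_pow_left₀ 2 (neg_nonneg.2 h) hc).le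
          have b3 : 9 / 10 * N * N ≤ (2 * N + q) * -q := by gcongr; linarith
          have b4 : κ * N ^ 2 ≤ 2 * N ^ 2 := by gcongr
          linarith
    have a3 : e * N ≤ e * N ^ 2 := by gcongr
    linarith
  have h2 := mul_le_mul_of_nonneg_left h1 (by positivity : 0 ≤ κ / 20)
  have h3 : δ * N ^ 2 ≤ κ ^ 2 / 40 * N ^ 2 := by gcongr
  linarith

end Ctrl

theorem ContDiff.hasDerivAt_one {v : ℝ → ℝ} (hv : ContDiff ℝ 1 v) (t : ℝ) :
    HasDerivAt v (deriv v t) t := (hv.differentiable one_ne_zero t).hasDerivAt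

namespace Ctrl

variable {p ε R c C : ℝ} {f P T : ℝ → ℝ}

/-- The square root of `QQ`. -/
noncomputable def NN (ε R t : ℝ) : ℝ := √(QQ ε R t)

/-- The derivative of `NN`. -/
noncomputable def NN' (ε R t : ℝ) : ℝ := R * (2 * ε * exp (2 * ε * t)) / (2 * NN ε R t)

theorem hasDerivAt_NN (hR : 0 < R) (t : ℝ) : HasDerivAt (NN ε R) (NN' ε R t) t :=
  Profile.hasDerivAt_sqrt_Q hR t

theorem abs_NN'_le (hR : 0 < R) (hε : 0 < ε) (t : ℝ) : |NN' ε R t| ≤ ε * NN ε R t :=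
  Profile.sqrt_Q_deriv_le hR hε t

theorem one_le_NN (hR : 0 < R) (t : ℝ) : 1 ≤ NN ε R t := Profile.one_le_sqrt_Q hR t

theorem NN_sq (hR : 0 < R) (t : ℝ) : NN ε R t ^ 2 = QQ ε R t :=
  sq_sqrt (by have := one_le_QQ (ε := ε) hR t; linarith)

@[fun_prop]
theorem contNN : Continuous (NN ε R) := by unfold NN; fun_prop

theorem contNN' (hR : 0 < R) : Continuous (NN' ε R) := by
  unfold NN'
  refine Continuous.div (by fun_prop) (by fun_prop) fun t => ?_
  have := one_le_NN (ε := ε) hR t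
  positivity

theorem P_sq_le' (hp : 1 < p) (hε : 0 < ε) (hC : 1 ≤ C) (h : Ctrl p ε R c C f P T) (t : ℝ) :
    P t ^ 2 ≤ (1 + C * ε) * QQ ε R t := by
  have h1 := (abs_le.1 (h.T_close t)).2
  have hT := h.T_pos t
  have hQ := one_le_QQ (ε := ε) h.R_pos t
  unfold QQ at *
  set Q := 1 + R * exp (2 * ε * t)
  have hCQ : 0 < C * ε * Q := by positivity
  by_contra! hc
  have : (p + 1) / 2 * (Q - P t ^ 2) ≤ (p + 1) / 2 * (-(C * ε * Q)) := by
    have : 0 < (p + 1) / 2 := by linarith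
    gcongr
    linarith
  nlinarith

theorem P_deriv_le (h : Ctrl p ε R c C f P T) (t : ℝ) :
    1 + R * exp (2 * ε * t) - T t - P t ^ 2 ≤
      -((p - 1) / 2) * (QQ ε R t - P t ^ 2) + C * ε * QQ ε R t := by
  have h1 := (abs_le.1 (h.T_close t)).1
  unfold QQ
  linarith

theorem P_le_eps (hε : 0 < ε) (hc : 0 < c) (h : Ctrl p ε R c C f P T) {t : ℝ} (ht : 0 ≤ t) :
    P t ≤ ε := by
  have h1 := h.P_right t ht
  have : 0 ≤ c * (t / (1 + t)) := by positivity
  linarith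

theorem le_P_eps (hc : 0 < c) (h : Ctrl p ε R c C f P T) {t : ℝ} (ht : t ≤ 0) :
    -P t ≤ ε := by
  have h1 := h.P_left t ht
  have : 0 ≤ -t / (1 - t) := div_nonneg (by linarith) (by linarith)
  have : 0 ≤ c * (-t / (1 - t)) := by positivity
  linarith

/-- The Hardy constant. -/
noncomputable def ka (p : ℝ) : ℝ := min ((p - 1) / 2) 2

theorem ka_pos (hp : 1 < p) : 0 < ka p := lt_min (by linarith) two_pos

/-- Smallness of the error parameter. -/
def Small (p C ε : ℝ) : Prop := ((p - 1) / 2 + 20) * (C * ε) ≤ ka p / 100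

theorem hardy (hp : 1 < p) (hε : 0 < ε) (hc : 0 < c) (hC : 1 ≤ C) (hs : Small p C ε)
    (h : Ctrl p ε R c C f P T) {v : ℝ → ℝ} (hv : ContDiff ℝ 1 v) (hvs : HasCompactSupport v)
    (hv0 : v 0 = 0) :
    ka p ^ 2 / 40 * ∫ t, QQ ε R t * v t ^ 2 ≤ ∫ t, (deriv v t - P t * v t) ^ 2 := by
  have hR := h.R_pos
  have cP := contP h.toProfile
  have cT := contT h.toProfile
  have cN' := contNN' (ε := ε) hR
  have cv : Continuous v := hv.continuous
  have cv' : Continuous (deriv v) := hv.continuous_deriv le_rfl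
  have i1 : Integrable fun t => (deriv v t - P t * v t) ^ 2 :=
    (by fun_prop : Continuous _).integrable_of_deriv_zero hvs (by intro t h1 h2; simp [h1, h2])
  have i2 : Integrable fun t => QQ ε R t * v t ^ 2 :=
    (by fun_prop : Continuous _).integrable_of_deriv_zero hvs (by intro t h1 h2; simp [h1])
  rw [← sub_nonneg, ← integral_const_mul, ← integral_sub i1 (i2.const_mul _)]
  set κ := ka p with hκ
  have hκ0 : 0 < κ := ka_pos hp
  have hεC : ε ≤ C * ε := le_mul_of_one_le_left hε.le hC
  have pw : ∀ t N' q P', |N'| ≤ ε * NN ε R t →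
      P' ≤ -((p - 1) / 2) * (NN ε R t ^ 2 - q ^ 2) + C * ε * NN ε R t ^ 2 → q ≤ ε →
      q ^ 2 ≤ (1 + C * ε) * NN ε R t ^ 2 →
      κ ^ 2 / 40 * NN ε R t ^ 2 ≤ -(κ / 20) * (2 * N' + P') - 2 * (κ / 20 * (2 * NN ε R t + q)) * q
      - (κ / 20 * (2 * NN ε R t + q)) ^ 2 := by
    intro t N' q P' a1 a2 a3 a4
    have hN := one_le_NN (ε := ε) hR t
    exact hardy_pointwise hκ0 (min_le_left _ _) (min_le_right _ _) (by positivity) hs hN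
      (a1.trans (by gcongr)) a2 (a3.trans hεC) a4 le_rfl
  refine HasCompactSupport.integral_nonneg_of_deriv_le (i1.sub (i2.const_mul _))
    (u₁ := fun t => -(κ / 20) * (2 * NN ε R t - P t) * v t ^ 2)
    (u₂ := fun t => κ / 20 * (2 * NN ε R t + P t) * v t ^ 2)
    (u₁' := fun t => -(κ / 20) * (2 * NN' ε R t - (1 + R * exp (2 * ε * t) - T t - P t ^ 2))
      * v t ^ 2
      + -(κ / 20) * (2 * NN ε R t - P t) * (2 * v t * deriv v t))
    (u₂' := fun t => κ / 20 * (2 * NN' ε R t + (1 + R * exp (2 * ε * t) - T t - P t ^ 2)) * v t ^ 2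
      + κ / 20 * (2 * NN ε R t + P t) * (2 * v t * deriv v t))
    (hvs.of_deriv_zero (by intro t h1 h2; simp [h1]))
    (hvs.of_deriv_zero (by intro t h1 h2; simp [h1])) ?_ ?_ (by fun_prop) (by fun_prop)
    (by simp [hv0]) (by simp [hv0]) ?_ ?_
  · intro t
    have := (((((hasDerivAt_NN (ε := ε) hR t).const_mul 2).sub (h.hP t)).const_mul (-(κ / 20))).mul
      ((hv.hasDerivAt_one t).pow 2))
    refine this.congr_deriv ?_
    simp
  · intro t
    have := (((((hasDerivAt_NN (ε := ε) hR t).const_mul 2).add (h.hP t)).const_mul (κ / 20)).mul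
      ((hv.hasDerivAt_one t).pow 2))
    refine this.congr_deriv ?_
    simp
  · intro t ht
    have hd := pw t (-NN' ε R t) (-P t) (1 + R * exp (2 * ε * t) - T t - P t ^ 2)
        (by rw [abs_neg]; exact abs_NN'_le hR hε t)
      (by rw [NN_sq hR, neg_sq]; exact h.P_deriv_le t) (h.le_P_eps hc ht)
      (by rw [NN_sq hR, neg_sq]; exact h.P_sq_le' hp hε hC t)
    rw [NN_sq hR] at hd
    have h1 := mul_le_mul_of_nonneg_right hd (sq_nonneg (v t))
    have h2 := sq_nonneg (deriv v t - P t * v t - -(κ / 20) * (2 * NN ε R t - P t) * v t)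
    linarith
  · intro t ht
    have hd := pw t (NN' ε R t) (P t) (1 + R * exp (2 * ε * t) - T t - P t ^ 2) (abs_NN'_le hR hε t)
      (by rw [NN_sq hR]; exact h.P_deriv_le t) (h.P_le_eps hε hc ht)
      (by rw [NN_sq hR]; exact h.P_sq_le' hp hε hC t)
    rw [NN_sq hR] at hd
    have h1 := mul_le_mul_of_nonneg_right hd (sq_nonneg (v t))
    have h2 := sq_nonneg (deriv v t - P t * v t - κ / 20 * (2 * NN ε R t + P t) * v t)
    linarith

/-- The quadratic form of `L₋` as a square. -/
theorem form_minus_eq (h : Profile p ε R f P T) {v : ℝ → ℝ} (hv : ContDiff ℝ 1 v)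
    (hvs : HasCompactSupport v) :
    ∫ t, (deriv v t - P t * v t) ^ 2 = ∫ t, (deriv v t ^ 2 + (QQ ε R t - T t) * v t ^ 2) := by
  have cP := contP h
  have cT := contT h
  have cv : Continuous v := hv.continuous
  have cv' : Continuous (deriv v) := hv.continuous_deriv le_rfl
  have i1 : Integrable fun t => (deriv v t - P t * v t) ^ 2 :=
    (by fun_prop : Continuous _).integrable_of_deriv_zero hvs (by intro t h1 h2; simp [h1, h2])
  have i2 : Integrable fun t => deriv v t ^ 2 + (QQ ε R t - T t) * v t ^ 2 :=
    (by fun_prop : Continuous _).integrable_of_deriv_zero hvs (by intro t h1 h2; simp [h1, h2])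
  rw [← sub_eq_zero, ← integral_sub i1 i2]
  refine HasCompactSupport.integral_hasDerivAt_eq_zero (u := fun t => -(P t) * v t ^ 2)
    (hvs.of_deriv_zero (by intro t h1 h2; simp [h1])) (fun t => ?_) (by fun_prop)
  refine (((h.hP t).neg).mul ((hv.hasDerivAt_one t).pow 2)).congr_deriv ?_
  simp only [QQ, Pi.pow_apply, Pi.neg_apply]; push_cast; ring

end Ctrl

/-- A primitive of a compactly supported function whose integrals over both half-lines vanish. -/
theorem hasCompactSupport_primitive {u : ℝ → ℝ} (hu : Continuous u) (hs : HasCompactSupport u)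
    (h1 : ∫ t in Set.Ioi 0, u t = 0) (h2 : ∫ t in Set.Iic 0, u t = 0) :
    HasCompactSupport fun t => ∫ s in (0:ℝ)..t, u s := by
  obtain ⟨L, hL⟩ := hs.isCompact.isBounded.subset_closedBall 0
  have hi : Integrable u := hu.integrable_of_hasCompactSupport hs
  have hz : ∀ t, L < |t| → u t = 0 := by
    intro t ht
    refine image_eq_zero_of_notMem_tsupport fun hm => ?_
    have := hL hm
    rw [mem_closedBall_zero_iff, norm_eq_abs] at this
    linarith
  refine HasCompactSupport.intro (isCompact_closedBall (0:ℝ) (max L 0)) fun t ht => ?_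
  rw [mem_closedBall_zero_iff, norm_eq_abs, not_le, max_lt_iff] at ht
  rcases le_total 0 t with h0 | h0
  · rw [abs_of_nonneg h0] at ht
    have e := intervalIntegral.integral_interval_add_Ioi (a := 0) (b := t) hi.integrableOn
      hi.integrableOn
    rw [h1, setIntegral_eq_zero_of_forall_eq_zero (t := Set.Ioi t), add_zero] at e
    · exact e
    · intro s hs
      have hs' : t < s := hs
      apply hz; rw [abs_of_pos (by linarith)]; linarith
  · rw [abs_of_nonpos h0] at ht
    have e := intervalIntegral.integral_Iic_sub_Iic (a := t) (b := 0) hi.integrableOn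
      hi.integrableOn
    rw [h2, setIntegral_eq_zero_of_forall_eq_zero (t := Set.Iic t), sub_zero] at e
    · rw [intervalIntegral.integral_symm, ← e, neg_zero]
    · intro s hs
      have hs' : s ≤ t := hs
      apply hz; rw [abs_of_nonpos (by linarith)]; linarith

namespace Ctrl

variable {p ε R c C : ℝ} {f P T : ℝ → ℝ}

/-- The kernel of the conjugated first order operator. -/
noncomputable def gg (p : ℝ) (f : ℝ → ℝ) (t : ℝ) : ℝ := f t ^ ((p + 1) / 2)

theorem gg_pos (h : Profile p ε R f P T) (t : ℝ) : 0 < gg p f t := rpow_pos_of_pos (h.f_pos t) _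

theorem hasDerivAt_gg (h : Profile p ε R f P T) (t : ℝ) :
    HasDerivAt (gg p f) ((p + 1) / 2 * P t * gg p f t) t := by
  have hf := h.f_pos t
  refine ((h.hf t).rpow_const (p := (p + 1) / 2) (Or.inl hf.ne')).congr_deriv ?_
  unfold gg
  rw [rpow_sub_one hf.ne']
  field_simp

theorem contgg (h : Profile p ε R f P T) : Continuous (gg p f) :=
  continuous_iff_continuousAt.2 fun t => (hasDerivAt_gg h t).continuousAt

/-- The critical constant of the conjugation. -/
noncomputable def E0 (p : ℝ) : ℝ := (p - 1) * (p + 3) / 4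

/-- The coercivity constant of `L₋`. -/
noncomputable def de (p : ℝ) : ℝ := ka p ^ 2 / 40

theorem de_pos (hp : 1 < p) : 0 < de p := by have := ka_pos hp; unfold de; positivity

/-- Second smallness condition. -/
def Small' (p C ε : ℝ) : Prop :=
  (E0 p + de p + (p + 3) / 2 + 1 + (p - 1) / 2) * (C * ε) ≤ de p / 4 ∧ ε ≤ 1

theorem conj_lower (hp : 1 < p) (hε : 0 < ε) (hc : 0 < c) (hC : 1 ≤ C) (hs : Small p C ε)
    (h : Ctrl p ε R c C f P T) {v : ℝ → ℝ} (hv : ContDiff ℝ 1 v) (hvs : HasCompactSupport v)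
    (hv0 : v 0 = 0) :
    (E0 p + de p - (p + 3) / 2 * (C * ε)) * ∫ t, QQ ε R t * v t ^ 2 ≤
      ∫ t, (deriv v t + (p + 1) / 2 * P t * v t) ^ 2 := by
  have cP := contP h.toProfile
  have cT := contT h.toProfile
  have cv : Continuous v := hv.continuous
  have cv' : Continuous (deriv v) := hv.continuous_deriv le_rfl
  have i0 : Integrable fun t => (deriv v t - P t * v t) ^ 2 :=
    (by fun_prop : Continuous _).integrable_of_deriv_zero hvs (by intro t h1 h2; simp [h1, h2])
  have i1 : Integrable fun t => (deriv v t + (p + 1) / 2 * P t * v t) ^ 2 :=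
    (by fun_prop : Continuous _).integrable_of_deriv_zero hvs (by intro t h1 h2; simp [h1, h2])
  have i2 : Integrable fun t => QQ ε R t * v t ^ 2 :=
    (by fun_prop : Continuous _).integrable_of_deriv_zero hvs (by intro t h1 h2; simp [h1])
  set D : ℝ → ℝ := fun t => ((p + 1) / 2 + 1) *
    ((1 + R * exp (2 * ε * t) - T t - P t ^ 2) * v t ^ 2 + P t * (2 * v t * deriv v t)) with hD
  have hDc : Continuous D := by fun_prop
  have i3 : Integrable D :=
    hDc.integrable_of_deriv_zero hvs (by intro t h1 h2; simp [hD, h1])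
  have hD0 : ∫ t, D t = 0 := by
    refine HasCompactSupport.integral_hasDerivAt_eq_zero
      (u := fun t => ((p + 1) / 2 + 1) * (P t * v t ^ 2))
      (hvs.of_deriv_zero (by intro t h1 h2; simp [h1])) (fun t => ?_) hDc
    refine (((h.hP t).mul ((hv.hasDerivAt_one t).pow 2)).const_mul _).congr_deriv ?_
    simp [hD]
  have key := h.hardy hp hε hc hC hs hv hvs hv0
  have hmono : ∫ t, ((deriv v t - P t * v t) ^ 2
      + (E0 p - (p + 3) / 2 * (C * ε)) * (QQ ε R t * v t ^ 2) + D t) ≤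
      ∫ t, (deriv v t + (p + 1) / 2 * P t * v t) ^ 2 := by
    refine integral_mono ((i0.add (i2.const_mul _)).add i3) i1 fun t => ?_
    have h1 := mul_le_mul_of_nonneg_right (abs_le.1 (h.T_close t)).1
      (mul_nonneg (by linarith : 0 ≤ (p + 3) / 2) (sq_nonneg (v t)))
    simp only [QQ, E0, hD]
    linarith
  have i4 : Integrable fun t => (deriv v t - P t * v t) ^ 2
      + (E0 p - (p + 3) / 2 * (C * ε)) * (QQ ε R t * v t ^ 2) := i0.add (i2.const_mul _)
  rw [integral_add i4 i3, integral_add i0 (i2.const_mul _), integral_const_mul, hD0] at hmono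
  unfold de
  linarith

theorem form_plus_lower (hp : 1 < p) (h : Ctrl p ε R c C f P T) {a : ℝ → ℝ}
    (ha : ContDiff ℝ 1 a) (has : HasCompactSupport a) :
    (∫ t, (deriv a t - (p + 1) / 2 * P t * a t) ^ 2)
        - (E0 p + (p - 1) / 2 * (C * ε)) * ∫ t, QQ ε R t * a t ^ 2 ≤
      ∫ t, (deriv a t ^ 2 + (QQ ε R t - p * T t) * a t ^ 2) := by
  have cP := contP h.toProfile
  have cT := contT h.toProfile
  have cv : Continuous a := ha.continuous
  have cv' : Continuous (deriv a) := ha.continuous_deriv le_rfl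
  have i0 : Integrable fun t => deriv a t ^ 2 + (QQ ε R t - p * T t) * a t ^ 2 :=
    (by fun_prop : Continuous _).integrable_of_deriv_zero has (by intro t h1 h2; simp [h1, h2])
  have i1 : Integrable fun t => (deriv a t - (p + 1) / 2 * P t * a t) ^ 2 :=
    (by fun_prop : Continuous _).integrable_of_deriv_zero has (by intro t h1 h2; simp [h1, h2])
  have i2 : Integrable fun t => QQ ε R t * a t ^ 2 :=
    (by fun_prop : Continuous _).integrable_of_deriv_zero has (by intro t h1 h2; simp [h1])
  set D : ℝ → ℝ := fun t => ((p + 1) / 2) *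
    ((1 + R * exp (2 * ε * t) - T t - P t ^ 2) * a t ^ 2 + P t * (2 * a t * deriv a t)) with hD
  have hDc : Continuous D := by fun_prop
  have i3 : Integrable D :=
    hDc.integrable_of_deriv_zero has (by intro t h1 h2; simp [hD, h1])
  have hD0 : ∫ t, D t = 0 := by
    refine HasCompactSupport.integral_hasDerivAt_eq_zero
      (u := fun t => ((p + 1) / 2) * (P t * a t ^ 2))
      (has.of_deriv_zero (by intro t h1 h2; simp [h1])) (fun t => ?_) hDc
    refine (((h.hP t).mul ((ha.hasDerivAt_one t).pow 2)).const_mul _).congr_deriv ?_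
    simp [hD]
  have hmono : ∫ t, ((deriv a t - (p + 1) / 2 * P t * a t) ^ 2
      - (E0 p + (p - 1) / 2 * (C * ε)) * (QQ ε R t * a t ^ 2) + D t) ≤
      ∫ t, (deriv a t ^ 2 + (QQ ε R t - p * T t) * a t ^ 2) := by
    refine integral_mono ((i1.sub (i2.const_mul _)).add i3) i0 fun t => ?_
    have h1 := mul_le_mul_of_nonneg_right (abs_le.1 (h.T_close t)).2
      (mul_nonneg (by linarith : 0 ≤ (p - 1) / 2) (sq_nonneg (a t)))
    simp only [QQ, E0, hD]
    linarith
  have i4 : Integrable fun t => (deriv a t - (p + 1) / 2 * P t * a t) ^ 2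
      - (E0 p + (p - 1) / 2 * (C * ε)) * (QQ ε R t * a t ^ 2) := i1.sub (i2.const_mul _)
  rw [integral_add i4 i3, integral_sub i1 (i2.const_mul _), integral_const_mul, hD0] at hmono
  linarith

theorem coercive_plus (hp : 1 < p) (hε : 0 < ε) (hc : 0 < c) (hC : 1 ≤ C) (hs : Small p C ε)
    (hs' : Small' p C ε) (h : Ctrl p ε R c C f P T) {a : ℝ → ℝ} (ha : ContDiff ℝ 1 a)
    (has : HasCompactSupport a)
    (h1 : ∫ t in Set.Ioi 0, QQ ε R t * gg p f t * a t = 0)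
    (h2 : ∫ t in Set.Iic 0, QQ ε R t * gg p f t * a t = 0) :
    de p / 4 * ∫ t, QQ ε R t * a t ^ 2 ≤
      ∫ t, (deriv a t ^ 2 + (QQ ε R t - p * T t) * a t ^ 2) := by
  have hR := h.R_pos
  have cP := contP h.toProfile
  have cg := contgg h.toProfile
  have ca : Continuous a := ha.continuous
  have ca' : Continuous (deriv a) := ha.continuous_deriv le_rfl
  have cN' := contNN' (ε := ε) hR
  set u : ℝ → ℝ := fun t => QQ ε R t * gg p f t * a t with hu
  have cu : Continuous u := by fun_prop
  set G : ℝ → ℝ := fun t => ∫ s in (0:ℝ)..t, u s with hG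
  have hGs : HasCompactSupport G := hasCompactSupport_primitive cu
    (has.of_deriv_zero (by intro t h1 _; simp [hu, h1])) h1 h2
  have hGd : ∀ t, HasDerivAt G (u t) t := fun t =>
    intervalIntegral.integral_hasDerivAt_right (cu.intervalIntegrable _ _)
      cu.stronglyMeasurable.stronglyMeasurableAtFilter cu.continuousAt
  have cG : Continuous G := continuous_iff_continuousAt.2 fun t => (hGd t).continuousAt
  have hN0 : ∀ t, NN ε R t ≠ 0 := fun t => by
    have := one_le_NN (ε := ε) hR t; positivity
  have hg0 : ∀ t, gg p f t ≠ 0 := fun t => (gg_pos h.toProfile t).ne'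
  set w : ℝ → ℝ := fun t => -(G t / gg p f t) with hw
  set w' : ℝ → ℝ := fun t => -((p + 1) / 2 * P t * w t) - QQ ε R t * a t with hw'
  have hwd : ∀ t, HasDerivAt w (w' t) t := by
    intro t
    refine ((hGd t).div (hasDerivAt_gg h.toProfile t) (hg0 t)).neg.congr_deriv ?_
    have := hg0 t
    simp only [hw', hw, hu]
    field_simp
    ring
  have cw : Continuous w := continuous_iff_continuousAt.2 fun t => (hwd t).continuousAt
  have cw' : Continuous w' := by fun_prop
  have hws : HasCompactSupport w := hGs.of_deriv_zero (by intro t h1 _; simp [hw, h1])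
  set v : ℝ → ℝ := fun t => w t / NN ε R t with hv
  set v' : ℝ → ℝ := fun t => w' t / NN ε R t - NN' ε R t / NN ε R t * v t with hv'
  have hvd : ∀ t, HasDerivAt v (v' t) t := by
    intro t
    refine ((hwd t).div (hasDerivAt_NN hR t) (hN0 t)).congr_deriv ?_
    have := hN0 t
    simp only [hv', hv]
    field_simp
  have cv : Continuous v := continuous_iff_continuousAt.2 fun t => (hvd t).continuousAt
  have cv' : Continuous v' := by
    have : Continuous fun t => (NN ε R t)⁻¹ := contNN.inv₀ hN0
    simp only [hv', div_eq_mul_inv]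
    fun_prop
  have hvc : ContDiff ℝ 1 v := contDiff_one_iff_deriv.2
    ⟨fun t => (hvd t).differentiableAt, by
      have : deriv v = v' := by funext t; exact (hvd t).deriv
      rw [this]; exact cv'⟩
  have hvs : HasCompactSupport v := hws.of_deriv_zero (by intro t h1 _; simp [hv, h1])
  have hv0 : v 0 = 0 := by simp [hv, hw, hG]
  have hderiv : deriv v = v' := by funext t; exact (hvd t).deriv
  have k1 := h.conj_lower hp hε hc hC hs hvc hvs hv0
  have k2 := h.form_plus_lower hp ha has
  rw [hderiv] at k1
  have hvw : ∀ t, QQ ε R t * v t ^ 2 = w t ^ 2 := by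
    intro t
    have := hN0 t
    simp only [hv]
    rw [← NN_sq hR]; field_simp
  simp only [hvw] at k1
  have hboth : ∀ {g : ℝ → ℝ}, Continuous g → (∀ t, v t = 0 → v' t = 0 → g t = 0) →
      Integrable g := fun hg h0 =>
    hg.integrable_of_deriv_zero hvs (by rw [hderiv]; exact h0)
  have iw : Integrable fun t => w t ^ 2 := (by fun_prop : Continuous _).integrable_of_deriv_zero hws
    (by intro t h1 _; simp [h1])
  have iv : Integrable fun t => (v' t + (p + 1) / 2 * P t * v t) ^ 2 :=
    hboth (by fun_prop) (by intro t h1 h2; simp [h1, h2])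
  have ia : Integrable fun t => QQ ε R t * a t ^ 2 :=
    (by fun_prop : Continuous _).integrable_of_deriv_zero has (by intro t h1 _; simp [h1])
  have iA : Integrable fun t => (deriv a t - (p + 1) / 2 * P t * a t) ^ 2 :=
    (by fun_prop : Continuous _).integrable_of_deriv_zero has (by intro t h1 h2; simp [h1, h2])
  have iaw : Integrable fun t => (deriv a t - (p + 1) / 2 * P t * a t) * w t :=
    (by fun_prop : Continuous _).integrable_of_deriv_zero has (by intro t h1 h2; simp [h1, h2])
  set A := ∫ t, (deriv a t - (p + 1) / 2 * P t * a t) ^ 2 with hA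
  set I := ∫ t, QQ ε R t * a t ^ 2 with hI
  set J := ∫ t, w t ^ 2 with hJ
  have hJ0 : 0 ≤ J := integral_nonneg fun t => sq_nonneg _
  have hI0 : 0 ≤ I := integral_nonneg fun t => by
    have := one_le_QQ (ε := ε) hR t; simp only [Pi.zero_apply]; positivity
  have m1 : (1 - ε) * ∫ t, (v' t + (p + 1) / 2 * P t * v t) ^ 2 ≤ I + ε * J := by
    rw [← integral_const_mul, ← integral_const_mul, ← integral_add ia (iw.const_mul _)]
    refine integral_mono (iv.const_mul _) (ia.add (iw.const_mul _)) fun t => ?_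
    have hN := one_le_NN (ε := ε) hR t
    have hr : |NN' ε R t / NN ε R t| ≤ ε := by
      rw [abs_div, abs_of_pos (by linarith : 0 < NN ε R t), div_le_iff₀ (by linarith)]
      exact abs_NN'_le hR hε t
    have hr2 : (NN' ε R t / NN ε R t) ^ 2 ≤ ε ^ 2 := by
      rw [← sq_abs]; gcongr
    have e0 : v' t + (p + 1) / 2 * P t * v t + NN' ε R t / NN ε R t * v t
        = - NN ε R t * a t := by
      have := hN0 t
      simp only [hv', hv, hw']
      rw [← NN_sq hR]
      field_simp
      ring
    set r := NN' ε R t / NN ε R t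
    have e1 : QQ ε R t * a t ^ 2 = (v' t + (p + 1) / 2 * P t * v t + r * v t) ^ 2 := by
      rw [e0, ← NN_sq hR]; ring
    have e2 : v t ^ 2 ≤ w t ^ 2 := by
      rw [← hvw]; exact le_mul_of_one_le_left (sq_nonneg _) (one_le_QQ hR t)
    set X := v' t + (p + 1) / 2 * P t * v t
    have e3 : (r * v t) ^ 2 ≤ ε ^ 2 * w t ^ 2 := by rw [mul_pow]; gcongr
    simp only
    rw [e1]
    have e4 : 0 ≤ (ε * X + r * v t) ^ 2 := sq_nonneg _
    have e5 : 0 ≤ ε * ((X + r * v t) ^ 2 + ε * w t ^ 2 - (1 - ε) * X ^ 2) := by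
      nlinarith [sq_nonneg (r * v t)]
    linarith [nonneg_of_mul_nonneg_right e5 hε]
  have m2 : I = ∫ t, (deriv a t - (p + 1) / 2 * P t * a t) * w t := by
    rw [← sub_eq_zero, hI, ← integral_sub ia iaw]
    refine HasCompactSupport.integral_hasDerivAt_eq_zero (u := fun t => -(a t * w t))
      (has.of_deriv_zero (by intro t h1 _; simp [h1])) (fun t => ?_) (by fun_prop)
    refine ((ha.hasDerivAt_one t).mul (hwd t)).neg.congr_deriv ?_
    simp only [hw']; ring
  set M := E0 p + de p / 2 with hM
  have hde := de_pos hp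
  have hE0 : 0 < E0 p := by unfold E0; have : 0 < p - 1 := by linarith
                            positivity
  have hM0 : 0 < M := by positivity
  obtain ⟨hs1, hs2⟩ := hs'
  have hCε : 0 < C * ε := by positivity
  have hεC : ε ≤ C * ε := le_mul_of_one_le_left hε.le hC
  have m3 : M * J ≤ I := by
    have e1 := mul_le_mul_of_nonneg_left k1 (by linarith : 0 ≤ 1 - ε)
    have e2 : M + ε ≤ (1 - ε) * (E0 p + de p - (p + 3) / 2 * (C * ε)) := by
      have : ε * (E0 p + de p) ≤ C * ε * (E0 p + de p) := by gcongr
      have : 0 < (p - 1) / 2 * (C * ε) := mul_pos (by linarith) hCε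
      have : 0 < ε * ((p + 3) / 2 * (C * ε)) := by
        have : 0 < (p + 3) / 2 := by linarith
        positivity
      nlinarith
    have e3 := mul_le_mul_of_nonneg_right e2 hJ0
    linarith
  have m4 : I ≤ 1 / (2 * M) * A + M / 2 * J := by
    rw [m2, ← integral_const_mul, ← integral_const_mul,
      ← integral_add (iA.const_mul _) (iw.const_mul _)]
    refine integral_mono iaw ((iA.const_mul _).add (iw.const_mul _)) fun t => ?_
    simp only
    set x := deriv a t - (p + 1) / 2 * P t * a t
    have : 0 ≤ (x - M * w t) ^ 2 / (2 * M) := by positivity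
    have e : (x - M * w t) ^ 2 / (2 * M) = 1 / (2 * M) * x ^ 2 + M / 2 * w t ^ 2 - x * w t := by
      field_simp; ring
    linarith
  have m5 : M * I ≤ A := by
    have : I ≤ 1 / M * A := by
      have : 1 / (2 * M) = 1 / M / 2 := by field_simp
      rw [this] at m4; linarith
    rw [one_div, ← div_eq_inv_mul, le_div_iff₀ hM0] at this
    linarith
  refine le_trans ?_ k2
  have e4 : (p - 1) / 2 * (C * ε) ≤ de p / 4 := by
    have : 0 < (E0 p + de p + (p + 3) / 2 + 1) * (C * ε) := by
      have : 0 < (p + 3) / 2 := by linarith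
      positivity
    linarith
  have e5 := mul_le_mul_of_nonneg_right e4 hI0
  rw [hM] at m5
  linarith

end Ctrl

theorem abs_exp_sub_one_le_mul_exp (x : ℝ) : |exp x - 1| ≤ |x| * exp |x| := by
  rcases le_total 0 x with h | h
  · rw [abs_of_nonneg h, abs_of_nonneg (by linarith [one_le_exp h])]
    have h1 := mul_le_mul_of_nonneg_left (add_one_le_exp (-x)) (exp_pos x).le
    rw [← exp_add, add_neg_cancel, exp_zero] at h1
    linarith
  · rw [abs_of_nonpos h, abs_of_nonpos (by linarith [exp_le_one_iff.2 h])]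
    have h1 := add_one_le_exp x
    have h2 := mul_le_mul_of_nonneg_left (one_le_exp (neg_nonneg.2 h)) (neg_nonneg.2 h)
    linarith

/-- Exponential growth bounds (decay for negative `k`). -/
def ExpBound (η K k : ℝ) (g : ℝ → ℝ) : Prop := ∀ t, |g t| ≤ K * exp (k * (η * |t|))

namespace ExpBound

variable {η K L k l : ℝ} {g h : ℝ → ℝ}

theorem nonneg (hg : ExpBound η K k g) : 0 ≤ K := by
  have := (abs_nonneg _).trans (hg 0)
  simpa using this

theorem mul (hg : ExpBound η K k g) (hh : ExpBound η L l h) :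
    ExpBound η (K * L) (k + l) fun t => g t * h t := fun t => by
  rw [abs_mul, add_mul, exp_add]
  refine (mul_le_mul (hg t) (hh t) (abs_nonneg _) ((abs_nonneg _).trans (hg t))).trans_eq ?_
  ring

theorem add (hg : ExpBound η K k g) (hh : ExpBound η L k h) :
    ExpBound η (K + L) k fun t => g t + h t := fun t => by
  refine (abs_add_le _ _).trans ?_
  rw [add_mul]; exact add_le_add (hg t) (hh t)

theorem neg (hg : ExpBound η K k g) : ExpBound η K k fun t => -g t := fun t => by
  rw [abs_neg]; exact hg t

theorem sub (hg : ExpBound η K k g) (hh : ExpBound η L k h) :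
    ExpBound η (K + L) k fun t => g t - h t := by
  simpa only [sub_eq_add_neg] using hg.add hh.neg

theorem const_mul (a : ℝ) (hg : ExpBound η K k g) : ExpBound η (|a| * K) k fun t => a * g t :=
  fun t => by
    rw [abs_mul, mul_assoc]; exact mul_le_mul_of_nonneg_left (hg t) (abs_nonneg _)

theorem mono (hη : 0 ≤ η) (hg : ExpBound η K k g) (hK : K ≤ L) (hk : k ≤ l) : ExpBound η L l g :=
  fun t => (hg t).trans <| mul_le_mul hK (exp_le_exp.2 (by gcongr)) (exp_pos _).le
    (hg.nonneg.trans hK)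

end ExpBound

/-- A fixed smooth cutoff. -/
noncomputable def bump : ℝ → ℝ := (⟨1, 2, one_pos, one_lt_two⟩ : ContDiffBump (0 : ℝ))

theorem contDiff_bump : ContDiff ℝ 2 bump := ContDiffBump.contDiff _

theorem hasCompactSupport_bump : HasCompactSupport bump := ContDiffBump.hasCompactSupport _

theorem bump_nonneg (x : ℝ) : 0 ≤ bump x := ContDiffBump.nonneg _

theorem bump_le_one (x : ℝ) : bump x ≤ 1 := ContDiffBump.le_one _

theorem bump_eq_one {x : ℝ} (hx : |x| ≤ 1) : bump x = 1 :=
  ContDiffBump.one_of_mem_closedBall _ (by simpa using hx)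

theorem contDiff_deriv_bump : ContDiff ℝ 1 (deriv bump) :=
  ((contDiff_succ_iff_deriv (n := 1)).1 (by exact contDiff_bump)).2.2

theorem exists_bump_bound : ∃ B : ℝ, 1 ≤ B ∧ (∀ x, |deriv bump x| ≤ B) ∧
    ∀ x, |deriv (deriv bump) x| ≤ B := by
  obtain ⟨B1, h1⟩ := (hasCompactSupport_bump.deriv).exists_bound_of_continuous
    contDiff_deriv_bump.continuous
  obtain ⟨B2, h2⟩ := (hasCompactSupport_bump.deriv.deriv).exists_bound_of_continuous
    (contDiff_deriv_bump.continuous_deriv le_rfl)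
  exact ⟨max 1 (max B1 B2), le_max_left _ _,
    fun x => (h1 x).trans ((le_max_left _ _).trans (le_max_right _ _)),
    fun x => (h2 x).trans ((le_max_right _ _).trans (le_max_right _ _))⟩

/-- The rescaled cutoff. -/
noncomputable def ch (ε t : ℝ) : ℝ := bump (ε ^ 2 * t)

/-- First derivative of the rescaled cutoff. -/
noncomputable def ch1 (ε t : ℝ) : ℝ := deriv bump (ε ^ 2 * t) * ε ^ 2

/-- Second derivative of the rescaled cutoff. -/
noncomputable def ch2 (ε t : ℝ) : ℝ := deriv (deriv bump) (ε ^ 2 * t) * ε ^ 2 * ε ^ 2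

theorem hasDerivAt_ch (ε t : ℝ) : HasDerivAt (ch ε) (ch1 ε t) t := by
  have h : HasDerivAt bump (deriv bump (ε ^ 2 * t)) (ε ^ 2 * t) :=
    (contDiff_bump.differentiable (by norm_num) _).hasDerivAt
  exact (h.comp t ((hasDerivAt_id t).const_mul (ε ^ 2))).congr_deriv (by simp [ch1])

theorem hasDerivAt_ch1 (ε t : ℝ) : HasDerivAt (ch1 ε) (ch2 ε t) t := by
  have h : HasDerivAt (deriv bump) (deriv (deriv bump) (ε ^ 2 * t)) (ε ^ 2 * t) :=
    (contDiff_deriv_bump.differentiable (by norm_num) _).hasDerivAt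
  exact ((h.comp t ((hasDerivAt_id t).const_mul (ε ^ 2))).mul_const (ε ^ 2)).congr_deriv
    (by simp [ch2])

theorem cont_ch (ε : ℝ) : Continuous (ch ε) :=
  continuous_iff_continuousAt.2 fun t => (hasDerivAt_ch ε t).continuousAt

theorem cont_ch1 (ε : ℝ) : Continuous (ch1 ε) :=
  continuous_iff_continuousAt.2 fun t => (hasDerivAt_ch1 ε t).continuousAt

theorem cont_ch2 (ε : ℝ) : Continuous (ch2 ε) := by
  have := contDiff_deriv_bump.continuous_deriv le_rfl
  unfold ch2; fun_prop

theorem hasCompactSupport_ch {ε : ℝ} (hε : 0 < ε) : HasCompactSupport (ch ε) := by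
  have := hasCompactSupport_bump.comp_homeomorph (Homeomorph.mulLeft₀ (ε ^ 2) (by positivity))
  exact this

/-- Growth bounds, uniform in the parameters, for the building blocks of the special functions. -/
structure Atoms (p ε R η M : ℝ) (f P T : ℝ → ℝ) : Prop where
  one_le : 1 ≤ M
  η_pos : 0 < η
  hR : R ≤ M
  hp : 2 / (p - 1) ≤ M
  bf : ExpBound η M (-8) f
  bP : ExpBound η M 2 P
  bQ : ExpBound η M 2 (QQ ε R)
  bW : ExpBound η M 2 fun t => QQ ε R t - T t
  bs : ExpBound η 1 1 fun t => exp (-(ε * t))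
  bu : ExpBound η M 2 fun t => (1 - exp (-(ε * t))) / ε
  bv : ExpBound η (M * ε) 3 fun t => exp (2 * ε * t) - 1
  b0 : ExpBound η 1 0 (ch ε)
  b1 : ExpBound η (M * ε ^ 2) 0 (ch1 ε)
  b2 : ExpBound η (M * ε ^ 2) 0 (ch2 ε)
  T_le : ∀ t, T t ≤ M * QQ ε R t

theorem exists_atoms {p c C : ℝ} (hp : 1 < p) (hc : 0 < c) (hC : 1 ≤ C) :
    ∃ M : ℝ, ∀ {ε R : ℝ} {f P T : ℝ → ℝ}, 0 < ε → ε ≤ 1 → ε ≤ c / 8 → Ctrl p ε R c C f P T →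
      Atoms p ε R (c / 8) M f P T := by
  obtain ⟨B, hB, hB1, hB2⟩ := exists_bump_bound
  set η := c / 8 with hη
  have hη0 : 0 < η := by positivity
  set L := C + p + 1 / η + 2 / (p - 1) + B with hL
  have i1 : 0 < 1 / η := by positivity
  have i2 : 0 < 2 / (p - 1) := div_pos two_pos (by linarith)
  have hL1 : 1 ≤ L := by linarith
  have hL2 : L ≤ L ^ 2 := by nlinarith
  have hM : 10 * L ≤ 10 * L ^ 2 := by linarith
  refine ⟨10 * L ^ 2, fun {ε R f P T} hε hε1 hεη h => ?_⟩
  have hR := h.R_pos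
  have habs : ∀ t : ℝ, 0 ≤ |t| := abs_nonneg
  have het : ∀ t, ε * |t| ≤ η * |t| := fun t => mul_le_mul_of_nonneg_right hεη (habs t)
  have ht : ∀ t : ℝ, |t| ≤ 1 / η * exp (η * |t|) := fun t => by
    have := add_one_le_exp (η * |t|)
    rw [one_div, ← div_eq_inv_mul, le_div_iff₀ hη0]
    linarith
  have hQ : ∀ t, QQ ε R t ≤ (1 + C) * exp (2 * (η * |t|)) := fun t => by
    unfold QQ
    have e1 : exp (2 * ε * t) ≤ exp (2 * (η * |t|)) := exp_le_exp.2 (by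
      have := mul_le_mul_of_nonneg_left (le_abs_self t) hε.le
      have := het t
      linarith)
    have e2 : 1 ≤ exp (2 * (η * |t|)) := one_le_exp (by positivity)
    have e3 := mul_le_mul h.R_ub e1 (exp_pos _).le (by linarith)
    linarith
  have hQ1 := Ctrl.one_le_QQ (ε := ε) hR
  have hT : ∀ t, T t ≤ ((p + 1) / 2 + C) * QQ ε R t := fun t => by
    have e1 := (abs_le.1 (h.T_close t)).2
    have e2 : C * ε * QQ ε R t ≤ C * QQ ε R t := by
      have := hQ1 t
      have : C * ε ≤ C := mul_le_of_le_one_right (by linarith) hε1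
      gcongr
    have e3 : 0 ≤ (p + 1) / 2 * P t ^ 2 := mul_nonneg (by linarith) (sq_nonneg _)
    unfold QQ at e2 ⊢
    linarith
  have hMT : ((p + 1) / 2 + C) * (1 + C) ≤ 10 * L ^ 2 := by
    have : (p + 1) / 2 + C ≤ 2 * L := by linarith
    have : ((p + 1) / 2 + C) * (1 + C) ≤ 2 * L * (2 * L) := by gcongr; linarith
    nlinarith
  have hMT' : (p + 1) / 2 + C ≤ 10 * L ^ 2 := by linarith
  have hε2 : ε ^ 2 ≤ 1 := pow_le_one₀ hε.le hε1
  refine ⟨by linarith, hη0, by linarith [h.R_ub], by linarith, fun t => ?_, fun t => ?_,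
    fun t => ?_, fun t => ?_, fun t => ?_, fun t => ?_, fun t => ?_, fun t => ?_, fun t => ?_,
    fun t => ?_, fun t => ?_⟩
  · rw [abs_of_pos (h.f_pos t)]
    refine (h.f_le t).trans (mul_le_mul (by linarith) (exp_le_exp.2 ?_) (exp_pos _).le
      (by positivity))
    rw [hη]; linarith
  · have e1 : |P t| ≤ 2 * QQ ε R t := by
      refine abs_le_of_sq_le_sq ?_ (by linarith [hQ1 t])
      have := h.P_le t
      have e := hQ1 t
      unfold QQ at e ⊢
      nlinarith
    have := hQ t
    have e2 : (2 * (1 + C)) * exp (2 * (η * |t|)) ≤ 10 * L ^ 2 * exp (2 * (η * |t|)) := by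
      gcongr <;> linarith
    linarith
  · rw [abs_of_pos (by linarith [hQ1 t])]
    refine (hQ t).trans ?_
    gcongr; linarith
  · have e0 : 0 < (p + 1) / 2 + C := by linarith
    have e1 := hQ1 t
    have e2 : |QQ ε R t - T t| ≤ ((p + 1) / 2 + C) * QQ ε R t := by
      rw [abs_le]
      have := hT t
      have := h.T_pos t
      have : QQ ε R t ≤ ((p + 1) / 2 + C) * QQ ε R t :=
        le_mul_of_one_le_left (by linarith) (by linarith)
      constructor <;> linarith
    have e3 := mul_le_mul_of_nonneg_left (hQ t) e0.le
    have e4 := mul_le_mul_of_nonneg_right hMT (exp_pos (2 * (η * |t|))).le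
    linarith
  · rw [abs_of_pos (exp_pos _), one_mul]
    refine exp_le_exp.2 ?_
    have := mul_le_mul_of_nonneg_left (neg_abs_le t) hε.le
    have := het t
    linarith
  · rw [abs_div, abs_of_pos hε, abs_sub_comm, div_le_iff₀ hε]
    have e1 := abs_exp_sub_one_le_mul_exp (-(ε * t))
    rw [abs_neg, abs_mul, abs_of_pos hε] at e1
    have e2 : exp (ε * |t|) ≤ exp (η * |t|) := exp_le_exp.2 (het t)
    have e3 : exp (2 * (η * |t|)) = exp (η * |t|) * exp (η * |t|) := by
      rw [← exp_add]; ring_nf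
    calc _ ≤ ε * |t| * exp (ε * |t|) := e1
      _ ≤ ε * (1 / η * exp (η * |t|)) * exp (η * |t|) := by gcongr; exact ht t
      _ = (1 / η) * exp (2 * (η * |t|)) * ε := by rw [e3]; ring
      _ ≤ _ := by gcongr; linarith
  · have e1 := abs_exp_sub_one_le_mul_exp (2 * ε * t)
    rw [abs_mul, abs_mul, abs_of_pos hε, abs_two] at e1
    have e2 : exp (2 * ε * |t|) ≤ exp (2 * (η * |t|)) := exp_le_exp.2 (by linarith [het t])
    have e3 : exp (3 * (η * |t|)) = exp (η * |t|) * exp (2 * (η * |t|)) := by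
      rw [← exp_add]; ring_nf
    calc _ ≤ 2 * ε * |t| * exp (2 * ε * |t|) := e1
      _ ≤ 2 * ε * (1 / η * exp (η * |t|)) * exp (2 * (η * |t|)) := by gcongr; exact ht t
      _ = (2 * (1 / η)) * ε * exp (3 * (η * |t|)) := by rw [e3]; ring
      _ ≤ _ := by gcongr <;> linarith
  · rw [zero_mul, exp_zero, mul_one, ch, abs_of_nonneg (bump_nonneg _)]
    exact bump_le_one _
  · rw [zero_mul, exp_zero, mul_one, ch1, abs_mul, abs_of_nonneg (sq_nonneg ε)]
    gcongr
    linarith [hB1 (ε ^ 2 * t)]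
  · rw [zero_mul, exp_zero, mul_one, ch2, abs_mul, abs_mul, abs_of_nonneg (sq_nonneg ε)]
    have e1 : |deriv (deriv bump) (ε ^ 2 * t)| * ε ^ 2 ≤ 10 * L ^ 2 * 1 := by
      gcongr; linarith [hB2 (ε ^ 2 * t)]
    rw [mul_one] at e1
    gcongr
  · refine (hT t).trans ?_
    have := hQ1 t
    gcongr

theorem integral_exp_neg_mul_abs {η : ℝ} (hη : 0 < η) : ∫ t : ℝ, exp (-(η * |t|)) = 2 / η := by
  have h := integral_comp_abs (f := fun t => exp (-(η * t)))
  rw [h]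
  have := integral_exp_mul_Ioi (neg_lt_zero.2 hη) 0
  simp only [mul_zero, exp_zero, neg_mul] at this
  rw [this]
  field_simp

theorem integrable_exp_neg_mul_abs {η : ℝ} (hη : 0 < η) :
    Integrable fun t : ℝ => exp (-(η * |t|)) :=
  Integrable.of_integral_ne_zero (by rw [integral_exp_neg_mul_abs hη]; positivity)

theorem ExpBound.abs_setIntegral_le {η K k : ℝ} {g : ℝ → ℝ} (hη : 0 < η) (hk : k ≤ -1)
    (hg : ExpBound η K k g) (S : Set ℝ) : |∫ t in S, g t| ≤ K * (2 / η) := by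
  have hg' := hg.mono hη.le le_rfl hk
  rw [← integral_exp_neg_mul_abs hη, ← integral_const_mul]
  have hi := (integrable_exp_neg_mul_abs hη).const_mul K
  refine (norm_integral_le_of_norm_le (f := g) hi.integrableOn (Eventually.of_forall fun t =>
    ?_)).trans
    (setIntegral_le_integral hi (Eventually.of_forall fun t => ?_))
  · simpa using hg' t
  · have := hg.nonneg
    simp only [Pi.zero_apply]; positivity

theorem ExpBound.abs_integral_le {η K k : ℝ} {g : ℝ → ℝ} (hη : 0 < η) (hk : k ≤ -1)
    (hg : ExpBound η K k g) : |∫ t, g t| ≤ K * (2 / η) := by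
  simpa using hg.abs_setIntegral_le hη hk Set.univ

theorem mul_le_setIntegral {S : Set ℝ} {g : ℝ → ℝ} {a b m : ℝ} (hS : MeasurableSet S)
    (hg : IntegrableOn g S) (h0 : ∀ t ∈ S, 0 ≤ g t) (hab : a ≤ b) (hs : Set.Icc a b ⊆ S)
    (hm : ∀ t ∈ Set.Icc a b, m ≤ g t) : m * (b - a) ≤ ∫ t in S, g t := by
  calc m * (b - a) = ∫ t in Set.Icc a b, m := by
        simp [hab, mul_comm]
    _ ≤ ∫ t in Set.Icc a b, g t :=
        setIntegral_mono_on (integrableOn_const (by simp)) (hg.mono_set hs) measurableSet_Icc hm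
    _ ≤ ∫ t in S, g t :=
        setIntegral_mono_set hg ((ae_restrict_mem hS).mono h0) hs.eventuallyLE

theorem abs_integral_mul_le_sqrt {u v : ℝ → ℝ} (hu : Integrable fun t => u t ^ 2)
    (hv : Integrable fun t => v t ^ 2) (huv : Integrable fun t => u t * v t) :
    |∫ t, u t * v t| ≤ √(∫ t, u t ^ 2) * √(∫ t, v t ^ 2) := by
  have hu0 : 0 ≤ ∫ t, u t ^ 2 := integral_nonneg fun t => sq_nonneg _
  rw [← sqrt_mul hu0]
  refine abs_le_sqrt ?_
  have h : ∀ x : ℝ, 0 ≤ (∫ t, v t ^ 2) * (x * x) + (2 * ∫ t, u t * v t) * x + ∫ t, u t ^ 2 := by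
    intro x
    have e : (∫ t, v t ^ 2) * (x * x) + (2 * ∫ t, u t * v t) * x + ∫ t, u t ^ 2
        = ∫ t, (u t + x * v t) ^ 2 := by
      have i1 : Integrable fun t => x * x * v t ^ 2 + 2 * x * (u t * v t) :=
        (hv.const_mul _).add (huv.const_mul _)
      have : ∀ t, (u t + x * v t) ^ 2 = x * x * v t ^ 2 + 2 * x * (u t * v t) + u t ^ 2 :=
        fun t => by ring
      simp only [this]
      rw [integral_add i1 hu, integral_add (hv.const_mul _) (huv.const_mul _),
        integral_const_mul, integral_const_mul]
      ring
    rw [e]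
    exact integral_nonneg fun t => sq_nonneg _
  have := discrim_le_zero h
  unfold discrim at this
  linarith

/-- The weighted norm. -/
noncomputable def nQ (ε R : ℝ) (a : ℝ → ℝ) : ℝ := √(∫ t, QQ ε R t * a t ^ 2)

theorem nQ_nonneg (ε R : ℝ) (a : ℝ → ℝ) : 0 ≤ nQ ε R a := sqrt_nonneg _

theorem nQ_sq {ε R : ℝ} (hR : 0 < R) (a : ℝ → ℝ) : nQ ε R a ^ 2 = ∫ t, QQ ε R t * a t ^ 2 :=
  sq_sqrt <| integral_nonneg fun t => by
    have := Ctrl.one_le_QQ (ε := ε) hR t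
    simp only [Pi.zero_apply]; positivity

theorem integral_sq_le_nQ_sq {ε R : ℝ} (hR : 0 < R) {a : ℝ → ℝ} (ca : Continuous a)
    (sa : HasCompactSupport a) : ∫ t, a t ^ 2 ≤ nQ ε R a ^ 2 := by
  rw [nQ_sq hR]
  refine integral_mono
    ((by fun_prop : Continuous _).integrable_of_deriv_zero sa (by intro t h _; simp [h]))
    ((by fun_prop : Continuous _).integrable_of_deriv_zero sa (by intro t h _; simp [h]))
    fun t => le_mul_of_one_le_left (sq_nonneg _) (Ctrl.one_le_QQ hR t)

theorem ExpBound.abs_integral_mul_le {η K k ε R : ℝ} {g a : ℝ → ℝ} (hη : 0 < η) (hR : 0 < R)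
    (hk : k ≤ -1) (hg : ExpBound η K k g) (cg : Continuous g) (ca : Continuous a)
    (sa : HasCompactSupport a) : |∫ t, g t * a t| ≤ K * (1 + 2 / η) * nQ ε R a := by
  have hg' := hg.mono hη.le le_rfl hk
  have hb : ∀ t, g t ^ 2 ≤ K ^ 2 * exp (-(η * |t|)) := fun t => by
    have h1 := hg' t
    have h2 : exp (-(η * |t|)) ≤ 1 := exp_le_one_iff.2 (by have := abs_nonneg t; nlinarith)
    rw [neg_one_mul] at h1
    rw [← sq_abs]
    calc |g t| ^ 2 ≤ (K * exp (-(η * |t|))) ^ 2 := by gcongr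
      _ = K ^ 2 * (exp (-(η * |t|)) * exp (-(η * |t|))) := by ring
      _ ≤ K ^ 2 * (exp (-(η * |t|)) * 1) := by gcongr
      _ = _ := by ring
  have hi := (integrable_exp_neg_mul_abs hη).const_mul (K ^ 2)
  have i1 : Integrable fun t => g t ^ 2 := hi.mono' (by fun_prop)
    (Eventually.of_forall fun t => by rw [norm_of_nonneg (sq_nonneg _)]; exact hb t)
  refine (abs_integral_mul_le_sqrt i1
    ((by fun_prop : Continuous _).integrable_of_deriv_zero sa (by intro t h _; simp [h]))
    ((by fun_prop : Continuous _).integrable_of_deriv_zero sa (by intro t h _; simp [h]))).trans ?_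
  have hK := hg.nonneg
  have hη2 : 0 < 2 / η := by positivity
  refine mul_le_mul ?_ ?_ (sqrt_nonneg _) (by positivity)
  · refine sqrt_le_iff.2 ⟨by positivity, ?_⟩
    have : ∫ t, g t ^ 2 ≤ K ^ 2 * (2 / η) := by
      rw [← integral_exp_neg_mul_abs hη, ← integral_const_mul]
      exact integral_mono i1 hi hb
    refine this.trans ?_
    rw [mul_pow]
    gcongr
    nlinarith
  · exact sqrt_le_iff.2 ⟨nQ_nonneg _ _ _, integral_sq_le_nQ_sq hR ca sa⟩

theorem HasCompactSupport.halfline_integral_eq_zero {u u' : ℝ → ℝ} (hs : HasCompactSupport u)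
    (hd : ∀ t, HasDerivAt u (u' t) t) (hc : Continuous u') (h0 : u 0 = 0) :
    ∫ t in Set.Ioi 0, u' t = 0 ∧ ∫ t in Set.Iic 0, u' t = 0 := by
  have hderiv : deriv u = u' := funext fun t => (hd t).deriv
  have hi : Integrable u' := hc.integrable_of_deriv_zero hs (by rw [hderiv]; exact fun t _ h => h)
  have h1 := integral_Ioi_of_hasDerivAt_of_tendsto' (fun t _ => hd t) hi.integrableOn
    hs.tendsto_zero.1 (a := 0)
  have h2 := integral_Iic_of_hasDerivAt_of_tendsto' (fun t _ => hd t) hi.integrableOn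
    hs.tendsto_zero.2 (a := 0)
  simpa [h0] using And.intro h1 h2

/-- Approximate kernel data for the linearised operators, with uniform constants `c` and `M`. -/
structure Frame (p ε R c M : ℝ) (T : ℝ → ℝ) where
  (φ Z A rφ rZ rA g : ℝ → ℝ)
  ε_pos : 0 < ε
  c_pos : 0 < c
  one_le_M : 1 ≤ M
  R_lb : c ≤ R
  R_ub : R ≤ M
  contT : Continuous T
  T_nonneg : ∀ t, 0 ≤ T t
  T_le : ∀ t, T t ≤ M * QQ ε R t
  dφ : ContDiff ℝ 1 φ
  dZ : ContDiff ℝ 1 Z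
  dA : ContDiff ℝ 1 A
  sφ : HasCompactSupport φ
  sZ : HasCompactSupport Z
  sA : HasCompactSupport A
  crφ : Continuous rφ
  crZ : Continuous rZ
  crA : Continuous rA
  cg : Continuous g
  wφ : ∀ a : ℝ → ℝ, ContDiff ℝ 1 a → HasCompactSupport a →
    ∫ t, (deriv φ t * deriv a t + (QQ ε R t - T t) * φ t * a t) = ∫ t, rφ t * a t
  wZ : ∀ a : ℝ → ℝ, ContDiff ℝ 1 a → HasCompactSupport a →
    ∫ t, (deriv Z t * deriv a t + (QQ ε R t - p * T t) * Z t * a t) =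
      2 * ε * (∫ t, φ t * a t) + ∫ t, rZ t * a t
  wA : ∀ a : ℝ → ℝ, ContDiff ℝ 1 a → HasCompactSupport a →
    ∫ t, (deriv A t * deriv a t + (QQ ε R t - p * T t) * A t * a t) =
      -(2 * (1 + R)) * (∫ t, φ t * a t) + ∫ t, rA t * a t
  bφ : ∀ a : ℝ → ℝ, Continuous a → HasCompactSupport a → |∫ t, φ t * a t| ≤ M * nQ ε R a
  bZ : ∀ a : ℝ → ℝ, Continuous a → HasCompactSupport a → |∫ t, Z t * a t| ≤ M * nQ ε R a
  bA : ∀ a : ℝ → ℝ, Continuous a → HasCompactSupport a → |∫ t, A t * a t| ≤ M * nQ ε R a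
  brφ : ∀ a : ℝ → ℝ, Continuous a → HasCompactSupport a →
    |∫ t, rφ t * a t| ≤ M * ε ^ 2 * nQ ε R a
  brZ : ∀ a : ℝ → ℝ, Continuous a → HasCompactSupport a →
    |∫ t, rZ t * a t| ≤ M * ε ^ 2 * nQ ε R a
  brA : ∀ a : ℝ → ℝ, Continuous a → HasCompactSupport a → |∫ t, rA t * a t| ≤ M * ε * nQ ε R a
  vφ : ∀ a : ℝ → ℝ, Continuous a → HasCompactSupport a →
    |∫ t, (exp (2 * ε * t) - 1) * φ t * a t| ≤ M * ε * nQ ε R a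
  vZ : ∀ a : ℝ → ℝ, Continuous a → HasCompactSupport a →
    |∫ t, (exp (2 * ε * t) - 1) * Z t * a t| ≤ M * ε * nQ ε R a
  vA : ∀ a : ℝ → ℝ, Continuous a → HasCompactSupport a →
    |∫ t, (exp (2 * ε * t) - 1) * A t * a t| ≤ M * ε * nQ ε R a
  nφ : nQ ε R φ ≤ M
  nZ : nQ ε R Z ≤ M
  nA : nQ ε R A ≤ M
  φ_zero : φ 0 = 1
  iφφ : c ≤ ∫ t, φ t ^ 2
  iZZ : c ≤ ∫ t, Z t ^ 2
  iφA : c ≤ ∫ t, φ t * A t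
  iφZ : |∫ t, φ t * Z t| ≤ M * ε
  lA : 0 < ∫ t in Set.Ioi 0, QQ ε R t * g t * A t
  lA' : 0 < ∫ t in Set.Iic 0, QQ ε R t * g t * A t
  lZ : ∫ t in Set.Ioi 0, QQ ε R t * g t * Z t < 0
  lZ' : 0 < ∫ t in Set.Iic 0, QQ ε R t * g t * Z t
  coercive_minus : ∀ v : ℝ → ℝ, ContDiff ℝ 1 v → HasCompactSupport v → v 0 = 0 →
    c * nQ ε R v ^ 2 ≤ ∫ t, (deriv v t ^ 2 + (QQ ε R t - T t) * v t ^ 2)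
  coercive_plus : ∀ a : ℝ → ℝ, ContDiff ℝ 1 a → HasCompactSupport a →
    ∫ t in Set.Ioi 0, QQ ε R t * g t * a t = 0 → ∫ t in Set.Iic 0, QQ ε R t * g t * a t = 0 →
    c * nQ ε R a ^ 2 ≤ ∫ t, (deriv a t ^ 2 + (QQ ε R t - p * T t) * a t ^ 2)

namespace Special

variable {p ε R η M : ℝ} {f P T : ℝ → ℝ}

/-- `(1 - e^{-εt}) / ε`. -/
noncomputable def uu (ε t : ℝ) : ℝ := (1 - exp (-(ε * t))) / ε

/-- `e^{-εt}`. -/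
noncomputable def ss (ε t : ℝ) : ℝ := exp (-(ε * t))

/-- `e^{2εt} - 1`. -/
noncomputable def vv (ε t : ℝ) : ℝ := exp (2 * ε * t) - 1

/-- Generator of translations. -/
noncomputable def Zf (ε : ℝ) (f P : ℝ → ℝ) (t : ℝ) : ℝ := ss ε t * (P t * f t)

/-- Derivative of `Zf`. -/
noncomputable def Zf' (ε R : ℝ) (f P T : ℝ → ℝ) (t : ℝ) : ℝ :=
  ss ε t * ((QQ ε R t - T t) * f t) - ε * Zf ε f P t

/-- Generator of scalings. -/
noncomputable def Af (p ε : ℝ) (f P : ℝ → ℝ) (t : ℝ) : ℝ :=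
  uu ε t * (P t * f t) + 2 / (p - 1) * f t

/-- Derivative of `Af`. -/
noncomputable def Af' (p ε R : ℝ) (f P T : ℝ → ℝ) (t : ℝ) : ℝ :=
  uu ε t * ((QQ ε R t - T t) * f t) + ss ε t * (P t * f t) + 2 / (p - 1) * (P t * f t)

/-- Remainder of `L₋ (χ f)`. -/
noncomputable def rphi (ε : ℝ) (f P : ℝ → ℝ) (t : ℝ) : ℝ :=
  -(2 * (ch1 ε t * (P t * f t)) + ch2 ε t * f t)

/-- Remainder of `L₊ (χ Z)`. -/
noncomputable def rZf (ε R : ℝ) (f P T : ℝ → ℝ) (t : ℝ) : ℝ :=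
  -(2 * ε ^ 2 * (ch ε t * (uu ε t * f t)) + ε ^ 2 * (ch ε t * Zf ε f P t))
    - (2 * (ch1 ε t * Zf' ε R f P T t) + ch2 ε t * Zf ε f P t)

/-- Remainder of `L₊ (χ A)`. -/
noncomputable def rAf (p ε R : ℝ) (f P T : ℝ → ℝ) (t : ℝ) : ℝ :=
  (-(2 * R) * (ch ε t * (vv ε t * f t)) + 2 * ε * (ch ε t * (uu ε t * f t))
    + ε * (ch ε t * Zf ε f P t))
    - (2 * (ch1 ε t * Af' p ε R f P T t) + ch2 ε t * Af p ε f P t)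

theorem cont_uu : Continuous (uu ε) := by unfold uu; fun_prop

theorem cont_ss : Continuous (ss ε) := by unfold ss; fun_prop

theorem cont_vv : Continuous (vv ε) := by unfold vv; fun_prop

theorem hasDerivAt_ss (t : ℝ) : HasDerivAt (ss ε) (-(ε * ss ε t)) t := by
  refine (((hasDerivAt_id t).const_mul ε).neg.exp).congr_deriv ?_
  simp [ss]; ring

theorem ss_eq (hε : ε ≠ 0) (t : ℝ) : ss ε t = 1 - ε * uu ε t := by
  unfold ss uu; field_simp; ring

theorem hasDerivAt_uu (hε : ε ≠ 0) (t : ℝ) : HasDerivAt (uu ε) (ss ε t) t := by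
  refine (((hasDerivAt_ss (ε := ε) t).const_sub 1).div_const ε).congr_deriv ?_
  field_simp

theorem QQ_eq (t : ℝ) : QQ ε R t = 1 + R * (vv ε t + 1) := by unfold QQ vv; ring

theorem hasDerivAt_Pf (h : Profile p ε R f P T) (t : ℝ) :
    HasDerivAt (fun t => P t * f t) ((QQ ε R t - T t) * f t) t := by
  refine ((h.hP t).mul (h.hf t)).congr_deriv ?_
  unfold QQ; ring

theorem hasDerivAt_QQ (t : ℝ) : HasDerivAt (QQ ε R) (2 * ε * (QQ ε R t - 1)) t := by
  refine ((((hasDerivAt_id t).const_mul (2 * ε)).exp).const_mul R |>.const_add 1).congr_deriv ?_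
  simp [QQ]; ring

theorem hasDerivAt_Wf (h : Profile p ε R f P T) (t : ℝ) :
    HasDerivAt (fun t => (QQ ε R t - T t) * f t)
      ((2 * ε * (QQ ε R t - 1) - T t * ((p - 1) * P t + 2 * ε)) * f t
        + (QQ ε R t - T t) * (P t * f t)) t :=
  ((hasDerivAt_QQ t).sub (h.hT t)).mul (h.hf t)

theorem hasDerivAt_Zf (h : Profile p ε R f P T) (t : ℝ) :
    HasDerivAt (Zf ε f P) (Zf' ε R f P T t) t := by
  refine ((hasDerivAt_ss t).mul (hasDerivAt_Pf h t)).congr_deriv ?_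
  unfold Zf' Zf; ring

theorem hasDerivAt_Zf' (h : Profile p ε R f P T) (t : ℝ) :
    HasDerivAt (Zf' ε R f P T)
      ((QQ ε R t - p * T t) * Zf ε f P t - (2 * ε * (ss ε t * f t) - ε ^ 2 * Zf ε f P t)) t := by
  refine (((hasDerivAt_ss t).mul (hasDerivAt_Wf h t)).sub
    ((hasDerivAt_Zf h t).const_mul ε)).congr_deriv ?_
  unfold Zf' Zf; ring

theorem hasDerivAt_Af (hε : ε ≠ 0) (h : Profile p ε R f P T) (t : ℝ) :
    HasDerivAt (Af p ε f P) (Af' p ε R f P T t) t := by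
  refine (((hasDerivAt_uu hε t).mul (hasDerivAt_Pf h t)).add
    ((h.hf t).const_mul (2 / (p - 1)))).congr_deriv ?_
  unfold Af'; ring

theorem hasDerivAt_Af' (hp : 1 < p) (hε : ε ≠ 0) (h : Profile p ε R f P T) (t : ℝ) :
    HasDerivAt (Af' p ε R f P T)
      ((QQ ε R t - p * T t) * Af p ε f P t
        - (-(2 * (QQ ε R t - 1 + ss ε t)) * f t + ε * Zf ε f P t)) t := by
  refine ((((hasDerivAt_uu hε t).mul (hasDerivAt_Wf h t)).add
    ((hasDerivAt_ss t).mul (hasDerivAt_Pf h t))).add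
    ((hasDerivAt_Pf h t).const_mul (2 / (p - 1)))).congr_deriv ?_
  have hp' : p - 1 ≠ 0 := by linarith
  rw [ss_eq hε]
  unfold Af Zf
  rw [ss_eq hε]
  field_simp
  ring

/-- Equation of a cut off function. -/
theorem hasDerivAt_cutoff {ψ ψ' : ℝ → ℝ} {W r t : ℝ} (h1 : HasDerivAt ψ (ψ' t) t)
    (h2 : HasDerivAt ψ' (W * ψ t - r) t) :
    HasDerivAt (fun t => ch1 ε t * ψ t + ch ε t * ψ' t)
      (W * (ch ε t * ψ t) - (ch ε t * r - (2 * (ch1 ε t * ψ' t) + ch2 ε t * ψ t))) t := by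
  refine (((hasDerivAt_ch1 ε t).mul h1).add ((hasDerivAt_ch ε t).mul h2)).congr_deriv ?_
  ring

theorem contDiff_cutoff {ψ ψ' : ℝ → ℝ} (h1 : ∀ t, HasDerivAt ψ (ψ' t) t) (hc : Continuous ψ') :
    ContDiff ℝ 1 (fun t => ch ε t * ψ t) ∧
      deriv (fun t => ch ε t * ψ t) = fun t => ch1 ε t * ψ t + ch ε t * ψ' t := by
  have hd : ∀ t, HasDerivAt (fun t => ch ε t * ψ t) (ch1 ε t * ψ t + ch ε t * ψ' t) t :=
    fun t => (hasDerivAt_ch ε t).mul (h1 t)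
  have e : deriv (fun t => ch ε t * ψ t) = fun t => ch1 ε t * ψ t + ch ε t * ψ' t :=
    funext fun t => (hd t).deriv
  have cψ : Continuous ψ := continuous_iff_continuousAt.2 fun t => (h1 t).continuousAt
  have := cont_ch ε
  have := cont_ch1 ε
  exact ⟨contDiff_one_iff_deriv.2 ⟨fun t => (hd t).differentiableAt, by rw [e]; fun_prop⟩, e⟩

theorem weak_of_strong {ψ ψ' W r a : ℝ → ℝ} (hψ' : ∀ t, HasDerivAt ψ' (W t * ψ t - r t) t)
    (cW : Continuous W) (cψ : Continuous ψ) (cr : Continuous r)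
    (ha : ContDiff ℝ 1 a) (sa : HasCompactSupport a) :
    ∫ t, (ψ' t * deriv a t + W t * ψ t * a t) = ∫ t, r t * a t := by
  have cψ' : Continuous ψ' := continuous_iff_continuousAt.2 fun t => (hψ' t).continuousAt
  have ca := ha.continuous
  have ca' := ha.continuous_deriv le_rfl
  rw [← sub_eq_zero, ← integral_sub]
  · refine HasCompactSupport.integral_hasDerivAt_eq_zero (u := fun t => ψ' t * a t)
      (sa.of_deriv_zero (by intro t h _; simp [h])) (fun t => ?_) (by fun_prop)
    refine ((hψ' t).mul (ha.hasDerivAt_one t)).congr_deriv ?_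
    ring
  · exact (by fun_prop : Continuous _).integrable_of_deriv_zero sa (by intro t h h'; simp [h, h'])
  · exact (by fun_prop : Continuous _).integrable_of_deriv_zero sa (by intro t h _; simp [h])

theorem contZf (h : Profile p ε R f P T) : Continuous (Zf ε f P) :=
  continuous_iff_continuousAt.2 fun t => (hasDerivAt_Zf h t).continuousAt

theorem contZf' (h : Profile p ε R f P T) : Continuous (Zf' ε R f P T) :=
  continuous_iff_continuousAt.2 fun t => (hasDerivAt_Zf' h t).continuousAt

theorem contAf (hε : ε ≠ 0) (h : Profile p ε R f P T) : Continuous (Af p ε f P) :=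
  continuous_iff_continuousAt.2 fun t => (hasDerivAt_Af hε h t).continuousAt

theorem contAf' (hp : 1 < p) (hε : ε ≠ 0) (h : Profile p ε R f P T) :
    Continuous (Af' p ε R f P T) :=
  continuous_iff_continuousAt.2 fun t => (hasDerivAt_Af' hp hε h t).continuousAt

section Weak

variable {a : ℝ → ℝ}

theorem weak_phi (h : Profile p ε R f P T) (ha : ContDiff ℝ 1 a) (sa : HasCompactSupport a) :
    ∫ t, (deriv (fun t => ch ε t * f t) t * deriv a t
      + (QQ ε R t - T t) * (ch ε t * f t) * a t) = ∫ t, rphi ε f P t * a t := by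
  have cf := Ctrl.contf h
  have cP := Ctrl.contP h
  have cT := Ctrl.contT h
  have := cont_ch ε
  have := cont_ch1 ε
  have := cont_ch2 ε
  rw [(contDiff_cutoff h.hf (by fun_prop)).2]
  refine weak_of_strong (W := fun t => QQ ε R t - T t) (ψ := fun t => ch ε t * f t)
    (fun t => ?_) (by fun_prop) (by fun_prop) (by unfold rphi; fun_prop) ha sa
  have h2 : HasDerivAt (fun t => P t * f t) ((QQ ε R t - T t) * f t - 0) t := by
    simpa using hasDerivAt_Pf h t
  refine (hasDerivAt_cutoff (h.hf t) h2).congr_deriv ?_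
  unfold rphi; ring

theorem weak_Z (hε : ε ≠ 0) (h : Profile p ε R f P T) (ha : ContDiff ℝ 1 a)
    (sa : HasCompactSupport a) :
    ∫ t, (deriv (fun t => ch ε t * Zf ε f P t) t * deriv a t
      + (QQ ε R t - p * T t) * (ch ε t * Zf ε f P t) * a t) =
      2 * ε * (∫ t, ch ε t * f t * a t) + ∫ t, rZf ε R f P T t * a t := by
  have cf := Ctrl.contf h
  have cP := Ctrl.contP h
  have cT := Ctrl.contT h
  have ca := ha.continuous
  have := cont_ch ε
  have := cont_ch1 ε
  have := cont_ch2 ε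
  have := contZf h
  have := contZf' h
  have := cont_uu (ε := ε)
  have cr : Continuous (rZf ε R f P T) := by unfold rZf; fun_prop
  rw [(contDiff_cutoff (hasDerivAt_Zf h) (by fun_prop)).2, ← integral_const_mul, ← integral_add]
  · refine (weak_of_strong (W := fun t => QQ ε R t - p * T t) (ψ := fun t => ch ε t * Zf ε f P t)
      (r := fun t => 2 * ε * (ch ε t * f t) + rZf ε R f P T t)
      (fun t => ?_) (by fun_prop) (by fun_prop) (by fun_prop) ha sa).trans ?_
    · refine (hasDerivAt_cutoff (hasDerivAt_Zf h t) (hasDerivAt_Zf' h t)).congr_deriv ?_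
      unfold rZf
      rw [ss_eq hε]
      ring
    · exact integral_congr_ae (Eventually.of_forall fun t => by simp only; ring)
  · exact (by fun_prop : Continuous _).integrable_of_deriv_zero sa (by intro t h _; simp [h])
  · exact (by fun_prop : Continuous _).integrable_of_deriv_zero sa (by intro t h _; simp [h])

theorem weak_A (hp : 1 < p) (hε : ε ≠ 0) (h : Profile p ε R f P T) (ha : ContDiff ℝ 1 a)
    (sa : HasCompactSupport a) :
    ∫ t, (deriv (fun t => ch ε t * Af p ε f P t) t * deriv a t
      + (QQ ε R t - p * T t) * (ch ε t * Af p ε f P t) * a t) =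
      -(2 * (1 + R)) * (∫ t, ch ε t * f t * a t) + ∫ t, rAf p ε R f P T t * a t := by
  have cf := Ctrl.contf h
  have cP := Ctrl.contP h
  have cT := Ctrl.contT h
  have ca := ha.continuous
  have := cont_ch ε
  have := cont_ch1 ε
  have := cont_ch2 ε
  have := contAf hε h
  have := contAf' hp hε h
  have := contZf h
  have := cont_uu (ε := ε)
  have := cont_vv (ε := ε)
  have cr : Continuous (rAf p ε R f P T) := by unfold rAf; fun_prop
  rw [(contDiff_cutoff (hasDerivAt_Af hε h) (by fun_prop)).2, ← integral_const_mul, ← integral_add]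
  · refine (weak_of_strong (W := fun t => QQ ε R t - p * T t) (ψ := fun t => ch ε t * Af p ε f P t)
      (r := fun t => -(2 * (1 + R)) * (ch ε t * f t) + rAf p ε R f P T t)
      (fun t => ?_) (by fun_prop) (by fun_prop) (by fun_prop) ha sa).trans ?_
    · refine (hasDerivAt_cutoff (hasDerivAt_Af hε h t) (hasDerivAt_Af' hp hε h t)).congr_deriv ?_
      unfold rAf
      rw [ss_eq hε, QQ_eq]
      ring
    · exact integral_congr_ae (Eventually.of_forall fun t => by simp only; ring)
  · exact (by fun_prop : Continuous _).integrable_of_deriv_zero sa (by intro t h _; simp [h])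
  · exact (by fun_prop : Continuous _).integrable_of_deriv_zero sa (by intro t h _; simp [h])

end Weak

end Special

namespace Special

variable {p ε R η M : ℝ} {f P T : ℝ → ℝ}

theorem bPf (h : Atoms p ε R η M f P T) : ExpBound η (M ^ 2) (-6) fun t => P t * f t :=
  (h.bP.mul h.bf).mono h.η_pos.le (by linarith) (by norm_num)

theorem bZf (h : Atoms p ε R η M f P T) : ExpBound η (M ^ 2) (-5) (Zf ε f P) :=
  (h.bs.mul (bPf h)).mono h.η_pos.le (by linarith) (by norm_num)

theorem bZf' (hε : 0 < ε) (hε1 : ε ≤ 1) (h : Atoms p ε R η M f P T) :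
    ExpBound η (2 * M ^ 2) (-5) (Zf' ε R f P T) := by
  have e : (1:ℝ) + (2 + -8) = -5 := by norm_num
  have h1 := h.bs.mul (h.bW.mul h.bf)
  rw [e] at h1
  refine (h1.sub ((bZf h).const_mul ε)).mono h.η_pos.le ?_ le_rfl
  rw [abs_of_pos hε]
  have : ε * M ^ 2 ≤ 1 * M ^ 2 := by gcongr
  linarith

theorem bAf (hp : 1 < p) (h : Atoms p ε R η M f P T) :
    ExpBound η (2 * M ^ 3) (-4) (Af p ε f P) := by
  have hM := h.one_le
  have hp' : 0 < 2 / (p - 1) := div_pos two_pos (by linarith)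
  have h1 := (h.bu.mul (bPf h)).mono (L := M ^ 3) (l := -4) h.η_pos.le (by linarith) (by norm_num)
  have h2 := (h.bf.const_mul (2 / (p - 1))).mono (L := M ^ 3) (l := -4) h.η_pos.le
    (by
      rw [abs_of_pos hp']
      calc 2 / (p - 1) * M ≤ M * M := by gcongr; exact h.hp
        _ = M ^ 2 := by ring
        _ ≤ M ^ 3 := pow_le_pow_right₀ hM (by norm_num)) (by norm_num)
  exact (h1.add h2).mono h.η_pos.le (by linarith) le_rfl

theorem bAf' (hp : 1 < p) (h : Atoms p ε R η M f P T) :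
    ExpBound η (3 * M ^ 3) (-4) (Af' p ε R f P T) := by
  have hM := h.one_le
  have hp' : 0 < 2 / (p - 1) := div_pos two_pos (by linarith)
  have h1 := (h.bu.mul (h.bW.mul h.bf)).mono (L := M ^ 3) (l := -4) h.η_pos.le (by linarith)
    (by norm_num)
  have h2 := (bZf h).mono (L := M ^ 3) (l := -4) h.η_pos.le
    (pow_le_pow_right₀ hM (by norm_num)) (by norm_num)
  have h3 := ((bPf h).const_mul (2 / (p - 1))).mono (L := M ^ 3) (l := -4) h.η_pos.le
    (by
      rw [abs_of_pos hp']
      calc 2 / (p - 1) * M ^ 2 ≤ M * M ^ 2 := by gcongr; exact h.hp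
        _ = M ^ 3 := by ring) (by norm_num)
  exact ((h1.add h2).add h3).mono h.η_pos.le (by linarith) le_rfl

theorem brphi (h : Atoms p ε R η M f P T) :
    ExpBound η (3 * M ^ 3 * ε ^ 2) (-1) (rphi ε f P) := by
  have hM := h.one_le
  have h1 := ((h.b1.mul (bPf h)).const_mul 2).mono (l := -1) h.η_pos.le le_rfl (by norm_num)
  have h2 := (h.b2.mul h.bf).mono (l := -1) h.η_pos.le le_rfl (by norm_num)
  refine (h1.add h2).neg.mono h.η_pos.le ?_ le_rfl
  rw [abs_two]
  have : M ^ 2 * ε ^ 2 ≤ M ^ 3 * ε ^ 2 := by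
    gcongr
    norm_num
  linarith

theorem brZ (hε : 0 < ε) (hε1 : ε ≤ 1) (h : Atoms p ε R η M f P T) :
    ExpBound η (8 * M ^ 3 * ε ^ 2) (-1) (rZf ε R f P T) := by
  have hM := h.one_le
  have hη := h.η_pos.le
  have h1 := ((h.b0.mul (h.bu.mul h.bf)).const_mul (2 * ε ^ 2)).mono (l := -1) hη le_rfl
    (by norm_num)
  have h2 := ((h.b0.mul (bZf h)).const_mul (ε ^ 2)).mono (l := -1) hη le_rfl (by norm_num)
  have h3 := ((h.b1.mul (bZf' hε hε1 h)).const_mul 2).mono (l := -1) hη le_rfl (by norm_num)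
  have h4 := (h.b2.mul (bZf h)).mono (l := -1) hη le_rfl (by norm_num)
  refine ((h1.add h2).neg.sub (h3.add h4)).mono hη ?_ le_rfl
  rw [abs_two, abs_of_nonneg (by positivity), abs_of_nonneg (by positivity)]
  have : M ^ 2 * ε ^ 2 ≤ M ^ 3 * ε ^ 2 := by
    gcongr
    norm_num
  linarith

theorem brA (hp : 1 < p) (hR : 0 < R) (hε : 0 < ε) (hε1 : ε ≤ 1) (h : Atoms p ε R η M f P T) :
    ExpBound η (13 * M ^ 4 * ε) (-1) (rAf p ε R f P T) := by
  have hM := h.one_le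
  have hη := h.η_pos.le
  have h0 := ((h.b0.mul (h.bv.mul h.bf)).const_mul (-(2 * R))).mono (l := -1) hη le_rfl
    (by norm_num)
  have h1 := ((h.b0.mul (h.bu.mul h.bf)).const_mul (2 * ε)).mono (l := -1) hη le_rfl
    (by norm_num)
  have h2 := ((h.b0.mul (bZf h)).const_mul ε).mono (l := -1) hη le_rfl (by norm_num)
  have h3 := ((h.b1.mul (bAf' hp h)).const_mul 2).mono (l := -1) hη le_rfl (by norm_num)
  have h4 := (h.b2.mul (bAf hp h)).mono (l := -1) hη le_rfl (by norm_num)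
  refine (((h0.add h1).add h2).sub (h3.add h4)).mono hη ?_ le_rfl
  rw [abs_two, abs_of_nonneg (by positivity : 0 ≤ 2 * ε), abs_of_pos hε, abs_neg,
    abs_of_pos (by positivity : 0 < 2 * R)]
  have e1 : M ^ 2 * ε ≤ M ^ 4 * ε := by
    gcongr
    norm_num
  have e2 : R * (M ^ 2 * ε) ≤ M * (M ^ 2 * ε) := by gcongr; exact h.hR
  have e3 : M ^ 3 * ε ≤ M ^ 4 * ε := by
    gcongr
    norm_num
  have e4 : M ^ 4 * (ε * ε) ≤ M ^ 4 * (ε * 1) := by gcongr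
  linarith

theorem bgg (hp : 1 < p) (hp5 : p < 5) (hf : ∀ t, 0 < f t) (h : Atoms p ε R η M f P T) :
    ExpBound η (M ^ 3) (-8) (Ctrl.gg p f) := fun t => by
  have hM := h.one_le
  have hη := h.η_pos
  unfold Ctrl.gg
  rw [abs_of_pos (rpow_pos_of_pos (hf t) _)]
  have h1 := h.bf t
  rw [abs_of_pos (hf t)] at h1
  refine (rpow_le_rpow (hf t).le h1 (by linarith)).trans ?_
  rw [mul_rpow (by linarith) (exp_pos _).le, ← exp_mul]
  refine mul_le_mul ?_ (exp_le_exp.2 ?_) (exp_pos _).le (by positivity)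
  · rw [← rpow_natCast]
    exact rpow_le_rpow_of_exponent_le hM (by push_cast; linarith)
  · have : 0 ≤ η * |t| := by positivity
    nlinarith

theorem nQ_le {K : ℝ} {ψ : ℝ → ℝ} (h : Atoms p ε R η M f P T)
    (hψ : ExpBound η K (-4) ψ) :
    nQ ε R ψ ≤ M * K * (1 + 2 / η) := by
  have hη := h.η_pos
  have hM := h.one_le
  have hK := hψ.nonneg
  have hη2 : 0 < 2 / η := by positivity
  refine sqrt_le_iff.2 ⟨by positivity, ?_⟩
  have h1 := (h.bQ.mul (hψ.mul hψ)).abs_integral_le hη (by norm_num)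
  have h2 : ∫ t, QQ ε R t * ψ t ^ 2 ≤ M * (K * K) * (2 / η) := by
    simpa only [sq] using (le_abs_self _).trans h1
  refine h2.trans ?_
  rw [mul_pow, mul_pow, sq K]
  have : M ≤ M ^ 2 := by nlinarith
  gcongr
  nlinarith

end Special

namespace Special

variable {p ε R η M c C : ℝ} {f P T : ℝ → ℝ}

theorem hasCompactSupport_cut (hε : 0 < ε) (ψ : ℝ → ℝ) :
    HasCompactSupport fun t => ch ε t * ψ t := (hasCompactSupport_ch hε).mul_right

theorem ch_eq_one (hε : 0 < ε) (hε1 : ε ≤ 1 / 100) {t : ℝ} (ht : |t| ≤ 2) : ch ε t = 1 := by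
  refine bump_eq_one ?_
  rw [abs_mul, abs_of_pos (by positivity)]
  nlinarith [abs_nonneg t]

theorem integral_phi_A (hp : 1 < p) (hε : 0 < ε) (hε1 : ε ≤ 1) (hP : Profile p ε R f P T)
    (h : Atoms p ε R η M f P T) :
    (2 / (p - 1) - 1 / 2) * (∫ t, (ch ε t * f t) ^ 2) - 2 * M ^ 4 * ε * (2 / η) ≤
      ∫ t, (ch ε t * f t) * (ch ε t * Af p ε f P t) := by
  have hM := h.one_le
  have cf := Ctrl.contf hP
  have cP := Ctrl.contP hP
  have c0 := cont_ch ε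
  have c1 := cont_ch1 ε
  have cu := cont_uu (ε := ε)
  have cs := cont_ss (ε := ε)
  have cA := contAf hε.ne' hP
  have sc : ∀ {g : ℝ → ℝ}, Continuous g → (∀ t, ch ε t = 0 → g t = 0) → Integrable g :=
    fun hg h0 => hg.integrable_of_deriv_zero (hasCompactSupport_ch hε) (fun t h1 _ => h0 t h1)
  set e : ℝ → ℝ := fun t => ε / 2 * ((ch ε t * f t) * (ch ε t * f t) * uu ε t)
    - (ch ε t * f t) * (ch1 ε t * f t) * uu ε t with he
  have be : ExpBound η (2 * M ^ 4 * ε) (-1) e := by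
    have h1 := (((h.b0.mul h.bf).mul (h.b0.mul h.bf)).mul h.bu).const_mul (ε / 2)
    have h2 := ((h.b0.mul h.bf).mul (h.b1.mul h.bf)).mul h.bu
    refine ((h1.mono (l := -1) h.η_pos.le le_rfl (by norm_num)).sub
      (h2.mono (l := -1) h.η_pos.le le_rfl (by norm_num))).mono h.η_pos.le ?_ le_rfl
    rw [abs_of_pos (by positivity)]
    have e1 : M ^ 3 * ε ≤ M ^ 4 * ε := by gcongr; norm_num
    have e2 : M ^ 4 * (ε * ε) ≤ M ^ 4 * (ε * 1) := by gcongr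
    have e3 : 0 ≤ M ^ 4 * ε := by positivity
    linarith
  have hU : ∫ t, (ch ε t * ch1 ε t * f t ^ 2 * uu ε t + ch ε t ^ 2 * (f t * (P t * f t)) * uu ε t
      + ch ε t ^ 2 * f t ^ 2 * ss ε t / 2) = 0 := by
    refine HasCompactSupport.integral_hasDerivAt_eq_zero
      (u := fun t => ch ε t ^ 2 * f t ^ 2 * uu ε t / 2)
      ((hasCompactSupport_ch hε).of_deriv_zero (by intro t h _; simp [h])) (fun t => ?_)
      (by fun_prop)
    refine (((((hasDerivAt_ch ε t).pow 2).mul ((hP.hf t).pow 2)).mul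
      (hasDerivAt_uu hε.ne' t)).div_const 2).congr_deriv ?_
    simp; ring
  have hA : ∫ t, (ch ε t * f t) * (ch ε t * Af p ε f P t)
      = (2 / (p - 1) - 1 / 2) * (∫ t, (ch ε t * f t) ^ 2) + ∫ t, e t := by
    rw [← integral_const_mul, ← integral_add (sc (by fun_prop) (by intro t h; simp [h]))
      (sc (by fun_prop) (by intro t h; simp [he, h])), ← sub_eq_zero, ← hU, ← integral_sub
      (sc (by fun_prop) (by intro t h; simp [h])) (sc (by fun_prop) (by intro t h; simp [he, h]))]
    refine integral_congr_ae (Eventually.of_forall fun t => ?_)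
    simp only [he, Af, ss_eq hε.ne']
    have : p - 1 ≠ 0 := by linarith
    field_simp
    ring
  rw [hA]
  linarith [(abs_le.1 (be.abs_integral_le h.η_pos le_rfl)).1]

theorem abs_integral_phi_Z (hε : 0 < ε) (hε1 : ε ≤ 1) (hP : Profile p ε R f P T)
    (h : Atoms p ε R η M f P T) :
    |∫ t, (ch ε t * f t) * (ch ε t * Zf ε f P t)| ≤ 2 * M ^ 3 * ε * (2 / η) := by
  have hM := h.one_le
  have cf := Ctrl.contf hP
  have cP := Ctrl.contP hP
  have c0 := cont_ch ε
  have c1 := cont_ch1 ε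
  have cs := cont_ss (ε := ε)
  have cZ := contZf hP
  have sc : ∀ {g : ℝ → ℝ}, Continuous g → (∀ t, ch ε t = 0 → g t = 0) → Integrable g :=
    fun hg h0 => hg.integrable_of_deriv_zero (hasCompactSupport_ch hε) (fun t h1 _ => h0 t h1)
  set e : ℝ → ℝ := fun t => ε / 2 * ((ch ε t * f t) * (ch ε t * f t) * ss ε t)
    - (ch ε t * f t) * (ch1 ε t * f t) * ss ε t with he
  have be : ExpBound η (2 * M ^ 3 * ε) (-1) e := by
    have h1 := (((h.b0.mul h.bf).mul (h.b0.mul h.bf)).mul h.bs).const_mul (ε / 2)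
    have h2 := ((h.b0.mul h.bf).mul (h.b1.mul h.bf)).mul h.bs
    refine ((h1.mono (l := -1) h.η_pos.le le_rfl (by norm_num)).sub
      (h2.mono (l := -1) h.η_pos.le le_rfl (by norm_num))).mono h.η_pos.le ?_ le_rfl
    rw [abs_of_pos (by positivity)]
    have e1 : M ^ 2 * ε ≤ M ^ 3 * ε := by gcongr; norm_num
    have e2 : M ^ 3 * (ε * ε) ≤ M ^ 3 * (ε * 1) := by gcongr
    have e3 : 0 ≤ M ^ 3 * ε := by positivity
    linarith
  have hU : ∫ t, (ch ε t * ch1 ε t * f t ^ 2 * ss ε t + ch ε t ^ 2 * (f t * (P t * f t)) * ss ε t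
      - ε / 2 * (ch ε t ^ 2 * f t ^ 2 * ss ε t)) = 0 := by
    refine HasCompactSupport.integral_hasDerivAt_eq_zero
      (u := fun t => ch ε t ^ 2 * f t ^ 2 * ss ε t / 2)
      ((hasCompactSupport_ch hε).of_deriv_zero (by intro t h _; simp [h])) (fun t => ?_)
      (by fun_prop)
    refine (((((hasDerivAt_ch ε t).pow 2).mul ((hP.hf t).pow 2)).mul
      (hasDerivAt_ss t)).div_const 2).congr_deriv ?_
    simp; ring
  have hA : ∫ t, (ch ε t * f t) * (ch ε t * Zf ε f P t) = ∫ t, e t := by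
    rw [← sub_eq_zero, ← hU, ← integral_sub
      (sc (by fun_prop) (by intro t h; simp [h])) (sc (by fun_prop) (by intro t h; simp [he, h]))]
    refine integral_congr_ae (Eventually.of_forall fun t => ?_)
    simp only [he, Zf]
    ring
  rw [hA]
  exact be.abs_integral_le h.η_pos le_rfl

theorem setIntegral_A (hp : 1 < p) (hp5 : p < 5) (hε : 0 < ε) (hε1 : ε ≤ 1)
    (hP : Profile p ε R f P T) (h : Atoms p ε R η M f P T) {S : Set ℝ}
    (hS : S = Set.Ioi 0 ∨ S = Set.Iic 0) :
    (2 / (p - 1) - 2 / (p + 3)) * (∫ t in S, QQ ε R t * Ctrl.gg p f t * (ch ε t * f t))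
      - 4 * M ^ 7 * ε * (2 / η) ≤
      ∫ t in S, QQ ε R t * Ctrl.gg p f t * (ch ε t * Af p ε f P t) := by
  have hM := h.one_le
  have cf := Ctrl.contf hP
  have cP := Ctrl.contP hP
  have cg := Ctrl.contgg hP
  have c0 := cont_ch ε
  have c1 := cont_ch1 ε
  have cu := cont_uu (ε := ε)
  have cs := cont_ss (ε := ε)
  have cA := contAf hε.ne' hP
  have sc : ∀ {g : ℝ → ℝ}, Continuous g → (∀ t, ch ε t = 0 → g t = 0) → IntegrableOn g S :=
    fun hg h0 => (hg.integrable_of_deriv_zero (hasCompactSupport_ch hε)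
      (fun t h1 _ => h0 t h1)).integrableOn
  have sc' : ∀ {g : ℝ → ℝ}, Continuous g → (∀ t, ch ε t = 0 → ch1 ε t = 0 → g t = 0) →
      IntegrableOn g S :=
    fun hg h0 => (hg.integrable_of_deriv_zero (hasCompactSupport_ch hε)
      (fun t h1 h2 => h0 t h1 (by rwa [(hasDerivAt_ch ε t).deriv] at h2))).integrableOn
  set e : ℝ → ℝ := fun t => 2 / (p + 3) * (2 * ε * (ch ε t * uu ε t * (Ctrl.gg p f t * f t))
    - ε * (QQ ε R t * (ch ε t * uu ε t * (Ctrl.gg p f t * f t)))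
    - QQ ε R t * (ch1 ε t * uu ε t * (Ctrl.gg p f t * f t))) with he
  have hp3 : 2 / (p + 3) ≤ 1 := by rw [div_le_one (by linarith)]; linarith
  have hp3' : 0 < 2 / (p + 3) := div_pos two_pos (by linarith)
  have be : ExpBound η (4 * M ^ 7 * ε) (-1) e := by
    have bgf := (bgg hp hp5 hP.f_pos h).mul h.bf
    have h0 := ((h.b0.mul h.bu).mul bgf).const_mul (2 * ε)
    have h1 := (h.bQ.mul ((h.b0.mul h.bu).mul bgf)).const_mul ε
    have h2 := h.bQ.mul ((h.b1.mul h.bu).mul bgf)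
    refine ((((h0.mono (l := -1) h.η_pos.le le_rfl (by norm_num)).sub
      (h1.mono (l := -1) h.η_pos.le le_rfl (by norm_num))).sub
      (h2.mono (l := -1) h.η_pos.le le_rfl (by norm_num))).const_mul (2 / (p + 3))).mono
      h.η_pos.le ?_ le_rfl
    rw [abs_of_pos hp3', abs_of_pos hε, abs_of_pos (by positivity : 0 < 2 * ε)]
    have e1 : M ^ 5 * ε ≤ M ^ 7 * ε := by gcongr; norm_num
    have e1' : M ^ 6 * ε ≤ M ^ 7 * ε := by gcongr; norm_num
    have e2 : M ^ 7 * (ε * ε) ≤ M ^ 7 * (ε * 1) := by gcongr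
    have e3 : 0 ≤ M ^ 7 * ε := by positivity
    refine (mul_le_of_le_one_left (by positivity) hp3).trans ?_
    linarith
  set U' : ℝ → ℝ := fun t => 2 / (p + 3) *
    (2 * ε * (QQ ε R t - 1) * (ch ε t * uu ε t * (Ctrl.gg p f t * f t))
      + QQ ε R t * (ch1 ε t * uu ε t * (Ctrl.gg p f t * f t))
      + QQ ε R t * (ch ε t * ss ε t * (Ctrl.gg p f t * f t))
      + QQ ε R t * (ch ε t * uu ε t * ((p + 3) / 2 * P t * (Ctrl.gg p f t * f t)))) with hU'
  have hU : ∫ t in S, U' t = 0 := by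
    have := HasCompactSupport.halfline_integral_eq_zero
      (u := fun t => 2 / (p + 3) * (QQ ε R t * (ch ε t * uu ε t * (Ctrl.gg p f t * f t))))
      (u' := U') ((hasCompactSupport_ch hε).of_deriv_zero (by intro t h _; simp [h]))
      (fun t => ?_) (by fun_prop) (by simp [uu])
    · rcases hS with rfl | rfl
      exacts [this.1, this.2]
    · refine (((hasDerivAt_QQ t).mul (((hasDerivAt_ch ε t).mul (hasDerivAt_uu hε.ne' t)).mul
        ((Ctrl.hasDerivAt_gg hP t).mul (hP.hf t)))).const_mul (2 / (p + 3))).congr_deriv ?_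
      simp only [hU', Pi.mul_apply]
      have : p + 3 ≠ 0 := by linarith
      field_simp
      ring
  have hA : ∫ t in S, QQ ε R t * Ctrl.gg p f t * (ch ε t * Af p ε f P t)
      = (2 / (p - 1) - 2 / (p + 3)) * (∫ t in S, QQ ε R t * Ctrl.gg p f t * (ch ε t * f t))
        + ∫ t in S, e t := by
    rw [← integral_const_mul, ← integral_add (sc (by fun_prop) (by intro t h; simp [h]))
      (sc' (by fun_prop) (by intro t h h'; simp [he, h, h'])), ← sub_eq_zero, ← hU, ← integral_sub
      (sc (by fun_prop) (by intro t h; simp [h]))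
      (sc' (by fun_prop) (by intro t h h'; simp [he, h, h']))]
    refine integral_congr_ae (Eventually.of_forall fun t => ?_)
    simp only [he, Af, hU', ss_eq hε.ne']
    have : p - 1 ≠ 0 := by linarith
    have : p + 3 ≠ 0 := by linarith
    field_simp
    ring
  rw [hA]
  linarith [(abs_le.1 (be.abs_setIntegral_le h.η_pos le_rfl S)).1]

end Special

namespace Special

variable {p ε R η M c C : ℝ} {f P T : ℝ → ℝ}

theorem gg_ge (hp : 1 < p) (hp5 : p < 5) (hc : 0 < c) (hc1 : c ≤ 1) (h : Ctrl p ε R c C f P T)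
    {t : ℝ} (ht : |t| ≤ 2) : c ^ 3 ≤ Ctrl.gg p f t := by
  have h1 : c ^ (3 : ℝ) ≤ c ^ ((p + 1) / 2) :=
    rpow_le_rpow_of_exponent_ge hc hc1 (by linarith)
  rw [rpow_ofNat] at h1
  exact h1.trans (rpow_le_rpow hc.le (h.f_ge t ht) (by linarith))

theorem le_integral_phi_sq (hε : 0 < ε) (hε1 : ε ≤ 1 / 100) (hc : 0 < c)
    (h : Ctrl p ε R c C f P T) : 4 * c ^ 2 ≤ ∫ t, (ch ε t * f t) ^ 2 := by
  have cf := Ctrl.contf h.toProfile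
  have c0 := cont_ch ε
  have hi : Integrable fun t => (ch ε t * f t) ^ 2 :=
    Continuous.integrable_of_deriv_zero (by fun_prop) (hasCompactSupport_ch hε)
      (by intro t h1 _; simp [h1])
  have := mul_le_setIntegral (a := -2) (b := 2) (m := c ^ 2) MeasurableSet.univ hi.integrableOn
    (fun t _ => sq_nonneg _) (by norm_num) (Set.subset_univ _) (fun t ht => by
      rw [ch_eq_one hε hε1 (abs_le.2 ht), one_mul]
      exact pow_le_pow_left₀ hc.le (h.f_ge t (abs_le.2 ht)) 2)
  rw [setIntegral_univ] at this
  linarith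

theorem half_le_ss (hε1 : ε ≤ 1 / 100) (hε : 0 < ε) {t : ℝ} (ht : t ≤ 2) : 1 / 2 ≤ ss ε t := by
  have := add_one_le_exp (-(ε * t))
  unfold ss
  nlinarith

theorem one_le_ss (hε : 0 < ε) {t : ℝ} (ht : t ≤ 0) : 1 ≤ ss ε t := by
  have := add_one_le_exp (-(ε * t))
  unfold ss
  nlinarith

theorem le_P_add (hc : 0 < c) (h : Ctrl p ε R c C f P T) {t : ℝ} (ht : t ≤ -1) :
    c / 2 ≤ P t + ε := by
  have h1 := h.P_left t (by linarith)
  have h2 : 1 / 2 ≤ -t / (1 - t) := by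
    rw [div_le_div_iff₀ two_pos (by linarith)]; linarith
  nlinarith

theorem le_integral_Z_sq (hε : 0 < ε) (hε1 : ε ≤ 1 / 100) (hc : 0 < c) (hεc : ε ≤ c / 4)
    (h : Ctrl p ε R c C f P T) : c ^ 4 / 16 ≤ ∫ t, (ch ε t * Zf ε f P t) ^ 2 := by
  have cZ := contZf h.toProfile
  have c0 := cont_ch ε
  have hi : Integrable fun t => (ch ε t * Zf ε f P t) ^ 2 :=
    Continuous.integrable_of_deriv_zero (by fun_prop) (hasCompactSupport_ch hε)
      (by intro t h1 _; simp [h1])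
  have := mul_le_setIntegral (a := -2) (b := -1) (m := (1 * (c / 4 * c)) ^ 2) MeasurableSet.univ
    hi.integrableOn (fun t _ => sq_nonneg _) (by norm_num) (Set.subset_univ _) (fun t ht => by
      have ht' : |t| ≤ 2 := abs_le.2 ⟨ht.1, by linarith [ht.2]⟩
      rw [ch_eq_one hε hε1 ht', one_mul (Zf ε f P t)]
      have h1 := le_P_add hc h ht.2
      have h2 := one_le_ss hε (t := t) (by linarith [ht.2])
      have h3 := h.f_ge t ht'
      have h4 : c / 4 ≤ P t := by linarith
      have h5 : 1 * (c / 4 * c) ≤ ss ε t * (P t * f t) :=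
        mul_le_mul h2 (mul_le_mul h4 h3 hc.le (by linarith)) (by positivity) (by linarith)
      exact pow_le_pow_left₀ (by positivity) h5 2)
  rw [setIntegral_univ] at this
  linarith

theorem le_setIntegral_phi (hp : 1 < p) (hp5 : p < 5) (hε : 0 < ε) (hε1 : ε ≤ 1 / 100) (hc : 0 < c)
    (hc1 : c ≤ 1) (h : Ctrl p ε R c C f P T) {S : Set ℝ} (hS : S = Set.Ioi 0 ∨ S = Set.Iic 0) :
    c ^ 4 ≤ ∫ t in S, QQ ε R t * Ctrl.gg p f t * (ch ε t * f t) := by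
  have cf := Ctrl.contf h.toProfile
  have cg := Ctrl.contgg h.toProfile
  have c0 := cont_ch ε
  have hi : Integrable fun t => QQ ε R t * Ctrl.gg p f t * (ch ε t * f t) :=
    Continuous.integrable_of_deriv_zero (by fun_prop) (hasCompactSupport_ch hε)
      (by intro t h1 _; simp [h1])
  have h0 : ∀ t, 0 ≤ QQ ε R t * Ctrl.gg p f t * (ch ε t * f t) := fun t =>
    mul_nonneg (mul_nonneg (zero_le_one.trans (Ctrl.one_le_QQ h.R_pos t))
      (Ctrl.gg_pos h.toProfile t).le) (mul_nonneg (bump_nonneg _) (h.f_pos t).le)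
  have key : ∀ t, |t| ≤ 2 → c ^ 4 ≤ QQ ε R t * Ctrl.gg p f t * (ch ε t * f t) := fun t ht => by
    rw [ch_eq_one hε hε1 ht, one_mul]
    have h1 := Ctrl.one_le_QQ (ε := ε) h.R_pos t
    calc c ^ 4 = 1 * c ^ 3 * c := by ring
      _ ≤ _ := mul_le_mul (mul_le_mul h1 (gg_ge hp hp5 hc hc1 h ht) (by positivity) (by linarith))
        (h.f_ge t ht) hc.le (mul_nonneg (by linarith) (Ctrl.gg_pos h.toProfile t).le)
  rcases hS with rfl | rfl
  · have := mul_le_setIntegral (S := Set.Ioi 0) (a := 1) (b := 2) (m := c ^ 4) measurableSet_Ioi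
        hi.integrableOn
      (fun t _ => h0 t) (by norm_num) (fun t ht => by simp only [Set.mem_Ioi]; linarith [ht.1])
      (fun t ht => key t (abs_le.2 ⟨by linarith [ht.1], ht.2⟩))
    linarith
  · have := mul_le_setIntegral (S := Set.Iic 0) (a := -2) (b := -1) (m := c ^ 4) measurableSet_Iic
        hi.integrableOn
      (fun t _ => h0 t) (by norm_num) (fun t ht => by simp only [Set.mem_Iic]; linarith [ht.2])
      (fun t ht => key t (abs_le.2 ⟨ht.1, by linarith [ht.2]⟩))
    linarith

theorem setIntegral_Z_right (hp : 1 < p) (hp5 : p < 5) (hε : 0 < ε) (hε1 : ε ≤ 1 / 100)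
    (hc : 0 < c) (hc1 : c ≤ 1) (h : Ctrl p ε R c C f P T) :
    ∫ t in Set.Ioi 0, QQ ε R t * Ctrl.gg p f t * (ch ε t * Zf ε f P t) ≤ -(c ^ 5 / 4) := by
  have cZ := contZf h.toProfile
  have cg := Ctrl.contgg h.toProfile
  have c0 := cont_ch ε
  have hi : Integrable fun t => -(QQ ε R t * Ctrl.gg p f t * (ch ε t * Zf ε f P t)) :=
    Continuous.integrable_of_deriv_zero (by fun_prop) (hasCompactSupport_ch hε)
      (by intro t h1 _; simp [h1])
  have hP : ∀ {t}, 0 < t → c * (t / (1 + t)) ≤ -P t := fun {t} ht => by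
    linarith [h.P_right t ht.le]
  have := mul_le_setIntegral (S := Set.Ioi 0) (a := 1) (b := 2)
      (m := 1 * c ^ 3 * (1 / 2 * (c / 2 * c)))
    measurableSet_Ioi hi.integrableOn (fun t ht => by
      have ht : 0 < t := ht
      have h1 := hP ht
      have h2 : 0 ≤ c * (t / (1 + t)) := by positivity
      have h3 := mul_nonneg (mul_nonneg (zero_le_one.trans (Ctrl.one_le_QQ (ε := ε) h.R_pos t))
        (Ctrl.gg_pos h.toProfile t).le) (mul_nonneg (bump_nonneg (ε ^ 2 * t))
          (mul_nonneg (exp_pos (-(ε * t))).le (mul_nonneg (h2.trans h1) (h.f_pos t).le)))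
      refine h3.trans_eq ?_
      simp only [Zf, ss, ch]; ring) (by norm_num)
    (fun t ht => by simp only [Set.mem_Ioi]; linarith [ht.1]) (fun t ht => by
      have ht' : |t| ≤ 2 := abs_le.2 ⟨by linarith [ht.1], ht.2⟩
      rw [ch_eq_one hε hε1 ht']
      have h1 := Ctrl.one_le_QQ (ε := ε) h.R_pos t
      have h2 : 1 / 2 ≤ t / (1 + t) := by
        rw [div_le_div_iff₀ two_pos (by linarith [ht.1])]; linarith [ht.1]
      have h3 : c / 2 ≤ -P t := by nlinarith [hP (t := t) (by linarith [ht.1])]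
      have h4 := half_le_ss hε1 hε ht.2
      have h5 := h.f_ge t ht'
      have h6 : 1 * c ^ 3 * (1 / 2 * (c / 2 * c)) ≤
          QQ ε R t * Ctrl.gg p f t * (ss ε t * (-P t * f t)) :=
        mul_le_mul (mul_le_mul h1 (gg_ge hp hp5 hc hc1 h ht') (by positivity) (by linarith))
          (mul_le_mul h4 (mul_le_mul h3 h5 hc.le (by linarith)) (by positivity) (by linarith))
          (by positivity) (mul_nonneg (by linarith) (Ctrl.gg_pos h.toProfile t).le)
      refine h6.trans_eq ?_
      simp only [Zf]; ring)
  rw [integral_neg] at this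
  linarith

theorem setIntegral_Z_left (hp : 1 < p) (hp5 : p < 5) (hε : 0 < ε) (hε1 : ε ≤ 1 / 100)
    (hc : 0 < c) (hc1 : c ≤ 1) (h : Ctrl p ε R c C f P T) (hA : Atoms p ε R η M f P T) :
    c ^ 5 / 2 - ε * (M ^ 5 * (2 / η)) ≤
      ∫ t in Set.Iic 0, QQ ε R t * Ctrl.gg p f t * (ch ε t * Zf ε f P t) := by
  have cf := Ctrl.contf h.toProfile
  have cP := Ctrl.contP h.toProfile
  have cg := Ctrl.contgg h.toProfile
  have c0 := cont_ch ε
  have cs := cont_ss (ε := ε)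
  set e : ℝ → ℝ := fun t => QQ ε R t * Ctrl.gg p f t * (ch ε t * (ss ε t * f t)) with he
  have be : ExpBound η (M ^ 5) (-1) e :=
    ((hA.bQ.mul (bgg hp hp5 h.f_pos hA)).mul (hA.b0.mul (hA.bs.mul hA.bf))).mono hA.η_pos.le
      (by linarith) (by norm_num)
  have hi : Integrable fun t =>
      QQ ε R t * Ctrl.gg p f t * (ch ε t * (ss ε t * ((P t + ε) * f t))) :=
    Continuous.integrable_of_deriv_zero (by fun_prop) (hasCompactSupport_ch hε)
      (by intro t h1 _; simp [h1])
  have hi' : Integrable fun t => ε * e t :=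
    Continuous.integrable_of_deriv_zero (by fun_prop) (hasCompactSupport_ch hε)
      (by intro t h1 _; simp [he, h1])
  have := mul_le_setIntegral (S := Set.Iic 0) (a := -2) (b := -1)
      (m := 1 * c ^ 3 * (1 * (c / 2 * c)))
    measurableSet_Iic hi.integrableOn (fun t ht => by
      have h1 := Ctrl.le_P_eps hc h ht
      exact mul_nonneg (mul_nonneg (zero_le_one.trans (Ctrl.one_le_QQ (ε := ε) h.R_pos t))
        (Ctrl.gg_pos h.toProfile t).le) (mul_nonneg (bump_nonneg (ε ^ 2 * t))
          (mul_nonneg (exp_pos (-(ε * t))).le (mul_nonneg (by linarith) (h.f_pos t).le))))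
    (by norm_num)
    (fun t ht => by simp only [Set.mem_Iic]; linarith [ht.2]) (fun t ht => by
      have ht' : |t| ≤ 2 := abs_le.2 ⟨ht.1, by linarith [ht.2]⟩
      rw [ch_eq_one hε hε1 ht']
      have h1 := Ctrl.one_le_QQ (ε := ε) h.R_pos t
      have h3 := le_P_add hc h ht.2
      have h4 := one_le_ss hε (t := t) (by linarith [ht.2])
      have h5 := h.f_ge t ht'
      have h6 : 1 * c ^ 3 * (1 * (c / 2 * c)) ≤
          QQ ε R t * Ctrl.gg p f t * (ss ε t * ((P t + ε) * f t)) :=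
        mul_le_mul (mul_le_mul h1 (gg_ge hp hp5 hc hc1 h ht') (by positivity) (by linarith))
          (mul_le_mul h4 (mul_le_mul h3 h5 hc.le (by linarith)) (by positivity) (by linarith))
          (by positivity) (mul_nonneg (by linarith) (Ctrl.gg_pos h.toProfile t).le)
      rwa [one_mul (ss ε t * _)])
  have h2 := be.abs_setIntegral_le hA.η_pos le_rfl (Set.Iic 0)
  have h3 : ∫ t in Set.Iic 0, QQ ε R t * Ctrl.gg p f t * (ch ε t * Zf ε f P t)
      = (∫ t in Set.Iic 0, QQ ε R t * Ctrl.gg p f t * (ch ε t * (ss ε t * ((P t + ε) * f t))))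
        - ∫ t in Set.Iic 0, ε * e t := by
    rw [← integral_sub hi.integrableOn hi'.integrableOn]
    refine integral_congr_ae (Eventually.of_forall fun t => ?_)
    simp only [he, Zf]; ring
  rw [h3, integral_const_mul]
  have := mul_le_mul_of_nonneg_left (abs_le.1 h2).2 hε.le
  linarith

end Special

namespace Special

variable {p ε R η M c C : ℝ} {f P T : ℝ → ℝ}

theorem contrphi (hP : Profile p ε R f P T) : Continuous (rphi ε f P) := by
  have := Ctrl.contf hP
  have := Ctrl.contP hP
  have := cont_ch1 ε
  have := cont_ch2 ε
  unfold rphi; fun_prop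

theorem contrZf (hP : Profile p ε R f P T) : Continuous (rZf ε R f P T) := by
  have := Ctrl.contf hP
  have := contZf hP
  have := contZf' hP
  have := cont_ch ε
  have := cont_ch1 ε
  have := cont_ch2 ε
  have := cont_uu (ε := ε)
  unfold rZf; fun_prop

theorem contrAf (hp : 1 < p) (hε : 0 < ε) (hP : Profile p ε R f P T) :
    Continuous (rAf p ε R f P T) := by
  have := Ctrl.contf hP
  have := contZf hP
  have := contAf hε.ne' hP
  have := contAf' hp hε.ne' hP
  have := cont_ch ε
  have := cont_ch1 ε
  have := cont_ch2 ε
  have := cont_uu (ε := ε)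
  have := cont_vv (ε := ε)
  unfold rAf; fun_prop

theorem eventually_mul_le (K : ℝ) {δ : ℝ} (hδ : 0 < δ) :
    ∀ᶠ ε in nhdsWithin (0:ℝ) (Set.Ioi 0), K * ε ≤ δ := by
  have : Tendsto (fun ε : ℝ => K * ε) (nhds 0) (nhds (K * 0)) := (continuous_const_mul K).tendsto 0
  rw [mul_zero] at this
  exact (this.eventually (eventually_le_nhds hδ)).filter_mono nhdsWithin_le_nhds

theorem exists_frame (hp : 1 < p) (hp5 : p < 5) :
    ∃ c > 0, ∃ M : ℝ, ∀ᶠ ε in nhdsWithin (0:ℝ) (Set.Ioi 0), ∀ (R : ℝ) (f P T : ℝ → ℝ),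
      Profile p ε R f P T → P 0 = -(Profile.th p * ε / 2) → f 0 = 1 →
      Nonempty (Frame p ε R c M T) := by
  obtain ⟨ε₀, hε₀, c, hc, C, hC0, hε₁, hc1, hC, hctrl⟩ := Profile.exists_ctrl hp hp5
  obtain ⟨M, hM⟩ := exists_atoms hp hc hC
  set η := c / 8 with hη
  have hη0 : 0 < η := by positivity
  have hka := Ctrl.ka_pos hp
  have hde := Ctrl.de_pos hp
  set k1 := 2 / (p - 1) - 1 / 2 with hk1
  have hk1' : 0 < k1 := by
    rw [hk1, sub_pos, div_lt_div_iff₀ two_pos (by linarith)]; linarith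
  set k2 := 2 / (p - 1) - 2 / (p + 3) with hk2
  have hk2' : 0 < k2 := by
    rw [hk2, sub_pos, div_lt_div_iff₀ (by linarith) (by linarith)]; linarith
  set c' := min (min (min c (4 * c ^ 2)) (min (c ^ 4 / 16) (k1 * (2 * c ^ 2))))
    (min (Ctrl.ka p ^ 2 / 40) (Ctrl.de p / 4)) with hc'
  have hc'0 : 0 < c' := by
    rw [hc']; repeat' apply lt_min
    all_goals positivity
  refine ⟨c', hc'0, 13 * M ^ 4 * (1 + 2 / η), ?_⟩
  filter_upwards [self_mem_nhdsWithin, eventually_mul_le 1 hε₀, eventually_mul_le 1 hη0,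
    eventually_mul_le (2 * M ^ 4 * (2 / η)) (by positivity : 0 < k1 * (2 * c ^ 2)),
    eventually_mul_le (4 * M ^ 7 * (2 / η)) (by positivity : 0 < k2 * c ^ 4 / 2),
    eventually_mul_le (M ^ 5 * (2 / η)) (by positivity : 0 < c ^ 5 / 4),
    eventually_mul_le (((p - 1) / 2 + 20) * C) (by positivity : 0 < Ctrl.ka p / 100),
    eventually_mul_le ((Ctrl.E0 p + Ctrl.de p + (p + 3) / 2 + 1 + (p - 1) / 2) * C)
      (by positivity : 0 < Ctrl.de p / 4)] with ε hε s1 s2 s3 s4 s5 s6 s7 R f P T hP hP0 hf0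
  replace hε : 0 < ε := hε
  rw [one_mul] at s1 s2
  have h := hctrl hε s1 hP hP0 hf0
  have hε100 : ε ≤ 1 / 100 := s1.trans hε₁
  have hε1 : ε ≤ 1 := by linarith
  have a := hM hε hε1 s2 h
  have hM1 := a.one_le
  have hs : Ctrl.Small p C ε := by rw [Ctrl.Small, ← mul_assoc]; exact s6
  have hs' : Ctrl.Small' p C ε := ⟨by rw [← mul_assoc]; exact s7, hε1⟩
  have cf := Ctrl.contf hP
  have cT := Ctrl.contT hP
  have cZ := contZf hP
  have cA := contAf hε.ne' hP
  have c0 := cont_ch ε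
  have c00 : Continuous fun t : ℝ => exp (2 * ε * t) - 1 := by fun_prop
  have hL : 0 < 1 + 2 / η := by positivity
  have hL1 : 2 / η ≤ 1 + 2 / η := by linarith
  have hR := h.R_pos
  have m34 : M ^ 3 ≤ M ^ 4 := pow_le_pow_right₀ hM1 (by norm_num)
  have m24 : M ^ 2 ≤ M ^ 4 := pow_le_pow_right₀ hM1 (by norm_num)
  have m14 : M ≤ M ^ 4 := le_self_pow₀ hM1 (by norm_num)
  have m0 : 0 < M ^ 4 := by positivity
  have bd : ∀ {K k K' : ℝ} {g : ℝ → ℝ}, ExpBound η K k g → k ≤ -1 → Continuous g →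
      K ≤ 13 * M ^ 4 * K' → ∀ a : ℝ → ℝ, Continuous a → HasCompactSupport a →
      |∫ t, g t * a t| ≤ 13 * M ^ 4 * (1 + 2 / η) * K' * nQ ε R a := by
    intro K k K' g hg hk cg hK a ca sa
    refine (hg.abs_integral_mul_le (ε := ε) hη0 hR hk cg ca sa).trans ?_
    refine mul_le_mul_of_nonneg_right ?_ (nQ_nonneg _ _ _)
    have := mul_le_mul_of_nonneg_right hK hL.le
    linarith
  have bd1 : ∀ {K k : ℝ} {g : ℝ → ℝ}, ExpBound η K k g → k ≤ -1 → Continuous g →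
      K ≤ 13 * M ^ 4 → ∀ a : ℝ → ℝ, Continuous a → HasCompactSupport a →
      |∫ t, g t * a t| ≤ 13 * M ^ 4 * (1 + 2 / η) * nQ ε R a := by
    intro K k g hg hk cg hK a ca sa
    have := bd (K' := 1) hg hk cg (by linarith) a ca sa
    rwa [mul_one] at this
  have bN : ∀ {K : ℝ} {ψ : ℝ → ℝ}, ExpBound η K (-4) ψ → M * K ≤ 13 * M ^ 4 →
      nQ ε R ψ ≤ 13 * M ^ 4 * (1 + 2 / η) := fun hψ hK =>
    (nQ_le a hψ).trans (mul_le_mul_of_nonneg_right hK hL.le)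
  have bφ := (a.b0.mul a.bf).mono (l := -4) hη0.le le_rfl (by norm_num)
  have bZ := (a.b0.mul (bZf a)).mono (l := -4) hη0.le le_rfl (by norm_num)
  have bA := (a.b0.mul (bAf hp a)).mono (l := -4) hη0.le le_rfl (by norm_num)
  have hε2 : ε * M ^ 2 ≤ ε * M ^ 4 := by gcongr
  have hε3 : ε * M ^ 3 ≤ ε * M ^ 4 := by gcongr
  have hεε : ε ^ 2 * M ^ 3 ≤ ε ^ 2 * M ^ 4 := by gcongr
  have hε4 : 0 < ε * M ^ 4 := by positivity
  have hεε4 : 0 < ε ^ 2 * M ^ 4 := by positivity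
  have hM' : M ≤ 13 * M ^ 4 * (1 + 2 / η) := by
    calc M ≤ 13 * M ^ 4 * 1 := by linarith
      _ ≤ _ := by gcongr; linarith [div_pos two_pos hη0]
  have hφφ := le_integral_phi_sq hε hε100 hc h
  refine ⟨{
    φ := fun t => ch ε t * f t
    Z := fun t => ch ε t * Zf ε f P t
    A := fun t => ch ε t * Af p ε f P t
    rφ := rphi ε f P
    rZ := rZf ε R f P T
    rA := rAf p ε R f P T
    g := Ctrl.gg p f
    ε_pos := hε
    c_pos := hc'0
    one_le_M := hM1.trans hM'
    R_lb := ((min_le_left _ _).trans ((min_le_left _ _).trans (min_le_left _ _))).trans h.R_lb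
    R_ub := a.hR.trans hM'
    contT := cT
    T_nonneg := fun t => (h.T_pos t).le
    T_le := fun t => (a.T_le t).trans
      (mul_le_mul_of_nonneg_right hM' (zero_le_one.trans (Ctrl.one_le_QQ hR t)))
    dφ := (contDiff_cutoff hP.hf (by have := Ctrl.contP hP; fun_prop)).1
    dZ := (contDiff_cutoff (hasDerivAt_Zf hP) (contZf' hP)).1
    dA := (contDiff_cutoff (hasDerivAt_Af hε.ne' hP) (contAf' hp hε.ne' hP)).1
    sφ := hasCompactSupport_cut hε _
    sZ := hasCompactSupport_cut hε _
    sA := hasCompactSupport_cut hε _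
    crφ := contrphi hP
    crZ := contrZf hP
    crA := contrAf hp hε hP
    cg := Ctrl.contgg hP
    wφ := fun a ha sa => weak_phi hP ha sa
    wZ := fun a ha sa => weak_Z hε.ne' hP ha sa
    wA := fun a ha sa => weak_A hp hε.ne' hP ha sa
    bφ := bd1 bφ (by norm_num) (by fun_prop) (by linarith)
    bZ := bd1 bZ (by norm_num) (by fun_prop) (by linarith)
    bA := bd1 bA (by norm_num) (by fun_prop) (by linarith)
    brφ := fun b cb sb => ?_
    brZ := fun b cb sb => ?_
    brA := fun b cb sb => ?_
    vφ := fun b cb sb => ?_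
    vZ := fun b cb sb => ?_
    vA := fun b cb sb => ?_
    nφ := bN bφ (by linarith)
    nZ := bN bZ (by linarith)
    nA := bN bA (by linarith)
    φ_zero := by rw [ch_eq_one hε hε100 (by norm_num), hf0, one_mul]
    iφφ := ((min_le_left _ _).trans ((min_le_left _ _).trans (min_le_right _ _))).trans hφφ
    iZZ := ((min_le_left _ _).trans ((min_le_right _ _).trans (min_le_left _ _))).trans
      (le_integral_Z_sq hε hε100 hc (by linarith) h)
    iφA := ((min_le_left _ _).trans ((min_le_right _ _).trans (min_le_right _ _))).trans ?_
    iφZ := (abs_integral_phi_Z hε hε1 hP a).trans ?_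
    lA := ?_
    lA' := ?_
    lZ := ?_
    lZ' := ?_
    coercive_minus := fun v hv sv hv0 => ?_
    coercive_plus := fun v hv sv h1 h2 => ?_ }⟩
  · exact bd (brphi a) le_rfl (contrphi hP) (by linarith) b cb sb
  · exact bd (brZ hε hε1 a) le_rfl (contrZf hP) (by linarith) b cb sb
  · exact bd (brA hp hR hε hε1 a) le_rfl (contrAf hp hε hP) le_rfl b cb sb
  · simpa only [mul_assoc] using
      bd (a.bv.mul bφ) (by norm_num) (by fun_prop) (K' := ε) (by linarith) b cb sb
  · simpa only [mul_assoc] using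
      bd (a.bv.mul bZ) (by norm_num) (by fun_prop) (K' := ε) (by linarith) b cb sb
  · simpa only [mul_assoc] using
      bd (a.bv.mul bA) (by norm_num) (by fun_prop) (K' := ε) (by linarith) b cb sb
  · have := integral_phi_A hp hε hε1 hP a
    rw [← hk1] at this
    have h2 := mul_le_mul_of_nonneg_left hφφ hk1'.le
    linarith
  · have : 2 * M ^ 3 * (2 / η) ≤ 13 * M ^ 4 * (1 + 2 / η) :=
      mul_le_mul (by linarith) hL1 (by positivity) (by positivity)
    nlinarith
  · have h1 := setIntegral_A hp hp5 hε hε1 hP a (Or.inl rfl)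
    have h2 := mul_le_mul_of_nonneg_left
      (le_setIntegral_phi hp hp5 hε hε100 hc hc1 h (Or.inl rfl)) hk2'.le
    have h3 : 0 < k2 * c ^ 4 := by positivity
    linarith
  · have h1 := setIntegral_A hp hp5 hε hε1 hP a (Or.inr rfl)
    have h2 := mul_le_mul_of_nonneg_left
      (le_setIntegral_phi hp hp5 hε hε100 hc hc1 h (Or.inr rfl)) hk2'.le
    have h3 : 0 < k2 * c ^ 4 := by positivity
    linarith
  · have := setIntegral_Z_right hp hp5 hε hε100 hc hc1 h
    have h3 : 0 < c ^ 5 := by positivity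
    linarith
  · have := setIntegral_Z_left hp hp5 hε hε100 hc hc1 h a
    have h3 : 0 < c ^ 5 := by positivity
    linarith
  · rw [nQ_sq hR, ← Ctrl.form_minus_eq hP hv sv]
    refine le_trans ?_ (Ctrl.hardy hp hε hc hC hs h hv sv hv0)
    exact mul_le_mul_of_nonneg_right ((min_le_right _ _).trans (min_le_left _ _))
      (integral_nonneg fun t => mul_nonneg (zero_le_one.trans (Ctrl.one_le_QQ hR t)) (sq_nonneg _))
  · rw [nQ_sq hR]
    refine le_trans ?_ (Ctrl.coercive_plus hp hε hc hC hs hs' h hv sv h1 h2)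
    exact mul_le_mul_of_nonneg_right ((min_le_right _ _).trans (min_le_right _ _))
      (integral_nonneg fun t => mul_nonneg (zero_le_one.trans (Ctrl.one_le_QQ hR t)) (sq_nonneg _))

end Special

/-- Continuously differentiable functions of compact support on the line. -/
def testSubmodule (𝕜 : Type*) [RCLike 𝕜] : Submodule 𝕜 (ℝ → 𝕜) where
  carrier := {a | ContDiff ℝ 1 a ∧ HasCompactSupport a}
  add_mem' ha hb := ⟨ha.1.add hb.1, ha.2.add hb.2⟩
  zero_mem' := ⟨contDiff_const, HasCompactSupport.zero⟩
  smul_mem' k _ ha := ⟨contDiff_const.smul ha.1, ha.2.smul_left (f := fun _ => k)⟩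

/-- The type of test functions. -/
abbrev Test (𝕜 : Type*) [RCLike 𝕜] : Type _ := testSubmodule 𝕜

namespace Test

variable {𝕜 : Type*} [RCLike 𝕜]

instance : CoeFun (Test 𝕜) fun _ => ℝ → 𝕜 := ⟨Subtype.val⟩

theorem contDiff (a : Test 𝕜) : ContDiff ℝ 1 a := a.2.1

theorem supp (a : Test 𝕜) : HasCompactSupport a := a.2.2

theorem continuous (a : Test 𝕜) : Continuous a := a.contDiff.continuous

theorem continuous_deriv (a : Test 𝕜) : Continuous (deriv a) := a.contDiff.continuous_deriv le_rfl

theorem differentiableAt (a : Test 𝕜) (t : ℝ) : DifferentiableAt ℝ a t :=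
  a.contDiff.differentiable one_ne_zero t

theorem deriv_add (a b : Test 𝕜) (t : ℝ) : deriv (a + b : Test 𝕜) t = deriv a t + deriv b t :=
  _root_.deriv_add (a.differentiableAt t) (b.differentiableAt t)

theorem deriv_smul (k : 𝕜) (a : Test 𝕜) (t : ℝ) : deriv (k • a : Test 𝕜) t = k * deriv a t := by
  have : ((k • a : Test 𝕜) : ℝ → 𝕜) = fun t => k * a t := rfl
  rw [this, deriv_const_mul _ (a.differentiableAt t)]

theorem integrable_of (a : Test 𝕜) {g : ℝ → 𝕜} (hg : Continuous g)
    (h0 : ∀ t, a t = 0 → deriv a t = 0 → g t = 0) : Integrable g :=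
  hg.integrable_of_deriv_zero a.supp h0

theorem integrable_dir (a b : Test 𝕜) : Integrable fun t => conj (deriv a t) * deriv b t :=
  a.integrable_of ((RCLike.continuous_conj.comp a.continuous_deriv).mul b.continuous_deriv)
    (by intro t _ h; simp [h])

theorem integrable_wt (W : C(ℝ, ℝ)) (a b : Test 𝕜) :
    Integrable fun t => (W t : 𝕜) * (conj (a t) * b t) :=
  a.integrable_of ((RCLike.continuous_ofReal.comp W.continuous).mul
    ((RCLike.continuous_conj.comp a.continuous).mul b.continuous)) (by intro t h _; simp [h])

/-- The Dirichlet form. -/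
noncomputable def dir : Test 𝕜 →ₗ⋆[𝕜] Test 𝕜 →ₗ[𝕜] 𝕜 :=
  LinearMap.mk₂'ₛₗ _ _ (fun a b => ∫ t, conj (deriv a t) * deriv b t)
    (fun a b c => by
      rw [← integral_add (integrable_dir a c) (integrable_dir b c)]
      simp only [deriv_add, map_add, add_mul])
    (fun k a b => by
      rw [smul_eq_mul, ← integral_const_mul]
      simp only [deriv_smul, map_mul, mul_assoc])
    (fun a b c => by
      rw [← integral_add (integrable_dir a b) (integrable_dir a c)]
      simp only [deriv_add, mul_add])
    (fun k a b => by
      rw [smul_eq_mul, ← integral_const_mul]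
      simp only [deriv_smul, mul_left_comm, RingHom.id_apply])

/-- The weighted mass form. -/
noncomputable def wt (W : C(ℝ, ℝ)) : Test 𝕜 →ₗ⋆[𝕜] Test 𝕜 →ₗ[𝕜] 𝕜 :=
  LinearMap.mk₂'ₛₗ _ _ (fun a b => ∫ t, (W t : 𝕜) * (conj (a t) * b t))
    (fun a b c => by
      rw [← integral_add (integrable_wt W a c) (integrable_wt W b c)]
      simp only [Submodule.coe_add, Pi.add_apply, map_add, add_mul, mul_add])
    (fun k a b => by
      rw [smul_eq_mul, ← integral_const_mul]
      refine integral_congr_ae (Eventually.of_forall fun t => ?_)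
      simp only [Submodule.coe_smul, Pi.smul_apply, smul_eq_mul, map_mul]; ring)
    (fun a b c => by
      rw [← integral_add (integrable_wt W a b) (integrable_wt W a c)]
      simp only [Submodule.coe_add, Pi.add_apply, mul_add])
    (fun k a b => by
      rw [smul_eq_mul, ← integral_const_mul]
      refine integral_congr_ae (Eventually.of_forall fun t => ?_)
      simp only [Submodule.coe_smul, Pi.smul_apply, smul_eq_mul, RingHom.id_apply]; ring)

/-- Integration against a continuous function. -/
noncomputable def lin (g : C(ℝ, ℝ)) : Test 𝕜 →ₗ[𝕜] 𝕜 where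
  toFun a := ∫ t, (g t : 𝕜) * a t
  map_add' a b := by
    have := a.continuous; have := b.continuous
    rw [← integral_add (a.integrable_of (by fun_prop) (by intro t h _; simp [h]))
      (b.integrable_of (by fun_prop) (by intro t h _; simp [h]))]
    simp only [Submodule.coe_add, Pi.add_apply, mul_add]
  map_smul' k a := by
    rw [RingHom.id_apply, smul_eq_mul, ← integral_const_mul]
    refine integral_congr_ae (Eventually.of_forall fun t => ?_)
    simp only [Submodule.coe_smul, Pi.smul_apply, smul_eq_mul]; ring

theorem dir_apply (a b : Test 𝕜) : dir a b = ∫ t, conj (deriv a t) * deriv b t := rfl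

theorem wt_apply (W : C(ℝ, ℝ)) (a b : Test 𝕜) :
    wt W a b = ∫ t, (W t : 𝕜) * (conj (a t) * b t) := rfl

theorem lin_apply (g : C(ℝ, ℝ)) (a : Test 𝕜) : lin g a = ∫ t, (g t : 𝕜) * a t := rfl

theorem wt_add (W V : C(ℝ, ℝ)) (a b : Test 𝕜) : wt (W + V) a b = wt W a b + wt V a b := by
  simp only [wt_apply]
  rw [← integral_add (integrable_wt W a b) (integrable_wt V a b)]
  simp only [ContinuousMap.add_apply, RCLike.ofReal_add, add_mul]

theorem conj_dir (a b : Test 𝕜) : conj (dir a b) = dir b a := by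
  simp only [dir_apply]
  rw [← integral_conj]
  simp only [map_mul, RCLike.conj_conj, mul_comm]

theorem conj_wt (W : C(ℝ, ℝ)) (a b : Test 𝕜) : conj (wt W a b) = wt W b a := by
  simp only [wt_apply]
  rw [← integral_conj]
  refine integral_congr_ae (Eventually.of_forall fun t => ?_)
  simp only [map_mul, RCLike.conj_conj, RCLike.conj_ofReal]; ring

/-- Real part of a complex test function. -/
noncomputable def reT (a : Test ℂ) : Test ℝ :=
  ⟨fun t => (a t).re, Complex.reCLM.contDiff.comp a.contDiff, a.supp.comp_left (g := Complex.re)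
    rfl⟩

/-- Imaginary part of a complex test function. -/
noncomputable def imT (a : Test ℂ) : Test ℝ :=
  ⟨fun t => (a t).im, Complex.imCLM.contDiff.comp a.contDiff, a.supp.comp_left (g := Complex.im)
    rfl⟩

/-- A real test function seen as a complex one. -/
noncomputable def ofR (a : Test ℝ) : Test ℂ :=
  ⟨fun t => (a t : ℂ), Complex.ofRealCLM.contDiff.comp a.contDiff,
    a.supp.comp_left (g := Complex.ofReal) rfl⟩

theorem deriv_reT (a : Test ℂ) (t : ℝ) : deriv (reT a) t = (deriv a t).re :=
  (Complex.reCLM.hasFDerivAt.comp_hasDerivAt t (a.differentiableAt t).hasDerivAt).deriv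

theorem deriv_imT (a : Test ℂ) (t : ℝ) : deriv (imT a) t = (deriv a t).im :=
  (Complex.imCLM.hasFDerivAt.comp_hasDerivAt t (a.differentiableAt t).hasDerivAt).deriv

theorem deriv_ofR (a : Test ℝ) (t : ℝ) : deriv (ofR a) t = ((deriv (a : ℝ → ℝ) t : ℝ) : ℂ) :=
  (a.differentiableAt t).hasDerivAt.ofReal_comp.deriv

theorem re_dir (a : Test ℂ) : (dir a a).re = dir (reT a) (reT a) + dir (imT a) (imT a) := by
  simp only [dir_apply]
  rw [← integral_add (integrable_dir _ _) (integrable_dir _ _), ← RCLike.re_eq_complex_re,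
    ← integral_re (integrable_dir a a)]
  refine integral_congr_ae (Eventually.of_forall fun t => ?_)
  simp [deriv_reT, deriv_imT]

theorem re_wt (W : C(ℝ, ℝ)) (a b : Test ℂ) :
    (wt W a b).re = wt W (reT a) (reT b) + wt W (imT a) (imT b) := by
  simp only [wt_apply]
  rw [← integral_add (integrable_wt _ _ _) (integrable_wt _ _ _), ← RCLike.re_eq_complex_re,
    ← integral_re (integrable_wt W a b)]
  refine integral_congr_ae (Eventually.of_forall fun t => ?_)
  simp [reT, imT]; ring

theorem re_lin (g : C(ℝ, ℝ)) (a : Test ℂ) : (lin g a).re = lin g (reT a) := by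
  have := a.continuous
  simp only [lin_apply]
  rw [← RCLike.re_eq_complex_re,
    ← integral_re (a.integrable_of (by fun_prop) (by intro t h _; simp [h]))]
  refine integral_congr_ae (Eventually.of_forall fun t => ?_)
  simp [reT]

theorem im_lin (g : C(ℝ, ℝ)) (a : Test ℂ) : (lin g a).im = lin g (imT a) := by
  have := a.continuous
  simp only [lin_apply]
  rw [← RCLike.im_eq_complex_im,
    ← integral_im (a.integrable_of (by fun_prop) (by intro t h _; simp [h]))]
  refine integral_congr_ae (Eventually.of_forall fun t => ?_)
  simp [imT]

end Test

namespace Test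

theorem dir_real (a b : Test ℝ) : dir a b = ∫ t, deriv a t * deriv b t := by
  simp [dir_apply]

theorem wt_real (W : C(ℝ, ℝ)) (a b : Test ℝ) : wt W a b = ∫ t, W t * a t * b t := by
  simp [wt_apply, mul_assoc]

theorem lin_real (g : C(ℝ, ℝ)) (a : Test ℝ) : lin g a = ∫ t, g t * a t := by
  simp [lin_apply]

theorem dir_comm (a b : Test ℝ) : dir a b = dir b a := by
  simp only [dir_real, mul_comm]

theorem wt_comm (W : C(ℝ, ℝ)) (a b : Test ℝ) : wt W a b = wt W b a := by
  simp only [wt_real, mul_assoc, mul_comm (a _)]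

theorem integrable_real (a : Test ℝ) {g : ℝ → ℝ} (hg : Continuous g) (h0 : ∀ t, a t = 0 → g t = 0) :
    Integrable g :=
  a.integrable_of hg fun t h _ => h0 t h

theorem nQ_sq_eq {ε R : ℝ} (hR : 0 < R) (W : C(ℝ, ℝ)) (hW : ∀ t, W t = QQ ε R t) (a : Test ℝ) :
    nQ ε R a ^ 2 = wt W a a := by
  rw [nQ_sq hR, wt_real]
  simp only [hW, sq, mul_assoc]

theorem abs_wt_le {ε R : ℝ} (hR : 0 < R) {W : C(ℝ, ℝ)} {K : ℝ} (hK : 0 ≤ K)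
    (hW : ∀ t, |W t| ≤ K * QQ ε R t) (a b : Test ℝ) :
    |wt W a b| ≤ K * (nQ ε R a * nQ ε R b) := by
  have ca := a.continuous; have cb := b.continuous
  have hQ : ∀ t, 0 ≤ QQ ε R t := fun t => zero_le_one.trans (Ctrl.one_le_QQ hR t)
  have cQ : Continuous (QQ ε R) := by unfold QQ; fun_prop
  have hs : ∀ t, √(QQ ε R t) ^ 2 = QQ ε R t := fun t => sq_sqrt (hQ t)
  rw [wt_real]
  have h1 : |∫ t, W t * a t * b t| ≤ ∫ t, K * ((√(QQ ε R t) * |a t|) * (√(QQ ε R t) * |b t|)) := by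
    have cg : Continuous fun t => K * ((√(QQ ε R t) * |a t|) * (√(QQ ε R t) * |b t|)) := by
      fun_prop
    refine norm_integral_le_of_norm_le (f := fun t => W t * a t * b t)
      (a.integrable_real cg (by intro t h; simp [h])) (Eventually.of_forall fun t => ?_)
    rw [norm_eq_abs, abs_mul, abs_mul]
    have := mul_le_mul_of_nonneg_right (hW t) (mul_nonneg (abs_nonneg (a t)) (abs_nonneg (b t)))
    rw [← hs t] at this
    linarith
  refine h1.trans ?_
  rw [integral_const_mul]
  have h2 := abs_integral_mul_le_sqrt (u := fun t => √(QQ ε R t) * |a t|)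
    (v := fun t => √(QQ ε R t) * |b t|)
    (a.integrable_real (by fun_prop) (by intro t h; simp [h]))
    (b.integrable_real (by fun_prop) (by intro t h; simp [h]))
    (a.integrable_real (by fun_prop) (by intro t h; simp [h]))
  simp only [mul_pow, hs, sq_abs] at h2
  exact mul_le_mul_of_nonneg_left ((le_abs_self _).trans h2) hK

theorem nQ_smul {ε R : ℝ} (k : ℝ) (a : Test ℝ) :
    nQ ε R (k • a : Test ℝ) = |k| * nQ ε R a := by
  have : ∀ t, QQ ε R t * (k • a : Test ℝ) t ^ 2 = k ^ 2 * (QQ ε R t * a t ^ 2) := fun t => by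
    simp only [Submodule.coe_smul, Pi.smul_apply, smul_eq_mul]; ring
  unfold nQ
  simp only [this]
  rw [integral_const_mul, sqrt_mul (sq_nonneg k), sqrt_sq_eq_abs]

theorem nQ_add_le {ε R : ℝ} (hR : 0 < R) (a b : Test ℝ) :
    nQ ε R (a + b : Test ℝ) ≤ nQ ε R a + nQ ε R b := by
  have cQ : Continuous (QQ ε R) := by unfold QQ; fun_prop
  let W : C(ℝ, ℝ) := ⟨QQ ε R, cQ⟩
  have e := nQ_sq_eq hR W (fun _ => rfl)
  refine le_of_sq_le_sq ?_ (add_nonneg (nQ_nonneg _ _ _) (nQ_nonneg _ _ _))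
  have h := (le_abs_self _).trans (abs_wt_le (ε := ε) hR (W := W) zero_le_one (fun t => by
    rw [one_mul]
    exact (abs_of_nonneg (zero_le_one.trans (Ctrl.one_le_QQ hR t))).le) a b)
  have h1 : nQ ε R (a + b : Test ℝ) ^ 2 = nQ ε R a ^ 2 + 2 * wt W a b + nQ ε R b ^ 2 := by
    rw [e, e, e]
    simp only [map_add, LinearMap.add_apply]
    rw [wt_comm W b a]; ring
  rw [h1]
  linarith

end Test

namespace Frame

variable {p ε R c M : ℝ} {T : ℝ → ℝ} (F : Frame p ε R c M T)

theorem R_pos (F : Frame p ε R c M T) : 0 < R := F.c_pos.trans_le F.R_lb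

/-- The potential `Q` as a continuous map. -/
noncomputable def Qc (_ : Frame p ε R c M T) : C(ℝ, ℝ) := ⟨QQ ε R, by unfold QQ; fun_prop⟩

/-- The potential `T` as a continuous map. -/
def Tc : C(ℝ, ℝ) := ⟨T, F.contT⟩

/-- The weight `exp (2 ε t)` as a continuous map. -/
noncomputable def Ec (_ : Frame p ε R c M T) : C(ℝ, ℝ) := ⟨fun t => exp (2 * ε * t), by fun_prop⟩

def φT : Test ℝ := ⟨F.φ, F.dφ, F.sφ⟩
def ZT : Test ℝ := ⟨F.Z, F.dZ, F.sZ⟩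
def AT : Test ℝ := ⟨F.A, F.dA, F.sA⟩
def φc : C(ℝ, ℝ) := ⟨F.φ, F.φT.continuous⟩
def rφc : C(ℝ, ℝ) := ⟨F.rφ, F.crφ⟩
def rZc : C(ℝ, ℝ) := ⟨F.rZ, F.crZ⟩
def rAc : C(ℝ, ℝ) := ⟨F.rA, F.crA⟩

theorem coe_φT : (F.φT : ℝ → ℝ) = F.φ := rfl
theorem coe_ZT : (F.ZT : ℝ → ℝ) = F.Z := rfl
theorem coe_AT : (F.AT : ℝ → ℝ) = F.A := rfl

variable {𝕜 : Type*} [RCLike 𝕜]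

/-- The form of `L₋`. -/
noncomputable def qm : Test 𝕜 →ₗ⋆[𝕜] Test 𝕜 →ₗ[𝕜] 𝕜 := Test.dir + Test.wt (F.Qc - F.Tc)

/-- The form of `L₊`. -/
noncomputable def qp : Test 𝕜 →ₗ⋆[𝕜] Test 𝕜 →ₗ[𝕜] 𝕜 := Test.dir + Test.wt (F.Qc - p • F.Tc)

theorem qm_real (a b : Test ℝ) :
    F.qm a b = ∫ t, (deriv a t * deriv b t + (QQ ε R t - T t) * a t * b t) := by
  have ca := a.continuous; have cb := b.continuous
  have ca' := a.continuous_deriv; have cb' := b.continuous_deriv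
  have cT := F.contT
  have cQ : Continuous (QQ ε R) := by unfold QQ; fun_prop
  rw [integral_add (a.integrable_of (by fun_prop) (by intro t _ h; simp [h]))
    (a.integrable_of (by fun_prop) (by intro t h _; simp [h])), ← Test.dir_real]
  simp only [qm, LinearMap.add_apply, Test.wt_real]
  rfl

theorem qp_real (a b : Test ℝ) :
    F.qp a b = ∫ t, (deriv a t * deriv b t + (QQ ε R t - p * T t) * a t * b t) := by
  have ca := a.continuous; have cb := b.continuous
  have ca' := a.continuous_deriv; have cb' := b.continuous_deriv
  have cT := F.contT
  have cQ : Continuous (QQ ε R) := by unfold QQ; fun_prop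
  rw [integral_add (a.integrable_of (by fun_prop) (by intro t _ h; simp [h]))
    (a.integrable_of (by fun_prop) (by intro t h _; simp [h])), ← Test.dir_real]
  simp only [qp, LinearMap.add_apply, Test.wt_real]
  rfl

theorem qm_comm (a b : Test ℝ) : F.qm a b = F.qm b a := by
  simp only [qm, LinearMap.add_apply, Test.wt_comm _ a, Test.dir_comm a]

theorem qp_comm (a b : Test ℝ) : F.qp a b = F.qp b a := by
  simp only [qp, LinearMap.add_apply, Test.wt_comm _ a, Test.dir_comm a]

theorem qm_φ (a : Test ℝ) : F.qm F.φT a = Test.lin F.rφc a := by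
  rw [qm_real, Test.lin_real]; exact F.wφ a a.contDiff a.supp

theorem qp_Z (a : Test ℝ) : F.qp F.ZT a = 2 * ε * Test.lin F.φc a + Test.lin F.rZc a := by
  rw [qp_real, Test.lin_real, Test.lin_real]; exact F.wZ a a.contDiff a.supp

theorem qp_A (a : Test ℝ) :
    F.qp F.AT a = -(2 * (1 + R)) * Test.lin F.φc a + Test.lin F.rAc a := by
  rw [qp_real, Test.lin_real, Test.lin_real]; exact F.wA a a.contDiff a.supp

/-- The half-line functionals annihilated in the coercivity estimate for `L₊`. -/
noncomputable def half (F : Frame p ε R c M T) (S : Set ℝ) (a : Test ℝ) : ℝ :=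
  ∫ t in S, QQ ε R t * F.g t * a t

theorem half_add_smul (S : Set ℝ) (a b d : Test ℝ) (x y : ℝ) :
    F.half S (a + x • b + y • d) = F.half S a + x * F.half S b + y * F.half S d := by
  have cg := F.cg
  have cQ : Continuous (QQ ε R) := by unfold QQ; fun_prop
  have h : ∀ a : Test ℝ, IntegrableOn (fun t => QQ ε R t * F.g t * a t) S := fun a =>
    (a.integrable_real (by have := a.continuous; fun_prop) (by intro t h; simp [h])).integrableOn
  unfold half
  rw [← integral_const_mul, ← integral_const_mul, ← integral_add (h a) ((h b).const_mul x)]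
  have i1 : IntegrableOn (fun t => QQ ε R t * F.g t * a t + x * (QQ ε R t * F.g t * b t)) S :=
    (h a).add ((h b).const_mul x)
  rw [← integral_add i1 ((h d).const_mul y)]
  refine integral_congr_ae (Eventually.of_forall fun t => ?_)
  simp only [Submodule.coe_add, Submodule.coe_smul, Pi.add_apply, Pi.smul_apply, smul_eq_mul]
  ring

theorem exists_decomp (a : Test ℝ) : ∃ (γ τ : ℝ) (a₂ : Test ℝ), a = γ • F.ZT + τ • F.AT + a₂ ∧
    c * nQ ε R a₂ ^ 2 ≤ F.qp a₂ a₂ := by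
  have h1 : 0 < F.half (Set.Ioi 0) F.AT := F.lA
  have h2 : 0 < F.half (Set.Iic 0) F.AT := F.lA'
  have h3 : F.half (Set.Ioi 0) F.ZT < 0 := F.lZ
  have h4 : 0 < F.half (Set.Iic 0) F.ZT := F.lZ'
  have hd : 0 < F.half (Set.Iic 0) F.ZT * F.half (Set.Ioi 0) F.AT
      - F.half (Set.Ioi 0) F.ZT * F.half (Set.Iic 0) F.AT := by nlinarith
  set D := F.half (Set.Iic 0) F.ZT * F.half (Set.Ioi 0) F.AT
      - F.half (Set.Ioi 0) F.ZT * F.half (Set.Iic 0) F.AT with hD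
  set γ := (F.half (Set.Iic 0) a * F.half (Set.Ioi 0) F.AT
      - F.half (Set.Ioi 0) a * F.half (Set.Iic 0) F.AT) / D with hγ
  set τ := (F.half (Set.Iic 0) F.ZT * F.half (Set.Ioi 0) a
      - F.half (Set.Ioi 0) F.ZT * F.half (Set.Iic 0) a) / D with hτ
  refine ⟨γ, τ, a + (-γ) • F.ZT + (-τ) • F.AT, by module, ?_⟩
  have key := F.coercive_plus (a + (-γ) • F.ZT + (-τ) • F.AT : Test ℝ) (Test.contDiff _)
    (Test.supp _)
    ((F.half_add_smul (Set.Ioi 0) a F.ZT F.AT (-γ) (-τ)).trans (by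
      rw [hγ, hτ]; field_simp; rw [hD]; ring))
    ((F.half_add_smul (Set.Iic 0) a F.ZT F.AT (-γ) (-τ)).trans (by
      rw [hγ, hτ]; field_simp; rw [hD]; ring))
  rw [qp_real]
  simpa only [sq, mul_assoc] using key

end Frame

namespace Frame

variable {p ε R c M : ℝ} {T : ℝ → ℝ} (F : Frame p ε R c M T)

/-- The weight `1 - exp (2 ε t)` as a continuous map. -/
noncomputable def vc (F : Frame p ε R c M T) : C(ℝ, ℝ) := 1 - F.Ec

theorem abs_wt_vc_le (a b : Test ℝ) :
    |Test.wt F.vc a b| ≤ (1 + 1 / c) * (nQ ε R a * nQ ε R b) := by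
  have hc := F.c_pos
  refine Test.abs_wt_le F.R_pos (by positivity) (fun t => ?_) a b
  have h : F.vc t = 1 - exp (2 * ε * t) := rfl
  have he := exp_pos (2 * ε * t)
  have h1 : exp (2 * ε * t) ≤ 1 / c * (R * exp (2 * ε * t)) := by
    rw [one_div, ← mul_assoc]
    refine le_mul_of_one_le_left he.le ?_
    rw [inv_mul_eq_div, one_le_div hc]; exact F.R_lb
  have h2 : 0 < R * exp (2 * ε * t) := mul_pos F.R_pos he
  have h3 : 0 < 1 / c := by positivity
  rw [h, QQ, abs_le]
  constructor <;> nlinarith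

theorem lin_φ (a : Test ℝ) : Test.lin F.φc a = Test.wt 1 F.φT a := by
  rw [Test.lin_real, Test.wt_real, coe_φT]; simp only [ContinuousMap.one_apply, one_mul]; rfl

theorem abs_lin_φ_le (a : Test ℝ) : |Test.lin F.φc a| ≤ M * nQ ε R a := by
  rw [Test.lin_real]; exact F.bφ a a.continuous a.supp

theorem abs_lin_rφ_le (a : Test ℝ) : |Test.lin F.rφc a| ≤ M * ε ^ 2 * nQ ε R a := by
  rw [Test.lin_real]; exact F.brφ a a.continuous a.supp

theorem abs_lin_rZ_le (a : Test ℝ) : |Test.lin F.rZc a| ≤ M * ε ^ 2 * nQ ε R a := by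
  rw [Test.lin_real]; exact F.brZ a a.continuous a.supp

theorem abs_lin_rA_le (a : Test ℝ) : |Test.lin F.rAc a| ≤ M * ε * nQ ε R a := by
  rw [Test.lin_real]; exact F.brA a a.continuous a.supp

theorem abs_wt_Z_le (a : Test ℝ) : |Test.wt 1 F.ZT a| ≤ M * nQ ε R a := by
  rw [Test.wt_real]; simpa [coe_ZT] using F.bZ a a.continuous a.supp

theorem wt_vc_eq (u a : Test ℝ) :
    Test.wt F.vc u a = -∫ t, (exp (2 * ε * t) - 1) * u t * a t := by
  rw [Test.wt_real, ← integral_neg]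
  refine integral_congr_ae (Eventually.of_forall fun t => ?_)
  have h : F.vc t = 1 - exp (2 * ε * t) := rfl
  simp only [h]; ring

theorem abs_wt_vc_φ_le (a : Test ℝ) : |Test.wt F.vc F.φT a| ≤ M * ε * nQ ε R a := by
  rw [wt_vc_eq, abs_neg]; exact F.vφ a a.continuous a.supp

theorem abs_wt_vc_Z_le (a : Test ℝ) : |Test.wt F.vc F.ZT a| ≤ M * ε * nQ ε R a := by
  rw [wt_vc_eq, abs_neg]; exact F.vZ a a.continuous a.supp

theorem abs_wt_vc_A_le (a : Test ℝ) : |Test.wt F.vc F.AT a| ≤ M * ε * nQ ε R a := by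
  rw [wt_vc_eq, abs_neg]; exact F.vA a a.continuous a.supp

theorem nQ_φ : nQ ε R F.φT ≤ M := F.nφ
theorem nQ_Z : nQ ε R F.ZT ≤ M := F.nZ
theorem nQ_A : nQ ε R F.AT ≤ M := F.nA

theorem wt_φφ : c ≤ Test.wt 1 F.φT F.φT := by
  rw [Test.wt_real]; simpa [sq, coe_φT] using F.iφφ

theorem wt_ZZ : c ≤ Test.wt 1 F.ZT F.ZT := by
  rw [Test.wt_real]; simpa [sq, coe_ZT] using F.iZZ

theorem lin_φA : c ≤ Test.lin F.φc F.AT := by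
  rw [Test.lin_real]; exact F.iφA

theorem abs_lin_φZ : |Test.lin F.φc F.ZT| ≤ M * ε := by
  rw [Test.lin_real]; exact F.iφZ

theorem qm_le (v : Test ℝ) (h : v 0 = 0) : c * nQ ε R v ^ 2 ≤ F.qm v v := by
  rw [qm_real]
  simpa only [sq, mul_assoc] using F.coercive_minus v v.contDiff v.supp h

end Frame

theorem abs_mul_le_mul {x y u v : ℝ} (hx : |x| ≤ u) (hy : |y| ≤ v) : |x * y| ≤ u * v := by
  rw [abs_mul]
  exact mul_le_mul hx hy (abs_nonneg _) ((abs_nonneg _).trans hx)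

namespace Frame

variable {p ε R c M : ℝ} {T : ℝ → ℝ} (F : Frame p ε R c M T)

theorem nQ_comb_le (F : Frame p ε R c M T) (x y : ℝ) (u v w : Test ℝ) :
    nQ ε R (x • u + y • v + w : Test ℝ) ≤ |x| * nQ ε R u + |y| * nQ ε R v + nQ ε R w := by
  have h1 := Test.nQ_add_le (ε := ε) F.R_pos (x • u + y • v) w
  have h2 := Test.nQ_add_le (ε := ε) F.R_pos (x • u) (y • v)
  rw [Test.nQ_smul, Test.nQ_smul] at h2
  linarith

theorem qp_lower {γ τ δ S : ℝ} {a₂ : Test ℝ} (hδ : δ ≤ 1) (hε : ε ≤ δ)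
    (h2 : c * nQ ε R a₂ ^ 2 ≤ F.qp a₂ a₂) (hγ : ε * |γ| ≤ δ * S) (hτ : |τ| ≤ S)
    (hX : nQ ε R a₂ ≤ S) (hn : |Test.lin F.φc (γ • F.ZT + τ • F.AT + a₂)| ≤ S) :
    c * nQ ε R a₂ ^ 2 + 2 * c * τ ^ 2
      - 4 * (1 + M) * (|τ| * |Test.lin F.φc (γ • F.ZT + τ • F.AT + a₂)|)
      - 20 * M ^ 2 * (δ * S ^ 2)
      ≤ F.qp (γ • F.ZT + τ • F.AT + a₂) (γ • F.ZT + τ • F.AT + a₂) := by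
  have hM := F.one_le_M
  have hε0 := F.ε_pos
  have hS : 0 ≤ S := (abs_nonneg _).trans hτ
  have hδ0 : 0 ≤ δ := hε0.le.trans hε
  have hR := F.R_pos
  have hR' := F.R_ub
  have hX0 := nQ_nonneg ε R a₂
  set n := Test.lin F.φc (γ • F.ZT + τ • F.AT + a₂) with hnd
  set z := Test.lin F.φc F.ZT with hz
  set d := Test.lin F.φc F.AT with hd
  set X := nQ ε R a₂ with hXd
  set u : Test ℝ := γ • F.ZT + τ • F.AT + (2 : ℝ) • a₂ with hu
  have e1 : F.qp (γ • F.ZT + τ • F.AT + a₂) (γ • F.ZT + τ • F.AT + a₂) = F.qp a₂ a₂ +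
      (2 * ε * γ - 2 * (1 + R) * τ) * (2 * n - γ * z - τ * d)
      + γ * Test.lin F.rZc u + τ * Test.lin F.rAc u := by
    have h1 : F.qp (γ • F.ZT + τ • F.AT + a₂) (γ • F.ZT + τ • F.AT + a₂)
        = F.qp a₂ a₂ + (γ * F.qp F.ZT u + τ * F.qp F.AT u) := by
      simp only [hu, map_add, map_smul, LinearMap.add_apply, LinearMap.smul_apply,
        smul_eq_mul, F.qp_comm a₂, F.qp_comm F.AT F.ZT]
      ring
    have h3 : Test.lin F.φc u = 2 * n - γ * z - τ * d := by
      simp only [hu, hnd, hz, hd, map_add, map_smul, smul_eq_mul]; ring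
    rw [h1, F.qp_Z, F.qp_A, h3]; ring
  have hb : nQ ε R u ≤ M * |γ| + M * |τ| + 2 * X := by
    refine (F.nQ_comb_le γ τ F.ZT F.AT _).trans ?_
    rw [Test.nQ_smul, abs_two]
    have h5 := mul_le_mul_of_nonneg_left F.nQ_Z (abs_nonneg γ)
    have h6 := mul_le_mul_of_nonneg_left F.nQ_A (abs_nonneg τ)
    linarith
  have hg0 := abs_nonneg γ
  have ht0 := abs_nonneg τ
  have hu0 := nQ_nonneg ε R u
  have hεu : ε * nQ ε R u ≤ 4 * M * S := by
    have h5 := mul_le_mul_of_nonneg_left hb hε0.le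
    have h6 : ε * |τ| ≤ 1 * S := mul_le_mul (hε.trans hδ) hτ ht0 zero_le_one
    have h7 : ε * X ≤ 1 * S := mul_le_mul (hε.trans hδ) hX hX0 zero_le_one
    have h8 : δ * S ≤ 1 * S := mul_le_mul_of_nonneg_right hδ hS
    have h9 := mul_le_mul_of_nonneg_left (hγ.trans h8) (zero_le_one.trans hM)
    have h10 := mul_le_mul_of_nonneg_left h6 (zero_le_one.trans hM)
    have h11 : 1 * S ≤ M * S := mul_le_mul_of_nonneg_right hM hS
    linarith
  have hεu' : ε * nQ ε R u ≤ 4 * M * (δ * S) := by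
    have h5 := mul_le_mul_of_nonneg_left hb hε0.le
    have h6 : ε * |τ| ≤ δ * S := mul_le_mul hε hτ ht0 hδ0
    have h7 : ε * X ≤ δ * S := mul_le_mul hε hX hX0 hδ0
    have h9 := mul_le_mul_of_nonneg_left hγ (zero_le_one.trans hM)
    have h10 := mul_le_mul_of_nonneg_left h6 (zero_le_one.trans hM)
    have h11 : 1 * (δ * S) ≤ M * (δ * S) := mul_le_mul_of_nonneg_right hM (by positivity)
    linarith
  have hγ' : |ε * γ| ≤ δ * S := by rwa [abs_mul, abs_of_pos hε0]
  have hγz : |γ * z| ≤ M * (δ * S) := by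
    have := mul_le_mul_of_nonneg_left F.abs_lin_φZ hg0
    have h9 := mul_le_mul_of_nonneg_left hγ (zero_le_one.trans hM)
    rw [abs_mul]; linarith
  have hdM : |d| ≤ M ^ 2 := by
    have h5 := F.abs_lin_φ_le F.AT
    have h6 := mul_le_mul_of_nonneg_left F.nQ_A (zero_le_one.trans hM)
    nlinarith
  have t1 := abs_mul_le_mul hγ' hn
  have t2 := abs_mul_le_mul hγ' hγz
  have t3 := abs_mul_le_mul hγ' (abs_mul_le_mul hτ hdM)
  have t4 := abs_mul_le_mul hτ hγz
  have t5 : |γ * Test.lin F.rZc u| ≤ 4 * M ^ 2 * (δ * S ^ 2) := by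
    have h5 := mul_le_mul_of_nonneg_left (F.abs_lin_rZ_le u) hg0
    have h6 : (ε * |γ|) * (ε * nQ ε R u) ≤ (δ * S) * (4 * M * S) :=
      mul_le_mul hγ hεu (by positivity) (by positivity)
    have h7 := mul_le_mul_of_nonneg_left h6 (zero_le_one.trans hM)
    rw [abs_mul]; linarith
  have t6 : |τ * Test.lin F.rAc u| ≤ 4 * M ^ 2 * (δ * S ^ 2) := by
    have h5 := mul_le_mul_of_nonneg_left (F.abs_lin_rA_le u) ht0
    have h6 : |τ| * (ε * nQ ε R u) ≤ S * (4 * M * (δ * S)) :=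
      mul_le_mul hτ hεu' (by positivity) hS
    have h7 := mul_le_mul_of_nonneg_left h6 (zero_le_one.trans hM)
    rw [abs_mul]; linarith
  have t7 : τ * n ≤ |τ| * |n| := (le_abs_self _).trans (abs_mul _ _).le
  have t7' : (1 + R) * (τ * n) ≤ (1 + M) * (|τ| * |n|) :=
    (mul_le_mul_of_nonneg_left t7 (by linarith)).trans
      (mul_le_mul_of_nonneg_right (by linarith) (by positivity))
  have t8 : c * τ ^ 2 ≤ (1 + R) * (τ ^ 2 * d) := by
    have h5 : c * τ ^ 2 ≤ d * τ ^ 2 := mul_le_mul_of_nonneg_right F.lin_φA (sq_nonneg τ)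
    have h6 : 0 ≤ c * τ ^ 2 := mul_nonneg F.c_pos.le (sq_nonneg τ)
    have h7 : 0 ≤ R * (d * τ ^ 2) := mul_nonneg hR.le (h6.trans h5)
    linarith
  have t4' : (1 + R) * (-(τ * (γ * z))) ≤ (1 + M) * (S * (M * (δ * S))) :=
    (mul_le_mul_of_nonneg_left ((neg_le_abs _).trans t4) (by linarith)).trans
      (mul_le_mul_of_nonneg_right (by linarith) (by positivity))
  have hδS : 0 ≤ δ * S ^ 2 := by positivity
  have hδ2 : δ * (δ * S ^ 2) ≤ 1 * (δ * S ^ 2) := mul_le_mul_of_nonneg_right hδ hδS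
  have hδ3 : M * (δ * (δ * S ^ 2)) ≤ M * (1 * (δ * S ^ 2)) :=
    mul_le_mul_of_nonneg_left hδ2 (zero_le_one.trans hM)
  have hM2 : 1 * (δ * S ^ 2) ≤ M * (δ * S ^ 2) := mul_le_mul_of_nonneg_right hM hδS
  have hM3 : M * (1 * (δ * S ^ 2)) ≤ M * (M * (δ * S ^ 2)) :=
    mul_le_mul_of_nonneg_left hM2 (zero_le_one.trans hM)
  rw [e1]
  have l1 := (abs_le.1 t1).1
  have l2 := (abs_le.1 t2).2
  have l3 := (abs_le.1 t3).2
  have l5 := (abs_le.1 t5).1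
  have l6 := (abs_le.1 t6).1
  linarith

theorem qm_lower {β δ S : ℝ} {b₁ : Test ℝ} (hδ : δ ≤ 1) (hε : ε ≤ δ)
    (h2 : c * nQ ε R b₁ ^ 2 ≤ F.qm b₁ b₁) (hβ : ε * |β| ≤ δ * S) (hS : 0 ≤ S)
    (hY : nQ ε R b₁ ≤ S) :
    c * nQ ε R b₁ ^ 2 - 3 * M ^ 2 * (δ * S ^ 2)
      ≤ F.qm (β • F.φT + b₁) (β • F.φT + b₁) := by
  have hM := F.one_le_M
  have hε0 := F.ε_pos
  have hδ0 : 0 ≤ δ := hε0.le.trans hε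
  have hY0 := nQ_nonneg ε R b₁
  set Y := nQ ε R b₁ with hYd
  have e1 : F.qm (β • F.φT + b₁) (β • F.φT + b₁) = F.qm b₁ b₁ +
      2 * (β * Test.lin F.rφc b₁) + β * (β * Test.lin F.rφc F.φT) := by
    rw [← F.qm_φ, ← F.qm_φ]
    simp only [map_add, map_smul, LinearMap.add_apply, LinearMap.smul_apply,
      smul_eq_mul, F.qm_comm b₁]
    ring
  have hb0 := abs_nonneg β
  have t1 : |β * Test.lin F.rφc b₁| ≤ M * (δ * S ^ 2) := by
    have h5 := mul_le_mul_of_nonneg_left (F.abs_lin_rφ_le b₁) hb0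
    have h4 : ε * Y ≤ 1 * S := mul_le_mul (hε.trans hδ) hY hY0 zero_le_one
    have h6 : (ε * |β|) * (ε * Y) ≤ (δ * S) * (1 * S) :=
      mul_le_mul hβ h4 (by positivity) (by positivity)
    have h7 := mul_le_mul_of_nonneg_left h6 (zero_le_one.trans hM)
    rw [abs_mul]; linarith
  have t2 : |β * (β * Test.lin F.rφc F.φT)| ≤ M ^ 2 * (δ * S ^ 2) := by
    have h5 := mul_le_mul_of_nonneg_left (F.abs_lin_rφ_le F.φT) (mul_nonneg hb0 hb0)
    have h8 := mul_le_mul_of_nonneg_left F.nQ_φ (by positivity : 0 ≤ |β| * |β| * (M * ε ^ 2))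
    have h9 : δ * S ≤ 1 * S := mul_le_mul_of_nonneg_right hδ hS
    have h6 : (ε * |β|) * (ε * |β|) ≤ (δ * S) * (1 * S) :=
      mul_le_mul hβ (hβ.trans h9) (by positivity) (by positivity)
    have h7 := mul_le_mul_of_nonneg_left h6 (by positivity : 0 ≤ M ^ 2)
    rw [abs_mul, abs_mul]; linarith
  have hδS : 0 ≤ δ * S ^ 2 := by positivity
  have hM2 : M * (δ * S ^ 2) ≤ M ^ 2 * (δ * S ^ 2) :=
    mul_le_mul_of_nonneg_right (by nlinarith) hδS
  rw [e1]
  have l1 := (abs_le.1 t1).1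
  have l2 := (abs_le.1 t2).1
  linarith

theorem wt_one_nonneg (a : Test ℝ) : 0 ≤ Test.wt 1 a a := by
  rw [Test.wt_real]
  exact integral_nonneg fun t => by simpa using mul_self_nonneg (a t)

theorem mass_a_lower {γ τ κ δ S : ℝ} {a₂ : Test ℝ} (hκ : κ ≤ δ) (hκ0 : 0 ≤ κ)
    (hγ : κ * |γ| ≤ S) (hτ : |τ| ≤ S) (hX : nQ ε R a₂ ≤ S) :
    c * (κ * |γ|) ^ 2 - 4 * M ^ 2 * (δ * S ^ 2)
      ≤ κ ^ 2 * Test.wt 1 (γ • F.ZT + τ • F.AT + a₂) (γ • F.ZT + τ • F.AT + a₂) := by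
  have hM := F.one_le_M
  have hS : 0 ≤ S := (abs_nonneg _).trans hτ
  have hδ0 : 0 ≤ δ := hκ0.trans hκ
  set u : Test ℝ := (0 : ℝ) • F.ZT + τ • F.AT + a₂ with hu
  have e : γ • F.ZT + τ • F.AT + a₂ = γ • F.ZT + u := by rw [hu]; module
  have e1 : Test.wt 1 (γ • F.ZT + u) (γ • F.ZT + u) = γ ^ 2 * Test.wt 1 F.ZT F.ZT +
      2 * (γ * Test.wt 1 F.ZT u) + Test.wt 1 u u := by
    simp only [map_add, map_smul, LinearMap.add_apply, LinearMap.smul_apply,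
      smul_eq_mul, Test.wt_comm 1 u]
    ring
  have hb : nQ ε R u ≤ 2 * M * S := by
    refine (F.nQ_comb_le 0 τ F.ZT F.AT a₂).trans ?_
    rw [abs_zero, zero_mul, zero_add]
    have h6 : |τ| * nQ ε R F.AT ≤ S * M := mul_le_mul hτ F.nQ_A (nQ_nonneg _ _ _) hS
    have h11 : 1 * S ≤ M * S := mul_le_mul_of_nonneg_right hM hS
    linarith
  have t1 : κ ^ 2 * |γ * Test.wt 1 F.ZT u| ≤ 2 * M ^ 2 * (δ * S ^ 2) := by
    have h5 : |Test.wt 1 F.ZT u| ≤ 2 * M ^ 2 * S := by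
      have := F.abs_wt_Z_le u
      have h7 := mul_le_mul_of_nonneg_left hb (zero_le_one.trans hM)
      linarith
    have h8 : (κ * |γ|) * |Test.wt 1 F.ZT u| ≤ S * (2 * M ^ 2 * S) :=
      mul_le_mul hγ h5 (abs_nonneg _) hS
    have h9 : κ * ((κ * |γ|) * |Test.wt 1 F.ZT u|) ≤ δ * (S * (2 * M ^ 2 * S)) :=
      mul_le_mul hκ h8 (by positivity) hδ0
    rw [abs_mul]; linarith
  have t2 := mul_le_mul_of_nonneg_left F.wt_ZZ (sq_nonneg (κ * |γ|))
  have t3 := mul_nonneg (sq_nonneg κ) (wt_one_nonneg u)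
  have t4 : -(κ ^ 2 * |γ * Test.wt 1 F.ZT u|) ≤ κ ^ 2 * (γ * Test.wt 1 F.ZT u) := by
    have := mul_le_mul_of_nonneg_left (neg_abs_le (γ * Test.wt 1 F.ZT u)) (sq_nonneg κ)
    linarith
  have t5 : (κ * |γ|) ^ 2 = κ ^ 2 * γ ^ 2 := by rw [mul_pow, sq_abs]
  rw [e, e1]
  rw [t5] at t2 ⊢
  linarith

theorem mass_b_lower {β κ δ S : ℝ} {b₁ : Test ℝ} (hκ : κ ≤ δ) (hκ0 : 0 ≤ κ)
    (hβ : κ * |β| ≤ S) (hY : nQ ε R b₁ ≤ S) :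
    c * (κ * |β|) ^ 2 - 2 * M ^ 2 * (δ * S ^ 2)
      ≤ κ ^ 2 * Test.wt 1 (β • F.φT + b₁) (β • F.φT + b₁) := by
  have hM := F.one_le_M
  have hS : 0 ≤ S := (nQ_nonneg _ _ _).trans hY
  have hδ0 : 0 ≤ δ := hκ0.trans hκ
  have e1 : Test.wt 1 (β • F.φT + b₁) (β • F.φT + b₁) = β ^ 2 * Test.wt 1 F.φT F.φT +
      2 * (β * Test.wt 1 F.φT b₁) + Test.wt 1 b₁ b₁ := by
    simp only [map_add, map_smul, LinearMap.add_apply, LinearMap.smul_apply,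
      smul_eq_mul, Test.wt_comm 1 b₁]
    ring
  have t1 : κ ^ 2 * |β * Test.wt 1 F.φT b₁| ≤ M * (δ * S ^ 2) := by
    have h5 : |Test.wt 1 F.φT b₁| ≤ M * S := by
      rw [← F.lin_φ]
      exact (F.abs_lin_φ_le b₁).trans (mul_le_mul_of_nonneg_left hY (zero_le_one.trans hM))
    have h8 : (κ * |β|) * |Test.wt 1 F.φT b₁| ≤ S * (M * S) :=
      mul_le_mul hβ h5 (abs_nonneg _) hS
    have h9 : κ * ((κ * |β|) * |Test.wt 1 F.φT b₁|) ≤ δ * (S * (M * S)) :=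
      mul_le_mul hκ h8 (by positivity) hδ0
    rw [abs_mul]; linarith
  have t2 := mul_le_mul_of_nonneg_left F.wt_φφ (sq_nonneg (κ * |β|))
  have t3 := mul_nonneg (sq_nonneg κ) (wt_one_nonneg b₁)
  have t4 : -(κ ^ 2 * |β * Test.wt 1 F.φT b₁|) ≤ κ ^ 2 * (β * Test.wt 1 F.φT b₁) := by
    have := mul_le_mul_of_nonneg_left (neg_abs_le (β * Test.wt 1 F.φT b₁)) (sq_nonneg κ)
    linarith
  have t5 : (κ * |β|) ^ 2 = κ ^ 2 * β ^ 2 := by rw [mul_pow, sq_abs]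
  have hδS : 0 ≤ δ * S ^ 2 := by positivity
  have hM2 : M * (δ * S ^ 2) ≤ M ^ 2 * (δ * S ^ 2) :=
    mul_le_mul_of_nonneg_right (by nlinarith) hδS
  rw [e1]
  rw [t5] at t2 ⊢
  linarith

theorem coupling_le {γ τ β κ δ S : ℝ} {a₂ b₁ : Test ℝ} (hδ : δ ≤ 1) (hε : ε ≤ δ) (hκ : κ ≤ δ)
    (hκ0 : 0 ≤ κ) (hγ : κ * |γ| ≤ S) (hτ : |τ| ≤ S) (hX : nQ ε R a₂ ≤ S)
    (hβ : κ * |β| ≤ S) (hβ' : ε * |β| ≤ δ * S) (hY : nQ ε R b₁ ≤ S) :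
    |κ * Test.wt F.vc (γ • F.ZT + τ • F.AT + a₂) (β • F.φT + b₁)|
      ≤ (5 * M ^ 2 + 1 + 1 / c) * (δ * S ^ 2) := by
  have hM := F.one_le_M
  have hε0 := F.ε_pos
  have hc := F.c_pos
  have hS : 0 ≤ S := (abs_nonneg _).trans hτ
  have hδ0 : 0 ≤ δ := hκ0.trans hκ
  have hY0 := nQ_nonneg ε R b₁
  have hX0 := nQ_nonneg ε R a₂
  have e1 : κ * Test.wt F.vc (γ • F.ZT + τ • F.AT + a₂) (β • F.φT + b₁) =
      (κ * γ) * (β * Test.wt F.vc F.ZT F.φT) + (κ * γ) * Test.wt F.vc F.ZT b₁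
      + (κ * β) * (τ * Test.wt F.vc F.AT F.φT) + κ * (τ * Test.wt F.vc F.AT b₁)
      + (κ * β) * Test.wt F.vc F.φT a₂ + κ * Test.wt F.vc a₂ b₁ := by
    simp only [map_add, map_smul, LinearMap.add_apply, LinearMap.smul_apply,
      smul_eq_mul, Test.wt_comm F.vc a₂ F.φT]
    ring
  have hγ' : |κ * γ| ≤ S := by rwa [abs_mul, abs_of_nonneg hκ0]
  have hβ'' : |κ * β| ≤ S := by rwa [abs_mul, abs_of_nonneg hκ0]
  have hκ' : |κ| ≤ δ := by rwa [abs_of_nonneg hκ0]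
  have hM0 := zero_le_one.trans hM
  have hMM : M ≤ M ^ 2 := by nlinarith
  have b0 : ∀ {x : ℝ} {w : Test ℝ} , nQ ε R w ≤ M → |x| ≤ M * ε * nQ ε R w → |x| ≤ M ^ 2 * ε := by
    intro x w hw hx
    have := mul_le_mul_of_nonneg_left hw (by positivity : 0 ≤ M * ε)
    linarith
  have b1 : ∀ {x : ℝ} {w : Test ℝ} , nQ ε R w ≤ S → |x| ≤ M * ε * nQ ε R w →
      |x| ≤ M ^ 2 * (δ * S) := by
    intro x w hw hx
    have h1 := mul_le_mul_of_nonneg_left hw (by positivity : 0 ≤ M * ε)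
    have h2 : M * ε ≤ M ^ 2 * δ := mul_le_mul hMM hε hε0.le (by positivity)
    have h3 := mul_le_mul_of_nonneg_right h2 hS
    linarith
  have u1 : |β * Test.wt F.vc F.ZT F.φT| ≤ M ^ 2 * (δ * S) := by
    have h1 := mul_le_mul_of_nonneg_left (b0 F.nQ_φ (F.abs_wt_vc_Z_le F.φT)) (abs_nonneg β)
    have h2 := mul_le_mul_of_nonneg_left hβ' (by positivity : 0 ≤ M ^ 2)
    rw [abs_mul]; linarith
  have u2 : |τ * Test.wt F.vc F.AT F.φT| ≤ M ^ 2 * (δ * S) := by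
    have h1 := mul_le_mul_of_nonneg_left (b0 F.nQ_φ (F.abs_wt_vc_A_le F.φT)) (abs_nonneg τ)
    have h3 : ε * |τ| ≤ δ * S := mul_le_mul hε hτ (abs_nonneg _) hδ0
    have h2 := mul_le_mul_of_nonneg_left h3 (by positivity : 0 ≤ M ^ 2)
    rw [abs_mul]; linarith
  have t1 := abs_mul_le_mul hγ' u1
  have t2 := abs_mul_le_mul hγ' (b1 hY (F.abs_wt_vc_Z_le b₁))
  have t3 := abs_mul_le_mul hβ'' u2
  have t4 := abs_mul_le_mul (hκ'.trans hδ) (abs_mul_le_mul hτ (b1 hY (F.abs_wt_vc_A_le b₁)))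
  have t5 := abs_mul_le_mul hβ'' (b1 hX (F.abs_wt_vc_φ_le a₂))
  have u6 : |Test.wt F.vc a₂ b₁| ≤ (1 + 1 / c) * (S * S) :=
    (F.abs_wt_vc_le a₂ b₁).trans (mul_le_mul_of_nonneg_left
      (mul_le_mul hX hY hY0 hS) (by positivity))
  have t6 := abs_mul_le_mul hκ' u6
  rw [e1]
  rw [abs_le] at *
  constructor <;> linarith

end Frame

theorem sq_sum_six_le (x y z u v w : ℝ) : (x + y + z + u + v + w) ^ 2
    ≤ 6 * (x ^ 2 + y ^ 2 + z ^ 2 + u ^ 2 + v ^ 2 + w ^ 2) := by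
  have h : ∀ a b : ℝ, 2 * (a * b) ≤ a ^ 2 + b ^ 2 := fun a b => by
    linarith [two_mul_le_add_sq a b]
  have e : (x + y + z + u + v + w) ^ 2 = x ^ 2 + y ^ 2 + z ^ 2 + u ^ 2 + v ^ 2 + w ^ 2
      + (2 * (x * y) + 2 * (x * z) + 2 * (x * u) + 2 * (x * v) + 2 * (x * w)
      + 2 * (y * z) + 2 * (y * u) + 2 * (y * v) + 2 * (y * w) + 2 * (z * u) + 2 * (z * v)
      + 2 * (z * w) + 2 * (u * v) + 2 * (u * w) + 2 * (v * w)) := by ring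
  rw [e]
  linarith [h x y, h x z, h x u, h x v, h x w, h y z, h y u, h y v, h y w, h z u, h z v, h z w,
    h u v, h u w, h v w]

namespace Frame

variable {p ε R c M : ℝ} {T : ℝ → ℝ} (F : Frame p ε R c M T)

/-- The quadratic form of the linearised operator on a pair. -/
noncomputable def quad (κ : ℝ) (a b : Test ℝ) : ℝ :=
  F.qp a a + F.qm b b + κ ^ 2 * (Test.wt 1 a a + Test.wt 1 b b) + 4 * (κ * Test.wt F.vc a b)

set_option maxHeartbeats 1000000 in
theorem exists_coercive_real {c M : ℝ} (hc : 0 < c) (hM : 1 ≤ M) : ∃ C > 0, ∃ δ > 0,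
    ∀ (p ε R : ℝ) (T : ℝ → ℝ) (F : Frame p ε R c M T) (κ j : ℝ), 1 ≤ j → κ = j * ε → κ ≤ δ →
      1 / j ≤ δ → ∀ a b : Test ℝ,
      0 ≤ F.quad κ a b + C * Test.lin F.φc a ^ 2 ∧
      κ ^ 2 * nQ ε R a ^ 2 ≤ C * (F.quad κ a b + C * Test.lin F.φc a ^ 2) ∧
      κ ^ 2 * b 0 ^ 2 ≤ C * (F.quad κ a b + C * Test.lin F.φc a ^ 2) ∧
      nQ ε R (b + (-(b 0)) • F.φT : Test ℝ) ^ 2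
        ≤ C * (F.quad κ a b + C * Test.lin F.φc a ^ 2) := by
  have hM0 := zero_le_one.trans hM
  set K := 49 * M ^ 2 + 4 + 4 / c with hK
  have hKp : 0 < K := by positivity
  set C := 4 * (1 + M) ^ 2 / c + c + 6 * M ^ 2 / c + 2 / c with hC
  have hCp : 0 < C := by positivity
  refine ⟨C, hCp, min 1 (c / (12 * K)), by positivity, ?_⟩
  intro p ε R T F κ j hj hκj hκδ hjδ a b
  set δ := min 1 (c / (12 * K)) with hδd
  have hδ1 : δ ≤ 1 := min_le_left _ _
  have hδK : K * δ ≤ c / 12 := by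
    have := mul_le_mul_of_nonneg_left (min_le_right 1 (c / (12 * K))) hKp.le
    refine this.trans_eq ?_
    field_simp
  have hε0 := F.ε_pos
  have hεκ : ε ≤ κ := by rw [hκj]; exact le_mul_of_one_le_left hε0.le hj
  have hκ0 : 0 ≤ κ := hε0.le.trans hεκ
  have hεδ := hεκ.trans hκδ
  have hδ0 : 0 ≤ δ := hε0.le.trans hεδ
  have hεδκ : ε ≤ δ * κ := by
    have h1 : 1 / j * κ ≤ δ * κ := mul_le_mul_of_nonneg_right hjδ hκ0
    have h2 : 1 / j * κ = ε := by rw [hκj]; field_simp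
    linarith
  obtain ⟨γ, τ, a₂, ha, h2⟩ := F.exists_decomp a
  set b₁ : Test ℝ := b + (-(b 0)) • F.φT with hb₁
  set β := b 0 with hβ
  have hb : b = β • F.φT + b₁ := by rw [hb₁]; module
  have hb₁0 : b₁ 0 = 0 := by
    have h : b₁ 0 = b 0 + -β * F.φ 0 := rfl
    rw [h, F.φ_zero, ← hβ]; ring
  have h3 := F.qm_le b₁ hb₁0
  set n := Test.lin F.φc a with hn
  set X := nQ ε R a₂ with hX
  set Y := nQ ε R b₁ with hY
  have hX0 : 0 ≤ X := nQ_nonneg _ _ _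
  have hY0 : 0 ≤ Y := nQ_nonneg _ _ _
  set t := |τ| with ht
  have ht0 : 0 ≤ t := abs_nonneg _
  set G := κ * |γ| with hG
  have hG0 : 0 ≤ G := mul_nonneg hκ0 (abs_nonneg _)
  set H := κ * |β| with hH
  have hH0 : 0 ≤ H := mul_nonneg hκ0 (abs_nonneg _)
  set N := |n| with hN
  have hN0 : 0 ≤ N := abs_nonneg _
  set S := X + Y + t + G + H + N with hS
  have hS0 : 0 ≤ S := by positivity
  have hγ' : ε * |γ| ≤ δ * S := by
    have h5 := mul_le_mul_of_nonneg_right hεδκ (abs_nonneg γ)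
    have h6 : δ * G ≤ δ * S := mul_le_mul_of_nonneg_left (by linarith) hδ0
    have h7 : δ * κ * |γ| = δ * G := by rw [hG]; ring
    linarith
  have hβ' : ε * |β| ≤ δ * S := by
    have h5 := mul_le_mul_of_nonneg_right hεδκ (abs_nonneg β)
    have h6 : δ * H ≤ δ * S := mul_le_mul_of_nonneg_left (by linarith) hδ0
    have h7 : δ * κ * |β| = δ * H := by rw [hH]; ring
    linarith
  have L1 := F.qp_lower (S := S) hδ1 hεδ h2 hγ' (by linarith : |τ| ≤ S) (by linarith)
    (by rw [← ha, ← hn]; linarith)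
  have L2 := F.qm_lower hδ1 hεδ h3 hβ' hS0 (by linarith)
  have L3 := F.mass_a_lower (S := S) (γ := γ) (τ := τ) (a₂ := a₂) hκδ hκ0 (by linarith)
    (by linarith) (by linarith)
  have L4 := F.mass_b_lower (S := S) (β := β) (b₁ := b₁) hκδ hκ0 (by linarith) (by linarith)
  have L5 := F.coupling_le (S := S) (γ := γ) (τ := τ) (a₂ := a₂) (β := β) (b₁ := b₁) hδ1 hεδ hκδ
    hκ0 (by linarith) (by linarith) (by linarith) (by linarith) hβ' (by linarith)
  rw [← ha] at L1 L3 L5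
  rw [← hb] at L2 L4 L5
  rw [← hn, ← hN, ← ht, ← hX] at L1
  rw [← hG] at L3
  rw [← hH] at L4
  rw [← hY] at L2
  have L5' := (abs_le.1 L5).1
  have hSS : S ^ 2 ≤ 6 * (X ^ 2 + Y ^ 2 + t ^ 2 + G ^ 2 + H ^ 2 + N ^ 2) := by
    exact sq_sum_six_le X Y t G H N
  have hKS : K * (δ * S ^ 2) ≤ c / 2 * (X ^ 2 + Y ^ 2 + t ^ 2 + G ^ 2 + H ^ 2 + N ^ 2) := by
    have h5 := mul_le_mul_of_nonneg_right hδK (sq_nonneg S)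
    have h6 := mul_le_mul_of_nonneg_left hSS (by positivity : 0 ≤ c / 12)
    linarith
  have htN : 4 * (1 + M) * (t * N) ≤ c * t ^ 2 + 4 * (1 + M) ^ 2 / c * N ^ 2 := by
    have h5 : 0 ≤ (c * t - 2 * (1 + M) * N) ^ 2 / c := by positivity
    have h6 : (c * t - 2 * (1 + M) * N) ^ 2 / c
        = c * t ^ 2 - 4 * (1 + M) * (t * N) + 4 * (1 + M) ^ 2 / c * N ^ 2 := by
      field_simp; ring
    linarith
  have hτ2 : τ ^ 2 = t ^ 2 := (sq_abs τ).symm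
  have hn2 : n ^ 2 = N ^ 2 := (sq_abs n).symm
  rw [hτ2] at L1
  have hCN : C * N ^ 2 = 4 * (1 + M) ^ 2 / c * N ^ 2 + c * N ^ 2
      + (6 * M ^ 2 / c + 2 / c) * N ^ 2 := by rw [hC]; ring
  have hCN' : 0 ≤ (6 * M ^ 2 / c + 2 / c) * N ^ 2 := by positivity
  have hQ : c / 2 * (X ^ 2 + Y ^ 2 + t ^ 2 + G ^ 2 + H ^ 2 + N ^ 2)
      ≤ F.quad κ a b + C * n ^ 2 := by
    have h7 : 4 * ((5 * M ^ 2 + 1 + 1 / c) * (δ * S ^ 2))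
        + (20 + 3 + 4 + 2) * M ^ 2 * (δ * S ^ 2) = K * (δ * S ^ 2) := by rw [hK]; ring
    rw [hn2, quad, hCN]
    have h8 : 0 ≤ c * t ^ 2 := by positivity
    linarith
  set Θ := F.quad κ a b + C * n ^ 2 with hΘ
  have hΘ0 : 0 ≤ Θ := le_trans (by positivity) hQ
  have hcΘ : X ^ 2 + Y ^ 2 + t ^ 2 + G ^ 2 + H ^ 2 + N ^ 2 ≤ 2 / c * Θ := by
    have := mul_le_mul_of_nonneg_left hQ (by positivity : 0 ≤ 2 / c)
    refine le_trans (le_of_eq ?_) this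
    field_simp
  have hCΘ : 2 / c * Θ ≤ C * Θ := by
    refine mul_le_mul_of_nonneg_right ?_ hΘ0
    have : 0 ≤ 4 * (1 + M) ^ 2 / c + c + 6 * M ^ 2 / c := by positivity
    linarith
  have hCΘ' : 3 * M ^ 2 * (2 / c * Θ) ≤ C * Θ := by
    have : 0 ≤ 4 * (1 + M) ^ 2 / c + c + 2 / c := by positivity
    have h9 := mul_nonneg this hΘ0
    have h10 : 3 * M ^ 2 * (2 / c * Θ) = 6 * M ^ 2 / c * Θ := by ring
    have h11 : C * Θ = (4 * (1 + M) ^ 2 / c + c + 2 / c) * Θ + 6 * M ^ 2 / c * Θ := by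
      rw [hC]; ring
    linarith
  refine ⟨hΘ0, ?_, ?_, ?_⟩
  · have h5 : κ * nQ ε R a ≤ M * (G + t + X) := by
      have h6 := F.nQ_comb_le γ τ F.ZT F.AT a₂
      rw [← ha] at h6
      have h7 := mul_le_mul_of_nonneg_left h6 hκ0
      have h8 := mul_le_mul_of_nonneg_left F.nQ_Z hG0
      have h9 : κ * (t * nQ ε R F.AT) ≤ 1 * (t * M) :=
        mul_le_mul (hκδ.trans hδ1) (mul_le_mul_of_nonneg_left F.nQ_A ht0)
          (mul_nonneg ht0 (nQ_nonneg _ _ _)) zero_le_one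
      have h10 : κ * X ≤ 1 * X := mul_le_mul_of_nonneg_right (hκδ.trans hδ1) hX0
      have h11 : 1 * X ≤ M * X := mul_le_mul_of_nonneg_right hM hX0
      rw [hG] at h8
      rw [hG]
      linarith
    have h6 : (κ * nQ ε R a) ^ 2 ≤ (M * (G + t + X)) ^ 2 :=
      pow_le_pow_left₀ (mul_nonneg hκ0 (nQ_nonneg _ _ _)) h5 2
    have h7 : (G + t + X) ^ 2 ≤ 3 * (X ^ 2 + Y ^ 2 + t ^ 2 + G ^ 2 + H ^ 2 + N ^ 2) := by
      linarith [two_mul_le_add_sq G t, two_mul_le_add_sq G X, two_mul_le_add_sq t X,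
        sq_nonneg Y, sq_nonneg H, sq_nonneg N]
    have h8 := mul_le_mul_of_nonneg_left h7 (sq_nonneg M)
    have h9 := mul_le_mul_of_nonneg_left hcΘ (by positivity : 0 ≤ 3 * M ^ 2)
    rw [mul_pow, mul_pow] at h6
    linarith
  · have h5 : κ ^ 2 * β ^ 2 = H ^ 2 := by rw [hH, mul_pow, sq_abs]
    rw [h5]
    linarith [sq_nonneg X, sq_nonneg Y, sq_nonneg t, sq_nonneg G, sq_nonneg N]
  · linarith [sq_nonneg X, sq_nonneg H, sq_nonneg t, sq_nonneg G, sq_nonneg N]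

end Frame

section Pencil

variable {V : Type*} [AddCommGroup V] [Module ℂ V] {K σ : V →ₗ⋆[ℂ] V →ₗ[ℂ] ℂ}

theorem Submodule.exists_eigenvector_nonpos [FiniteDimensional ℂ V]
    (hK : ∀ x y, conj (K x y) = K y x) {T : V →ₗ[ℂ] V} (hT : ∀ x y, K (T x) y = K x (T y))
    (n : ℕ) : ∀ W : Submodule ℂ V, Module.finrank ℂ W = n → (∀ w ∈ W, T w ∈ W) →
      (∃ x ∈ W, (K x x).re < 0) → ∃ y ≠ 0, ∃ z : ℂ, T y = z • y ∧ (K y y).re ≤ 0 := by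
  induction n using Nat.strong_induction_on with
  | _ n ih =>
    rintro W hWn hW ⟨x₀, hx₀, hneg⟩
    have hx0 : x₀ ≠ 0 := by rintro rfl; simp at hneg
    have : Nontrivial W := ⟨⟨x₀, hx₀⟩, 0, by simpa [Subtype.ext_iff] using hx0⟩
    obtain ⟨z, hz⟩ := Module.End.exists_eigenvalue (T.restrict hW)
    obtain ⟨y, hy⟩ := hz.exists_hasEigenvector
    have hy0 : (y : V) ≠ 0 := by simpa using hy.2
    have hTy : T y = z • (y : V) := by
      simpa [Subtype.ext_iff] using hy.apply_eq_smul
    by_cases hle : (K y y).re ≤ 0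
    · exact ⟨y, hy0, z, hTy, hle⟩
    push Not at hle
    have him : ∀ x, ((K x x).re : ℂ) = K x x := fun x => Complex.conj_eq_iff_re.1 (hK x x)
    have hne : K y y ≠ 0 := by
      intro h; rw [h] at hle; simp at hle
    refine ih (Module.finrank ℂ (W ⊓ (K y).ker : Submodule ℂ V)) ?_ (W ⊓ (K y).ker) rfl ?_ ?_
    · rw [← hWn]
      refine Submodule.finrank_lt_finrank_of_lt (lt_of_le_of_ne inf_le_left fun h => hne ?_)
      have : (y : V) ∈ W ⊓ (K y).ker := h.ge y.2
      exact this.2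
    · intro w hw
      refine ⟨hW w hw.1, ?_⟩
      have hw2 : K y w = 0 := hw.2
      change K y (T w) = 0
      rw [← hT, hTy, LinearMap.map_smulₛₗ, LinearMap.smul_apply, hw2, smul_zero]
    · refine ⟨x₀ - (K y x₀ / K y y) • (y : V), ⟨W.sub_mem hx₀ (W.smul_mem _ y.2), ?_⟩, ?_⟩
      · change K y _ = 0
        rw [map_sub, map_smul, smul_eq_mul, div_mul_cancel₀ _ hne, sub_self]
      · have e : K (x₀ - (K y x₀ / K y y) • (y : V)) (x₀ - (K y x₀ / K y y) • (y : V))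
            = K x₀ x₀ - K y x₀ * conj (K y x₀) / K y y := by
          simp only [map_sub, LinearMap.map_smulₛₗ, LinearMap.sub_apply, LinearMap.smul_apply,
            smul_eq_mul, map_div₀, hK, map_smul]
          field_simp
          ring
        rw [e, Complex.mul_conj, ← him y, ← Complex.ofReal_div, Complex.sub_re, Complex.ofReal_re]
        have : 0 ≤ Complex.normSq (K y x₀) / (K y y).re :=
            div_nonneg (Complex.normSq_nonneg _) hle.le
        linarith

theorem exists_pencil_eigenvector [FiniteDimensional ℂ V] (hK : ∀ x y, conj (K x y) = K y x)
    (hσ : ∀ x y, conj (σ x y) = σ y x) (hnd : ∀ y, (∀ x, σ y x = 0) → y = 0)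
    (hneg : ∃ x, (K x x).re < 0) :
    ∃ y ≠ 0, ∃ z : ℂ, (∀ x, K x y = z * σ x y) ∧ (K y y).re ≤ 0 := by
  have hinj : Function.Injective σ := fun a b hab => by
    rw [← sub_eq_zero]
    refine hnd _ fun x => ?_
    rw [map_sub, hab, sub_self, LinearMap.zero_apply]
  let s : V →ₗ[ℝ] (V →ₗ[ℂ] ℂ) :=
    { toFun := σ
      map_add' := map_add σ
      map_smul' := fun r x => by
        rw [← Complex.coe_smul, LinearMap.map_smulₛₗ, Complex.conj_ofReal, Complex.coe_smul]
        rfl }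
  have : FiniteDimensional ℝ V := FiniteDimensional.complexToReal V
  have : FiniteDimensional ℝ (V →ₗ[ℂ] ℂ) := FiniteDimensional.complexToReal _
  have hsurj : Function.Surjective σ := by
    refine (LinearMap.injective_iff_surjective_of_finrank_eq_finrank (f := s) ?_).1 hinj
    rw [finrank_real_of_complex, finrank_real_of_complex]
    congr 1
    exact (Subspace.dual_finrank_eq (K := ℂ) (V := V)).symm
  choose τ hτ using hsurj
  let T : V →ₗ[ℂ] V :=
    { toFun := fun y => τ (K y)
      map_add' := fun x y => hinj (by rw [map_add σ, hτ, hτ, hτ, map_add])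
      map_smul' := fun k x => hinj (by
        rw [LinearMap.map_smulₛₗ σ, hτ, hτ, LinearMap.map_smulₛₗ]; rfl) }
  have hT : ∀ y, σ (T y) = K y := fun y => hτ (K y)
  obtain ⟨x, hx⟩ := hneg
  obtain ⟨y, hy0, z, hy, hle⟩ := Submodule.exists_eigenvector_nonpos hK (T := T)
    (fun x y => by rw [← hK, ← hT y, hσ, hT]) _ ⊤ rfl (fun _ _ => trivial) ⟨x, trivial, hx⟩
  refine ⟨y, hy0, z, fun x => ?_, hle⟩
  rw [← hK, ← hT y, hy, LinearMap.map_smulₛₗ, LinearMap.smul_apply, smul_eq_mul, map_mul, hσ,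
    Complex.conj_conj]

end Pencil

theorem Complex.norm_sq_eq_add (w : ℂ) : ‖w‖ ^ 2 = w.re ^ 2 + w.im ^ 2 := by
  rw [Complex.sq_norm, Complex.normSq_apply, sq, sq]

namespace Test

/-- The weighted norm of a complex test function. -/
noncomputable def nC (ε R : ℝ) (a : Test ℂ) : ℝ :=
  √(nQ ε R (reT a) ^ 2 + nQ ε R (imT a) ^ 2)

theorem nC_nonneg (ε R : ℝ) (a : Test ℂ) : 0 ≤ nC ε R a := sqrt_nonneg _

theorem nC_sq (ε R : ℝ) (a : Test ℂ) :
    nC ε R a ^ 2 = nQ ε R (reT a) ^ 2 + nQ ε R (imT a) ^ 2 := sq_sqrt (by positivity)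

theorem norm_le_nC {ε R k : ℝ} (hk : 0 ≤ k) {w : ℂ} {a : Test ℂ}
    (hre : |w.re| ≤ k * nQ ε R (reT a)) (him : |w.im| ≤ k * nQ ε R (imT a)) :
    ‖w‖ ≤ k * nC ε R a := by
  refine le_of_sq_le_sq ?_ (mul_nonneg hk (nC_nonneg _ _ _))
  rw [Complex.norm_sq_eq_add, mul_pow, nC_sq]
  have h1 := pow_le_pow_left₀ (abs_nonneg _) hre 2
  have h2 := pow_le_pow_left₀ (abs_nonneg _) him 2
  rw [sq_abs, mul_pow] at h1 h2
  linarith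

theorem eq_zero_of_nQ {ε R : ℝ} (hR : 0 < R) {a : Test ℝ} (h : nQ ε R a = 0) : a = 0 := by
  by_contra hne
  have cQ : Continuous (QQ ε R) := by unfold QQ; fun_prop
  have ca := a.continuous
  have hQ : ∀ t, 0 < QQ ε R t := fun t => zero_lt_one.trans_le (Ctrl.one_le_QQ hR t)
  obtain ⟨t, ht⟩ : ∃ t, a t ≠ 0 := by
    by_contra! h0
    exact hne (Subtype.ext (funext h0))
  have hpos : 0 < ∫ t, QQ ε R t * a t ^ 2 :=
    Continuous.integral_pos_of_hasCompactSupport_nonneg_nonzero (by fun_prop)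
      ((a.supp.comp_left (g := fun x => x ^ 2) (by simp)).mul_left)
      (fun t => mul_nonneg (hQ t).le (sq_nonneg _))
      (x := t) (mul_ne_zero (hQ t).ne' (pow_ne_zero 2 ht))
  rw [← nQ_sq hR, h] at hpos
  simp at hpos

theorem eq_zero_of_re_im {a : Test ℂ} (h1 : reT a = 0) (h2 : imT a = 0) : a = 0 :=
  Subtype.ext <| funext fun t => Complex.ext
    (congrFun (congrArg Subtype.val h1) t) (congrFun (congrArg Subtype.val h2) t)

theorem eq_zero_of_nC {ε R : ℝ} (hR : 0 < R) {a : Test ℂ} (h : nC ε R a = 0) : a = 0 := by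
  have h1 := nC_sq ε R a
  rw [h] at h1
  have h2 := sq_nonneg (nQ ε R (reT a))
  have h3 := sq_nonneg (nQ ε R (imT a))
  exact eq_zero_of_re_im (eq_zero_of_nQ hR (pow_eq_zero_iff (two_ne_zero) |>.1 (by linarith)))
    (eq_zero_of_nQ hR (pow_eq_zero_iff (two_ne_zero) |>.1 (by linarith)))

theorem reT_ofR (u : Test ℝ) : reT (ofR u) = u := rfl

theorem imT_ofR (u : Test ℝ) : imT (ofR u) = 0 := rfl

theorem wt_ofR_re (W : C(ℝ, ℝ)) (u : Test ℝ) (a : Test ℂ) :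
    (wt W (ofR u) a).re = wt W u (reT a) := by
  rw [re_wt, reT_ofR, imT_ofR, map_zero, LinearMap.zero_apply, add_zero]

theorem imT_eq (a : Test ℂ) : imT a = reT ((-Complex.I) • a) :=
  Subtype.ext <| funext fun t => by simp [imT, reT]

theorem wt_ofR_im (W : C(ℝ, ℝ)) (u : Test ℝ) (a : Test ℂ) :
    (wt W (ofR u) a).im = wt W u (imT a) := by
  rw [imT_eq, ← wt_ofR_re, map_smul]; simp

theorem dir_ofR_re (u : Test ℝ) (a : Test ℂ) : (dir (ofR u) a).re = dir u (reT a) := by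
  simp only [dir_apply]
  rw [← RCLike.re_eq_complex_re, ← integral_re (integrable_dir _ a)]
  refine integral_congr_ae (Eventually.of_forall fun t => ?_)
  simp [deriv_reT, deriv_ofR]

theorem dir_ofR_im (u : Test ℝ) (a : Test ℂ) : (dir (ofR u) a).im = dir u (imT a) := by
  rw [imT_eq, ← dir_ofR_re, map_smul]; simp

end Test

namespace Frame

open Test

variable {p ε R c M : ℝ} {T : ℝ → ℝ} (F : Frame p ε R c M T)

theorem re_qm (a : Test ℂ) : (F.qm a a).re = F.qm (reT a) (reT a) + F.qm (imT a) (imT a) := by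
  simp only [qm, LinearMap.add_apply, Complex.add_re, re_dir, re_wt]; ring

theorem re_qp (a : Test ℂ) : (F.qp a a).re = F.qp (reT a) (reT a) + F.qp (imT a) (imT a) := by
  simp only [qp, LinearMap.add_apply, Complex.add_re, re_dir, re_wt]; ring

/-- The sesquilinear form of the linearised operator on pairs. -/
noncomputable def form (κ : ℝ) : (Test ℂ × Test ℂ) →ₗ⋆[ℂ] (Test ℂ × Test ℂ) →ₗ[ℂ] ℂ :=
  LinearMap.mk₂'ₛₗ _ _ (fun x y => F.qp x.1 y.1 + κ ^ 2 * wt 1 x.1 y.1 + F.qm x.2 y.2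
      + κ ^ 2 * wt 1 x.2 y.2 + 2 * κ * (wt F.vc x.1 y.2 + wt F.vc x.2 y.1))
    (fun x x' y => by simp only [Prod.fst_add, Prod.snd_add, map_add, LinearMap.add_apply]; ring)
    (fun k x y => by
      simp only [Prod.smul_fst, Prod.smul_snd, LinearMap.map_smulₛₗ, LinearMap.smul_apply,
        smul_eq_mul]; ring)
    (fun x y y' => by simp only [Prod.fst_add, Prod.snd_add, map_add]; ring)
    (fun k x y => by
      simp only [Prod.smul_fst, Prod.smul_snd, map_smul, smul_eq_mul, RingHom.id_apply]; ring)

theorem form_apply (κ : ℝ) (x y : Test ℂ × Test ℂ) :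
    F.form κ x y = F.qp x.1 y.1 + κ ^ 2 * wt 1 x.1 y.1 + F.qm x.2 y.2
      + κ ^ 2 * wt 1 x.2 y.2 + 2 * κ * (wt F.vc x.1 y.2 + wt F.vc x.2 y.1) := rfl

/-- The weight form on pairs. -/
noncomputable def wform (F : Frame p ε R c M T) :
    (Test ℂ × Test ℂ) →ₗ⋆[ℂ] (Test ℂ × Test ℂ) →ₗ[ℂ] ℂ :=
  LinearMap.mk₂'ₛₗ _ _ (fun x y => wt F.Ec x.1 y.2 + wt F.Ec x.2 y.1)
    (fun x x' y => by simp only [Prod.fst_add, Prod.snd_add, map_add, LinearMap.add_apply]; ring)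
    (fun k x y => by
      simp only [Prod.smul_fst, Prod.smul_snd, LinearMap.map_smulₛₗ, LinearMap.smul_apply,
        smul_eq_mul]; ring)
    (fun x y y' => by simp only [Prod.fst_add, Prod.snd_add, map_add]; ring)
    (fun k x y => by
      simp only [Prod.smul_fst, Prod.smul_snd, map_smul, smul_eq_mul, RingHom.id_apply]; ring)

theorem wform_apply (x y : Test ℂ × Test ℂ) :
    F.wform x y = wt F.Ec x.1 y.2 + wt F.Ec x.2 y.1 := rfl

theorem conj_form (κ : ℝ) (x y : Test ℂ × Test ℂ) : conj (F.form κ x y) = F.form κ y x := by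
  simp only [form_apply, qp, qm, LinearMap.add_apply, map_add, map_mul, map_pow, conj_wt, conj_dir,
    Complex.conj_ofReal, Complex.conj_ofNat]
  ring

theorem conj_wform (x y : Test ℂ × Test ℂ) : conj (F.wform x y) = F.wform y x := by
  simp only [wform_apply, map_add, conj_wt]
  ring

theorem re_form (κ : ℝ) (x : Test ℂ × Test ℂ) : (F.form κ x x).re =
    F.quad κ (reT x.1) (reT x.2) + F.quad κ (imT x.1) (imT x.2) := by
  have h : F.form κ x x = F.qp x.1 x.1 + ((κ ^ 2 : ℝ) : ℂ) * wt 1 x.1 x.1 + F.qm x.2 x.2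
      + ((κ ^ 2 : ℝ) : ℂ) * wt 1 x.2 x.2
      + ((2 * κ : ℝ) : ℂ) * (wt F.vc x.1 x.2 + wt F.vc x.2 x.1) := by
    rw [form_apply]; push_cast; rfl
  rw [h]
  simp only [Complex.add_re, Complex.re_ofReal_mul, re_qp, re_qm, re_wt, quad]
  rw [wt_comm F.vc (reT x.2), wt_comm F.vc (imT x.2)]
  ring

theorem exists_coercive {c M : ℝ} (hc : 0 < c) (hM : 1 ≤ M) : ∃ C > 0, ∃ δ > 0,
    ∀ (p ε R : ℝ) (T : ℝ → ℝ) (F : Frame p ε R c M T) (κ j : ℝ), 1 ≤ j → κ = j * ε → κ ≤ δ →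
      1 / j ≤ δ → ∀ x : Test ℂ × Test ℂ, (F.form κ x x).re ≤ 0 →
      κ * nC ε R x.1 ≤ C * ‖lin F.φc x.1‖ ∧ κ * ‖x.2 0‖ ≤ C * ‖lin F.φc x.1‖ ∧
      nC ε R (x.2 + (-(x.2 0)) • ofR F.φT) ≤ C * ‖lin F.φc x.1‖ := by
  obtain ⟨C, hC, δ, hδ, h⟩ := exists_coercive_real hc hM
  refine ⟨C, hC, δ, hδ, fun p ε R T F κ j hj hκj hκδ hjδ x hx => ?_⟩
  have hκ0 : 0 ≤ κ := by rw [hκj]; exact mul_nonneg (by linarith) F.ε_pos.le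
  obtain ⟨-, r1, r2, r3⟩ := h p ε R T F κ j hj hκj hκδ hjδ (reT x.1) (reT x.2)
  obtain ⟨-, i1, i2, i3⟩ := h p ε R T F κ j hj hκj hκδ hjδ (imT x.1) (imT x.2)
  rw [re_form] at hx
  have hn : ‖lin F.φc x.1‖ ^ 2 = lin F.φc (reT x.1) ^ 2 + lin F.φc (imT x.1) ^ 2 := by
    rw [Complex.norm_sq_eq_add, re_lin, im_lin]
  have hCx := mul_le_mul_of_nonneg_left hx hC.le
  have hCn : 0 ≤ C * ‖lin F.φc x.1‖ := by positivity
  have hre : reT (x.2 + (-(x.2 0)) • ofR F.φT) = reT x.2 + (-(reT x.2 0)) • F.φT :=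
    Subtype.ext <| funext fun t => by simp [reT, ofR]
  have him : imT (x.2 + (-(x.2 0)) • ofR F.φT) = imT x.2 + (-(imT x.2 0)) • F.φT :=
    Subtype.ext <| funext fun t => by simp [imT, ofR]
  refine ⟨le_of_sq_le_sq ?_ hCn, le_of_sq_le_sq ?_ hCn, le_of_sq_le_sq ?_ hCn⟩
  · rw [mul_pow, mul_pow, nC_sq, hn]
    linarith
  · have h0 : ‖x.2 0‖ ^ 2 = reT x.2 0 ^ 2 + imT x.2 0 ^ 2 := Complex.norm_sq_eq_add _
    rw [mul_pow, mul_pow, h0, hn]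
    linarith
  · rw [nC_sq, mul_pow, hn, hre, him]
    linarith

end Frame

/-- A perturbed pair of scalar relations forcing a non-real solution. -/
theorem exists_im_sq_lower {c M C : ℝ} (hc : 0 < c) (hM : 1 ≤ M) (hC : 0 < C) :
    ∃ δ > 0, ∃ ρ > 0, ∃ Z > 0, ∀ (N d Ω : ℝ) (B ζ e₁ e₂ e₃ e₄ : ℂ), c ≤ N → N ≤ M ^ 2 → c ≤ d →
      d ≤ M ^ 2 → 1 ≤ Ω → ‖B‖ ≤ C → ‖e₁‖ ≤ δ → ‖e₂‖ ≤ δ → ‖e₃‖ ≤ δ → ‖e₄‖ ≤ δ →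
      B * N + e₁ = ζ * (1 - e₂) → -(2 * (Ω : ℂ)) + e₃ = ζ * (B * d + e₄) →
      ρ ≤ ζ.im ^ 2 ∧ ‖ζ‖ ≤ Z := by
  have hM0 := zero_lt_one.trans_le hM
  set Z := 2 * C * M ^ 2 + 1 with hZ
  have hZ0 : 0 < Z := by positivity
  refine ⟨min (1 / 2) (c / (M ^ 2 * (1 + Z) ^ 2)), by positivity, c / M ^ 2, by positivity, Z,
    hZ0, ?_⟩
  intro N d Ω B ζ e₁ e₂ e₃ e₄ hN hN' hd hd' hΩ hB h1 h2 h3 h4 E1 E2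
  set δ := min (1 / 2) (c / (M ^ 2 * (1 + Z) ^ 2)) with hδ
  have hδ2 : δ ≤ 1 / 2 := min_le_left _ _
  have hδc : δ * (M ^ 2 * (1 + Z) ^ 2) ≤ c := by
    have := mul_le_mul_of_nonneg_right (min_le_right (1 / 2) (c / (M ^ 2 * (1 + Z) ^ 2)))
      (by positivity : 0 ≤ M ^ 2 * (1 + Z) ^ 2)
    refine this.trans_eq ?_
    field_simp
  have hδ0 : 0 ≤ δ := (norm_nonneg _).trans h1
  have hNn : ‖(N : ℂ)‖ ≤ M ^ 2 := by
    rwa [Complex.norm_real, norm_of_nonneg (hc.le.trans hN)]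
  have hdn : ‖(d : ℂ)‖ ≤ M ^ 2 := by
    rwa [Complex.norm_real, norm_of_nonneg (hc.le.trans hd)]
  have hζ : ‖ζ‖ ≤ Z := by
    have l1 : 1 / 2 ≤ ‖1 - e₂‖ := by
      have := norm_sub_norm_le (1 : ℂ) e₂
      rw [norm_one] at this
      linarith
    have l2 := mul_le_mul_of_nonneg_left l1 (norm_nonneg ζ)
    rw [← norm_mul, ← E1] at l2
    have l3 := norm_add_le (B * N) e₁
    have l4 : ‖B * N‖ ≤ C * M ^ 2 := by
      rw [norm_mul]; exact mul_le_mul hB hNn (norm_nonneg _) hC.le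
    linarith
  refine ⟨?_, hζ⟩
  set X : ℂ := N * e₃ + ζ * (ζ * e₂ + e₁) * d - ζ * N * e₄ with hX
  have e : ζ ^ 2 * d = -((2 * Ω * N : ℝ) : ℂ) + X := by
    rw [hX]; push_cast
    linear_combination (-ζ * d) * E1 - (N : ℂ) * E2
  have hXn : ‖X‖ ≤ c := by
    have l1 : ‖(N : ℂ) * e₃‖ ≤ M ^ 2 * δ := by
      rw [norm_mul]; exact mul_le_mul hNn h3 (norm_nonneg _) (by positivity)
    have l2 : ‖ζ * e₂ + e₁‖ ≤ Z * δ + δ := by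
      refine (norm_add_le _ _).trans (add_le_add ?_ h1)
      rw [norm_mul]; exact mul_le_mul hζ h2 (norm_nonneg _) hZ0.le
    have l3 : ‖ζ * (ζ * e₂ + e₁) * d‖ ≤ Z * (Z * δ + δ) * M ^ 2 := by
      rw [norm_mul, norm_mul]
      exact mul_le_mul (mul_le_mul hζ l2 (norm_nonneg _) hZ0.le) hdn (norm_nonneg _) (by positivity)
    have l4 : ‖ζ * N * e₄‖ ≤ Z * M ^ 2 * δ := by
      rw [norm_mul, norm_mul]
      exact mul_le_mul (mul_le_mul hζ hNn (norm_nonneg _) hZ0.le) h4 (norm_nonneg _)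
        (by positivity)
    have l5 := norm_sub_le (N * e₃ + ζ * (ζ * e₂ + e₁) * d) (ζ * N * e₄)
    have l6 := norm_add_le (N * e₃) (ζ * (ζ * e₂ + e₁) * d)
    linarith
  have hre := congrArg Complex.re e
  rw [Complex.add_re, Complex.neg_re, Complex.ofReal_re, mul_comm, Complex.re_ofReal_mul, sq,
    Complex.mul_re] at hre
  have l1 := (Complex.re_le_norm X).trans hXn
  have l2 : 1 * c ≤ Ω * N := mul_le_mul hΩ hN hc.le (by linarith)
  have hd0 : 0 ≤ d := hc.le.trans hd
  have l3 : d * ζ.im ^ 2 ≤ M ^ 2 * ζ.im ^ 2 := mul_le_mul_of_nonneg_right hd' (sq_nonneg _)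
  have l4 : 0 ≤ d * (ζ.re * ζ.re) := mul_nonneg hd0 (mul_self_nonneg _)
  rw [div_le_iff₀ (by positivity)]
  linarith

namespace Test

theorem norm_wt_ofR_le {ε R k : ℝ} (hk : 0 ≤ k) {W : C(ℝ, ℝ)} {u : Test ℝ}
    (h : ∀ a : Test ℝ, |wt W u a| ≤ k * nQ ε R a) (a : Test ℂ) :
    ‖wt W (ofR u) a‖ ≤ k * nC ε R a :=
  norm_le_nC hk (by rw [wt_ofR_re]; exact h _) (by rw [wt_ofR_im]; exact h _)

theorem nC_ofR (ε R : ℝ) (u : Test ℝ) : nC ε R (ofR u) = nQ ε R u := by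
  have : nQ ε R (imT (ofR u)) = 0 := by rw [imT_ofR]; simp [nQ]
  rw [nC, this, reT_ofR]
  simp [sqrt_sq (nQ_nonneg ε R u)]

theorem wt_ofR_ofR (W : C(ℝ, ℝ)) (u v : Test ℝ) : wt W (ofR u) (ofR v) = (wt W u v : ℝ) :=
  Complex.ext (by rw [wt_ofR_re, reT_ofR, Complex.ofReal_re])
    (by rw [wt_ofR_im, imT_ofR, map_zero, Complex.ofReal_im])

end Test

namespace Frame

open Test

variable {p ε R c M : ℝ} {T : ℝ → ℝ} (F : Frame p ε R c M T)

theorem M_nonneg (F : Frame p ε R c M T) : 0 ≤ M := zero_le_one.trans F.one_le_M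

theorem norm_qm_φ_le (a : Test ℂ) : ‖F.qm (ofR F.φT) a‖ ≤ M * ε ^ 2 * nC ε R a := by
  have hM := F.M_nonneg
  refine norm_le_nC (by positivity) ?_ ?_
  · have : (F.qm (ofR F.φT) a).re = F.qm F.φT (reT a) := by
      simp only [qm, LinearMap.add_apply, Complex.add_re, dir_ofR_re, wt_ofR_re]
    rw [this, F.qm_φ]; exact F.abs_lin_rφ_le _
  · have : (F.qm (ofR F.φT) a).im = F.qm F.φT (imT a) := by
      simp only [qm, LinearMap.add_apply, Complex.add_im, dir_ofR_im, wt_ofR_im]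
    rw [this, F.qm_φ]; exact F.abs_lin_rφ_le _

theorem norm_qp_A_le (a : Test ℂ) :
    ‖F.qp (ofR F.AT) a + 2 * ((1 + R : ℝ) : ℂ) * lin F.φc a‖ ≤ M * ε * nC ε R a := by
  have hM := F.M_nonneg
  have hε := F.ε_pos
  have e : F.qp (ofR F.AT) a + 2 * ((1 + R : ℝ) : ℂ) * lin F.φc a
      = F.qp (ofR F.AT) a + ((2 * (1 + R) : ℝ) : ℂ) * lin F.φc a := by push_cast; ring
  rw [e]
  refine norm_le_nC (by positivity) ?_ ?_
  · have : (F.qp (ofR F.AT) a).re = F.qp F.AT (reT a) := by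
      simp only [qp, LinearMap.add_apply, Complex.add_re, dir_ofR_re, wt_ofR_re]
    rw [Complex.add_re, this, F.qp_A, Complex.re_ofReal_mul, re_lin]
    convert F.abs_lin_rA_le (reT a) using 2; ring
  · have : (F.qp (ofR F.AT) a).im = F.qp F.AT (imT a) := by
      simp only [qp, LinearMap.add_apply, Complex.add_im, dir_ofR_im, wt_ofR_im]
    rw [Complex.add_im, this, F.qp_A, Complex.im_ofReal_mul, im_lin]
    convert F.abs_lin_rA_le (imT a) using 2; ring

theorem wt_one_ofR_φ (a : Test ℂ) : wt 1 (ofR F.φT) a = lin F.φc a :=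
  Complex.ext (by rw [wt_ofR_re, re_lin, F.lin_φ]) (by rw [wt_ofR_im, im_lin, F.lin_φ])

theorem wt_Ec (a b : Test ℂ) : wt F.Ec a b = wt 1 a b - wt F.vc a b := by
  have : (1 : C(ℝ, ℝ)) = F.vc + F.Ec := by simp [vc]
  rw [this, wt_add]; ring

theorem norm_lin_φ_le (a : Test ℂ) : ‖lin F.φc a‖ ≤ M * nC ε R a := by
  rw [← F.wt_one_ofR_φ]
  exact norm_wt_ofR_le F.M_nonneg (fun a => by rw [← F.lin_φ]; exact F.abs_lin_φ_le a) a

theorem norm_wt_one_A_le (a : Test ℂ) : ‖wt 1 (ofR F.AT) a‖ ≤ M * nC ε R a :=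
  norm_wt_ofR_le F.M_nonneg (fun a => by
    rw [wt_real]; simpa [coe_AT] using F.bA a a.continuous a.supp) a

theorem norm_wt_vc_φ_le (a : Test ℂ) : ‖wt F.vc (ofR F.φT) a‖ ≤ M * ε * nC ε R a :=
  norm_wt_ofR_le (mul_nonneg F.M_nonneg F.ε_pos.le) F.abs_wt_vc_φ_le a

theorem norm_wt_vc_A_le (a : Test ℂ) : ‖wt F.vc (ofR F.AT) a‖ ≤ M * ε * nC ε R a :=
  norm_wt_ofR_le (mul_nonneg F.M_nonneg F.ε_pos.le) F.abs_wt_vc_A_le a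

theorem wt_φφ_le : wt 1 F.φT F.φT ≤ M ^ 2 := by
  rw [← F.lin_φ, sq]
  exact ((le_abs_self _).trans (F.abs_lin_φ_le _)).trans
    (mul_le_mul_of_nonneg_left F.nQ_φ F.M_nonneg)

theorem lin_φA_le : lin F.φc F.AT ≤ M ^ 2 := by
  rw [sq]
  exact ((le_abs_self _).trans (F.abs_lin_φ_le _)).trans
    (mul_le_mul_of_nonneg_left F.nQ_A F.M_nonneg)

/-- A normalised solution of the weak equations against the approximate kernels is non-real. -/
theorem exists_nonreal {c M C : ℝ} (hc : 0 < c) (hM : 1 ≤ M) (hC : 0 < C) :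
    ∃ δ > 0, ∃ ρ > 0, ∃ Z > 0, ∀ (p ε R : ℝ) (T : ℝ → ℝ) (F : Frame p ε R c M T) (κ j : ℝ), 1 ≤ j →
      κ = j * ε → κ ≤ δ → 1 / j ≤ δ → ∀ (y : Test ℂ × Test ℂ) (z : ℂ), lin F.φc y.1 = 1 →
      κ * nC ε R y.1 ≤ C → κ * ‖y.2 0‖ ≤ C → nC ε R (y.2 + (-(y.2 0)) • ofR F.φT) ≤ C →
      F.form κ (0, ofR F.φT) y = z * F.wform (0, ofR F.φT) y →
      F.form κ (ofR F.AT, 0) y = z * F.wform (ofR F.AT, 0) y →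
      ρ * κ ^ 2 ≤ z.im ^ 2 ∧ ‖z‖ ≤ Z * κ := by
  obtain ⟨δ₀, hδ₀, ρ, hρ, Z, hZ, key⟩ := exists_im_sq_lower hc hM hC
  have hM0 := zero_lt_one.trans_le hM
  refine ⟨min 1 (δ₀ / (6 * C * M ^ 2)), by positivity, ρ, hρ, Z, hZ, ?_⟩
  rintro p ε R T F κ j hj hκj hκδ hjδ ⟨a, b⟩ z hn ha hb0 hb1 E1 E2
  simp only at hn ha hb0 hb1
  set δ := min 1 (δ₀ / (6 * C * M ^ 2)) with hδ
  have hδ1 : δ ≤ 1 := min_le_left _ _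
  have hδ6 : 6 * (C * M ^ 2 * δ) ≤ δ₀ := by
    have := mul_le_mul_of_nonneg_left (min_le_right 1 (δ₀ / (6 * C * M ^ 2)))
      (by positivity : 0 ≤ 6 * C * M ^ 2)
    refine le_trans (le_of_eq ?_) (this.trans_eq ?_)
    · rw [← hδ]; ring
    · field_simp
  have hε := F.ε_pos
  have hκ : 0 < κ := by rw [hκj]; positivity
  have hεκ : ε = κ * (1 / j) := by rw [hκj]; field_simp
  have hj0 : 0 ≤ 1 / j := by positivity
  have hδ0 : 0 ≤ δ := hj0.trans hjδ
  have hεκδ : ε ≤ κ * δ := hεκ.trans_le (mul_le_mul_of_nonneg_left hjδ hκ.le)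
  have hεδ : ε ≤ δ := hεκδ.trans (mul_le_of_le_one_left hδ0 (hκδ.trans hδ1))
  set b₁ : Test ℂ := b + (-(b 0)) • ofR F.φT with hb₁
  have hb : b = b 0 • ofR F.φT + b₁ := by rw [hb₁]; module
  have hX0 := nC_nonneg ε R a
  have hY0 := nC_nonneg ε R b₁
  set X := nC ε R a with hX
  set Y := nC ε R b₁ with hY
  have hεX : ε * X ≤ δ * C := by
    have h1 := mul_le_mul_of_nonneg_right hεκδ hX0
    have h2 := mul_le_mul_of_nonneg_left ha hδ0
    linarith
  have hεY : ε * Y ≤ κ * (δ * C) := by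
    have : ε * Y ≤ κ * δ * C := mul_le_mul hεκδ hb1 hY0 (by positivity)
    linarith
  have hMM : M ≤ M ^ 2 := by nlinarith
  have hMδ : M * (C * δ) ≤ C * M ^ 2 * δ := by
    have := mul_le_mul_of_nonneg_right hMM (by positivity : 0 ≤ C * δ); linarith
  set N := wt 1 F.φT F.φT with hN
  set d := lin F.φc F.AT with hd
  have dA : wt 1 (ofR F.AT) (ofR F.φT) = (d : ℂ) := by
    rw [wt_ofR_ofR, wt_comm, ← F.lin_φ]
  -- the scaled remainders
  set e₁ : ℂ := F.qm (ofR F.φT) b / κ + κ * wt 1 (ofR F.φT) b₁ + 2 * wt F.vc (ofR F.φT) a with he₁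
  set e₂ : ℂ := wt F.vc (ofR F.φT) a with he₂
  set r : ℂ := F.qp (ofR F.AT) a + 2 * ((1 + R : ℝ) : ℂ) * lin F.φc a with hr
  set e₃ : ℂ := r + κ ^ 2 * wt 1 (ofR F.AT) a + 2 * κ * wt F.vc (ofR F.AT) b with he₃
  set e₄ : ℂ := κ * (wt 1 (ofR F.AT) b₁ - wt F.vc (ofR F.AT) b) with he₄
  have hκne : (κ : ℂ) ≠ 0 := by exact_mod_cast hκ.ne'
  have hκn : ‖(κ : ℂ)‖ = κ := by rw [Complex.norm_real, norm_of_nonneg hκ.le]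
  have n2 : ‖e₂‖ ≤ C * M ^ 2 * δ := by
    have h1 := F.norm_wt_vc_φ_le a
    have h2 := mul_le_mul_of_nonneg_left hεX hM0.le
    rw [← hX] at h1
    linarith
  have hvA : κ * ‖wt F.vc (ofR F.AT) b‖ ≤ 2 * (C * M ^ 2 * δ) := by
    have h1 := F.norm_wt_vc_A_le (ofR F.φT)
    have h2 := F.norm_wt_vc_A_le b₁
    rw [nC_ofR] at h1
    have h3 := mul_le_mul_of_nonneg_left F.nQ_φ (by positivity : 0 ≤ M * ε)
    have h4 : ‖wt F.vc (ofR F.AT) b‖ ≤ ‖b 0‖ * (M * ε * M) + M * ε * Y := by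
      conv_lhs => rw [hb]
      rw [map_add, map_smul, smul_eq_mul]
      refine (norm_add_le _ _).trans (add_le_add ?_ h2)
      rw [norm_mul]
      exact mul_le_mul_of_nonneg_left (h1.trans h3) (norm_nonneg _)
    have h5 := mul_le_mul_of_nonneg_left h4 hκ.le
    have h6 : κ * ‖b 0‖ * (M * M * ε) ≤ C * (M * M * δ) :=
      mul_le_mul hb0 (mul_le_mul_of_nonneg_left hεδ (by positivity)) (by positivity) hC.le
    have h7 : ε * Y ≤ δ * C := mul_le_mul hεδ hb1 hY0 hδ0
    have h8 : κ * (M * (ε * Y)) ≤ 1 * (M * (δ * C)) :=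
      mul_le_mul (hκδ.trans hδ1) (mul_le_mul_of_nonneg_left h7 hM0.le) (by positivity) zero_le_one
    linarith
  have n1 : ‖e₁‖ ≤ 5 * (C * M ^ 2 * δ) := by
    have h1 := F.norm_qm_φ_le (ofR F.φT)
    have h2 := F.norm_qm_φ_le b₁
    rw [nC_ofR] at h1
    have h3 := mul_le_mul_of_nonneg_left F.nQ_φ (by positivity : 0 ≤ M * ε ^ 2)
    have h4 : ‖F.qm (ofR F.φT) b‖ ≤ ‖b 0‖ * (M * ε ^ 2 * M) + M * ε ^ 2 * Y := by
      conv_lhs => rw [hb]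
      rw [map_add, map_smul, smul_eq_mul]
      refine (norm_add_le _ _).trans (add_le_add ?_ h2)
      rw [norm_mul]
      exact mul_le_mul_of_nonneg_left (h1.trans h3) (norm_nonneg _)
    have h5 : ‖F.qm (ofR F.φT) b / κ‖ ≤ 2 * (C * M ^ 2 * δ) := by
      rw [norm_div, hκn, div_le_iff₀ hκ]
      refine h4.trans ?_
      have h62 : ‖b 0‖ * (ε * ε) ≤ C * (κ * δ) := by
        have h63 : ‖b 0‖ * (ε * ε) * κ ≤ C * (κ * δ) * κ := by
          have h64 : κ * ‖b 0‖ * (ε * ε) ≤ C * ((κ * δ) * (κ * δ)) :=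
            mul_le_mul hb0 (mul_le_mul hεκδ hεκδ hε.le (by positivity)) (by positivity) hC.le
          have h65 : δ * δ ≤ 1 * δ := mul_le_mul_of_nonneg_right hδ1 hδ0
          have h66 := mul_le_mul_of_nonneg_left h65 (by positivity : 0 ≤ C * κ * κ)
          linarith
        exact le_of_mul_le_mul_right h63 hκ
      have h7 := mul_le_mul_of_nonneg_left h62 (by positivity : 0 ≤ M * M)
      have h8 : ε * (ε * Y) ≤ 1 * (κ * (δ * C)) :=
        mul_le_mul (hεδ.trans hδ1) hεY (by positivity) zero_le_one
      have h9 := mul_le_mul_of_nonneg_left h8 hM0.le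
      have h10 := mul_le_mul_of_nonneg_left hMδ hκ.le
      linarith
    have h6 : ‖(κ : ℂ) * wt 1 (ofR F.φT) b₁‖ ≤ C * M ^ 2 * δ := by
      rw [norm_mul, hκn, F.wt_one_ofR_φ]
      have h7 := F.norm_lin_φ_le b₁
      have h8 := mul_le_mul_of_nonneg_left hb1 hM0.le
      have h9 : κ * ‖lin F.φc b₁‖ ≤ δ * (M * C) :=
        mul_le_mul hκδ (h7.trans h8) (norm_nonneg _) hδ0
      linarith
    have h7 : ‖2 * e₂‖ ≤ 2 * (C * M ^ 2 * δ) := by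
      rw [norm_mul, Complex.norm_ofNat]; linarith
    rw [he₁]
    exact (norm_add₃_le).trans (by linarith)
  have n3 : ‖e₃‖ ≤ 6 * (C * M ^ 2 * δ) := by
    have h1 := F.norm_qp_A_le a
    have h2 := mul_le_mul_of_nonneg_left hεX hM0.le
    have h3 : ‖(κ : ℂ) ^ 2 * wt 1 (ofR F.AT) a‖ ≤ C * M ^ 2 * δ := by
      rw [norm_mul, norm_pow, hκn]
      have h4 := mul_le_mul_of_nonneg_left (F.norm_wt_one_A_le a) hκ.le
      have h5 := mul_le_mul_of_nonneg_left ha hM0.le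
      have h6 : κ * ‖wt 1 (ofR F.AT) a‖ ≤ M * C := by linarith
      have h7 : κ * (κ * ‖wt 1 (ofR F.AT) a‖) ≤ δ * (M * C) :=
        mul_le_mul hκδ h6 (by positivity) hδ0
      linarith
    have h4 : ‖2 * (κ : ℂ) * wt F.vc (ofR F.AT) b‖ ≤ 4 * (C * M ^ 2 * δ) := by
      rw [norm_mul, norm_mul, hκn, Complex.norm_ofNat]; linarith
    rw [← hr, ← hX] at h1
    rw [he₃]
    exact (norm_add₃_le).trans (by linarith)
  have n4 : ‖e₄‖ ≤ 3 * (C * M ^ 2 * δ) := by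
    have h1 := F.norm_wt_one_A_le b₁
    have h2 := mul_le_mul_of_nonneg_left hb1 hM0.le
    have h3 : κ * ‖wt 1 (ofR F.AT) b₁‖ ≤ δ * (M * C) :=
      mul_le_mul hκδ (h1.trans h2) (norm_nonneg _) hδ0
    rw [he₄, norm_mul, hκn]
    have h4 := mul_le_mul_of_nonneg_left
      (norm_sub_le (wt 1 (ofR F.AT) b₁) (wt F.vc (ofR F.AT) b)) hκ.le
    linarith
  have hδp : 0 ≤ C * M ^ 2 * δ := by positivity
  have R1 : (κ * b 0) * (N : ℂ) + e₁ = (z / κ) * (1 - e₂) := by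
    have h1 : wt 1 (ofR F.φT) b = b 0 * N + wt 1 (ofR F.φT) b₁ := by
      conv_lhs => rw [hb]
      rw [map_add, map_smul, smul_eq_mul, wt_ofR_ofR]
    simp only [form_apply, wform_apply, map_zero, LinearMap.zero_apply, F.wt_Ec, h1] at E1
    rw [F.wt_one_ofR_φ a, hn, ← he₂] at E1
    rw [he₁]
    field_simp
    linear_combination E1
  have R2 : -(2 * ((1 + R : ℝ) : ℂ)) + e₃ = (z / κ) * ((κ * b 0) * (d : ℂ) + e₄) := by
    have h1 : wt 1 (ofR F.AT) b = b 0 * d + wt 1 (ofR F.AT) b₁ := by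
      conv_lhs => rw [hb]
      rw [map_add, map_smul, smul_eq_mul, dA]
    simp only [form_apply, wform_apply, map_zero, LinearMap.zero_apply, F.wt_Ec, h1] at E2
    rw [he₃, he₄, hr, hn]
    field_simp
    linear_combination E2
  obtain ⟨k1, k2⟩ := key N d (1 + R) (κ * b 0) (z / κ) e₁ e₂ e₃ e₄ F.wt_φφ F.wt_φφ_le F.lin_φA
    F.lin_φA_le (by linarith [F.R_pos]) (by rw [norm_mul, hκn]; exact hb0) (by linarith)
    (by linarith) (by linarith) (by linarith) R1 R2
  constructor
  · rw [Complex.div_ofReal_im, div_pow, le_div_iff₀ (by positivity)] at k1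
    exact k1
  · rw [norm_div, hκn, div_le_iff₀ hκ] at k2
    exact k2

end Frame

namespace Frame

open Test

variable {p ε R c M : ℝ} {T : ℝ → ℝ} (F : Frame p ε R c M T)

theorem dir_le_quad {κ : ℝ} (hκ : 0 ≤ κ) (a b : Test ℝ) :
    dir a a + dir b b ≤ F.quad κ a b
      + (2 + (|p| + 1) * M + 2 * κ * (1 + 1 / c)) * (nQ ε R a ^ 2 + nQ ε R b ^ 2) := by
  have hc := F.c_pos
  have hM := F.M_nonneg
  have hQ : ∀ t, 0 ≤ QQ ε R t := fun t => zero_le_one.trans (Ctrl.one_le_QQ F.R_pos t)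
  have h1 := (abs_le.1 (abs_wt_le (ε := ε) F.R_pos (W := F.Qc - p • F.Tc) (K := 1 + |p| * M)
    (by positivity) (fun t => by
      change |QQ ε R t - p * T t| ≤ _
      refine (abs_sub _ _).trans ?_
      rw [abs_of_nonneg (hQ t), abs_mul, abs_of_nonneg (F.T_nonneg t)]
      have := mul_le_mul_of_nonneg_left (F.T_le t) (abs_nonneg p)
      linarith) a a)).1
  have h2 := (abs_le.1 (abs_wt_le (ε := ε) F.R_pos (W := F.Qc - F.Tc) (K := 1 + M)
    (by positivity) (fun t => by
      change |QQ ε R t - T t| ≤ _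
      refine (abs_sub _ _).trans ?_
      rw [abs_of_nonneg (hQ t), abs_of_nonneg (F.T_nonneg t)]
      have := F.T_le t
      linarith) b b)).1
  have h3 := (abs_le.1 (F.abs_wt_vc_le a b)).1
  have h4 : nQ ε R a * nQ ε R b ≤ (nQ ε R a ^ 2 + nQ ε R b ^ 2) / 2 := by
    have := sq_nonneg (nQ ε R a - nQ ε R b); linarith
  have h5 := mul_le_mul_of_nonneg_left h4 (by positivity : 0 ≤ 1 + 1 / c)
  have h6 := mul_le_mul_of_nonneg_left (neg_le.1 (h3)) hκ
  have h7 := mul_le_mul_of_nonneg_left h5 hκ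
  have h8 := mul_nonneg (sq_nonneg κ) (wt_one_nonneg a)
  have h9 := mul_nonneg (sq_nonneg κ) (wt_one_nonneg b)
  have h10 : 0 ≤ (1 + |p| * M) * nQ ε R b ^ 2 := by positivity
  have h11 : 0 ≤ (1 + M) * nQ ε R a ^ 2 := by positivity
  rw [quad, qp, qm]
  simp only [LinearMap.add_apply]
  nlinarith

theorem re_dir_le_form {κ : ℝ} (hκ : 0 ≤ κ) (x : Test ℂ × Test ℂ) :
    (dir x.1 x.1).re + (dir x.2 x.2).re ≤ (F.form κ x x).re
      + (2 + (|p| + 1) * M + 2 * κ * (1 + 1 / c)) * (nC ε R x.1 ^ 2 + nC ε R x.2 ^ 2) := by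
  have h1 := F.dir_le_quad hκ (reT x.1) (reT x.2)
  have h2 := F.dir_le_quad hκ (imT x.1) (imT x.2)
  rw [re_form, re_dir, re_dir, nC_sq, nC_sq]
  linarith

theorem eq_zero_of_wt_Ec {a : Test ℂ} (h : (wt F.Ec a a).re ≤ 0) : a = 0 := by
  have key : ∀ u : Test ℝ, 0 ≤ wt F.Ec u u ∧ (wt F.Ec u u = 0 → u = 0) := fun u => by
    have h1 : wt F.Ec u u = nQ ε 1 u ^ 2 - wt 1 u u := by
      have hw : wt (1 + F.Ec) u u = wt 1 u u + wt F.Ec u u := wt_add _ _ _ _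
      rw [nQ_sq_eq one_pos (1 + F.Ec) (fun t => by simp [QQ, Ec]) u, hw]; ring
    have h0 : wt F.Ec u u = ∫ t, exp (2 * ε * t) * u t * u t := wt_real _ _ _
    refine ⟨?_, fun h2 => ?_⟩
    · rw [h0]
      exact integral_nonneg fun t => by
        rw [mul_assoc]; exact mul_nonneg (exp_pos _).le (mul_self_nonneg _)
    · by_contra hne
      obtain ⟨t, ht⟩ : ∃ t, u t ≠ 0 := by
        by_contra! h0
        exact hne (Subtype.ext (funext h0))
      have cu := u.continuous
      have hpos : 0 < ∫ t, exp (2 * ε * t) * u t * u t :=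
        Continuous.integral_pos_of_hasCompactSupport_nonneg_nonzero (by fun_prop)
          (u.supp.mul_left)
          (fun t => by rw [mul_assoc]; exact mul_nonneg (exp_pos _).le (mul_self_nonneg _))
          (x := t) (by simp [ht])
      linarith
  rw [re_wt] at h
  obtain ⟨h1, h1'⟩ := key (reT a)
  obtain ⟨h2, h2'⟩ := key (imT a)
  exact eq_zero_of_re_im (h1' (by linarith)) (h2' (by linarith))

theorem form_A_re_neg {κ : ℝ} (hε : ε ≤ κ) (hκ : κ ≤ 1) (hκc : 2 * (M ^ 2 * κ) < 2 * c) :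
    (F.form κ (ofR F.AT, 0) (ofR F.AT, 0)).re < 0 := by
  have hM := F.M_nonneg
  have hκ0 : 0 ≤ κ := F.ε_pos.le.trans hε
  have h0 : F.form κ (ofR F.AT, 0) (ofR F.AT, 0)
      = F.qp (ofR F.AT) (ofR F.AT) + ((κ ^ 2 : ℝ) : ℂ) * wt 1 (ofR F.AT) (ofR F.AT) := by
    simp [form_apply]
  rw [h0, Complex.add_re, Complex.re_ofReal_mul, re_qp, reT_ofR, imT_ofR, map_zero, wt_ofR_re,
    reT_ofR, F.qp_A, add_zero]
  have h1 := F.lin_φA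
  have h2 := (le_abs_self _).trans (F.abs_lin_rA_le F.AT)
  have h3 : wt 1 F.AT F.AT ≤ M * nQ ε R F.AT := by
    rw [wt_real]; simpa [coe_AT] using (le_abs_self _).trans (F.bA F.AT F.AT.continuous F.AT.supp)
  have h4 := mul_le_mul_of_nonneg_left F.nQ_A hM
  have h5 := mul_le_mul_of_nonneg_left (h3.trans h4) (sq_nonneg κ)
  have h6 : M * ε * nQ ε R F.AT ≤ M * κ * M :=
    mul_le_mul (mul_le_mul_of_nonneg_left hε hM) F.nQ_A (nQ_nonneg _ _ _) (by positivity)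
  have h7 : κ ^ 2 * (M * M) ≤ κ * (M * M) := by
    refine mul_le_mul_of_nonneg_right ?_ (by positivity)
    rw [sq]; exact mul_le_of_le_one_left hκ0 hκ
  have h8 := mul_le_mul h1 (by linarith [F.R_pos] : (1 : ℝ) ≤ 1 + R) zero_le_one
    (F.c_pos.le.trans h1)
  nlinarith

theorem nC_add_le (hR : 0 < R) (a b : Test ℂ) : nC ε R (a + b) ^ 2 ≤
    2 * nC ε R a ^ 2 + 2 * nC ε R b ^ 2 := by
  have key : ∀ u v : Test ℝ, nQ ε R (u + v : Test ℝ) ^ 2 ≤ 2 * nQ ε R u ^ 2 + 2 * nQ ε R v ^ 2 :=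
    fun u v => by
      have h := pow_le_pow_left₀ (nQ_nonneg _ _ _) (nQ_add_le (ε := ε) hR u v) 2
      have := sq_nonneg (nQ ε R u - nQ ε R v)
      linarith
  have h1 : reT (a + b) = reT a + reT b := Subtype.ext <| funext fun t => by simp [reT]
  have h2 : imT (a + b) = imT a + imT b := Subtype.ext <| funext fun t => by simp [imT]
  rw [nC_sq, nC_sq, nC_sq, h1, h2]
  linarith [key (reT a) (reT b), key (imT a) (imT b)]

theorem nC_smul_ofR (w : ℂ) (u : Test ℝ) : nC ε R (w • ofR u) = ‖w‖ * nQ ε R u := by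
  have h1 : reT (w • ofR u) = w.re • u := Subtype.ext <| funext fun t => by simp [reT, ofR]
  have h2 : imT (w • ofR u) = w.im • u := Subtype.ext <| funext fun t => by simp [imT, ofR]
  refine (sq_eq_sq₀ (nC_nonneg _ _ _) (mul_nonneg (norm_nonneg _) (nQ_nonneg _ _ _))).1 ?_
  rw [nC_sq, h1, h2, nQ_smul, nQ_smul, mul_pow, mul_pow, mul_pow, sq_abs, sq_abs,
    Complex.norm_sq_eq_add]
  ring

theorem exists_eigenvector_on {c M : ℝ} (hc : 0 < c) (hM : 1 ≤ M) : ∃ C > 0, ∃ δ > 0,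
    ∀ (p ε R : ℝ) (T : ℝ → ℝ) (F : Frame p ε R c M T) (κ j : ℝ), 1 ≤ j → κ = j * ε → κ ≤ δ →
      1 / j ≤ δ → ∀ S : Set (Test ℂ), S.Finite → ofR F.φT ∈ S → ofR F.AT ∈ S →
      ∃ (y : Test ℂ × Test ℂ) (z : ℂ), lin F.φc y.1 = 1 ∧ (F.form κ y y).re ≤ 0 ∧
      κ * nC ε R y.1 ≤ C ∧ κ * ‖y.2 0‖ ≤ C ∧ nC ε R (y.2 + (-(y.2 0)) • ofR F.φT) ≤ C ∧
      ∀ u ∈ Submodule.span ℂ S, ∀ v ∈ Submodule.span ℂ S,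
        F.form κ (u, v) y = z * F.wform (u, v) y := by
  obtain ⟨C, hC, δ₀, hδ₀, hcoer⟩ := exists_coercive hc hM
  have hM0 : 0 < M := by linarith
  refine ⟨C, hC, min δ₀ (min 1 (c / (2 * M ^ 2))), lt_min hδ₀ (lt_min one_pos (by positivity)),
    fun p ε R T F κ j hj hκj hκδ hjδ S hS hφ hA => ?_⟩
  have hκδ₀ := hκδ.trans (min_le_left _ _)
  have hκ1 : κ ≤ 1 := hκδ.trans ((min_le_right _ _).trans (min_le_left _ _))
  have hκc : κ ≤ c / (2 * M ^ 2) := hκδ.trans ((min_le_right _ _).trans (min_le_right _ _))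
  have hεκ : ε ≤ κ := by rw [hκj]; exact le_mul_of_one_le_left F.ε_pos.le hj
  have hκ : 0 < κ := F.ε_pos.trans_le hεκ
  have hneg := F.form_A_re_neg hεκ hκ1 (by
    rw [le_div_iff₀ (by positivity)] at hκc; linarith)
  set W := Submodule.span ℂ S with hW
  have : FiniteDimensional ℂ W := FiniteDimensional.span_of_finite ℂ hS
  let ι : W × W →ₗ[ℂ] Test ℂ × Test ℂ := W.subtype.prodMap W.subtype
  let K : W × W →ₗ⋆[ℂ] W × W →ₗ[ℂ] ℂ := ((F.form κ).comp ι).compl₂ ι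
  let σ : W × W →ₗ⋆[ℂ] W × W →ₗ[ℂ] ℂ := (F.wform.comp ι).compl₂ ι
  have hK : ∀ x y, K x y = F.form κ (x.1, x.2) (y.1, y.2) := fun _ _ => rfl
  have hσ : ∀ x y, σ x y = F.wform (x.1, x.2) (y.1, y.2) := fun _ _ => rfl
  obtain ⟨y, hy0, z, hyz, hyneg⟩ := exists_pencil_eigenvector (V := W × W) (K := K) (σ := σ)
    (fun x y => by rw [hK, hK]; exact F.conj_form _ _ _)
    (fun x y => by rw [hσ, hσ]; exact F.conj_wform _ _)
    (fun y hy => by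
      have h := hy (y.2, y.1)
      rw [hσ, wform_apply] at h
      have h1 := congrArg Complex.re h
      rw [Complex.add_re, Complex.zero_re] at h1
      have hnn : ∀ a : Test ℂ, 0 ≤ (wt F.Ec a a).re := fun a => by
        by_contra! hlt
        have h0 := F.eq_zero_of_wt_Ec hlt.le
        rw [h0, map_zero] at hlt
        simp at hlt
      have e1 := F.eq_zero_of_wt_Ec (a := y.1) (by linarith [hnn y.2])
      have e2 := F.eq_zero_of_wt_Ec (a := y.2) (by linarith [hnn y.1])
      exact Prod.ext (Subtype.ext e1) (Subtype.ext e2))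
    ⟨(⟨_, Submodule.subset_span hA⟩, 0), by rw [hK]; exact hneg⟩
  rw [hK] at hyneg
  have hne : lin F.φc (y.1 : Test ℂ) ≠ 0 := by
    intro h0
    obtain ⟨h1, h2, h3⟩ := hcoer p ε R T F κ j hj hκj hκδ₀ (hjδ.trans (min_le_left _ _)) _ hyneg
    simp only [h0, norm_zero, mul_zero] at h1 h2 h3
    have e1 : (y.1 : Test ℂ) = 0 := eq_zero_of_nC F.R_pos
      (le_antisymm (nonpos_of_mul_nonpos_right h1 hκ) (nC_nonneg _ _ _))
    have e2 : (y.2 : Test ℂ) 0 = 0 := norm_le_zero_iff.1 (nonpos_of_mul_nonpos_right h2 hκ)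
    rw [e2, neg_zero, zero_smul, add_zero] at h3
    have e3 : (y.2 : Test ℂ) = 0 := eq_zero_of_nC F.R_pos (le_antisymm h3 (nC_nonneg _ _ _))
    exact hy0 (Prod.ext (Subtype.ext e1) (Subtype.ext e3))
  set k : ℂ := (lin F.φc (y.1 : Test ℂ))⁻¹ with hk
  set x : Test ℂ × Test ℂ := (y.1, y.2) with hx
  have hx1 : lin F.φc (k • x).1 = 1 := by
    rw [Prod.smul_fst, map_smul, smul_eq_mul, hk]; exact inv_mul_cancel₀ hne
  have hx2 : (F.form κ (k • x) (k • x)).re ≤ 0 := by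
    rw [map_smul, LinearMap.map_smulₛₗ, LinearMap.smul_apply, smul_eq_mul, smul_eq_mul, ← mul_assoc,
      Complex.mul_conj', ← Complex.ofReal_pow, Complex.re_ofReal_mul]
    exact mul_nonpos_of_nonneg_of_nonpos (sq_nonneg _) hyneg
  have h := hcoer p ε R T F κ j hj hκj hκδ₀ (hjδ.trans (min_le_left _ _)) _ hx2
  rw [hx1, norm_one, mul_one] at h
  refine ⟨k • x, z, hx1, hx2, h.1, h.2.1, h.2.2, fun u hu v hv => ?_⟩
  have := hyz (⟨u, hu⟩, ⟨v, hv⟩)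
  rw [hK, hσ] at this
  rw [map_smul, map_smul, smul_eq_mul, smul_eq_mul, this]
  ring

theorem exists_galerkin {c M : ℝ} (hc : 0 < c) (hM : 1 ≤ M) : ∃ δ > 0,
    ∀ (p ε R : ℝ) (T : ℝ → ℝ) (F : Frame p ε R c M T) (κ j : ℝ), 1 ≤ j → κ = j * ε → κ ≤ δ →
      1 / j ≤ δ → ∃ ρ > 0, ∃ B, ∀ S : Finset (Test ℂ), ∃ (y : Test ℂ × Test ℂ) (z : ℂ),
      lin F.φc y.1 = 1 ∧ (∀ u ∈ S, ∀ v ∈ S, F.form κ (u, v) y = z * F.wform (u, v) y) ∧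
      ρ ≤ z.im ^ 2 ∧ ‖z‖ ≤ B ∧ nC ε R y.1 ^ 2 ≤ B ∧ nC ε R y.2 ^ 2 ≤ B ∧
      (dir y.1 y.1).re ≤ B ∧ (dir y.2 y.2).re ≤ B := by
  obtain ⟨C, hC, δ₁, hδ₁, hev⟩ := exists_eigenvector_on hc hM
  obtain ⟨δ₂, hδ₂, ρ, hρ, Z, hZ, hnr⟩ := exists_nonreal hc hM hC
  refine ⟨min δ₁ δ₂, lt_min hδ₁ hδ₂, fun p ε R T F κ j hj hκj hκδ hjδ => ?_⟩
  have hεκ : ε ≤ κ := by rw [hκj]; exact le_mul_of_one_le_left F.ε_pos.le hj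
  have hκ : 0 < κ := F.ε_pos.trans_le hεκ
  set B₁ := (C / κ) ^ 2 with hB₁
  set B₂ := 2 * C ^ 2 + 2 * (C / κ * M) ^ 2 with hB₂
  set L := 2 + (|p| + 1) * M + 2 * κ * (1 + 1 / c) with hL
  have hM0 := F.M_nonneg
  have hL0 : 0 ≤ L := by positivity
  refine ⟨ρ * κ ^ 2, by positivity, Z * κ + B₁ + B₂ + L * (B₁ + B₂), fun S => ?_⟩
  obtain ⟨y, z, h1, h2, h3, h4, h5, h6⟩ := hev p ε R T F κ j hj hκj (hκδ.trans (min_le_left _ _))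
    (hjδ.trans (min_le_left _ _)) (insert (ofR F.φT) (insert (ofR F.AT) (S : Set (Test ℂ))))
    (((S.finite_toSet).insert _).insert _) (by simp) (by simp)
  obtain ⟨hρz, hzZ⟩ := hnr p ε R T F κ j hj hκj (hκδ.trans (min_le_right _ _))
    (hjδ.trans (min_le_right _ _)) y z h1 h3 h4 h5
    (h6 _ (Submodule.zero_mem _) _ (Submodule.subset_span (by simp)))
    (h6 _ (Submodule.subset_span (by simp)) _ (Submodule.zero_mem _))
  have b1 : nC ε R y.1 ^ 2 ≤ B₁ := by
    refine pow_le_pow_left₀ (nC_nonneg _ _ _) ?_ 2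
    rw [le_div_iff₀ hκ]; linarith
  have b2 : nC ε R y.2 ^ 2 ≤ B₂ := by
    have e : y.2 = (y.2 + (-(y.2 0)) • ofR F.φT) + (y.2 0) • ofR F.φT := by
      module
    have := nC_add_le (ε := ε) F.R_pos (y.2 + (-(y.2 0)) • ofR F.φT) ((y.2 0) • ofR F.φT)
    rw [← e, nC_smul_ofR] at this
    have q1 := pow_le_pow_left₀ (nC_nonneg _ _ _) h5 2
    have q2 : ‖y.2 0‖ ≤ C / κ := by rw [le_div_iff₀ hκ]; linarith
    have q3 := pow_le_pow_left₀ (by have := nQ_nonneg ε R F.φT; positivity)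
      (mul_le_mul q2 F.nQ_φ (nQ_nonneg _ _ _) (by positivity)) 2
    linarith
  have b3 := F.re_dir_le_form hκ.le y
  rw [← hL] at b3
  have b4 := mul_le_mul_of_nonneg_left (add_le_add b1 b2) hL0
  have hd : ∀ a : Test ℂ, 0 ≤ (dir a a).re := fun a => by
    rw [re_dir, dir_real, dir_real]
    exact add_nonneg (integral_nonneg fun _ => mul_self_nonneg _)
      (integral_nonneg fun _ => mul_self_nonneg _)
  have p1 : 0 ≤ B₁ := by positivity
  have p2 : 0 ≤ B₂ := by positivity
  have p3 : 0 ≤ Z * κ := by positivity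
  have p4 : 0 ≤ L * (B₁ + B₂) := by positivity
  refine ⟨y, z, h1, fun u hu v hv => h6 u (Submodule.subset_span ?_) v (Submodule.subset_span ?_),
    hρz, by linarith, by linarith, by linarith, by linarith [hd y.2], by linarith [hd y.1]⟩ <;>
  simp [hu, hv]

end Frame

section DuBoisReymond

theorem HasCompactSupport.exists_Icc {u : ℝ → ℝ} (hs : HasCompactSupport u) :
    ∃ L > 0, ∀ t, L ≤ |t| → u t = 0 := by
  obtain ⟨L, hL⟩ := hs.isCompact.isBounded.subset_closedBall 0
  refine ⟨max L 0 + 1, by positivity, fun t ht => image_eq_zero_of_notMem_tsupport fun hm => ?_⟩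
  have h1 := hL hm
  rw [mem_closedBall_zero_iff, norm_eq_abs] at h1
  linarith [le_max_left L 0]

theorem MeasureTheory.LocallyIntegrable.intervalIntegrable' {E : Type*} [NormedAddCommGroup E]
    {g : ℝ → E} (hg : LocallyIntegrable g) (a b : ℝ) : IntervalIntegrable g volume a b :=
  intervalIntegrable_iff.mpr <|
    (hg.integrableOn_isCompact isCompact_uIcc).mono_set Set.uIoc_subset_uIcc

theorem integral_eq_intervalIntegral_of_zero {u : ℝ → ℝ} {L : ℝ} (hL : 0 < L)
    (h : ∀ t, L ≤ |t| → u t = 0) : ∫ t, u t = ∫ t in (-L)..L, u t := by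
  rw [intervalIntegral.integral_of_le (by linarith),
    setIntegral_eq_integral_of_forall_compl_eq_zero]
  intro t ht
  refine h t ?_
  by_contra! hlt
  rw [abs_lt] at hlt
  exact ht ⟨hlt.1, hlt.2.le⟩

theorem integral_deriv_mul_primitive {g ψ : ℝ → ℝ} (hg : LocallyIntegrable g)
    (hψ : ContDiff ℝ 1 ψ) (hs : HasCompactSupport ψ) :
    ∫ t, deriv ψ t * ∫ s in (0:ℝ)..t, g s = -∫ t, ψ t * g t := by
  obtain ⟨L, hL, h0⟩ := hs.exists_Icc
  obtain ⟨L', hL', h0'⟩ := hs.deriv.exists_Icc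
  set A := max L L'
  have hA : 0 < A := hL.trans_le (le_max_left _ _)
  have z0 : ∀ t, A ≤ |t| → ψ t = 0 := fun t ht => h0 t ((le_max_left _ _).trans ht)
  have z1 : ∀ t, A ≤ |t| → deriv ψ t = 0 := fun t ht => h0' t ((le_max_right _ _).trans ht)
  rw [integral_eq_intervalIntegral_of_zero hA (fun t ht => by rw [z1 t ht, zero_mul]),
    integral_eq_intervalIntegral_of_zero hA (fun t ht => by rw [z0 t ht, zero_mul])]
  have a1 : AbsolutelyContinuousOnInterval ψ (-A) A :=
    hψ.contDiffOn.absolutelyContinuousOnInterval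
  have a2 : AbsolutelyContinuousOnInterval (fun t => ∫ s in (0:ℝ)..t, g s) (-A) A :=
    (hg.intervalIntegrable' _ _).absolutelyContinuousOnInterval_intervalIntegral
      (Set.mem_uIcc.2 (Or.inl ⟨by linarith, hA.le⟩))
  have h := a1.integral_mul_deriv_eq_deriv_mul a2
  rw [z0 A (by rw [abs_of_pos hA]), z0 (-A) (by rw [abs_neg, abs_of_pos hA])] at h
  have e : ∫ x in (-A)..A, ψ x * deriv (fun t => ∫ s in (0:ℝ)..t, g s) x
      = ∫ x in (-A)..A, ψ x * g x := by
    refine intervalIntegral.integral_congr_ae ?_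
    filter_upwards [LocallyIntegrable.ae_hasDerivAt_integral hg] with x hx _
    rw [(hx 0).deriv]
  rw [e] at h
  linarith

theorem exists_ae_eq_primitive {f g : ℝ → ℝ} (hf : LocallyIntegrable f) (hg : LocallyIntegrable g)
    (h : ∀ ψ : ℝ → ℝ, ContDiff ℝ 1 ψ → HasCompactSupport ψ →
      ∫ t, deriv ψ t * f t = -∫ t, ψ t * g t) :
    ∃ c, ∀ᵐ t, f t = c + ∫ s in (0:ℝ)..t, g s := by
  set I : ℝ → ℝ := fun t => ∫ s in (0:ℝ)..t, g s with hI
  have cI : Continuous I := intervalIntegral.continuous_primitive hg.intervalIntegrable' 0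
  have lI : LocallyIntegrable I := cI.locallyIntegrable
  obtain ⟨η, hη, hηs, hη1⟩ : ∃ η : ℝ → ℝ, ContDiff ℝ 1 η ∧ HasCompactSupport η ∧ ∫ t, η t = 1 := by
    let b : ContDiffBump (0:ℝ) := default
    exact ⟨b.normed volume, b.contDiff_normed, b.hasCompactSupport_normed, b.integral_normed⟩
  have key : ∀ ψ : ℝ → ℝ, ContDiff ℝ 1 ψ → HasCompactSupport ψ →
      ∫ t, deriv ψ t * (f t - I t) = 0 := fun ψ hψ hs => by
    have cd := hψ.continuous_deriv le_rfl
    have i1 : Integrable fun t => deriv ψ t * f t := by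
      simpa using hf.integrable_smul_left_of_hasCompactSupport cd hs.deriv
    have i2 : Integrable fun t => deriv ψ t * I t := by
      simpa using lI.integrable_smul_left_of_hasCompactSupport cd hs.deriv
    simp only [mul_sub]
    rw [integral_sub i1 i2, h ψ hψ hs, integral_deriv_mul_primitive hg hψ hs, sub_self]
  set c := ∫ t, η t * (f t - I t) with hc
  refine ⟨c, ?_⟩
  have l : LocallyIntegrable fun t => f t - I t := hf.sub lI
  have := ae_eq_zero_of_integral_contDiff_smul_eq_zero
    (l.sub (locallyIntegrable_const (μ := volume) c)) (fun w hw hws => ?_)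
  · filter_upwards [this] with t ht
    have ht' : f t - I t - c = 0 := ht
    linarith
  have cw := hw.continuous
  have cη := hη.continuous
  set k := ∫ t, w t with hk
  have iw : Integrable w := cw.integrable_of_hasCompactSupport hws
  have iη : Integrable η := cη.integrable_of_hasCompactSupport hηs
  set u : ℝ → ℝ := fun t => w t - k * η t with hu
  have cu : Continuous u := by fun_prop
  have us : HasCompactSupport u := hws.sub hηs.mul_left
  have u0 : ∫ t, u t = 0 := by
    rw [hu, integral_sub iw (iη.const_mul k), integral_const_mul, hη1, hk]; ring
  obtain ⟨L, hL, hz⟩ := us.exists_Icc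
  set ψ : ℝ → ℝ := fun t => ∫ s in (-L)..t, u s with hψ
  have dψ : ∀ t, HasDerivAt ψ (u t) t := fun t =>
    intervalIntegral.integral_hasDerivAt_right (cu.intervalIntegrable _ _)
      cu.stronglyMeasurable.stronglyMeasurableAtFilter cu.continuousAt
  have dψ' : deriv ψ = u := funext fun t => (dψ t).deriv
  have cψ : ContDiff ℝ 1 ψ := contDiff_one_iff_deriv.2
    ⟨fun t => (dψ t).differentiableAt, by rw [dψ']; exact cu⟩
  have ψs : HasCompactSupport ψ := by
    refine HasCompactSupport.intro (isCompact_Icc (a := -L) (b := L)) fun t ht => ?_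
    have hvan : ∀ a b : ℝ, (∀ x ∈ Set.uIcc a b, L ≤ |x|) → ∫ s in a..b, u s = 0 := fun a b hab => by
      rw [intervalIntegral.integral_congr (g := fun _ => (0:ℝ)) fun x hx => hz x (hab x hx)]
      simp
    rcases lt_or_ge t (-L) with h1 | h1
    · refine hvan _ _ fun x hx => ?_
      rw [Set.uIcc_of_ge h1.le] at hx
      rw [abs_of_nonpos (by linarith [hx.2])]; linarith [hx.2]
    · have h2 : L < t := by by_contra! h2; exact ht ⟨h1, h2⟩
      rw [hψ]; simp only
      rw [← intervalIntegral.integral_add_adjacent_intervals (b := L) (cu.intervalIntegrable _ _)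
        (cu.intervalIntegrable _ _), ← integral_eq_intervalIntegral_of_zero hL hz, u0, zero_add]
      refine hvan _ _ fun x hx => ?_
      rw [Set.uIcc_of_le h2.le] at hx
      rw [abs_of_nonneg (by linarith [hx.1])]; exact hx.1
  have hk0 := key ψ cψ ψs
  rw [dψ'] at hk0
  have i1 : Integrable fun t => w t * (f t - I t) := by
    simpa using l.integrable_smul_left_of_hasCompactSupport cw hws
  have i2 : Integrable fun t => η t * (f t - I t) := by
    simpa using l.integrable_smul_left_of_hasCompactSupport cη hηs
  have e1 : ∫ t, u t * (f t - I t) = (∫ t, w t * (f t - I t)) - k * c := by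
    rw [hc, ← integral_const_mul, ← integral_sub i1 (i2.const_mul k)]
    congr 1; funext t; simp only [hu]; ring
  have e2 : ∫ t, w t • (f t - I t - c) = (∫ t, w t * (f t - I t)) - k * c := by
    rw [hk, ← integral_mul_const, ← integral_sub i1 (iw.mul_const c)]
    congr 1; funext t; simp only [smul_eq_mul]; ring
  change ∫ t, w t • (f t - I t - c) = 0
  rw [e2, ← e1, hk0]

/-- The du Bois-Reymond lemma for complex-valued functions. -/
theorem exists_ae_eq_primitive_complex {f g : ℝ → ℂ} (hf : LocallyIntegrable f)
    (hg : LocallyIntegrable g)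
    (h : ∀ ψ : ℝ → ℝ, ContDiff ℝ 1 ψ → HasCompactSupport ψ →
      ∫ t, ((deriv ψ t : ℝ) : ℂ) * f t = -∫ t, (ψ t : ℂ) * g t) :
    ∃ c, ∀ᵐ t, f t = c + ∫ s in (0:ℝ)..t, g s := by
  have lre : ∀ {f : ℝ → ℂ}, LocallyIntegrable f → LocallyIntegrable fun t => (f t).re :=
    fun hf x => let ⟨s, hs, hi⟩ := hf x; ⟨s, hs, hi.re⟩
  have lim : ∀ {f : ℝ → ℂ}, LocallyIntegrable f → LocallyIntegrable fun t => (f t).im :=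
    fun hf x => let ⟨s, hs, hi⟩ := hf x; ⟨s, hs, hi.im⟩
  have int : ∀ {f : ℝ → ℂ} {u : ℝ → ℝ}, LocallyIntegrable f → Continuous u → HasCompactSupport u →
      Integrable fun t => (u t : ℂ) * f t := fun hf hu hs => by
    simpa using hf.integrable_smul_left_of_hasCompactSupport hu hs
  obtain ⟨c₁, h₁⟩ := exists_ae_eq_primitive (lre hf) (lre hg) fun ψ hψ hs => by
    have := congrArg Complex.re (h ψ hψ hs)
    rw [Complex.neg_re, ← RCLike.re_eq_complex_re,
      ← integral_re (int hf (hψ.continuous_deriv le_rfl) hs.deriv),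
      ← integral_re (int hg hψ.continuous hs)] at this
    simpa using this
  obtain ⟨c₂, h₂⟩ := exists_ae_eq_primitive (lim hf) (lim hg) fun ψ hψ hs => by
    have := congrArg Complex.im (h ψ hψ hs)
    rw [Complex.neg_im, ← RCLike.im_eq_complex_im,
      ← integral_im (int hf (hψ.continuous_deriv le_rfl) hs.deriv),
      ← integral_im (int hg hψ.continuous hs)] at this
    simpa using this
  refine ⟨⟨c₁, c₂⟩, ?_⟩
  filter_upwards [h₁, h₂] with t e₁ e₂
  have r1 : (∫ s in (0:ℝ)..t, g s).re = ∫ s in (0:ℝ)..t, (g s).re :=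
    ((Complex.reCLM.intervalIntegral_comp_comm (hg.intervalIntegrable' 0 t))).symm
  have r2 : (∫ s in (0:ℝ)..t, g s).im = ∫ s in (0:ℝ)..t, (g s).im :=
    ((Complex.imCLM.intervalIntegral_comp_comm (hg.intervalIntegrable' 0 t))).symm
  exact Complex.ext (by rw [Complex.add_re, r1, e₁]) (by rw [Complex.add_im, r2, e₂])

end DuBoisReymond

section WeakLimits

variable {ι : Type*}

theorem Ultrafilter.exists_weak_limit {H : Type*} [NormedAddCommGroup H] [InnerProductSpace ℂ H]
    [CompleteSpace H] (𝒰 : Ultrafilter ι) {x : ι → H} {B : ℝ} (hx : ∀ i, ‖x i‖ ≤ B) :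
    ∃ y : H, ∀ w : H, Tendsto (fun i => inner ℂ (x i) w) 𝒰 (nhds (inner ℂ y w)) := by
  let F : ι → WeakDual ℂ H := fun i => StrongDual.toWeakDual (InnerProductSpace.toDual ℂ H (x i))
  have hc := WeakDual.isCompact_closedBall (𝕜 := ℂ) (E := H) 0 B
  obtain ⟨f, -, hf⟩ := hc.ultrafilter_le_nhds (𝒰.map F) (le_principal_iff.2 <| by
    refine Filter.mem_map.2 (Filter.Eventually.of_forall fun i => ?_)
    change InnerProductSpace.toDual ℂ H (x i) ∈ Metric.closedBall 0 B
    rw [mem_closedBall_zero_iff, LinearIsometryEquiv.norm_map]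
    exact hx i)
  refine ⟨(InnerProductSpace.toDual ℂ H).symm (WeakDual.toStrongDual f), fun w => ?_⟩
  have h1 : Tendsto (fun i => F i w) 𝒰 (nhds (f w)) :=
    ((WeakDual.eval_continuous w).tendsto f).comp hf
  rw [InnerProductSpace.toDual_symm_apply]
  exact h1

theorem Ultrafilter.exists_weak_limit_L2 (𝒰 : Ultrafilter ι) {f : ι → ℝ → ℂ} {B : ℝ}
    (hf : ∀ i, MemLp (f i) 2) (hB : ∀ i, ∫ t, ‖f i t‖ ^ 2 ≤ B) :
    ∃ g : ℝ → ℂ, MemLp g 2 ∧ ∀ w : ℝ → ℂ, MemLp w 2 →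
      Tendsto (fun i => ∫ t, w t * f i t) 𝒰 (nhds (∫ t, w t * g t)) := by
  have hn : ∀ i, ‖(hf i).toLp‖ ≤ √B := fun i => by
    refine le_sqrt_of_sq_le ?_
    have h1 : ‖(hf i).toLp‖ ^ 2 = RCLike.re (inner ℂ (hf i).toLp (hf i).toLp) :=
      norm_sq_eq_re_inner _
    rw [h1, L2.inner_def, ← integral_re (L2.integrable_inner _ _)]
    refine le_of_eq_of_le (integral_congr_ae ?_) (hB i)
    filter_upwards [(hf i).coeFn_toLp] with t ht
    rw [ht, ← norm_sq_eq_re_inner]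
  obtain ⟨y, hy⟩ := 𝒰.exists_weak_limit (x := fun i => (hf i).toLp) hn
  refine ⟨y, Lp.memLp y, fun w hw => ?_⟩
  have hw' : MemLp (fun t => conj (w t)) 2 := hw.star
  have h := (Complex.continuous_conj.tendsto _).comp (hy hw'.toLp)
  have e : ∀ v : Lp ℂ 2 (volume : Measure ℝ), conj (inner ℂ v hw'.toLp) = ∫ t, w t * v t :=
    fun v => by
      rw [inner_conj_symm, L2.inner_def]
      refine integral_congr_ae ?_
      filter_upwards [hw'.coeFn_toLp] with t ht
      rw [ht, RCLike.inner_apply, RCLike.conj_conj, mul_comm]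
  rw [e] at h
  refine h.congr fun i => ?_
  rw [Function.comp_apply, e]
  refine integral_congr_ae ?_
  filter_upwards [(hf i).coeFn_toLp] with t ht
  rw [ht]

end WeakLimits

section Regularity

theorem MeasureTheory.LocallyIntegrable.continuous_mul' {u f : ℝ → ℂ} (hf : LocallyIntegrable f)
    (hu : Continuous u) : LocallyIntegrable fun t => u t * f t := by
  rw [← locallyIntegrableOn_univ] at hf ⊢
  exact hf.continuousOn_mul hu.continuousOn isOpen_univ.isLocallyClosed

theorem exists_hasDerivAt_of_weak {α₁ G G' : ℝ → ℂ} (hα : LocallyIntegrable α₁)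
    (hG : LocallyIntegrable G) (hGG : G =ᵐ[volume] G') (cG : Continuous G')
    (h : ∀ ψ : ℝ → ℝ, ContDiff ℝ 1 ψ → HasCompactSupport ψ →
      ∫ t, ((deriv ψ t : ℝ) : ℂ) * α₁ t = -∫ t, (ψ t : ℂ) * G t) :
    ∃ a' : ℝ → ℂ, α₁ =ᵐ[volume] a' ∧ ∀ t, HasDerivAt a' (G' t) t := by
  obtain ⟨c, hc⟩ := exists_ae_eq_primitive_complex hα hG h
  refine ⟨fun t => c + ∫ s in (0:ℝ)..t, G' s, ?_, fun t => ?_⟩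
  · filter_upwards [hc] with t ht
    rw [ht]
    congr 1
    refine intervalIntegral.integral_congr_ae ?_
    filter_upwards [hGG] with s hs _ using hs
  · exact (intervalIntegral.integral_hasDerivAt_right (cG.intervalIntegrable _ _)
      cG.stronglyMeasurable.stronglyMeasurableAtFilter cG.continuousAt).const_add c

/-- Weak solutions of a second order linear system with continuous coefficients are classical. -/
theorem exists_classical_of_weak {α α₁ β β₁ : ℝ → ℂ} (hα : LocallyIntegrable α)
    (hα₁ : LocallyIntegrable α₁) (hβ : LocallyIntegrable β) (hβ₁ : LocallyIntegrable β₁)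
    {w₁ w₂ w₃ : ℝ → ℂ} (c₁ : Continuous w₁) (c₂ : Continuous w₂) (c₃ : Continuous w₃)
    (d₁ : ∀ ψ : ℝ → ℝ, ContDiff ℝ 1 ψ → HasCompactSupport ψ →
      ∫ t, ((deriv ψ t : ℝ) : ℂ) * α t = -∫ t, (ψ t : ℂ) * α₁ t)
    (d₂ : ∀ ψ : ℝ → ℝ, ContDiff ℝ 1 ψ → HasCompactSupport ψ →
      ∫ t, ((deriv ψ t : ℝ) : ℂ) * β t = -∫ t, (ψ t : ℂ) * β₁ t)
    (e₁ : ∀ ψ : ℝ → ℝ, ContDiff ℝ 1 ψ → HasCompactSupport ψ →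
      ∫ t, ((deriv ψ t : ℝ) : ℂ) * α₁ t = -∫ t, (ψ t : ℂ) * (w₁ t * α t + w₂ t * β t))
    (e₂ : ∀ ψ : ℝ → ℝ, ContDiff ℝ 1 ψ → HasCompactSupport ψ →
      ∫ t, ((deriv ψ t : ℝ) : ℂ) * β₁ t = -∫ t, (ψ t : ℂ) * (w₃ t * β t + w₂ t * α t)) :
    ∃ a a' b b' : ℝ → ℂ, α =ᵐ[volume] a ∧ α₁ =ᵐ[volume] a' ∧ β =ᵐ[volume] b ∧ β₁ =ᵐ[volume] b' ∧
      (∀ t, HasDerivAt a (a' t) t) ∧ (∀ t, HasDerivAt b (b' t) t) ∧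
      (∀ t, HasDerivAt a' (w₁ t * a t + w₂ t * b t) t) ∧
      (∀ t, HasDerivAt b' (w₃ t * b t + w₂ t * a t) t) := by
  obtain ⟨k₁, hk₁⟩ := exists_ae_eq_primitive_complex hα hα₁ d₁
  obtain ⟨k₂, hk₂⟩ := exists_ae_eq_primitive_complex hβ hβ₁ d₂
  have ca : Continuous fun t => k₁ + ∫ s in (0:ℝ)..t, α₁ s :=
    continuous_const.add (intervalIntegral.continuous_primitive hα₁.intervalIntegrable' 0)
  have cb : Continuous fun t => k₂ + ∫ s in (0:ℝ)..t, β₁ s :=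
    continuous_const.add (intervalIntegral.continuous_primitive hβ₁.intervalIntegrable' 0)
  obtain ⟨a', ha', da'⟩ := exists_hasDerivAt_of_weak
    (G' := fun t => w₁ t * (k₁ + ∫ s in (0:ℝ)..t, α₁ s) + w₂ t * (k₂ + ∫ s in (0:ℝ)..t, β₁ s)) hα₁
    ((hα.continuous_mul' c₁).add (hβ.continuous_mul' c₂))
    (by filter_upwards [hk₁, hk₂] with t h1 h2; simp only [Pi.add_apply]; rw [h1, h2])
    ((c₁.mul ca).add (c₂.mul cb)) e₁
  obtain ⟨b', hb', db'⟩ := exists_hasDerivAt_of_weak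
    (G' := fun t => w₃ t * (k₂ + ∫ s in (0:ℝ)..t, β₁ s) + w₂ t * (k₁ + ∫ s in (0:ℝ)..t, α₁ s)) hβ₁
    ((hβ.continuous_mul' c₃).add (hα.continuous_mul' c₂))
    (by filter_upwards [hk₁, hk₂] with t h1 h2; simp only [Pi.add_apply]; rw [h1, h2])
    ((c₃.mul cb).add (c₂.mul ca)) e₂
  have prim : ∀ {u u' v : ℝ → ℂ} (k : ℂ), u =ᵐ[volume] u' → (∀ t, HasDerivAt u' (v t) t) → ∀ t,
      HasDerivAt (fun t => k + ∫ s in (0:ℝ)..t, u s) (u' t) t := fun {u u' v} k hu hd t => by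
    have cu : Continuous u' := continuous_iff_continuousAt.2 fun t => (hd t).continuousAt
    have e : (fun t => k + ∫ s in (0:ℝ)..t, u s) = fun t => k + ∫ s in (0:ℝ)..t, u' s := by
      funext t
      congr 1
      refine intervalIntegral.integral_congr_ae ?_
      filter_upwards [hu] with s hs _ using hs
    rw [e]
    exact (intervalIntegral.integral_hasDerivAt_right (cu.intervalIntegrable _ _)
      cu.stronglyMeasurable.stronglyMeasurableAtFilter cu.continuousAt).const_add k
  exact ⟨_, a', _, b', hk₁, ha', hk₂, hb', prim k₁ ha' da', prim k₂ hb' db', da', db'⟩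

end Regularity

namespace Test

theorem integral_norm_sq_deriv (a : Test ℂ) : ∫ t, ‖deriv a t‖ ^ 2 = (dir a a).re := by
  rw [dir_apply, ← Complex.ofReal_re (∫ t, ‖deriv a t‖ ^ 2), ← integral_complex_ofReal]
  congr 2; funext t
  rw [Complex.conj_mul', Complex.ofReal_pow]

theorem integral_QQ_norm_sq {ε R : ℝ} (hR : 0 < R) (a : Test ℂ) :
    ∫ t, QQ ε R t * ‖a t‖ ^ 2 = nC ε R a ^ 2 := by
  have cQ : Continuous (QQ ε R) := by unfold QQ; fun_prop
  have h : nC ε R a ^ 2 = (wt ⟨QQ ε R, cQ⟩ a a).re := by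
    rw [nC_sq, re_wt, nQ_sq_eq hR ⟨QQ ε R, cQ⟩ (fun _ => rfl),
      nQ_sq_eq hR ⟨QQ ε R, cQ⟩ (fun _ => rfl)]
  rw [h, wt_apply, ← Complex.ofReal_re (∫ t, QQ ε R t * ‖a t‖ ^ 2), ← integral_complex_ofReal]
  congr 2; funext t
  rw [Complex.conj_mul', Complex.ofReal_mul, Complex.ofReal_pow]
  rfl

theorem exists_weak_limit {ι : Type*} (𝒰 : Ultrafilter ι) {ε R B : ℝ} (hR : 0 < R)
    {a : ι → Test ℂ} (h₁ : ∀ i, nC ε R (a i) ^ 2 ≤ B) (h₂ : ∀ i, (dir (a i) (a i)).re ≤ B) :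
    ∃ α α₁ : ℝ → ℂ, LocallyIntegrable α ∧ LocallyIntegrable α₁ ∧
      Integrable (fun t => QQ ε R t * ‖α t‖ ^ 2) ∧ Integrable (fun t => ‖α₁ t‖ ^ 2) ∧
      (∀ w : ℝ → ℂ, Continuous w → HasCompactSupport w →
        Tendsto (fun i => ∫ t, w t * a i t) 𝒰 (nhds (∫ t, w t * α t))) ∧
      (∀ w : ℝ → ℂ, Continuous w → HasCompactSupport w →
        Tendsto (fun i => ∫ t, w t * deriv (a i) t) 𝒰 (nhds (∫ t, w t * α₁ t))) ∧
      ∀ ψ : ℝ → ℝ, ContDiff ℝ 1 ψ → HasCompactSupport ψ →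
        ∫ t, ((deriv ψ t : ℝ) : ℂ) * α t = -∫ t, (ψ t : ℂ) * α₁ t := by
  have cQ : Continuous (QQ ε R) := by unfold QQ; fun_prop
  have hQ : ∀ t, 0 < QQ ε R t := fun t => zero_lt_one.trans_le (Ctrl.one_le_QQ hR t)
  set s : ℝ → ℂ := fun t => ((√(QQ ε R t) : ℝ) : ℂ) with hs
  have cs : Continuous s := by fun_prop
  have s0 : ∀ t, s t ≠ 0 := fun t => by
    rw [hs]; simpa using (sqrt_pos.2 (hQ t)).ne'
  have ns : ∀ t (x : ℂ), ‖s t * x‖ ^ 2 = QQ ε R t * ‖x‖ ^ 2 := fun t x => by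
    rw [norm_mul, mul_pow, hs, Complex.norm_real, norm_eq_abs, sq_abs, sq_sqrt (hQ t).le]
  have cs' : Continuous fun t => (s t)⁻¹ := cs.inv₀ s0
  obtain ⟨g, hg, hlim⟩ := 𝒰.exists_weak_limit_L2 (f := fun i t => s t * a i t) (B := B)
    (fun i => (cs.mul (a i).continuous).memLp_of_hasCompactSupport (a i).supp.mul_left)
    (fun i => by simp only [ns]; rw [integral_QQ_norm_sq hR]; exact h₁ i)
  obtain ⟨α₁, hα₁, hlim₁⟩ := 𝒰.exists_weak_limit_L2 (f := fun i => deriv (a i)) (B := B)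
    (fun i => (a i).continuous_deriv.memLp_of_hasCompactSupport (a i).supp.deriv)
    (fun i => by rw [integral_norm_sq_deriv]; exact h₂ i)
  have lg : LocallyIntegrable g := hg.locallyIntegrable one_le_two
  have L : ∀ w : ℝ → ℂ, Continuous w → HasCompactSupport w →
      Tendsto (fun i => ∫ t, w t * a i t) 𝒰 (nhds (∫ t, w t * ((s t)⁻¹ * g t))) :=
    fun w cw hw => by
      have := hlim (fun t => w t * (s t)⁻¹)
        ((cw.mul cs').memLp_of_hasCompactSupport hw.mul_right)
      simp only [mul_assoc] at this
      refine this.congr fun i => ?_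
      congr 1; funext t
      rw [inv_mul_cancel_left₀ (s0 t)]
  have L₁ : ∀ w : ℝ → ℂ, Continuous w → HasCompactSupport w →
      Tendsto (fun i => ∫ t, w t * deriv (a i) t) 𝒰 (nhds (∫ t, w t * α₁ t)) :=
    fun w cw hw => hlim₁ w (cw.memLp_of_hasCompactSupport hw)
  refine ⟨fun t => (s t)⁻¹ * g t, α₁, lg.continuous_mul' cs', hα₁.locallyIntegrable one_le_two,
    ?_, (memLp_two_iff_integrable_sq_norm hα₁.1).1 hα₁, L, L₁, fun ψ hψ hψs => ?_⟩
  · refine ((memLp_two_iff_integrable_sq_norm hg.1).1 hg).congr (Eventually.of_forall fun t => ?_)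
    simp only
    rw [← ns, mul_inv_cancel_left₀ (s0 t)]
  · have cd := hψ.continuous_deriv le_rfl
    have cψ := hψ.continuous
    have t1 := L (fun t => ((deriv ψ t : ℝ) : ℂ)) (by fun_prop)
      (hψs.deriv.comp_left (g := Complex.ofReal) rfl)
    have t2 := (L₁ (fun t => (ψ t : ℂ)) (by fun_prop)
      (hψs.comp_left (g := Complex.ofReal) rfl)).neg
    refine tendsto_nhds_unique t1 (t2.congr fun i => ?_)
    have ca := (a i).continuous
    have cda := (a i).continuous_deriv
    have h := HasCompactSupport.integral_hasDerivAt_eq_zero (u := fun t => (ψ t : ℂ) * a i t)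
      (u' := fun t => ((deriv ψ t : ℝ) : ℂ) * a i t + (ψ t : ℂ) * deriv (a i) t)
      (a i).supp.mul_left
      (fun t => ((hψ.differentiable one_ne_zero t).hasDerivAt.ofReal_comp).mul
        ((a i).differentiableAt t).hasDerivAt) (by fun_prop)
    have i1 : Integrable fun t => ((deriv ψ t : ℝ) : ℂ) * a i t :=
      Continuous.integrable_of_hasCompactSupport (by fun_prop) (a i).supp.mul_left
    have i2 : Integrable fun t => (ψ t : ℂ) * deriv (a i) t :=
      Continuous.integrable_of_hasCompactSupport (by fun_prop) (a i).supp.deriv.mul_left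
    rw [integral_add i1 i2] at h
    linear_combination -h

end Test

namespace Frame

open Test

theorem exists_solution {c M : ℝ} (hc : 0 < c) (hM : 1 ≤ M) : ∃ δ > 0,
    ∀ (p ε R : ℝ) (T : ℝ → ℝ) (_ : Frame p ε R c M T) (κ j : ℝ), 1 ≤ j → κ = j * ε → κ ≤ δ →
      1 / j ≤ δ → ∃ z : ℂ, z.im ≠ 0 ∧ ∃ a a' b b' : ℝ → ℂ,
      (∀ t, HasDerivAt a (a' t) t) ∧ (∀ t, HasDerivAt b (b' t) t) ∧
      (∀ t, HasDerivAt a' (((QQ ε R t - p * T t + κ ^ 2 : ℝ) : ℂ) * a t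
        + (((2 * κ * (1 - exp (2 * ε * t)) : ℝ) : ℂ) - z * ((exp (2 * ε * t) : ℝ) : ℂ)) * b t) t) ∧
      (∀ t, HasDerivAt b' (((QQ ε R t - T t + κ ^ 2 : ℝ) : ℂ) * b t
        + (((2 * κ * (1 - exp (2 * ε * t)) : ℝ) : ℂ) - z * ((exp (2 * ε * t) : ℝ) : ℂ)) * a t) t) ∧
      Integrable (fun t => QQ ε R t * ‖a t‖ ^ 2) ∧ Integrable (fun t => ‖a' t‖ ^ 2) ∧
      Integrable (fun t => QQ ε R t * ‖b t‖ ^ 2) ∧ Integrable (fun t => ‖b' t‖ ^ 2) ∧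
      ∃ t, a t ≠ 0 := by
  obtain ⟨δ, hδ, hgal⟩ := exists_galerkin hc hM
  refine ⟨δ, hδ, fun p ε R T F κ j hj hκj hκδ hjδ => ?_⟩
  obtain ⟨ρ, hρ, B, hB⟩ := hgal p ε R T F κ j hj hκj hκδ hjδ
  choose y ζ g1 g2 g3 g4 g5 g6 g7 g8 using hB
  let 𝒰 : Ultrafilter (Finset (Test ℂ)) := Ultrafilter.of atTop
  have h𝒰 : (𝒰 : Filter (Finset (Test ℂ))) ≤ atTop := Ultrafilter.of_le atTop
  obtain ⟨α, α₁, lα, lα₁, iα, iα₁, tα, tα₁, dα⟩ :=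
    Test.exists_weak_limit 𝒰 F.R_pos (a := fun S => (y S).1) g5 g7
  obtain ⟨β, β₁, lβ, lβ₁, iβ, iβ₁, tβ, tβ₁, dβ⟩ :=
    Test.exists_weak_limit 𝒰 F.R_pos (a := fun S => (y S).2) g6 g8
  obtain ⟨z, -, hz⟩ := (isCompact_closedBall (0 : ℂ) B).ultrafilter_le_nhds (𝒰.map ζ)
    (le_principal_iff.2 <| Filter.mem_map.2 (Filter.Eventually.of_forall fun S => by
      rw [mem_closedBall_zero_iff]; exact g4 S))
  have tz : Tendsto ζ 𝒰 (nhds z) := hz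
  have hzim : ρ ≤ z.im ^ 2 :=
    ge_of_tendsto' (((Complex.continuous_im.pow 2).tendsto z).comp tz) g3
  have cT := F.contT
  have cQ : Continuous (QQ ε R) := by unfold QQ; fun_prop
  have twt : ∀ (W : C(ℝ, ℝ)) (ψ : Test ℝ) (f : ℝ → ℂ) (x : Finset (Test ℂ) → Test ℂ),
      (∀ w : ℝ → ℂ, Continuous w → HasCompactSupport w →
        Tendsto (fun i => ∫ t, w t * x i t) 𝒰 (nhds (∫ t, w t * f t))) →
      Tendsto (fun i => wt W (ofR ψ) (x i)) 𝒰 (nhds (∫ t, (ψ t : ℂ) * ((W t : ℂ) * f t))) :=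
    fun W ψ f x hx => by
      have cψ := ψ.continuous
      have h := hx (fun t => (ψ t : ℂ) * (W t : ℂ)) (by fun_prop)
        (HasCompactSupport.mul_right (ψ.supp.comp_left (g := Complex.ofReal) rfl))
      simp only [mul_assoc] at h
      refine h.congr fun i => ?_
      rw [wt_apply]
      congr 1; funext t
      have : conj ((ofR ψ) t) = (ψ t : ℂ) := Complex.conj_ofReal _
      rw [this]
      exact mul_left_comm _ _ _
  have tdir : ∀ (ψ : Test ℝ) (f : ℝ → ℂ) (x : Finset (Test ℂ) → Test ℂ),
      (∀ w : ℝ → ℂ, Continuous w → HasCompactSupport w →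
        Tendsto (fun i => ∫ t, w t * deriv (x i) t) 𝒰 (nhds (∫ t, w t * f t))) →
      Tendsto (fun i => dir (ofR ψ) (x i)) 𝒰
        (nhds (∫ t, ((deriv (ψ : ℝ → ℝ) t : ℝ) : ℂ) * f t)) :=
    fun ψ f x hx => by
      have cψ := ψ.continuous_deriv
      refine (hx (fun t => ((deriv (ψ : ℝ → ℝ) t : ℝ) : ℂ)) (by fun_prop)
        (ψ.supp.deriv.comp_left (g := Complex.ofReal) rfl)).congr fun i => ?_
      rw [dir_apply]
      congr 1; funext t
      rw [deriv_ofR, Complex.conj_ofReal]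
  have combine : ∀ (W : C(ℝ, ℝ)) (ψ : Test ℝ) (f f₁ g : ℝ → ℂ)
      (x x' : Finset (Test ℂ) → Test ℂ), LocallyIntegrable f → LocallyIntegrable g →
      (∀ w : ℝ → ℂ, Continuous w → HasCompactSupport w →
        Tendsto (fun i => ∫ t, w t * x i t) 𝒰 (nhds (∫ t, w t * f t))) →
      (∀ w : ℝ → ℂ, Continuous w → HasCompactSupport w →
        Tendsto (fun i => ∫ t, w t * deriv (x i) t) 𝒰 (nhds (∫ t, w t * f₁ t))) →
      (∀ w : ℝ → ℂ, Continuous w → HasCompactSupport w →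
        Tendsto (fun i => ∫ t, w t * x' i t) 𝒰 (nhds (∫ t, w t * g t))) →
      (∀ᶠ i in (𝒰 : Filter (Finset (Test ℂ))), dir (ofR ψ) (x i) + wt W (ofR ψ) (x i)
        + κ ^ 2 * wt 1 (ofR ψ) (x i) + 2 * κ * wt F.vc (ofR ψ) (x' i)
        = ζ i * wt F.Ec (ofR ψ) (x' i)) →
      ∫ t, ((deriv (ψ : ℝ → ℝ) t : ℝ) : ℂ) * f₁ t = -∫ t, (ψ t : ℂ) *
        (((W t + κ ^ 2 : ℝ) : ℂ) * f t
          + (((2 * κ * (1 - exp (2 * ε * t)) : ℝ) : ℂ) - z * ((exp (2 * ε * t) : ℝ) : ℂ)) * g t) :=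
    fun W ψ f f₁ g x x' lf lg t1 t2 t3 hev => by
      have l := tendsto_nhds_unique_of_eventuallyEq
        ((((tdir ψ f₁ x t2).add (twt W ψ f x t1)).add
          ((twt 1 ψ f x t1).const_mul ((κ:ℂ) ^ 2))).add
          ((twt F.vc ψ g x' t3).const_mul (2 * (κ:ℂ)))) (tz.mul (twt F.Ec ψ g x' t3)) hev
      have int : ∀ (W : C(ℝ, ℝ)) {f : ℝ → ℂ}, LocallyIntegrable f →
          Integrable fun t => (ψ t : ℂ) * ((W t : ℂ) * f t) := fun W f hf => by
        have := (hf.continuous_mul' (u := fun t => (W t : ℂ))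
          (by fun_prop)).integrable_smul_left_of_hasCompactSupport ψ.continuous ψ.supp
        simpa using this
      have e : ∫ t, (ψ t : ℂ) * (((W t + κ ^ 2 : ℝ) : ℂ) * f t
          + (((2 * κ * (1 - exp (2 * ε * t)) : ℝ) : ℂ) - z * ((exp (2 * ε * t) : ℝ) : ℂ)) * g t)
          = (∫ t, (ψ t : ℂ) * ((W t : ℂ) * f t))
            + (κ:ℂ) ^ 2 * (∫ t, (ψ t : ℂ) * (((1 : C(ℝ, ℝ)) t : ℂ) * f t))
            + 2 * (κ:ℂ) * (∫ t, (ψ t : ℂ) * ((F.vc t : ℂ) * g t))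
            - z * ∫ t, (ψ t : ℂ) * ((F.Ec t : ℂ) * g t) := by
        have j1 := int W lf
        have j2 : Integrable fun t => (κ:ℂ) ^ 2 * ((ψ t : ℂ) * (((1 : C(ℝ, ℝ)) t : ℂ) * f t)) :=
          (int 1 lf).const_mul _
        have j3 : Integrable fun t => 2 * (κ:ℂ) * ((ψ t : ℂ) * ((F.vc t : ℂ) * g t)) :=
          (int F.vc lg).const_mul _
        have j4 : Integrable fun t => z * ((ψ t : ℂ) * ((F.Ec t : ℂ) * g t)) :=
          (int F.Ec lg).const_mul _
        have j12 : Integrable fun t => (ψ t : ℂ) * ((W t : ℂ) * f t)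
          + (κ:ℂ) ^ 2 * ((ψ t : ℂ) * (((1 : C(ℝ, ℝ)) t : ℂ) * f t)) := j1.add j2
        have j123 : Integrable fun t => (ψ t : ℂ) * ((W t : ℂ) * f t)
          + (κ:ℂ) ^ 2 * ((ψ t : ℂ) * (((1 : C(ℝ, ℝ)) t : ℂ) * f t))
          + 2 * (κ:ℂ) * ((ψ t : ℂ) * ((F.vc t : ℂ) * g t)) := j12.add j3
        rw [← integral_const_mul, ← integral_const_mul, ← integral_const_mul,
          ← integral_add j1 j2, ← integral_add j12 j3, ← integral_sub j123 j4]
        congr 1; funext t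
        have v : F.vc t = 1 - exp (2 * ε * t) := rfl
        have E : F.Ec t = exp (2 * ε * t) := rfl
        rw [v, E, ContinuousMap.one_apply]
        push_cast
        ring
      rw [e]
      linear_combination l
  have ev : ∀ u : Test ℂ, ∀ᶠ S in (𝒰 : Filter (Finset (Test ℂ))), u ∈ S ∧ (0 : Test ℂ) ∈ S :=
    fun u => by
      classical
      exact ((eventually_ge_atTop ({u, 0} : Finset (Test ℂ))).filter_mono h𝒰).mono
        fun S hS => ⟨hS (by simp), hS (by simp)⟩
  obtain ⟨a, a', b, b', ha, ha', hb, hb', d1, d2, d3, d4⟩ := exists_classical_of_weak lα lα₁ lβ lβ₁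
    (w₁ := fun t => ((QQ ε R t - p * T t + κ ^ 2 : ℝ) : ℂ))
    (w₂ := fun t => ((2 * κ * (1 - exp (2 * ε * t)) : ℝ) : ℂ) - z * ((exp (2 * ε * t) : ℝ) : ℂ))
    (w₃ := fun t => ((QQ ε R t - T t + κ ^ 2 : ℝ) : ℂ)) (by fun_prop) (by fun_prop) (by fun_prop)
    dα dβ
    (fun ψ hψ hs => combine (F.Qc - p • F.Tc) ⟨ψ, hψ, hs⟩ α α₁ β _ _ lα lβ tα tα₁ tβ
      ((ev (ofR ⟨ψ, hψ, hs⟩)).mono fun S hS => by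
        have := g2 S _ hS.1 _ hS.2
        simp only [form_apply, wform_apply, map_zero, LinearMap.zero_apply, qp,
          LinearMap.add_apply] at this
        linear_combination this))
    (fun ψ hψ hs => combine (F.Qc - F.Tc) ⟨ψ, hψ, hs⟩ β β₁ α _ _ lβ lα tβ tβ₁ tα
      ((ev (ofR ⟨ψ, hψ, hs⟩)).mono fun S hS => by
        have := g2 S _ hS.2 _ hS.1
        simp only [form_apply, wform_apply, map_zero, LinearMap.zero_apply, qm,
          LinearMap.add_apply] at this
        linear_combination this))
  refine ⟨z, fun h0 => ?_, a, a', b, b', d1, d2, d3, d4, iα.congr ?_, iα₁.congr ?_, iβ.congr ?_,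
    iβ₁.congr ?_, ?_⟩
  · rw [h0] at hzim; simp at hzim; linarith
  · filter_upwards [ha] with t ht; rw [ht]
  · filter_upwards [ha'] with t ht; rw [ht]
  · filter_upwards [hb] with t ht; rw [ht]
  · filter_upwards [hb'] with t ht; rw [ht]
  · by_contra! h0
    have cφ := F.φT.continuous
    have t1 := tα (fun t => (F.φc t : ℂ)) (by fun_prop)
      (F.φT.supp.comp_left (g := Complex.ofReal) rfl)
    have t2 : Tendsto (fun S => ∫ t, (F.φc t : ℂ) * (y S).1 t) 𝒰 (nhds 1) :=
      tendsto_const_nhds.congr fun S => (g1 S).symm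
    have h1 := tendsto_nhds_unique t1 t2
    have h2 : ∫ t, (F.φc t : ℂ) * α t = 0 := by
      rw [← integral_zero ℝ ℂ]
      refine integral_congr_ae ?_
      filter_upwards [ha] with t ht
      rw [ht, h0, mul_zero]
    rw [h2] at h1
    exact zero_ne_one h1

end Frame

theorem Continuous.exists_forall_le_of_eventually {h : ℝ → ℝ} (hc : Continuous h) {C₁ C₂ : ℝ}
    (h₁ : ∀ᶠ t in atTop, h t ≤ C₁) (h₂ : ∀ᶠ t in atBot, h t ≤ C₂) : ∃ C, ∀ t, h t ≤ C := by
  obtain ⟨x, hx⟩ := eventually_atTop.1 h₁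
  obtain ⟨y, hy⟩ := eventually_atBot.1 h₂
  obtain ⟨B, hB⟩ := (isCompact_Icc (a := y) (b := x)).bddAbove_image hc.continuousOn
  refine ⟨max B (max C₁ C₂), fun t => ?_⟩
  rcases le_total x t with h | h
  · exact (hx t h).trans ((le_max_left _ _).trans (le_max_right _ _))
  · rcases le_total t y with h' | h'
    · exact (hy t h').trans ((le_max_right _ _).trans (le_max_right _ _))
    · exact (hB ⟨t, ⟨h', h⟩, rfl⟩).trans (le_max_left _ _)

/-- Positive decaying solutions of a second order equation whose potential is eventually at least
`1` decay exponentially, together with their derivatives. -/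
theorem exists_exp_decay {F G q : ℝ → ℝ} (hF : ∀ t, HasDerivAt F (G t) t)
    (hG : ∀ t, HasDerivAt G (q t * F t) t) (hpos : ∀ t, 0 < F t) (h0 : Tendsto F atTop (nhds 0))
    (hq : ∀ᶠ t in atTop, 1 ≤ q t) :
    ∃ C, ∀ᶠ t in atTop, F t ≤ C * exp (-t) ∧ |G t| ≤ C * exp (-t) := by
  obtain ⟨t₀, ht₀⟩ := eventually_atTop.1 hq
  have mG : MonotoneOn G (Set.Ici t₀) := monotoneOn_of_hasDerivAt_nonneg (convex_Ici _)
    (fun x _ => hG x) fun x hx => mul_nonneg (zero_le_one.trans (ht₀ x hx)) (hpos x).le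
  have nG : ∀ t, t₀ ≤ t → G t ≤ 0 := fun t ht => by
    by_contra! h
    have mF : MonotoneOn F (Set.Ici t) := monotoneOn_of_hasDerivAt_nonneg (convex_Ici _)
      (fun x _ => hF x) fun x hx => h.le.trans (mG ht (ht.trans hx) hx)
    exact (hpos t).not_ge (nonpos_of_monotoneOn_Ici mF h0)
  have dG : ∀ t, t₀ + 1 ≤ t → |G t| ≤ F (t - 1) := fun t ht => by
    obtain ⟨ξ, hξ, h⟩ := exists_hasDerivAt_eq_slope F G (sub_one_lt t)
      (fun x _ => (hF x).continuousAt.continuousWithinAt) fun x _ => hF x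
    have h1 : G ξ ≤ G t := mG (by simp only [Set.mem_Ici]; linarith [hξ.1])
      (by simp only [Set.mem_Ici]; linarith) hξ.2.le
    rw [sub_sub_cancel, div_one] at h
    rw [abs_of_nonpos (nG t (by linarith))]
    linarith [hpos t]
  have tG : Tendsto G atTop (nhds 0) := by
    refine squeeze_zero_norm' ?_ (h0.comp (tendsto_atTop_add_const_right atTop (-1) tendsto_id))
    filter_upwards [eventually_ge_atTop (t₀ + 1)] with t ht
    exact dG t ht
  have mS : MonotoneOn (fun t => exp (-t) * (G t + F t)) (Set.Ici t₀) := by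
    refine monotoneOn_of_hasDerivAt_nonneg (convex_Ici _)
      (fun x _ => ((hasDerivAt_neg x).exp).mul ((hG x).add (hF x))) fun x hx => ?_
    have : 0 ≤ exp (-x) * ((q x - 1) * F x) :=
      mul_nonneg (exp_pos _).le (mul_nonneg (sub_nonneg.2 (ht₀ x hx)) (hpos x).le)
    linarith
  have tS : Tendsto (fun t => exp (-t) * (G t + F t)) atTop (nhds 0) := by
    simpa using (tendsto_exp_neg_atTop_nhds_zero).mul (tG.add h0)
  have nS : ∀ t, t₀ ≤ t → G t + F t ≤ 0 := fun t ht => by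
    have h := nonpos_of_monotoneOn_Ici (mS.mono (Set.Ici_subset_Ici.2 ht)) tS
    exact nonpos_of_mul_nonpos_right h (exp_pos _)
  have aF : AntitoneOn (fun t => exp t * F t) (Set.Ici t₀) := by
    refine antitoneOn_of_hasDerivAt_nonpos (convex_Ici _)
      (fun x _ => (Real.hasDerivAt_exp x).mul (hF x)) fun x hx => ?_
    have := mul_nonpos_of_nonneg_of_nonpos (exp_pos x).le (nS x hx)
    linarith
  have bF : ∀ t, t₀ ≤ t → F t ≤ exp t₀ * F t₀ * exp (-t) := fun t ht => by
    have h : exp t * F t ≤ exp t₀ * F t₀ := aF (Set.mem_Ici.2 le_rfl) ht ht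
    rw [exp_neg, ← div_eq_mul_inv, le_div_iff₀ (exp_pos _)]
    linarith
  refine ⟨exp t₀ * F t₀ * exp 1, ?_⟩
  filter_upwards [eventually_ge_atTop (t₀ + 1)] with t ht
  constructor
  · refine (bF t (by linarith)).trans (mul_le_mul_of_nonneg_right ?_ (exp_pos _).le)
    exact le_mul_of_one_le_right (mul_pos (exp_pos _) (hpos _)).le (one_le_exp zero_le_one)
  · refine ((dG t ht).trans (bF (t - 1) (by linarith))).trans_eq ?_
    rw [mul_assoc _ (exp 1), ← exp_add]
    ring_nf

namespace Profile

/-- The vortex profile in logarithmic variables, centred at the maximum of its weighted form. -/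
theorem exists_of_vortex {p ω : ℝ} {m : ℕ} (hp : 1 < p) (hω : 0 < ω) (hm : 1 ≤ m)
    {φ φ' : ℝ → ℝ} (hφ : ∀ r, 0 < r → HasDerivAt φ (φ' r) r)
    (hφ' : ∀ r, 0 < r → HasDerivAt φ' ((ω + (m : ℝ) ^ 2 / r ^ 2) * φ r - φ r ^ p - φ' r / r) r)
    (hpos : ∀ r, 0 < r → 0 < φ r) {L : ℝ}
    (h₀ : Tendsto (fun r => φ r / r ^ m) (nhdsWithin 0 (Set.Ioi 0)) (nhds L))
    (h₀' : Tendsto (fun r => φ' r / ((m : ℝ) * r ^ (m - 1)))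
      (nhdsWithin 0 (Set.Ioi 0)) (nhds L))
    (hinf : Tendsto φ atTop (nhds 0)) :
    ∃ r₀ > 0, ∃ f P : ℝ → ℝ, Profile p (1 / m) (ω * r₀ ^ 2 / m ^ 2) f P
      (fun t => (r₀ * exp (1 / m * t)) ^ 2 * φ (r₀ * exp (1 / m * t)) ^ (p - 1) / m ^ 2) ∧
      P 0 = -(th p * (1 / m) / 2) ∧ f 0 = 1 := by
  have hm0 : (0 : ℝ) < m := by exact_mod_cast hm
  set ε : ℝ := 1 / m with hε
  have ε0 : 0 < ε := by positivity
  have ε1 : ε ≤ 1 := by rw [hε, div_le_one hm0]; exact_mod_cast hm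
  have εm : ε * m = 1 := by rw [hε]; field_simp
  set ρ : ℝ → ℝ := fun t => exp (ε * t) with hρ
  have ρ0 : ∀ t, 0 < ρ t := fun t => exp_pos _
  have dρ : ∀ t, HasDerivAt ρ (ε * ρ t) t := fun t => by
    refine (((hasDerivAt_id t).const_mul ε).exp).congr_deriv ?_
    simp only [id, hρ]; ring
  have ρm : ∀ t, ρ t ^ m = exp t := fun t => by
    rw [hρ, ← exp_nat_mul, ← mul_assoc, mul_comm (m : ℝ), εm, one_mul]
  have ρtop : Tendsto ρ atTop atTop := tendsto_exp_atTop.comp (tendsto_id.const_mul_atTop ε0)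
  have ρbot : Tendsto ρ atBot (nhdsWithin 0 (Set.Ioi 0)) :=
    tendsto_exp_atBot_nhdsGT.comp (tendsto_id.const_mul_atBot ε0)
  set F : ℝ → ℝ := fun t => φ (ρ t) with hF
  set G : ℝ → ℝ := fun t => ε * ρ t * φ' (ρ t) with hG
  set q : ℝ → ℝ := fun t => 1 + ε ^ 2 * ρ t ^ 2 * (ω - φ (ρ t) ^ (p - 1)) with hq
  have F0 : ∀ t, 0 < F t := fun t => hpos _ (ρ0 t)
  have rp : ∀ r, 0 < r → φ r ^ p = φ r ^ (p - 1) * φ r := fun r hr => by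
    rw [← rpow_add_one (hpos r hr).ne', sub_add_cancel]
  have dF : ∀ t, HasDerivAt F (G t) t := fun t =>
    ((hφ _ (ρ0 t)).comp t (dρ t)).congr_deriv (by simp only [hG]; ring)
  have dG : ∀ t, HasDerivAt G (q t * F t) t := fun t => by
    refine (((dρ t).const_mul ε).mul ((hφ' _ (ρ0 t)).comp t (dρ t))).congr_deriv ?_
    have h := (ρ0 t).ne'
    have e : (m : ℝ) ^ 2 = 1 / ε ^ 2 := by rw [hε]; field_simp
    simp only [hq, hF, Function.comp]
    rw [rp _ (ρ0 t), e]
    field_simp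
    ring
  have cF : Continuous F := continuous_iff_continuousAt.2 fun t => (dF t).continuousAt
  have cG : Continuous G := continuous_iff_continuousAt.2 fun t => (dG t).continuousAt
  have Ftop : Tendsto F atTop (nhds 0) := hinf.comp ρtop
  have qtop : ∀ᶠ t in atTop, 1 ≤ q t := by
    have h : Tendsto (fun t => F t ^ (p - 1)) atTop (nhds 0) := by
      simpa [zero_rpow (sub_pos.2 hp).ne'] using
        Ftop.rpow_const (p := p - 1) (Or.inr (sub_pos.2 hp).le)
    filter_upwards [h.eventually_le_const hω] with t ht
    have : 0 ≤ ε ^ 2 * ρ t ^ 2 * (ω - φ (ρ t) ^ (p - 1)) :=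
      mul_nonneg (by positivity) (sub_nonneg.2 ht)
    simp only [hq]; linarith
  obtain ⟨C₁, hC₁⟩ := exists_exp_decay dF dG F0 Ftop qtop
  have Fbot : ∀ᶠ t in atBot, F t * exp |t| ≤ L + 1 := by
    filter_upwards [(h₀.comp ρbot).eventually_le_const (lt_add_one L), eventually_le_atBot 0]
      with t ht h0
    simp only [Function.comp, ρm] at ht
    rw [abs_of_nonpos h0, exp_neg, ← div_eq_mul_inv]
    exact ht
  have Gbot : ∀ᶠ t in atBot, |G t| * exp |t| ≤ |L| + 1 := by
    filter_upwards [(h₀'.abs.comp ρbot).eventually_le_const (lt_add_one |L|),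
      eventually_le_atBot 0] with t ht h0
    have e : φ' (ρ t) / (m * ρ t ^ (m - 1)) = G t / exp t := by
      rw [← ρm, hG, hε]
      have : ρ t ^ m = ρ t ^ (m - 1) * ρ t := by rw [← pow_succ, Nat.sub_add_cancel hm]
      have h := (ρ0 t).ne'
      simp only [this]
      field_simp
    simp only [Function.comp, e] at ht
    rwa [abs_div, abs_of_pos (exp_pos _), div_eq_mul_inv, ← exp_neg, ← abs_of_nonpos h0] at ht
  have top : ∀ {x t : ℝ}, x ≤ C₁ * exp (-t) → 0 ≤ t → x * exp |t| ≤ C₁ := fun {x t} h h0 => by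
    rw [abs_of_nonneg h0]
    calc x * exp t ≤ C₁ * exp (-t) * exp t := mul_le_mul_of_nonneg_right h (exp_pos _).le
      _ = C₁ := by rw [mul_assoc, ← exp_add]; simp
  obtain ⟨A₁, hA₁⟩ := Continuous.exists_forall_le_of_eventually (h := fun t => F t * exp |t|)
    (by fun_prop) (C₁ := C₁) (by
      filter_upwards [hC₁, eventually_ge_atTop 0] with t ht h0 using top ht.1 h0) Fbot
  obtain ⟨A₂, hA₂⟩ := Continuous.exists_forall_le_of_eventually (h := fun t => |G t| * exp |t|)
    (by fun_prop) (C₁ := C₁) (by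
      filter_upwards [hC₁, eventually_ge_atTop 0] with t ht h0 using top ht.2 h0) Gbot
  have A₁0 : 0 ≤ A₁ := (mul_pos (F0 0) (exp_pos _)).le.trans (hA₁ 0)
  have A₂0 : 0 ≤ A₂ := (mul_nonneg (abs_nonneg (G 0)) (exp_pos _).le).trans (hA₂ 0)
  have bF : ∀ t, F t ≤ A₁ * exp (-|t|) := fun t => by
    rw [exp_neg, ← div_eq_mul_inv, le_div_iff₀ (exp_pos _)]; exact hA₁ t
  have bG : ∀ t, |G t| ≤ A₂ * exp (-|t|) := fun t => by
    rw [exp_neg, ← div_eq_mul_inv, le_div_iff₀ (exp_pos _)]; exact hA₂ t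
  obtain ⟨s, hs⟩ : ∃ s, ∀ t, exp (th p * ε / 2 * t) * F t ≤ exp (th p * ε / 2 * s) * F s := by
    refine Continuous.exists_forall_ge' (by fun_prop) 0 ?_
    have hth : |th p * ε / 2| ≤ 1 / 2 := by
      have h1 := th_pos hp
      rw [abs_of_pos (by positivity)]
      have : th p * ε ≤ 1 * 1 := mul_le_mul (th_lt_one hp).le ε1 ε0.le zero_le_one
      linarith
    have lim : Tendsto (fun t : ℝ => A₁ * exp (-(1 / 2 * |t|))) (cocompact ℝ) (nhds 0) := by
      have h1 : Tendsto (fun t : ℝ => 1 / 2 * |t|) (cocompact ℝ) atTop :=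
        (tendsto_norm_cocompact_atTop (E := ℝ)).const_mul_atTop (by norm_num)
      simpa using (tendsto_exp_neg_atTop_nhds_zero.comp h1).const_mul A₁
    filter_upwards [lim.eventually_le_const (show 0 < exp (th p * ε / 2 * 0) * F 0 from
      mul_pos (exp_pos _) (F0 0))] with t ht
    refine le_trans ?_ ht
    have h1 : th p * ε / 2 * t ≤ 1 / 2 * |t| := by
      refine (le_abs_self _).trans ?_
      rw [abs_mul]
      exact mul_le_mul_of_nonneg_right hth (abs_nonneg _)
    calc exp (th p * ε / 2 * t) * F t ≤ exp (1 / 2 * |t|) * (A₁ * exp (-|t|)) :=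
          mul_le_mul (exp_le_exp.2 h1) (bF t) (F0 t).le (exp_pos _).le
      _ = A₁ * exp (-(1 / 2 * |t|)) := by
          rw [mul_left_comm, ← exp_add]; ring_nf
  have hs0 : G s = -(th p * ε / 2) * F s := by
    have hd : HasDerivAt (fun t => exp (th p * ε / 2 * t) * F t)
        (exp (th p * ε / 2 * s) * (th p * ε / 2 * F s + G s)) s := by
      refine ((((hasDerivAt_id s).const_mul (th p * ε / 2)).exp).mul (dF s)).congr_deriv ?_
      simp only [id]; ring
    have h := (IsLocalMax.hasDerivAt_eq_zero (Filter.Eventually.of_forall hs) hd)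
    rcases mul_eq_zero.1 h with h | h
    · exact absurd h (exp_pos _).ne'
    · linarith
  have shift : ∀ t, ρ s * exp (ε * t) = ρ (t + s) := fun t => by
    simp only [hρ]; rw [← exp_add]; ring_nf
  have sh : ∀ t : ℝ, exp (-|t + s|) ≤ exp |s| * exp (-|t|) := fun t => by
    rw [← exp_add, exp_le_exp]
    have := abs_sub (t + s) s
    rw [add_sub_cancel_right] at this
    linarith
  have dshift : ∀ {g : ℝ → ℝ} {g' t : ℝ}, HasDerivAt g g' (t + s) →
      HasDerivAt (fun t => g (t + s)) g' t := fun {g g' t} h => h.comp_add_const t s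
  have T0 : ∀ t, 0 < ρ (t + s) ^ 2 * φ (ρ (t + s)) ^ (p - 1) / m ^ 2 := fun t => by
    have := rpow_pos_of_pos (F0 (t + s)) (p - 1)
    have := ρ0 (t + s)
    positivity
  refine ⟨ρ s, ρ0 s, fun t => F (t + s) / F s, fun t => G (t + s) / F (t + s), ?_, ?_, ?_⟩
  · simp only [shift]
    refine ⟨by have := ρ0 s; positivity, fun t => div_pos (F0 _) (F0 _), T0, fun t => ?_,
      fun t => ?_, fun t => ?_, ?_⟩
    · refine ((dshift (dF (t + s))).div_const (F s)).congr_deriv ?_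
      have := (F0 (t + s)).ne'
      field_simp
    · refine ((dshift (dG (t + s))).div (dshift (dF (t + s))) (F0 _).ne').congr_deriv ?_
      have h := (F0 (t + s)).ne'
      have e : exp (2 * ε * t) * ρ s ^ 2 = ρ (t + s) ^ 2 := by
        rw [← shift, mul_pow, ← exp_nat_mul (ε * t)]; push_cast; ring_nf
      have e1 : ω * ρ s ^ 2 / m ^ 2 * exp (2 * ε * t) = ω * ρ (t + s) ^ 2 / m ^ 2 := by
        rw [← e]; ring
      rw [e1]
      simp only [hq]
      change _ = 1 + _ - ρ (t + s) ^ 2 * φ (ρ (t + s)) ^ (p - 1) / m ^ 2 - _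
      have e2 : ε ^ 2 = 1 / (m : ℝ) ^ 2 := by rw [hε]; ring
      rw [e2]
      field_simp
      ring
    · have d1 := ((dF (t + s)).rpow_const (p := p - 1) (Or.inl (F0 _).ne'))
      refine ((((dshift ((dρ (t + s)).pow 2)).mul (dshift d1)).div_const
        ((m : ℝ) ^ 2))).congr_deriv ?_
      have h := (F0 (t + s)).ne'
      have e : F (t + s) ^ (p - 1) = F (t + s) ^ (p - 1 - 1) * F (t + s) := by
        rw [← rpow_add_one h, sub_add_cancel]
      simp only [Pi.pow_apply]
      change _ = ρ (t + s) ^ 2 * F (t + s) ^ (p - 1) / m ^ 2 * _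
      rw [e]
      field_simp
      push_cast
      ring
    · have B : ∀ t, F t ≤ A₁ := fun t => (bF t).trans (mul_le_of_le_one_right A₁0
        (exp_le_one_iff.2 (neg_nonpos.2 (abs_nonneg t))))
      refine ⟨max (A₁ * exp |s| / F s) (max (A₂ * exp |s| / F s)
        (ρ s ^ 2 * A₁ ^ (p - 1) / m ^ 2)), fun t => ⟨?_, ?_, ?_⟩⟩
      · refine le_trans ?_ (mul_le_mul_of_nonneg_right (le_max_left _ _) (exp_pos _).le)
        rw [div_mul_eq_mul_div]
        refine div_le_div_of_nonneg_right ((bF _).trans ?_) (F0 s).le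
        rw [mul_assoc]
        exact mul_le_mul_of_nonneg_left (sh t) A₁0
      · refine le_trans ?_ (mul_le_mul_of_nonneg_right
          ((le_max_left _ _).trans (le_max_right _ _)) (exp_pos _).le)
        have e : |G (t + s) / F (t + s)| * (F (t + s) / F s) = |G (t + s)| / F s := by
          rw [abs_div, abs_of_pos (F0 _)]
          have := (F0 (t + s)).ne'
          field_simp
        rw [e, div_mul_eq_mul_div]
        refine div_le_div_of_nonneg_right ((bG _).trans ?_) (F0 s).le
        rw [mul_assoc]
        exact mul_le_mul_of_nonneg_left (sh t) A₂0
      · refine le_trans ?_ (mul_le_mul_of_nonneg_right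
          ((le_max_right _ _).trans (le_max_right _ _)) (exp_pos _).le)
        have h1 : φ (ρ (t + s)) ^ (p - 1) ≤ A₁ ^ (p - 1) :=
          rpow_le_rpow (F0 _).le (B _) (sub_pos.2 hp).le
        have h2 : ρ (t + s) ^ 2 ≤ ρ s ^ 2 * exp (2 * ε * |t|) := by
          rw [← shift, mul_pow, ← exp_nat_mul (ε * t)]
          refine mul_le_mul_of_nonneg_left (exp_le_exp.2 ?_) (sq_nonneg _)
          push_cast
          have := mul_le_mul_of_nonneg_left (le_abs_self t) ε0.le
          linarith
        have h3 : ρ (t + s) ^ 2 * φ (ρ (t + s)) ^ (p - 1)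
            ≤ ρ s ^ 2 * exp (2 * ε * |t|) * A₁ ^ (p - 1) :=
          mul_le_mul h2 h1 (rpow_pos_of_pos (F0 _) _).le (by positivity)
        rw [div_mul_eq_mul_div]
        exact div_le_div_of_nonneg_right (by linarith) (by positivity)
  · simp only [zero_add, hs0]
    rw [mul_div_assoc, div_self (F0 s).ne', mul_one]
  · simp only [zero_add]
    exact div_self (F0 s).ne'

end Profile

section LogChange

variable {m r₀ : ℝ} {u u' u'' : ℝ → ℂ}

theorem hasDerivAt_mul_log_div {r : ℝ} (hr₀ : 0 < r₀) (hr : 0 < r) :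
    HasDerivAt (fun r => m * log (r / r₀)) (m / r) r := by
  refine ((((hasDerivAt_id r).div_const r₀).log (div_pos hr hr₀).ne').const_mul m).congr_deriv ?_
  simp only [id]
  field_simp

theorem hasDerivAt_comp_mul_log_div (hu : ∀ t, HasDerivAt u (u' t) t) (hr₀ : 0 < r₀) {r : ℝ}
    (hr : 0 < r) : HasDerivAt (fun r => u (m * log (r / r₀)))
      (((m / r : ℝ) : ℂ) * u' (m * log (r / r₀))) r :=
  ((hu _).scomp r (hasDerivAt_mul_log_div hr₀ hr)).congr_deriv (by rw [Complex.real_smul])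

theorem deriv_comp_mul_log_div (hu : ∀ t, HasDerivAt u (u' t) t) (hr₀ : 0 < r₀) {r : ℝ}
    (hr : 0 < r) : deriv (fun r => u (m * log (r / r₀))) r
      = ((m / r : ℝ) : ℂ) * u' (m * log (r / r₀)) :=
  (hasDerivAt_comp_mul_log_div hu hr₀ hr).deriv

/-- The radial Laplacian in logarithmic variables. -/
theorem radial_laplacian_comp_mul_log_div (hu : ∀ t, HasDerivAt u (u' t) t)
    (hu' : ∀ t, HasDerivAt u' (u'' t) t) (hr₀ : 0 < r₀) {r : ℝ} (hr : 0 < r) :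
    deriv (deriv fun r => u (m * log (r / r₀))) r + deriv (fun r => u (m * log (r / r₀))) r
      / (r : ℂ)
      = ((m ^ 2 / r ^ 2 : ℝ) : ℂ) * u'' (m * log (r / r₀)) := by
  have hd : HasDerivAt (deriv fun r => u (m * log (r / r₀)))
      (((-(m / r ^ 2) : ℝ) : ℂ) * u' (m * log (r / r₀))
        + ((m / r : ℝ) : ℂ) * (((m / r : ℝ) : ℂ) * u'' (m * log (r / r₀)))) r := by
    have h1 : HasDerivAt (fun r : ℝ => m / r) (-(m / r ^ 2)) r := by
      refine ((hasDerivAt_inv hr.ne').const_mul m).congr_deriv ?_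
      ring
    refine (h1.ofReal_comp.mul (hasDerivAt_comp_mul_log_div hu' hr₀ hr)).congr_of_eventuallyEq ?_
    filter_upwards [lt_mem_nhds hr] with x hx
    exact deriv_comp_mul_log_div hu hr₀ hx
  have hr' : (r : ℂ) ≠ 0 := by exact_mod_cast hr.ne'
  rw [hd.deriv, deriv_comp_mul_log_div hu hr₀ hr]
  push_cast
  field_simp
  ring

theorem contDiffOn_comp_mul_log_div (hu : ∀ t, HasDerivAt u (u' t) t)
    (hu' : ∀ t, HasDerivAt u' (u'' t) t) (hc : Continuous u'') (hr₀ : 0 < r₀) :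
    ContDiffOn ℝ 2 (fun r => u (m * log (r / r₀))) (Set.Ioi 0) := by
  have e1 : deriv u = u' := funext fun t => (hu t).deriv
  have e2 : deriv u' = u'' := funext fun t => (hu' t).deriv
  have h1 : ContDiff ℝ 1 u' := contDiff_one_iff_deriv.2
    ⟨fun t => (hu' t).differentiableAt, by rwa [e2]⟩
  have h2 : ContDiff ℝ 2 u := by
    rw [show (2 : WithTop ℕ∞) = 1 + 1 from one_add_one_eq_two.symm, contDiff_succ_iff_deriv]
    exact ⟨fun t => (hu t).differentiableAt, by simp, by rwa [e1]⟩
  refine h2.comp_contDiffOn (contDiffOn_const.mul (ContDiffOn.log ?_ fun r hr => ?_))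
  · exact contDiffOn_id.div_const _
  · exact (div_pos hr hr₀).ne'

theorem integrableOn_comp_mul_log_div {R : ℝ} (hm : 0 < m) (hR : 0 < R)
    (hu : ∀ t, HasDerivAt u (u' t) t)
    (hu' : ∀ t, HasDerivAt u' (u'' t) t) (hr₀ : 0 < r₀)
    (h : Integrable fun t => QQ (1 / m) R t * ‖u t‖ ^ 2) (h' : Integrable fun t => ‖u' t‖ ^ 2) :
    IntegrableOn (fun r => (‖u (m * log (r / r₀))‖ ^ 2
      + ‖deriv (fun r => u (m * log (r / r₀))) r‖ ^ 2
      + (r ^ 2)⁻¹ * ‖u (m * log (r / r₀))‖ ^ 2) * r) (Set.Ioi 0) := by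
  have cu : Continuous u := continuous_iff_continuousAt.2 fun t => (hu t).continuousAt
  have cu' : Continuous u' := continuous_iff_continuousAt.2 fun t => (hu' t).continuousAt
  set ρ : ℝ → ℝ := fun t => r₀ * exp (1 / m * t) with hρ
  have ρ0 : ∀ t, 0 < ρ t := fun t => mul_pos hr₀ (exp_pos _)
  have dρ : ∀ t, HasDerivAt ρ (1 / m * ρ t) t := fun t => by
    refine ((((hasDerivAt_id t).const_mul (1 / m)).exp).const_mul r₀).congr_deriv ?_
    simp only [id, hρ]; ring
  have hl : ∀ t, m * log (ρ t / r₀) = t := fun t => by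
    simp only [hρ]
    rw [mul_div_cancel_left₀ _ hr₀.ne', log_exp]
    field_simp
  have him : ρ '' Set.univ = Set.Ioi 0 := by
    ext r
    refine ⟨fun ⟨t, _, ht⟩ => ht ▸ ρ0 t, fun hr => ⟨m * log (r / r₀), trivial, ?_⟩⟩
    simp only [hρ]
    rw [← mul_assoc, one_div_mul_cancel hm.ne', one_mul, exp_log (div_pos hr hr₀)]
    field_simp
  have hinj : Set.InjOn ρ Set.univ := fun x _ y _ hxy => by
    rw [← hl x, ← hl y, hxy]
  rw [← him, integrableOn_image_iff_integrableOn_abs_deriv_smul MeasurableSet.univ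
    (fun t _ => (dρ t).hasDerivWithinAt) hinj, integrableOn_univ]
  have hE : ∀ t, ρ t ^ 2 = r₀ ^ 2 * exp (2 * (1 / m) * t) := fun t => by
    simp only [hρ]
    rw [mul_pow, ← exp_nat_mul (1 / m * t)]
    push_cast; ring_nf
  have key : ∀ t, |1 / m * ρ t| • ((‖u (m * log (ρ t / r₀))‖ ^ 2
      + ‖deriv (fun r => u (m * log (r / r₀))) (ρ t)‖ ^ 2
      + (ρ t ^ 2)⁻¹ * ‖u (m * log (ρ t / r₀))‖ ^ 2) * ρ t)
      = 1 / m * (ρ t ^ 2 * ‖u t‖ ^ 2 + m ^ 2 * ‖u' t‖ ^ 2 + ‖u t‖ ^ 2) := fun t => by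
    have h0 := ρ0 t
    rw [deriv_comp_mul_log_div hu hr₀ (ρ0 t), hl, norm_mul, Complex.norm_real, norm_eq_abs,
      abs_of_pos (by positivity), abs_of_pos (by positivity), smul_eq_mul]
    field_simp
  simp only [key]
  have cρ : Continuous ρ := by fun_prop
  have i1 : Integrable fun t => ρ t ^ 2 * ‖u t‖ ^ 2 := by
    refine (h.const_mul (r₀ ^ 2 / R)).mono' (by fun_prop) (Eventually.of_forall fun t => ?_)
    have hx := exp_pos (2 * (1 / m) * t)
    rw [norm_of_nonneg (by positivity), hE, ← mul_assoc]
    refine mul_le_mul_of_nonneg_right ?_ (by positivity)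
    unfold QQ
    rw [div_mul_eq_mul_div, le_div_iff₀ hR]
    nlinarith [sq_nonneg r₀]
  have i2 : Integrable fun t => ‖u t‖ ^ 2 := by
    refine h.mono' (by fun_prop) (Eventually.of_forall fun t => ?_)
    rw [norm_of_nonneg (by positivity)]
    exact le_mul_of_one_le_left (by positivity) (Ctrl.one_le_QQ hR t)
  exact ((i1.add (h'.const_mul (m ^ 2))).add i2).const_mul _

end LogChange

theorem integrable_mul_norm_sq_add {w : ℝ → ℝ} {f g : ℝ → ℂ} (hw : Continuous w)
    (hw0 : ∀ t, 0 ≤ w t) (hf : Continuous f) (hg : Continuous g)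
    (h₁ : Integrable fun t => w t * ‖f t‖ ^ 2) (h₂ : Integrable fun t => w t * ‖g t‖ ^ 2) :
    Integrable fun t => w t * ‖f t + g t‖ ^ 2 := by
  refine ((h₁.add h₂).const_mul 2).mono' (by fun_prop) (Eventually.of_forall fun t => ?_)
  rw [norm_of_nonneg (mul_nonneg (hw0 t) (sq_nonneg _))]
  have h := norm_add_le (f t) (g t)
  have h1 : ‖f t + g t‖ ^ 2 ≤ 2 * (‖f t‖ ^ 2 + ‖g t‖ ^ 2) := by
    nlinarith [norm_nonneg (f t + g t), sq_nonneg (‖f t‖ - ‖g t‖)]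
  have := mul_le_mul_of_nonneg_left h1 (hw0 t)
  simp only [Pi.add_apply]
  linarith

/-- Solutions of the linearised system in logarithmic variables give unstable eigenfunctions. -/
theorem exists_unstable_of_log {p ω m r₀ j κ : ℝ} (hω : 0 < ω) (hm : 0 < m) (hr₀ : 0 < r₀)
    (hκ : κ = j * (1 / m)) {φ : ℝ → ℝ} {T : ℝ → ℝ} (hT : Continuous T)
    (hTφ : ∀ t, T t = (r₀ * exp (1 / m * t)) ^ 2 * φ (r₀ * exp (1 / m * t)) ^ (p - 1) / m ^ 2)
    {z : ℂ} (hz : 0 < z.im) {a a' b b' : ℝ → ℂ} (ha : ∀ t, HasDerivAt a (a' t) t)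
    (hb : ∀ t, HasDerivAt b (b' t) t)
    (ha' : ∀ t, HasDerivAt a' (((QQ (1 / m) (ω * r₀ ^ 2 / m ^ 2) t - p * T t + κ ^ 2 : ℝ) : ℂ) * a t
        + (((2 * κ * (1 - exp (2 * (1 / m) * t)) : ℝ) : ℂ)
          - z * ((exp (2 * (1 / m) * t) : ℝ) : ℂ)) * b t) t)
    (hb' : ∀ t, HasDerivAt b' (((QQ (1 / m) (ω * r₀ ^ 2 / m ^ 2) t - T t + κ ^ 2 : ℝ) : ℂ) * b t
        + (((2 * κ * (1 - exp (2 * (1 / m) * t)) : ℝ) : ℂ)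
          - z * ((exp (2 * (1 / m) * t) : ℝ) : ℂ)) * a t) t)
    (ia : Integrable (fun t => QQ (1 / m) (ω * r₀ ^ 2 / m ^ 2) t * ‖a t‖ ^ 2))
    (ia' : Integrable (fun t => ‖a' t‖ ^ 2))
    (ib : Integrable (fun t => QQ (1 / m) (ω * r₀ ^ 2 / m ^ 2) t * ‖b t‖ ^ 2))
    (ib' : Integrable (fun t => ‖b' t‖ ^ 2)) (hne : ∃ t, a t ≠ 0) :
    ∃ lam : ℂ, 0 < lam.re ∧
      ∃ yp ym : ℝ → ℂ,
        ContDiffOn ℝ 2 yp (Set.Ioi 0) ∧ ContDiffOn ℝ 2 ym (Set.Ioi 0) ∧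
        IntegrableOn (fun r => (‖yp r‖ ^ 2 + ‖deriv yp r‖ ^ 2
          + (r ^ 2)⁻¹ * ‖yp r‖ ^ 2) * r) (Set.Ioi 0) ∧
        IntegrableOn (fun r => (‖ym r‖ ^ 2 + ‖deriv ym r‖ ^ 2
          + (r ^ 2)⁻¹ * ‖ym r‖ ^ 2) * r) (Set.Ioi 0) ∧
        (∃ r ∈ Set.Ioi (0:ℝ), yp r ≠ 0 ∨ ym r ≠ 0) ∧
        (∀ r ∈ Set.Ioi (0:ℝ),
          deriv (deriv yp) r + deriv yp r / (r : ℂ)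
            - ((ω + (m + j) ^ 2 / r ^ 2 : ℝ) : ℂ) * yp r
            + Complex.I * lam * yp r
            + (((p + 1) / 2 * φ r ^ (p - 1) : ℝ) : ℂ) * yp r
            + (((p - 1) / 2 * φ r ^ (p - 1) : ℝ) : ℂ) * ym r = 0) ∧
        (∀ r ∈ Set.Ioi (0:ℝ),
          deriv (deriv ym) r + deriv ym r / (r : ℂ)
            - ((ω + (m - j) ^ 2 / r ^ 2 : ℝ) : ℂ) * ym r
            - Complex.I * lam * ym r
            + (((p + 1) / 2 * φ r ^ (p - 1) : ℝ) : ℂ) * ym r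
            + (((p - 1) / 2 * φ r ^ (p - 1) : ℝ) : ℂ) * yp r = 0) := by
  have hR : 0 < ω * r₀ ^ 2 / m ^ 2 := by positivity
  have ca : Continuous a := continuous_iff_continuousAt.2 fun t => (ha t).continuousAt
  have cb : Continuous b := continuous_iff_continuousAt.2 fun t => (hb t).continuousAt
  have ca' : Continuous a' := continuous_iff_continuousAt.2 fun t => (ha' t).continuousAt
  have cb' : Continuous b' := continuous_iff_continuousAt.2 fun t => (hb' t).continuousAt
  have cQ : Continuous (QQ (1 / m) (ω * r₀ ^ 2 / m ^ 2)) := by unfold QQ; fun_prop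
  have Q0 : ∀ t, 0 ≤ QQ (1 / m) (ω * r₀ ^ 2 / m ^ 2) t := fun t =>
    zero_le_one.trans (Ctrl.one_le_QQ hR t)
  set μ : ℂ := ((2 * m * j / r₀ ^ 2 : ℝ) : ℂ) + ((m ^ 2 / r₀ ^ 2 : ℝ) : ℂ) * z with hμ
  have hIμ : Complex.I * (-Complex.I * μ) = μ := by
    rw [← mul_assoc, mul_neg, Complex.I_mul_I]; ring
  set a'' : ℝ → ℂ := fun t => ((QQ (1 / m) (ω * r₀ ^ 2 / m ^ 2) t - p * T t + κ ^ 2 : ℝ) : ℂ) * a t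
        + (((2 * κ * (1 - exp (2 * (1 / m) * t)) : ℝ) : ℂ)
          - z * ((exp (2 * (1 / m) * t) : ℝ) : ℂ)) * b t with ha''
  set b'' : ℝ → ℂ := fun t => ((QQ (1 / m) (ω * r₀ ^ 2 / m ^ 2) t - T t + κ ^ 2 : ℝ) : ℂ) * b t
        + (((2 * κ * (1 - exp (2 * (1 / m) * t)) : ℝ) : ℂ)
          - z * ((exp (2 * (1 / m) * t) : ℝ) : ℂ)) * a t with hb''
  have ca'' : Continuous a'' := by fun_prop
  have cb'' : Continuous b'' := by fun_prop
  have s1 := fun t => (ha t).add (hb t)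
  have s2 := fun t => (ha' t).add (hb' t)
  have s3 := fun t => (ha t).add (hb t).neg
  have s4 := fun t => (ha' t).add (hb' t).neg
  have ib1 : Integrable fun t => QQ (1 / m) (ω * r₀ ^ 2 / m ^ 2) t * ‖-b t‖ ^ 2 := by
    simpa only [norm_neg] using ib
  have ib2 : Integrable fun t => ‖-b' t‖ ^ 2 := by simpa only [norm_neg] using ib'
  have one : ∀ {f g : ℝ → ℂ}, Continuous f → Continuous g → Integrable (fun t => ‖f t‖ ^ 2) →
      Integrable (fun t => ‖g t‖ ^ 2) → Integrable fun t => ‖f t + g t‖ ^ 2 :=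
    fun {f g} cf cg hf hg => by
      simpa using integrable_mul_norm_sq_add (w := fun _ => 1) continuous_const
        (fun _ => zero_le_one) cf cg (by simpa using hf) (by simpa using hg)
  have coef : ∀ r : ℝ, 0 < r → ∃ t, m * log (r / r₀) = t ∧
      m ^ 2 / r ^ 2 * QQ (1 / m) (ω * r₀ ^ 2 / m ^ 2) t = m ^ 2 / r ^ 2 + ω ∧
      m ^ 2 / r ^ 2 * T t = φ r ^ (p - 1) ∧ m ^ 2 / r ^ 2 * κ ^ 2 = j ^ 2 / r ^ 2 ∧
      m ^ 2 / r ^ 2 * (2 * κ * (1 - exp (2 * (1 / m) * t)))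
        = 2 * m * j / r ^ 2 - 2 * m * j / r₀ ^ 2 ∧
      m ^ 2 / r ^ 2 * exp (2 * (1 / m) * t) = m ^ 2 / r₀ ^ 2 := fun r hr => by
    have e1 : exp (1 / m * (m * log (r / r₀))) = r / r₀ := by
      rw [← mul_assoc, one_div_mul_cancel hm.ne', one_mul, exp_log (div_pos hr hr₀)]
    have e2 : exp (2 * (1 / m) * (m * log (r / r₀))) = r ^ 2 / r₀ ^ 2 := by
      rw [← div_pow, show 2 * (1 / m) * (m * log (r / r₀))
        = ((2 : ℕ) : ℝ) * (1 / m * (m * log (r / r₀))) by push_cast; ring, exp_nat_mul, e1]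
    refine ⟨_, rfl, ?_, ?_, ?_, ?_, ?_⟩
    · unfold QQ; rw [e2]; field_simp
    · rw [hTφ, e1, mul_div_cancel₀ _ hr₀.ne']; field_simp
    · rw [hκ]; field_simp
    · rw [hκ, e2]; field_simp
    · rw [e2]; field_simp
  refine ⟨-Complex.I * μ, ?_, fun r => (a + b) (m * log (r / r₀)),
    fun r => (a + -b) (m * log (r / r₀)),
    contDiffOn_comp_mul_log_div s1 s2 (ca''.add cb'') hr₀,
    contDiffOn_comp_mul_log_div s3 s4 (ca''.add cb''.neg) hr₀,
    integrableOn_comp_mul_log_div hm hR s1 s2 hr₀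
      (integrable_mul_norm_sq_add cQ Q0 ca cb ia ib) (one ca' cb' ia' ib'),
    integrableOn_comp_mul_log_div hm hR s3 s4 hr₀
      (integrable_mul_norm_sq_add cQ Q0 ca cb.neg ia ib1) (one ca' cb'.neg ia' ib2), ?_,
    fun r hr => ?_, fun r hr => ?_⟩
  · have : (-Complex.I * μ).re = m ^ 2 / r₀ ^ 2 * z.im := by
      rw [hμ, neg_mul, Complex.neg_re, Complex.I_mul_re, neg_neg, Complex.add_im,
        Complex.ofReal_im, Complex.im_ofReal_mul, zero_add]
    rw [this]
    positivity
  · obtain ⟨t, ht⟩ := hne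
    refine ⟨r₀ * exp (1 / m * t), mul_pos hr₀ (exp_pos _), ?_⟩
    have hl : m * log (r₀ * exp (1 / m * t) / r₀) = t := by
      rw [mul_div_cancel_left₀ _ hr₀.ne', log_exp]; field_simp
    simp only [hl, Pi.add_apply, Pi.neg_apply]
    by_contra! h
    refine ht ?_
    linear_combination (h.1 + h.2) / 2
  · rw [radial_laplacian_comp_mul_log_div s1 s2 hr₀ hr, hIμ]
    obtain ⟨t, ht, h1, h2, h3, h4, h5⟩ := coef r hr
    apply_fun ((↑) : ℝ → ℂ) at h1 h2 h3 h4 h5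
    simp only [ht, hμ, Pi.add_apply, Pi.neg_apply]
    push_cast at h1 h2 h3 h4 h5 ⊢
    linear_combination (a t + b t) * h1 - (p * a t + b t) * h2 + (a t + b t) * h3
      + (a t + b t) * h4 - z * (a t + b t) * h5
  · have hl := radial_laplacian_comp_mul_log_div (m := m) s3 s4 hr₀ hr
    rw [hl, hIμ]
    obtain ⟨t, ht, h1, h2, h3, h4, h5⟩ := coef r hr
    apply_fun ((↑) : ℝ → ℂ) at h1 h2 h3 h4 h5
    simp only [ht, hμ, Pi.add_apply, Pi.neg_apply]
    push_cast at h1 h2 h3 h4 h5 ⊢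
    linear_combination (a t - b t) * h1 - (p * a t - b t) * h2 + (a t - b t) * h3
      - (a t - b t) * h4 + z * (a t - b t) * h5

theorem HasDerivAt.conj' {f : ℝ → ℂ} {f' : ℂ} {t : ℝ} (h : HasDerivAt f f' t) :
    HasDerivAt (fun t => conj (f t)) (conj f') t :=
  Complex.conjCLE.toContinuousLinearMap.hasFDerivAt.comp_hasDerivAt t h

theorem tendsto_one_div_natCast_nhdsGT :
    Tendsto (fun m : ℕ => 1 / (m : ℝ)) atTop (nhdsWithin 0 (Set.Ioi 0)) := by
  refine tendsto_nhdsWithin_iff.2 ⟨tendsto_one_div_atTop_nhds_zero_nat, ?_⟩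
  filter_upwards [eventually_ge_atTop 1] with m hm
  have : (0 : ℝ) < m := by exact_mod_cast hm
  exact one_div_pos.2 this

theorem tendsto_natCast_rpow_floor {β : ℝ} (hβ : 0 < β) :
    Tendsto (fun m : ℕ => ((⌊(m : ℝ) ^ β⌋₊ : ℕ) : ℝ)) atTop atTop :=
  tendsto_natCast_atTop_atTop.comp (tendsto_nat_floor_atTop.comp
    ((tendsto_rpow_atTop hβ).comp tendsto_natCast_atTop_atTop))

theorem tendsto_rpow_floor_div {β : ℝ} (hβ1 : β < 1) :
    Tendsto (fun m : ℕ => ((⌊(m : ℝ) ^ β⌋₊ : ℕ) : ℝ) * (1 / m)) atTop (nhds 0) := by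
  refine squeeze_zero' (Eventually.of_forall fun m => by positivity) ?_
    ((tendsto_rpow_neg_atTop (sub_pos.2 hβ1)).comp tendsto_natCast_atTop_atTop)
  filter_upwards [eventually_ge_atTop 1] with m hm
  have h0 : (0 : ℝ) < m := by exact_mod_cast hm
  have h := Nat.floor_le (rpow_nonneg h0.le β)
  simp only [Function.comp]
  rw [neg_sub, rpow_sub_one h0.ne', mul_one_div]
  exact div_le_div_of_nonneg_right h h0.le

theorem stmt19 (p ω β : ℝ) (hp1 : 1 < p) (hp5 : p < 5) (hω : 0 < ω)
    (hβ : β = min (p - 1) 1 / 6) :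
    ∃ mstar : ℕ, ∀ m : ℕ, mstar ≤ m →
      ∀ φ : ℝ → ℝ, ContDiffOn ℝ 2 φ (Set.Ioi 0) →
      (∀ r ∈ Set.Ioi (0:ℝ), 0 < φ r) →
      (∀ r ∈ Set.Ioi (0:ℝ),
        deriv (deriv φ) r + deriv φ r / r - (ω + (m : ℝ) ^ 2 / r ^ 2) * φ r
          + φ r ^ p = 0) →
      (∃ L : ℝ,
        Tendsto (fun r => φ r / r ^ m) (nhdsWithin 0 (Set.Ioi 0)) (nhds L) ∧
        Tendsto (fun r => deriv φ r / ((m : ℝ) * r ^ (m - 1)))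
          (nhdsWithin 0 (Set.Ioi 0)) (nhds L)) →
      Tendsto φ atTop (nhds 0) →
      ∀ j : ℕ, j = ⌊(m : ℝ) ^ β⌋₊ →
      ∃ lam : ℂ, 0 < lam.re ∧
      ∃ yp ym : ℝ → ℂ,
        ContDiffOn ℝ 2 yp (Set.Ioi 0) ∧ ContDiffOn ℝ 2 ym (Set.Ioi 0) ∧
        IntegrableOn (fun r => (‖yp r‖ ^ 2 + ‖deriv yp r‖ ^ 2
          + (r ^ 2)⁻¹ * ‖yp r‖ ^ 2) * r) (Set.Ioi 0) ∧
        IntegrableOn (fun r => (‖ym r‖ ^ 2 + ‖deriv ym r‖ ^ 2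
          + (r ^ 2)⁻¹ * ‖ym r‖ ^ 2) * r) (Set.Ioi 0) ∧
        (∃ r ∈ Set.Ioi (0:ℝ), yp r ≠ 0 ∨ ym r ≠ 0) ∧
        (∀ r ∈ Set.Ioi (0:ℝ),
          deriv (deriv yp) r + deriv yp r / (r : ℂ)
            - ((ω + ((m : ℝ) + (j : ℝ)) ^ 2 / r ^ 2 : ℝ) : ℂ) * yp r
            + Complex.I * lam * yp r
            + (((p + 1) / 2 * φ r ^ (p - 1) : ℝ) : ℂ) * yp r
            + (((p - 1) / 2 * φ r ^ (p - 1) : ℝ) : ℂ) * ym r = 0) ∧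
        (∀ r ∈ Set.Ioi (0:ℝ),
          deriv (deriv ym) r + deriv ym r / (r : ℂ)
            - ((ω + ((m : ℝ) - (j : ℝ)) ^ 2 / r ^ 2 : ℝ) : ℂ) * ym r
            - Complex.I * lam * ym r
            + (((p + 1) / 2 * φ r ^ (p - 1) : ℝ) : ℂ) * ym r
            + (((p - 1) / 2 * φ r ^ (p - 1) : ℝ) : ℂ) * yp r = 0) := by
  have hβ0 : 0 < β := by
    rw [hβ]; exact div_pos (lt_min (sub_pos.2 hp1) one_pos) (by norm_num)
  have hβ1 : β < 1 := by
    have := min_le_right (p - 1) 1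
    rw [hβ]; linarith
  obtain ⟨c, hc, M, hframe⟩ := Special.exists_frame hp1 hp5
  obtain ⟨δ, hδ, hsol⟩ : ∃ δ > 0,
      ∀ (p ε R : ℝ) (T : ℝ → ℝ) (_ : Frame p ε R c M T) (κ j : ℝ), 1 ≤ j → κ = j * ε → κ ≤ δ →
        1 / j ≤ δ → ∃ z : ℂ, z.im ≠ 0 ∧ ∃ a a' b b' : ℝ → ℂ,
        (∀ t, HasDerivAt a (a' t) t) ∧ (∀ t, HasDerivAt b (b' t) t) ∧
        (∀ t, HasDerivAt a' (((QQ ε R t - p * T t + κ ^ 2 : ℝ) : ℂ) * a t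
          + (((2 * κ * (1 - exp (2 * ε * t)) : ℝ) : ℂ)
            - z * ((exp (2 * ε * t) : ℝ) : ℂ)) * b t) t) ∧
        (∀ t, HasDerivAt b' (((QQ ε R t - T t + κ ^ 2 : ℝ) : ℂ) * b t
          + (((2 * κ * (1 - exp (2 * ε * t)) : ℝ) : ℂ)
            - z * ((exp (2 * ε * t) : ℝ) : ℂ)) * a t) t) ∧
        Integrable (fun t => QQ ε R t * ‖a t‖ ^ 2) ∧ Integrable (fun t => ‖a' t‖ ^ 2) ∧
        Integrable (fun t => QQ ε R t * ‖b t‖ ^ 2) ∧ Integrable (fun t => ‖b' t‖ ^ 2) ∧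
        ∃ t, a t ≠ 0 := by
    by_cases hM : 1 ≤ M
    · exact Frame.exists_solution hc hM
    · exact ⟨1, one_pos, fun _ _ _ _ F => absurd F.one_le_M hM⟩
  have hev : ∀ᶠ m : ℕ in atTop, 1 ≤ m ∧ 1 ≤ ((⌊(m : ℝ) ^ β⌋₊ : ℕ) : ℝ) ∧
      ((⌊(m : ℝ) ^ β⌋₊ : ℕ) : ℝ) * (1 / m) ≤ δ ∧ 1 / ((⌊(m : ℝ) ^ β⌋₊ : ℕ) : ℝ) ≤ δ ∧
      ∀ (R : ℝ) (f P T : ℝ → ℝ), Profile p (1 / m) R f P T →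
        P 0 = -(Profile.th p * (1 / m) / 2) → f 0 = 1 → Nonempty (Frame p (1 / m) R c M T) := by
    filter_upwards [eventually_ge_atTop 1,
      (tendsto_natCast_rpow_floor hβ0).eventually_ge_atTop 1,
      (tendsto_rpow_floor_div hβ1).eventually_le_const hδ,
      (tendsto_natCast_rpow_floor hβ0).eventually_ge_atTop (1 / δ),
      tendsto_one_div_natCast_nhdsGT.eventually hframe] with m h1 h2 h3 h4 h5
    exact ⟨h1, h2, h3, (one_div_le (by linarith) hδ).2 h4, h5⟩
  obtain ⟨mstar, hmstar⟩ := eventually_atTop.1 hev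
  refine ⟨mstar, fun m hm φ hφ hpos hode ⟨L, hL, hL'⟩ hinf j hj => ?_⟩
  obtain ⟨h1, h2, h3, h4, h5⟩ := hmstar m hm
  rw [← hj] at h2 h3 h4
  have hm0 : (0 : ℝ) < m := by exact_mod_cast h1
  have dφ : ∀ r, 0 < r → HasDerivAt φ (deriv φ r) r := fun r hr =>
    ((hφ.differentiableOn two_ne_zero).differentiableAt (Ioi_mem_nhds hr)).hasDerivAt
  have dφ' : ∀ r, 0 < r → HasDerivAt (deriv φ)
      ((ω + (m : ℝ) ^ 2 / r ^ 2) * φ r - φ r ^ p - deriv φ r / r) r := fun r hr => by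
    rw [show (2 : WithTop ℕ∞) = 1 + 1 from one_add_one_eq_two.symm,
      contDiffOn_succ_iff_deriv_of_isOpen isOpen_Ioi] at hφ
    refine ((hφ.2.2.differentiableOn one_ne_zero).differentiableAt
      (Ioi_mem_nhds hr)).hasDerivAt.congr_deriv ?_
    linarith [hode r hr]
  obtain ⟨r₀, hr₀, f, P, hprof, hP, hf⟩ :=
    Profile.exists_of_vortex hp1 hω h1 dφ dφ' hpos hL hL' hinf
  obtain ⟨F⟩ := h5 _ f P _ hprof hP hf
  obtain ⟨z, hz, a, a', b, b', d1, d2, d3, d4, i1, i2, i3, i4, t, ht⟩ :=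
    hsol _ _ _ _ F _ j h2 rfl h3 h4
  rcases hz.lt_or_gt with hz | hz
  · refine exists_unstable_of_log hω hm0 hr₀ rfl F.contT (fun _ => rfl) (z := conj z)
      (by rw [Complex.conj_im]; linarith) (fun t => (d1 t).conj') (fun t => (d2 t).conj')
      (fun t => ((d3 t).conj').congr_deriv ?_) (fun t => ((d4 t).conj').congr_deriv ?_)
      ?_ ?_ ?_ ?_ ⟨t, (map_ne_zero _).2 ht⟩
    · simp only [map_add, map_sub, map_mul, Complex.conj_ofReal]
    · simp only [map_add, map_sub, map_mul, Complex.conj_ofReal]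
    all_goals simpa only [RCLike.norm_conj]
  · exact exists_unstable_of_log hω hm0 hr₀ rfl F.contT (fun _ => rfl) hz d1 d2 d3 d4 i1 i2 i3 i4
      ⟨t, ht⟩
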